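/- Let ε ∈ (0,1], k ∈ {0,1}, ε_k = (k+ε)/2, let Ω be a bounded domain in ℂⁿ whose closure admits a Stein neighborhood basis, and let p be a strictly pseudoconvex boundary point of Ω of class C^{k+2,ε}. Then there exist a constant C > 0 and a neighborhood U of p such that for every z ∈ Ω ∩ U and every X ∈ ℂⁿ, (1 − C·δ_Ω(z)^{ε_k})·M(z;X) ≤ γ_Ω(z;X) ≤ (1 + C·δ_Ω(z)^{ε_k})·M(z;X), where M(z;X) = ( |⟨∂δ_Ω(z),X⟩|²/δ_Ω(z)² + L(z;X)/δ_Ω(z) )^{1/2}. -/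

import Mathlib

open Metric MeasureTheory Set
open scoped NNReal ENNReal

noncomputable section

/-- Complex Euclidean `n`-space. -/
abbrev Cn (n : ℕ) := EuclideanSpace ℂ (Fin n)

variable {n : ℕ}

instance : MeasurableSpace (Cn n) := borel _
instance : BorelSpace (Cn n) := ⟨rfl⟩
instance : InnerProductSpace ℝ (Cn n) := InnerProductSpace.rclikeToReal ℂ _

/-- `δ_Ω(z)`: the Euclidean distance from `z` to the boundary of `Ω`. -/
def bdist (Ω : Set (Cn n)) (z : Cn n) : ℝ := Metric.infDist z (frontier Ω)

/-- The squeezing function `σ_Ω(z)` of a (bounded) domain `Ω`. -/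
def squeezing (Ω : Set (Cn n)) (z : Cn n) : ℝ :=
  sSup {r : ℝ | 0 < r ∧ ∃ f : Cn n → Cn n,
    DifferentiableOn ℂ f Ω ∧ Set.InjOn f Ω ∧ Set.MapsTo f Ω (Metric.ball 0 1) ∧
    f z = 0 ∧ Metric.ball (0 : Cn n) r ⊆ f '' Ω}

/-- The Kobayashi metric `κ_Ω(z;X)`. -/
def kobayashi (Ω : Set (Cn n)) (z X : Cn n) : ℝ :=
  sInf {r : ℝ | ∃ (α : ℂ) (φ : ℂ → Cn n),
    DifferentiableOn ℂ φ (Metric.ball 0 1) ∧ Set.MapsTo φ (Metric.ball 0 1) Ω ∧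
    φ 0 = z ∧ α • deriv φ 0 = X ∧ r = ‖α‖}

/-- The Carathéodory metric `γ_Ω(z;X)`. -/
def caratheodory (Ω : Set (Cn n)) (z X : Cn n) : ℝ :=
  sSup {r : ℝ | ∃ f : Cn n → ℂ,
    DifferentiableOn ℂ f Ω ∧ Set.MapsTo f Ω (Metric.ball 0 1) ∧
    r = ‖fderiv ℂ f z X‖}

/-- `⟨∂ρ(q),X⟩ = Σ_j (∂ρ/∂z_j)(q) X_j`, expressed via the real differential:
`⟨∂ρ(q),X⟩ = (Dρ(q)X - i·Dρ(q)(iX))/2`. -/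
def cderiv (ρ : Cn n → ℝ) (q X : Cn n) : ℂ :=
  (((fderiv ℝ ρ q X : ℝ) : ℂ) - Complex.I * ((fderiv ℝ ρ q (Complex.I • X) : ℝ) : ℂ)) / 2

/-- The Levi form `L_ρ(q;X) = Σ_{j,k} (∂²ρ/∂z_j∂z̄_k)(q) X_j X̄_k`, expressed via the real
second differential: `L_ρ(q;X) = (D²ρ(q)[X,X] + D²ρ(q)[iX,iX])/4`. -/
def leviForm (ρ : Cn n → ℝ) (q X : Cn n) : ℝ :=
  (fderiv ℝ (fun w => fderiv ℝ ρ w X) q X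
    + fderiv ℝ (fun w => fderiv ℝ ρ w (Complex.I • X)) q (Complex.I • X)) / 4

/-- `p` is a strictly pseudoconvex boundary point of `Ω` of class `C^{m,ε}`. -/
def IsStrictPscPtHolder (Ω : Set (Cn n)) (p : Cn n) (m : ℕ) (ε : ℝ) : Prop :=
  p ∈ frontier Ω ∧ ∃ W : Set (Cn n), IsOpen W ∧ p ∈ W ∧ ∃ ρ : Cn n → ℝ,
    ContDiffOn ℝ m ρ W ∧
    (∃ C : ℝ≥0, HolderOnWith C ε.toNNReal (iteratedFDeriv ℝ m ρ) W) ∧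
    Ω ∩ W = {z ∈ W | ρ z < 0} ∧
    (∀ q ∈ frontier Ω ∩ W, fderiv ℝ ρ q ≠ 0) ∧
    (∀ q ∈ frontier Ω ∩ W, ∀ X : Cn n, X ≠ 0 → cderiv ρ q X = 0 → 0 < leviForm ρ q X)

/-- `p` is a strictly pseudoconvex boundary point of `Ω` of class `C²`. -/
def IsStrictPscPtC2 (Ω : Set (Cn n)) (p : Cn n) : Prop :=
  p ∈ frontier Ω ∧ ∃ W : Set (Cn n), IsOpen W ∧ p ∈ W ∧ ∃ ρ : Cn n → ℝ,
    ContDiffOn ℝ 2 ρ W ∧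
    Ω ∩ W = {z ∈ W | ρ z < 0} ∧
    (∀ q ∈ frontier Ω ∩ W, fderiv ℝ ρ q ≠ 0) ∧
    (∀ q ∈ frontier Ω ∩ W, ∀ X : Cn n, X ≠ 0 → cderiv ρ q X = 0 → 0 < leviForm ρ q X)

/-- An open set `D ⊆ ℂⁿ` is pseudoconvex: `u = -log dist(·, Dᶜ)` is plurisubharmonic on `D`. -/
def IsPseudoconvex (D : Set (Cn n)) : Prop :=
  IsOpen D ∧
  UpperSemicontinuousOn (fun z => -Real.log (Metric.infDist z Dᶜ)) D ∧
  ∀ a ∈ D, ∀ w : Cn n, ∀ r : ℝ, 0 < r →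
    (∀ l : ℂ, ‖l‖ ≤ r → a + l • w ∈ D) →
    -Real.log (Metric.infDist a Dᶜ) ≤
      (1 / (2 * Real.pi)) * ∫ θ in (0:ℝ)..(2 * Real.pi),
        -Real.log (Metric.infDist (a + ((r : ℂ) * Complex.exp (θ * Complex.I)) • w) Dᶜ)

/-- `cl(Ω)` admits a Stein neighborhood basis. -/
def HasSteinBasis (Ω : Set (Cn n)) : Prop :=
  ∀ W : Set (Cn n), IsOpen W → closure Ω ⊆ W →
    ∃ U : Set (Cn n), IsPseudoconvex U ∧ closure Ω ⊆ U ∧ U ⊆ W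

/-- The squared `L²`-norm of `f` on `D` (as an extended nonnegative real). -/
def L2normSq (D : Set (Cn n)) (f : Cn n → ℂ) : ℝ≥0∞ := ∫⁻ w in D, (‖f w‖₊ : ℝ≥0∞) ^ 2

/-- `J⁰_D(z) = sup {|f(z)|² : f ∈ L²_h(D), ‖f‖_D ≤ 1}`; equals the Bergman kernel on the
diagonal. -/
def J0 (D : Set (Cn n)) (z : Cn n) : ℝ :=
  sSup {v : ℝ | ∃ f : Cn n → ℂ, DifferentiableOn ℂ f D ∧ L2normSq D f ≤ 1 ∧ v = ‖f z‖ ^ 2}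

/-- `J¹_D(z;X) = sup {|f'(z)X|² : f ∈ L²_h(D), ‖f‖_D ≤ 1, f(z) = 0}`. -/
def J1 (D : Set (Cn n)) (z X : Cn n) : ℝ :=
  sSup {v : ℝ | ∃ f : Cn n → ℂ, DifferentiableOn ℂ f D ∧ L2normSq D f ≤ 1 ∧ f z = 0 ∧
    v = ‖fderiv ℂ f z X‖ ^ 2}

/-- `J²_D(z;X,Y) = sup {|Σ_{j,k} f_{ζ_jζ_k}(z) X_j Y_k|² : f ∈ L²_h(D), ‖f‖_D ≤ 1,
f(z) = 0, f'(z) = 0}`. -/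
def J2 (D : Set (Cn n)) (z X Y : Cn n) : ℝ :=
  sSup {v : ℝ | ∃ f : Cn n → ℂ, DifferentiableOn ℂ f D ∧ L2normSq D f ≤ 1 ∧ f z = 0 ∧
    fderiv ℂ f z = 0 ∧ v = ‖fderiv ℂ (fun w => fderiv ℂ f w Y) z X‖ ^ 2}

/-- The Bergman metric `β_D(z;X) = (J¹_D(z;X)/J⁰_D(z))^{1/2}`. -/
def bergman (D : Set (Cn n)) (z X : Cn n) : ℝ := Real.sqrt (J1 D z X / J0 D z)

/-- The bisectional curvature of the Bergman metric. -/
def bisect (D : Set (Cn n)) (z X Y : Cn n) : ℝ :=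
  2 - J0 D z * J2 D z X Y / (J1 D z X * J1 D z Y)

/-- The holomorphic sectional curvature `s_D(z;X)` of the Bergman metric. -/
def sectCurv (D : Set (Cn n)) (z X : Cn n) : ℝ := bisect D z X X

/-- The Ricci curvature `r_D(z;X)` of the Bergman metric (w.r.t. the standard basis). -/
def ricciCurv (D : Set (Cn n)) (z X : Cn n) : ℝ :=
  ∑ j : Fin n, bisect D z (EuclideanSpace.single j 1) X

/-- The scalar curvature `t_D(z)` of the Bergman metric. -/
def scalarCurv (D : Set (Cn n)) (z : Cn n) : ℝ :=
  ∑ j : Fin n, ricciCurv D z (EuclideanSpace.single j 1)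

/-- `M(z;X) = ( |⟨∂δ_Ω(z),X⟩|²/δ_Ω(z)² + L(z;X)/δ_Ω(z) )^{1/2}`, where `L` is the Levi form
of `-δ_Ω`. -/
def Mfun (Ω : Set (Cn n)) (z X : Cn n) : ℝ :=
  Real.sqrt (‖cderiv (bdist Ω) z X‖ ^ 2 / (bdist Ω z) ^ 2
    + leviForm (fun w => -(bdist Ω w)) z X / bdist Ω z)

/-- The sesquilinear form of the Bergman metric, recovered from `β²` by polarization. -/
def bergForm (D : Set (Cn n)) (z X Y : Cn n) : ℂ :=
  (((J1 D z (X + Y) / J0 D z : ℝ) : ℂ) - ((J1 D z (X - Y) / J0 D z : ℝ) : ℂ)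
    + Complex.I * ((J1 D z (X + Complex.I • Y) / J0 D z : ℝ) : ℂ)
    - Complex.I * ((J1 D z (X - Complex.I • Y) / J0 D z : ℝ) : ℂ)) / 4

/-- The Hermitian matrix `(B_{jk}(z))` of the Bergman metric in the standard coordinates. -/
def bergMat (D : Set (Cn n)) (z : Cn n) : Matrix (Fin n) (Fin n) ℂ :=
  fun j k => bergForm D z (EuclideanSpace.single j 1) (EuclideanSpace.single k 1)

/-- The canonical Bergman invariant `J_D(z) = Δ_D(z)/K_D(z)`. -/
def canonInvariant (D : Set (Cn n)) (z : Cn n) : ℂ :=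
  (bergMat D z).det / ((J0 D z : ℝ) : ℂ)

namespace CE
set_option linter.unusedSectionVars false
open Filter
open scoped ContDiff ComplexConjugate Topology
open Complex (I norm_real normSq_eq_norm_sq ofRealCLM add_re conj_ofReal re_ofReal_mul conj_I ofReal_re sub_re normSq_eq_conj_mul_self)
open Real (smoothTransition norm_of_nonneg sq_sqrt rpow_two norm_eq_abs rpow_le_rpow_of_exponent_ge exp_pos)
open Finset (sum_congr mul_sum sum_mul sum_add_distrib sum_le_sum sum_nonneg)

section
variable {E : Type*} [NormedAddCommGroup E] [NormedSpace ℂ E]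

def dop (c : ℂ) (v : E) (f : E → ℂ) (w : E) : ℂ :=
  (fderiv ℝ f w v + c * fderiv ℝ f w (I • v)) / 2

lemma dop_mul {c : ℂ} {v : E} {f g : E → ℂ} {w : E} (hf : DifferentiableAt ℝ f w)
    (hg : DifferentiableAt ℝ g w) :
    dop c v (fun x ↦ f x * g x) w = dop c v f w * g w + f w * dop c v g w := by
  unfold dop
  rw [fderiv_fun_mul hf hg]
  simp; ring

lemma dop_add {c : ℂ} {v : E} {f g : E → ℂ} {w : E} (hf : DifferentiableAt ℝ f w)
    (hg : DifferentiableAt ℝ g w) :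
    dop c v (fun x ↦ f x + g x) w = dop c v f w + dop c v g w := by
  unfold dop
  rw [fderiv_fun_add hf hg]
  simp; ring

lemma dop_sub {c : ℂ} {v : E} {f g : E → ℂ} {w : E} (hf : DifferentiableAt ℝ f w)
    (hg : DifferentiableAt ℝ g w) :
    dop c v (fun x ↦ f x - g x) w = dop c v f w - dop c v g w := by
  unfold dop
  rw [fderiv_fun_sub hf hg]
  simp; ring

lemma dop_conj {c : ℂ} {v : E} {f : E → ℂ} {w : E} (hf : DifferentiableAt ℝ f w) :
    dop c v (fun x ↦ conj (f x)) w = conj (dop (conj c) v f w) := by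
  unfold dop
  have : fderiv ℝ (fun x ↦ conj (f x)) w
      = (Complex.conjCLE : ℂ →L[ℝ] ℂ).comp (fderiv ℝ f w) := by
    have := ((Complex.conjCLE : ℂ →L[ℝ] ℂ).hasFDerivAt.comp w hf.hasFDerivAt).fderiv
    exact this
  rw [this]
  simp [map_ofNat]

lemma dop_congr {c : ℂ} {v : E} {f g : E → ℂ} {w : E} (h : f =ᶠ[nhds w] g) :
    dop c v f w = dop c v g w := by
  unfold dop
  rw [h.fderiv_eq]

lemma dop_contDiff {c : ℂ} {v : E} {f : E → ℂ} (hf : ContDiff ℝ ∞ f) :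
    ContDiff ℝ ∞ (dop c v f) := by
  unfold dop
  have : ContDiff ℝ ∞ (fderiv ℝ f) := hf.fderiv_right (by simp)
  fun_prop

lemma dop_support {c : ℂ} {v : E} {f : E → ℂ} : Function.support (dop c v f) ⊆ tsupport f := by
  intro w hw
  by_contra h
  apply hw
  have : f =ᶠ[nhds w] fun _ ↦ 0 := notMem_tsupport_iff_eventuallyEq.mp h
  simp [dop, this.fderiv_eq]

lemma dop_tsupport {c : ℂ} {v : E} {f : E → ℂ} : tsupport (dop c v f) ⊆ tsupport f :=
  closure_minimal dop_support (isClosed_tsupport _)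

lemma dop_compact {c : ℂ} {v : E} {f : E → ℂ} (hf : HasCompactSupport f) :
    HasCompactSupport (dop c v f) :=
  hf.of_isClosed_subset (isClosed_tsupport _) dop_tsupport

lemma dop_expand {c : ℂ} {v : E} {f : E → ℂ} (d : ℂ) (u : E) (hf : ContDiff ℝ 2 f) (w : E) :
    dop c v (dop d u f) w = (fderiv ℝ (fderiv ℝ f) w v u + d * fderiv ℝ (fderiv ℝ f) w v (I • u)
      + c * (fderiv ℝ (fderiv ℝ f) w (I • v) u
      + d * fderiv ℝ (fderiv ℝ f) w (I • v) (I • u))) / 4 := by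
  have h1 : Differentiable ℝ (fderiv ℝ f) :=
    (hf.fderiv_right (m := 1) (by norm_num)).differentiable (by norm_num)
  have h2 : ∀ x : E, HasFDerivAt (fun w ↦ fderiv ℝ f w x) ((fderiv ℝ (fderiv ℝ f) w).flip x) w := by
    intro x
    exact ((h1 w).hasFDerivAt.clm_apply (hasFDerivAt_const x w)).congr_fderiv (by ext; simp)
  have : HasFDerivAt (dop d u f) ((2:ℂ)⁻¹ • ((fderiv ℝ (fderiv ℝ f) w).flip u +
      d • ((fderiv ℝ (fderiv ℝ f) w).flip (I • u)))) w := by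
    have := (((h2 u).add ((h2 (I • u)).const_smul d)).const_smul (2:ℂ)⁻¹)
    refine this.congr_of_eventuallyEq (Eventually.of_forall fun x ↦ ?_)
    simp [dop]; ring
  rw [dop, this.fderiv]
  simp; ring

lemma dop_comm {c d : ℂ} {v u : E} {f : E → ℂ} (hf : ContDiff ℝ 2 f) (w : E) :
    dop c v (dop d u f) w = dop d u (dop c v f) w := by
  have hs : ∀ x y, fderiv ℝ (fderiv ℝ f) w x y = fderiv ℝ (fderiv ℝ f) w y x := by
    intro x y
    exact (hf.contDiffAt.isSymmSndFDerivAt (by simp)).eq x y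
  rw [dop_expand d u hf, dop_expand c v hf, hs v u, hs (I • v) u, hs v, hs (I • v) (I • u)]
  ring

lemma dop_complex {v : E} {f : E → ℂ} {w : E} (hf : DifferentiableAt ℂ f w) :
    dop I v f w = 0 := by
  unfold dop
  have : fderiv ℝ f w = (fderiv ℂ f w).restrictScalars ℝ :=
    (hf.hasFDerivAt.restrictScalars ℝ).fderiv
  rw [this]
  simp only [ContinuousLinearMap.coe_restrictScalars', map_smul, smul_eq_mul, ← mul_assoc,
    Complex.I_mul_I]
  ring

lemma differentiableAt_of_dop {f : E → ℂ} {w : E} (hf : DifferentiableAt ℝ f w)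
    (h : ∀ v, dop I v f w = 0) : DifferentiableAt ℂ f w := by
  have key : ∀ v, fderiv ℝ f w (I • v) = I * fderiv ℝ f w v := by
    intro v
    have := h v
    unfold dop at this
    linear_combination (-2 * I) * this + Complex.I_sq * fderiv ℝ f w (I • v)
  refine (HasFDerivAt.differentiableAt (𝕜 := ℂ) (f' :=
    { toFun := fderiv ℝ f w, map_add' := map_add _, map_smul' := ?_, cont := (fderiv ℝ f w).cont }) ?_)
  · intro c v
    have : c • v = c.re • v + c.im • (I • v) := by
      conv_lhs => rw [← Complex.re_add_im c]
      rw [add_smul, mul_smul]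
      simp
    rw [this, map_add, map_smul, map_smul, key]
    simp only [Complex.real_smul, RingHom.id_apply, smul_eq_mul]
    linear_combination (fderiv ℝ f w v) * (Complex.re_add_im c)
  · exact HasFDerivAt.of_isLittleO hf.hasFDerivAt.isLittleO

variable [MeasurableSpace E] [BorelSpace E] [FiniteDimensional ℝ E] (μ : Measure E)
  [μ.IsAddHaarMeasure]

lemma integrable_cs {f : E → ℂ} (hf : Continuous f) (h : HasCompactSupport f) :
    Integrable f μ := hf.integrable_of_hasCompactSupport h

lemma dop_ibp {c : ℂ} {v : E} {f g : E → ℂ} (hf : ContDiff ℝ ∞ f) (hg : ContDiff ℝ ∞ g)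
    (hs : HasCompactSupport f) :
    ∫ w, f w * dop c v g w ∂μ = - ∫ w, dop c v f w * g w ∂μ := by
  have cf : Continuous f := hf.continuous
  have cg : Continuous g := hg.continuous
  have cf' : ∀ x, Continuous fun w ↦ fderiv ℝ f w x := fun x ↦
    (hf.continuous_fderiv (by simp)).clm_apply continuous_const
  have cg' : ∀ x, Continuous fun w ↦ fderiv ℝ g w x := fun x ↦
    (hg.continuous_fderiv (by simp)).clm_apply continuous_const
  have sf' : ∀ x, HasCompactSupport fun w ↦ fderiv ℝ f w x := fun x ↦ hs.fderiv_apply ℝ x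
  have i1 : ∀ x, Integrable (fun w ↦ fderiv ℝ f w x * g w) μ := fun x ↦
    integrable_cs μ ((cf' x).mul cg) ((sf' x).mul_right)
  have i2 : ∀ x, Integrable (fun w ↦ f w * fderiv ℝ g w x) μ := fun x ↦
    integrable_cs μ (cf.mul (cg' x)) (hs.mul_right)
  have i3 : Integrable (fun w ↦ f w * g w) μ := integrable_cs μ (cf.mul cg) (hs.mul_right)
  have key : ∀ x, ∫ w, f w * fderiv ℝ g w x ∂μ = - ∫ w, fderiv ℝ f w x * g w ∂μ := fun x ↦
    integral_mul_fderiv_eq_neg_fderiv_mul_of_integrable (i1 x) (i2 x) i3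
      (fun y _ ↦ hf.differentiable (by simp) y) (fun y _ ↦ hg.differentiable (by simp) y)
  have e1 : ∀ w, f w * dop c v g w = (2:ℂ)⁻¹ * (f w * fderiv ℝ g w v)
      + (c/2) * (f w * fderiv ℝ g w (I • v)) := fun w ↦ by unfold dop; ring
  have e2 : ∀ w, dop c v f w * g w = (2:ℂ)⁻¹ * (fderiv ℝ f w v * g w)
      + (c/2) * (fderiv ℝ f w (I • v) * g w) := fun w ↦ by unfold dop; ring
  simp_rw [e1, e2]
  rw [integral_add ((i2 _).const_mul _) ((i2 _).const_mul _),
    integral_add ((i1 _).const_mul _) ((i1 _).const_mul _)]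
  simp_rw [integral_const_mul, key]
  ring
end

section
variable {E : Type*} [NormedAddCommGroup E] [NormedSpace ℂ E]

def wad (φ : E → ℂ) (v : E) (b : E → ℂ) (w : E) : ℂ :=
  dop (-I) v b w - b w * dop (-I) v φ w

lemma contDiff_cexp_neg {φ : E → ℂ} (hφ : ContDiff ℝ ∞ φ) : ContDiff ℝ ∞ (fun w ↦ Complex.exp (-φ w)) := by
  exact (Complex.contDiff_exp (𝕜 := ℝ)).comp hφ.neg

lemma contDiff_conj {φ : E → ℂ} (hφ : ContDiff ℝ ∞ φ) : ContDiff ℝ ∞ (fun w ↦ conj (φ w)) :=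
  (Complex.conjCLE.contDiff (n := ∞)).comp hφ

lemma wad_contDiff {φ : E → ℂ} (hφ : ContDiff ℝ ∞ φ) {v : E} {b : E → ℂ} (hb : ContDiff ℝ ∞ b) :
    ContDiff ℝ ∞ (wad φ v b) := by
  have h1 := dop_contDiff (c := -I) (v := v) hb
  have h2 := dop_contDiff (c := -I) (v := v) hφ
  exact h1.sub (hb.mul h2)

lemma dop_exp {φ : E → ℂ} (hφ : ContDiff ℝ ∞ φ) {c : ℂ} {v w : E} :
    dop c v (fun w ↦ Complex.exp (-φ w)) w = - Complex.exp (-φ w) * dop c v φ w := by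
  unfold dop
  have h := ((hφ.differentiable (by simp) w).hasFDerivAt.neg.cexp).fderiv
  have : fderiv ℝ (fun w ↦ Complex.exp (-φ w)) w = Complex.exp (-φ w) • -fderiv ℝ φ w := h
  rw [this]
  simp; ring

lemma dop_mul_exp {φ : E → ℂ} (hφ : ContDiff ℝ ∞ φ) {v w : E} {b : E → ℂ} (hb : ContDiff ℝ ∞ b) :
    dop (-I) v (fun w ↦ b w * Complex.exp (-φ w)) w = wad φ v b w * Complex.exp (-φ w) := by
  rw [dop_mul (hb.differentiable (by simp) w) ((contDiff_cexp_neg hφ).differentiable (by simp) w),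
    dop_exp hφ, wad]
  ring

lemma dop_wad {φ : E → ℂ} (hφ : ContDiff ℝ ∞ φ) {v u w : E} {b : E → ℂ} (hb : ContDiff ℝ ∞ b) :
    dop I u (wad φ v b) w = wad φ v (dop I u b) w
      - b w * dop I u (dop (-I) v φ) w := by
  have h1 := (dop_contDiff (c := -I) (v := v) hb).differentiable (by simp)
  have h2 := (dop_contDiff (c := -I) (v := v) hφ).differentiable (by simp)
  have h3 := hb.differentiable (by simp)
  have : wad φ v b = fun w ↦ dop (-I) v b w - b w * dop (-I) v φ w := rfl
  rw [this, dop_sub (h1 w) ((h3 w).fun_mul (h2 w)), dop_mul (h3 w) (h2 w), wad,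
    dop_comm (hb.of_le ENat.LEInfty.out)]
  ring

variable [MeasurableSpace E] [BorelSpace E] [FiniteDimensional ℝ E] (μ : Measure E)
  [μ.IsAddHaarMeasure]

lemma mkh_pair {φ : E → ℂ} (hφ : ContDiff ℝ ∞ φ) (hre : ∀ w, conj (φ w) = φ w) (u v : E)
    {f g : E → ℂ} (hf : ContDiff ℝ ∞ f) (hg : ContDiff ℝ ∞ g) (sf : HasCompactSupport f) :
    ∫ w, wad φ u f w * conj (wad φ v g w) * Complex.exp (-φ w) ∂μ
    = ∫ w, dop I v f w * conj (dop I u g w) * Complex.exp (-φ w) ∂μ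
    + ∫ w, f w * conj (g w) * conj (dop I u (dop (-I) v φ) w) * Complex.exp (-φ w) ∂μ := by
  have hW := contDiff_cexp_neg hφ
  have rW : ∀ w, conj (Complex.exp (-φ w)) = Complex.exp (-φ w) := fun w ↦ by
    rw [← Complex.exp_conj, map_neg, hre]
  have hFW := hf.mul hW
  have sFW : HasCompactSupport (fun w ↦ f w * Complex.exp (-φ w)) := sf.mul_right
  have hwg := wad_contDiff hφ (v := v) hg
  have e1 := dop_ibp μ (c := -I) (v := u) hFW (contDiff_conj hwg) sFW
  have hug := dop_contDiff (c := I) (v := u) hg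
  have hcW : ContDiff ℝ ∞ (fun w ↦ conj (dop I u g w) * Complex.exp (-φ w)) :=
    (contDiff_conj hug).mul hW
  have e2 := dop_ibp μ (c := I) (v := v) hf hcW sf
  have c1 : ∀ w, dop (-I) u (fun w ↦ f w * Complex.exp (-φ w)) w * conj (wad φ v g w)
      = wad φ u f w * conj (wad φ v g w) * Complex.exp (-φ w) := fun w ↦ by
    rw [dop_mul_exp hφ hf]; ring
  have c2 : ∀ w, f w * Complex.exp (-φ w) * dop (-I) u (fun w ↦ conj (wad φ v g w)) w
      = f w * dop I v (fun w ↦ conj (dop I u g w) * Complex.exp (-φ w)) w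
      - f w * conj (g w) * conj (dop I u (dop (-I) v φ) w) * Complex.exp (-φ w) := fun w ↦ by
    rw [dop_conj (hwg.differentiable (by simp) w)]
    have : (fun w ↦ conj (dop I u g w) * Complex.exp (-φ w)) =
      fun w ↦ conj (dop I u g w * Complex.exp (-φ w)) := by
      ext w; rw [map_mul, rW]
    rw [this, dop_conj ((hug.mul hW).differentiable (by simp) w), conj_I, dop_mul_exp hφ hug,
      map_neg, conj_I, neg_neg, dop_wad hφ hg]
    simp only [map_mul, map_sub, rW]
    ring
  simp_rw [c1, c2] at e1
  rw [integral_sub] at e1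
  · rw [e2] at e1
    have : ∀ w, dop I v f w * (conj (dop I u g w) * Complex.exp (-φ w))
      = dop I v f w * conj (dop I u g w) * Complex.exp (-φ w) := fun w ↦ by ring
    simp_rw [this] at e1
    linear_combination e1
  · exact integrable_cs μ (hf.continuous.mul (dop_contDiff hcW).continuous) sf.mul_right
  · exact integrable_cs μ (((hf.continuous.mul (contDiff_conj hg).continuous).mul
      (contDiff_conj (dop_contDiff (dop_contDiff hφ))).continuous).mul hW.continuous)
      (sf.mul_right.mul_right.mul_right)

def crl (e : Fin n → E) (β : Fin n → E → ℂ) (j k : Fin n) (w : E) : ℂ :=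
  dop I (e k) (β j) w - dop I (e j) (β k) w

lemma mkh_ineq (e : Fin n → E) {φ : E → ℂ} (hφ : ContDiff ℝ ∞ φ) (hre : ∀ w, conj (φ w) = φ w)
    {β : Fin n → E → ℂ} (hβ : ∀ j, ContDiff ℝ ∞ (β j)) (sβ : ∀ j, HasCompactSupport (β j)) :
    ∫ w, (∑ j, ∑ k, β j w * conj (β k w) * conj (dop I (e j) (dop (-I) (e k) φ) w)).re
        * Real.exp (-(φ w).re) ∂μ
    ≤ ∫ w, ‖∑ j, wad φ (e j) (β j) w‖ ^ 2 * Real.exp (-(φ w).re) ∂μ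
      + 1/2 * ∫ w, (∑ j, ∑ k, ‖crl e β j k w‖ ^ 2) * Real.exp (-(φ w).re) ∂μ := by
  have hW := contDiff_cexp_neg hφ
  have sW : ∀ j, HasCompactSupport (wad φ (e j) (β j)) := fun j ↦
    (dop_compact (sβ j)).sub (sβ j).mul_right
  have eW : ∀ w, Complex.exp (-φ w) = ((Real.exp (-(φ w).re) : ℝ) : ℂ) := fun w ↦ by
    rw [Complex.ofReal_exp]
    congr 1
    push_cast
    rw [Complex.conj_eq_iff_re.mp (hre w)]
  have cR : Continuous fun w ↦ Real.exp (-(φ w).re) :=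
    Real.continuous_exp.comp (Complex.continuous_re.comp hφ.continuous).neg
  have i1 : ∀ j k, Integrable (fun w ↦ wad φ (e j) (β j) w * conj (wad φ (e k) (β k) w) * Complex.exp (-φ w)) μ :=
    fun j k ↦ integrable_cs μ (((wad_contDiff hφ (hβ j)).continuous.mul
      (contDiff_conj (wad_contDiff hφ (hβ k))).continuous).mul hW.continuous) (sW j).mul_right.mul_right
  have i2 : ∀ j k, Integrable (fun w ↦ dop I (e k) (β j) w * conj (dop I (e j) (β k) w) * Complex.exp (-φ w)) μ :=
    fun j k ↦ integrable_cs μ (((dop_contDiff (hβ j)).continuous.mul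
      (contDiff_conj (dop_contDiff (hβ k))).continuous).mul hW.continuous) (dop_compact (sβ j)).mul_right.mul_right
  have i3 : ∀ j k, Integrable (fun w ↦ β j w * conj (β k w) * conj (dop I (e j) (dop (-I) (e k) φ) w) * Complex.exp (-φ w)) μ :=
    fun j k ↦ integrable_cs μ (((((hβ j)).continuous.mul
      (contDiff_conj ((hβ k))).continuous).mul (contDiff_conj (dop_contDiff (dop_contDiff hφ))).continuous).mul hW.continuous)
       ((sβ j)).mul_right.mul_right.mul_right
  have key : ∫ w, (∑ j, ∑ k, wad φ (e j) (β j) w * conj (wad φ (e k) (β k) w) * Complex.exp (-φ w)) ∂μ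
    = ∫ w, (∑ j, ∑ k, dop I (e k) (β j) w * conj (dop I (e j) (β k) w) * Complex.exp (-φ w)) ∂μ
    + ∫ w, (∑ j, ∑ k, β j w * conj (β k w) * conj (dop I (e j) (dop (-I) (e k) φ) w) * Complex.exp (-φ w)) ∂μ := by
    rw [integral_finsetSum _ (fun j _ ↦ integrable_finsetSum _ fun k _ ↦ i1 j k),
      integral_finsetSum _ (fun j _ ↦ integrable_finsetSum _ fun k _ ↦ i2 j k),
      integral_finsetSum _ (fun j _ ↦ integrable_finsetSum _ fun k _ ↦ i3 j k), ← sum_add_distrib]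
    refine sum_congr rfl fun j _ ↦ ?_
    rw [integral_finsetSum _ (fun k _ ↦ i1 j k), integral_finsetSum _ (fun k _ ↦ i2 j k),
      integral_finsetSum _ (fun k _ ↦ i3 j k), ← sum_add_distrib]
    refine sum_congr rfl fun k _ ↦ ?_
    exact mkh_pair μ hφ hre (e j) (e k) (hβ j) (hβ k) (sβ j)
  have key2 := congrArg Complex.re key
  rw [add_re] at key2
  have re_int : ∀ {F : E → ℂ}, Integrable F μ → (∫ w, F w ∂μ).re = ∫ w, (F w).re ∂μ := fun {F} hF ↦
    (integral_re hF).symm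
  have j1 := (integrable_finsetSum Finset.univ fun j _ ↦ integrable_finsetSum Finset.univ fun k _ ↦ i1 j k)
  have j2 := (integrable_finsetSum Finset.univ fun j _ ↦ integrable_finsetSum Finset.univ fun k _ ↦ i2 j k)
  have j3 := (integrable_finsetSum Finset.univ fun j _ ↦ integrable_finsetSum Finset.univ fun k _ ↦ i3 j k)
  rw [re_int j1, re_int j2, re_int j3] at key2
  have p1 : ∀ w, (∑ j, ∑ k, wad φ (e j) (β j) w * conj (wad φ (e k) (β k) w) * Complex.exp (-φ w)).re
      = ‖∑ j, wad φ (e j) (β j) w‖ ^ 2 * Real.exp (-(φ w).re) := fun w ↦ by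
    simp_rw [← sum_mul, ← mul_sum, ← sum_mul, ← map_sum]
    rw [Complex.mul_conj, eW, ← Complex.ofReal_mul, ofReal_re, normSq_eq_norm_sq]
  have p3 : ∀ w, (∑ j, ∑ k, β j w * conj (β k w) * conj (dop I (e j) (dop (-I) (e k) φ) w) * Complex.exp (-φ w)).re
      = (∑ j, ∑ k, β j w * conj (β k w) * conj (dop I (e j) (dop (-I) (e k) φ) w)).re
        * Real.exp (-(φ w).re) := fun w ↦ by
    simp_rw [← sum_mul]
    rw [eW, Complex.re_mul_ofReal]
  have p2 : ∀ w, - (1/2 * ((∑ j, ∑ k, ‖crl e β j k w‖ ^ 2) * Real.exp (-(φ w).re))) ≤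
      (∑ j, ∑ k, dop I (e k) (β j) w * conj (dop I (e j) (β k) w) * Complex.exp (-φ w)).re := fun w ↦ by
    simp_rw [← sum_mul]
    rw [eW, Complex.re_mul_ofReal]
    have : -(1/2 * (∑ j, ∑ k, ‖crl e β j k w‖ ^ 2)) ≤
      (∑ j, ∑ k, dop I (e k) (β j) w * conj (dop I (e j) (β k) w)).re := by
      rw [Complex.re_sum]
      simp_rw [Complex.re_sum]
      rw [mul_sum, ← Finset.sum_neg_distrib]
      simp_rw [mul_sum, ← Finset.sum_neg_distrib]
      refine sum_le_sum fun j _ ↦ sum_le_sum fun k _ ↦ ?_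
      rw [crl, ← normSq_eq_norm_sq, Complex.normSq_sub]
      have a1 := Complex.normSq_nonneg (dop I (e k) (β j) w)
      have a2 := Complex.normSq_nonneg (dop I (e j) (β k) w)
      linarith
    nlinarith [exp_pos (-(φ w).re)]
  simp_rw [p1, p3] at key2
  rw [key2]
  have hcr : ∀ j k, ContDiff ℝ ∞ (crl e β j k) := fun j k ↦ (dop_contDiff (hβ j)).sub (dop_contDiff (hβ k))
  have scr : ∀ j k, HasCompactSupport (crl e β j k) := fun j k ↦ (dop_compact (sβ j)).sub (dop_compact (sβ k))
  have icr : Integrable (fun w ↦ (∑ j, ∑ k, ‖crl e β j k w‖ ^ 2) * Real.exp (-(φ w).re)) μ := by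
    have : ∀ j k, Integrable (fun w ↦ ‖crl e β j k w‖ ^ 2 * Real.exp (-(φ w).re)) μ := fun j k ↦
      Continuous.integrable_of_hasCompactSupport (((hcr j k).continuous.norm.pow 2).mul cR)
        (HasCompactSupport.mul_right (by
          have := (scr j k).norm
          exact this.comp_left (g := fun x : ℝ ↦ x ^ 2) (by simp)))
    simp_rw [sum_mul]
    exact integrable_finsetSum _ fun j _ ↦ integrable_finsetSum _ fun k _ ↦ this j k
  have := integral_mono (icr.const_mul (1/2)).neg (j2.re) p2
  have t : ∫ w, (-fun w ↦ 1/2 * ((∑ j, ∑ k, ‖crl e β j k w‖ ^ 2) * Real.exp (-(φ w).re))) w ∂μ = -(1/2 * ∫ w, (∑ j, ∑ k, ‖crl e β j k w‖ ^ 2) * Real.exp (-(φ w).re) ∂μ) := by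
    rw [← integral_const_mul, ← integral_neg]; rfl
  have t2 : ∫ w, RCLike.re (∑ j, ∑ k, dop I (e k) (β j) w * conj (dop I (e j) (β k) w) * Complex.exp (-φ w)) ∂μ
     = ∫ w, (∑ j, ∑ k, dop I (e k) (β j) w * conj (dop I (e j) (β k) w) * Complex.exp (-φ w)).re ∂μ := rfl
  rw [t, t2] at this
  linarith
end

section
variable {E : Type*} [NormedAddCommGroup E] [NormedSpace ℂ E]

def hcut (a t : ℝ) : ℝ := t * smoothTransition (2 * t / a - 1) + (1 - smoothTransition (2 * t / a - 1))

lemma hcut_contDiff (a : ℝ) : ContDiff ℝ ∞ (hcut a) := by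
  unfold hcut
  have : ContDiff ℝ ∞ (fun t : ℝ ↦ smoothTransition (2 * t / a - 1)) :=
    Real.smoothTransition.contDiff.comp (by fun_prop)
  fun_prop

lemma hcut_pos {a : ℝ} (ha : 0 < a) (t : ℝ) : 0 < hcut a t := by
  unfold hcut
  have h0 := Real.smoothTransition.nonneg (2 * t / a - 1)
  have h1 := Real.smoothTransition.le_one (2 * t / a - 1)
  by_cases h : t ≤ a / 2
  · rw [Real.smoothTransition.zero_of_nonpos]
    · simp
    · rw [sub_nonpos, div_le_one ha]; linarith
  · push Not at h
    have : 0 < t := by linarith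
    rcases eq_or_lt_of_le h0 with h2 | h2
    · rw [← h2]; simp
    · nlinarith [mul_pos this h2]

lemma hcut_eq {a t : ℝ} (ha : 0 < a) (h : a ≤ t) : hcut a t = t := by
  unfold hcut
  rw [Real.smoothTransition.one_of_one_le]
  · simp
  · rw [le_sub_iff_add_le, le_div_iff₀ ha]; linarith

def om (s : E → ℝ) (c A : ℝ) (w : E) : ℝ := if s w < c then Real.exp (-(A / (c - s w))) else 0

def kap (s : E → ℝ) (c A : ℝ) (v : E) (w : E) : ℂ :=
  dop (-I) v (fun w ↦ (s w : ℂ)) w * ((A / (c - s w) ^ 2 - 2 / (c - s w) : ℝ) : ℂ)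

def tdv (s : E → ℝ) (c A : ℝ) (e : Fin n → E) (β : Fin n → E → ℂ) (w : E) : ℂ :=
  ∑ j, (dop (-I) (e j) (β j) w - β j w * kap s c A (e j) w)

lemma dop_real_comp {g : ℝ → ℝ} {s : E → ℝ} {w : E} {g' : ℝ} (hg : HasDerivAt g g' (s w))
    (hs : DifferentiableAt ℝ s w) (c : ℂ) (v : E) :
    dop c v (fun w ↦ ((g (s w) : ℝ) : ℂ)) w = g' * dop c v (fun w ↦ (s w : ℂ)) w := by
  have h1 := (Complex.ofRealCLM.hasFDerivAt.comp w (hg.comp_hasFDerivAt w hs.hasFDerivAt)).fderiv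
  have h2 := (Complex.ofRealCLM.hasFDerivAt.comp w hs.hasFDerivAt).fderiv
  have h1' : fderiv ℝ (fun w ↦ ((g (s w) : ℝ) : ℂ)) w = _ := h1
  have h2' : fderiv ℝ (fun w ↦ ((s w : ℝ) : ℂ)) w = _ := h2
  unfold dop
  rw [h1', h2']
  simp; ring

lemma conj_dop_real {s : E → ℝ} {w : E} (hs : DifferentiableAt ℝ s w) (c : ℂ) (v : E) :
    conj (dop c v (fun w ↦ (s w : ℂ)) w) = dop (conj c) v (fun w ↦ (s w : ℂ)) w := by
  have : DifferentiableAt ℝ (fun w ↦ (s w : ℂ)) w := Complex.ofRealCLM.differentiableAt.comp w hs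
  have h := dop_conj (c := conj c) (v := v) this
  simp at h
  exact h.symm

lemma contDiff_ofReal' {s : E → ℝ} (hs : ContDiff ℝ ∞ s) : ContDiff ℝ ∞ (fun w ↦ (s w : ℂ)) :=
  Complex.ofRealCLM.contDiff.comp hs

lemma hess_phi {s : E → ℝ} (hs : ContDiff ℝ ∞ s) {c A : ℝ} {φ : E → ℂ} {w : E} (hw : s w < c)
    (hφ : ∀ᶠ x in nhds w, φ x = ((A / (c - s x) : ℝ) : ℂ)) (u v : E) :
    dop (-I) v φ w = ((A / (c - s w) ^ 2 : ℝ) : ℂ) * dop (-I) v (fun w ↦ (s w : ℂ)) w ∧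
    dop I u (dop (-I) v φ) w =
      ((A / (c - s w) ^ 2 : ℝ) : ℂ) * dop I u (dop (-I) v (fun w ↦ (s w : ℂ))) w
      + ((2 * A / (c - s w) ^ 3 : ℝ) : ℂ) * (dop (-I) v (fun w ↦ (s w : ℂ)) w
        * dop I u (fun w ↦ (s w : ℂ)) w) := by
  have hd := hs.differentiable (by simp)
  have h1 : ∀ᶠ x in nhds w, s x < c := hs.continuous.continuousAt.eventually (gt_mem_nhds hw)
  have h2 : ∀ᶠ x in nhds w, dop (-I) v φ x =
      ((A / (c - s x) ^ 2 : ℝ) : ℂ) * dop (-I) v (fun w ↦ (s w : ℂ)) x := by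
    filter_upwards [hφ.eventually_nhds, h1] with x hx hx1
    rw [dop_congr (g := fun x ↦ ((A / (c - s x) : ℝ) : ℂ)) hx]
    have hg : HasDerivAt (fun y ↦ A / (c - y)) (A / (c - s x) ^ 2) (s x) := by
      have h := ((hasDerivAt_id (s x)).const_sub c).fun_inv (sub_pos.2 hx1).ne'
      have := h.const_mul A
      refine (this.congr_deriv ?_).congr_of_eventuallyEq (Eventually.of_forall fun y ↦ ?_)
      · simp; ring
      · simp [div_eq_mul_inv]
    exact dop_real_comp hg (hd x) _ _
  refine ⟨h2.self_of_nhds, ?_⟩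
  rw [dop_congr h2]
  have hg : HasDerivAt (fun y ↦ A / (c - y) ^ 2) (2 * A / (c - s w) ^ 3) (s w) := by
    have hne := (sub_pos.2 hw).ne'
    have h := ((((hasDerivAt_id (s w)).const_sub c).fun_pow 2).fun_inv (pow_ne_zero 2 hne)).const_mul A
    refine (h.congr_deriv ?_).congr_of_eventuallyEq (Eventually.of_forall fun y ↦ ?_)
    · simp; field_simp
    · simp [div_eq_mul_inv]
  have hc := contDiff_ofReal' hs
  have d1 : DifferentiableAt ℝ (fun x ↦ ((A / (c - s x) ^ 2 : ℝ) : ℂ)) w :=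
    Complex.ofRealCLM.differentiableAt.comp w (hg.differentiableAt.comp w (hd w))
  rw [dop_mul d1 ((dop_contDiff hc).differentiable (by simp) w), dop_real_comp hg (hd w)]
  ring

variable [MeasurableSpace E] [BorelSpace E] [FiniteDimensional ℝ E] (μ : Measure E)
  [μ.IsAddHaarMeasure]

lemma basic_est (e : Fin n → E) {s : E → ℝ} (hs : ContDiff ℝ ∞ s) {c A m T : ℝ}
    (hT : ∀ w, s w < c → c - s w ≤ T) (hA1 : 4 * T ≤ A) (hA2 : 1 ≤ A * m) (hA : 0 < A)
    (hL : ∀ w, s w < c → ∀ b : Fin n → ℂ, m * ∑ j, ‖b j‖ ^ 2 ≤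
      (∑ j, ∑ k, b j * conj (b k) * conj (dop I (e j) (dop (-I) (e k) fun w ↦ (s w : ℂ)) w)).re)
    {β : Fin n → E → ℂ} (hβ : ∀ j, ContDiff ℝ ∞ (β j)) (sβ : ∀ j, HasCompactSupport (β j))
    (tβ : ∀ j, tsupport (β j) ⊆ {w | s w < c}) :
    ∫ w, (∑ j, ‖β j w‖ ^ 2) * (om s c A w / (c - s w) ^ 2) ∂μ ≤
      2 * ∫ w, ‖tdv s c A e β w‖ ^ 2 * om s c A w ∂μ
      + 1/2 * ∫ w, (∑ j, ∑ k, ‖crl e β j k w‖ ^ 2) * om s c A w ∂μ := by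
  set K := ⋃ j, tsupport (β j) with hK
  have cK : IsCompact K := isCompact_iUnion fun j ↦ sβ j
  obtain ⟨a, ha, hKa⟩ : ∃ a > 0, ∀ w ∈ K, a < c - s w := by
    rcases K.eq_empty_or_nonempty with h | h
    · exact ⟨1, one_pos, by simp [h]⟩
    · obtain ⟨x, hx, hmin⟩ := cK.exists_isMinOn h (continuous_const.sub hs.continuous : Continuous fun w ↦ c - s w).continuousOn
      have hx' : s x < c := by
        obtain ⟨j, hj⟩ := mem_iUnion.1 hx
        exact tβ j hj
      refine ⟨(c - s x) / 2, by linarith, fun w hw ↦ ?_⟩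
      have := hmin hw
      have : c - s x ≤ c - s w := this
      linarith
  set h : E → ℝ := fun w ↦ hcut a (c - s w) with hh
  have ch : ContDiff ℝ ∞ h := (hcut_contDiff a).comp (contDiff_const.sub hs)
  have hpos : ∀ w, 0 < h w := fun w ↦ hcut_pos ha _
  have heq : ∀ w ∈ K, ∀ᶠ x in nhds w, h x = c - s x := fun w hw ↦ by
    have : ∀ᶠ x in nhds w, a < c - s x :=
      (continuous_const.sub hs.continuous : Continuous fun w ↦ c - s w).continuousAt.eventually (lt_mem_nhds (hKa w hw))
    filter_upwards [this] with x hx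
    exact hcut_eq ha hx.le
  set φr : E → ℝ := fun w ↦ A / h w with hφr
  have cφr : ContDiff ℝ ∞ φr := contDiff_const.div ch fun w ↦ (hpos w).ne'
  set φ : E → ℂ := fun w ↦ (φr w : ℂ) with hφ
  have cφ : ContDiff ℝ ∞ φ := contDiff_ofReal' cφr
  have main := mkh_ineq μ e cφ (fun w ↦ conj_ofReal _) hβ sβ
  have hφre : ∀ w, (φ w).re = φr w := fun w ↦ rfl
  simp_rw [hφre] at main
  have zβ : ∀ w, w ∉ K → ∀ j, w ∉ tsupport (β j) := fun w hw j hj ↦ hw (mem_iUnion.2 ⟨j, hj⟩)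
  have z0 : ∀ w, w ∉ K → ∀ j, β j w = 0 := fun w hw j ↦ image_eq_zero_of_notMem_tsupport (zβ w hw j)
  have zd : ∀ w, w ∉ K → ∀ c v j, dop c v (β j) w = 0 := fun w hw c v j ↦ by
    by_contra h
    exact zβ w hw j (dop_support h)
  have eom : ∀ w ∈ K, om s c A w = Real.exp (-φr w) := fun w hw ↦ by
    have := hKa w hw
    rw [om, if_pos (by linarith)]; simp only [hφr]; rw [(heq w hw).self_of_nhds]
  have f1 : ∀ w, (∑ j, ‖β j w‖ ^ 2) * (om s c A w / (c - s w) ^ 2) = (∑ j, ‖β j w‖ ^ 2) * (Real.exp (-φr w) / (h w) ^ 2) := fun w ↦ by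
    by_cases hw : w ∈ K
    · rw [eom w hw, (heq w hw).self_of_nhds]
    · simp [z0 w hw]
  set S : E → ℂ := fun w ↦ (s w : ℂ) with hS
  have cS : ContDiff ℝ ∞ S := contDiff_ofReal' hs
  have ckap : ∀ j, Continuous fun w ↦ dop (-I) (e j) S w * ((A / (h w) ^ 2 - 2 / (h w) : ℝ) : ℂ) := fun j ↦ by
    refine (dop_contDiff cS).continuous.mul (Complex.continuous_ofReal.comp ?_)
    have := ch.continuous
    exact (continuous_const.div (this.pow 2) fun w ↦ pow_ne_zero 2 (hpos w).ne').sub (continuous_const.div this fun w ↦ (hpos w).ne')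
  have f2 : ∀ w, tdv s c A e β w = ∑ j, (dop (-I) (e j) (β j) w - β j w * (dop (-I) (e j) S w * ((A / (h w) ^ 2 - 2 / (h w) : ℝ) : ℂ))) := fun w ↦ by
    by_cases hw : w ∈ K
    · rw [(heq w hw).self_of_nhds]; rfl
    · simp [tdv, z0 w hw, zd w hw]
  have ctdv : Continuous (tdv s c A e β) := by
    have : tdv s c A e β = _ := funext f2
    rw [this]
    exact continuous_finsetSum _ fun j _ ↦ (dop_contDiff (hβ j)).continuous.sub ((hβ j).continuous.mul (ckap j))
  have off : ∀ {F : E → ℝ}, Continuous F → (∀ w, w ∉ K → F w = 0) → Integrable F μ := fun {F} hF hz ↦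
    hF.integrable_of_hasCompactSupport (HasCompactSupport.intro cK hz)
  have cexp : Continuous fun w ↦ Real.exp (-φr w) := Real.continuous_exp.comp cφr.continuous.neg
  have cwad : ∀ j, Continuous (wad φ (e j) (β j)) := fun j ↦ (wad_contDiff cφ (hβ j)).continuous
  have z1 : ∀ w, w ∉ K → tdv s c A e β w = 0 := fun w hw ↦ by simp [tdv, z0 w hw, zd w hw]
  have g2 : ∀ w, ‖tdv s c A e β w‖ ^ 2 * om s c A w = ‖tdv s c A e β w‖ ^ 2 * Real.exp (-φr w) := fun w ↦ by
    by_cases hw : w ∈ K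
    · rw [eom w hw]
    · simp [z1 w hw]
  have g3 : ∀ w, (∑ j, ∑ k, ‖crl e β j k w‖ ^ 2) * om s c A w = (∑ j, ∑ k, ‖crl e β j k w‖ ^ 2) * Real.exp (-φr w) := fun w ↦ by
    by_cases hw : w ∈ K
    · rw [eom w hw]
    · simp [crl, zd w hw]
  have I1 : Integrable (fun w ↦ (∑ j, ‖β j w‖ ^ 2) * (Real.exp (-φr w) / (h w) ^ 2)) μ :=
    off ((continuous_finsetSum _ fun j _ ↦ (hβ j).continuous.norm.pow 2).mul
      (cexp.div (ch.continuous.pow 2) fun w ↦ pow_ne_zero 2 (hpos w).ne')) fun w hw ↦ by simp [z0 w hw]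
  have I2 : Integrable (fun w ↦ ‖tdv s c A e β w‖ ^ 2 * Real.exp (-φr w)) μ :=
    off ((ctdv.norm.pow 2).mul cexp) fun w hw ↦ by simp [z1 w hw]
  have I3 : Integrable (fun w ↦ ‖∑ j, wad φ (e j) (β j) w‖ ^ 2 * Real.exp (-φr w)) μ :=
    off (((continuous_finsetSum _ fun j _ ↦ cwad j).norm.pow 2).mul cexp) fun w hw ↦ by
      simp [wad, z0 w hw, zd w hw]
  have I4 : Integrable (fun w ↦ (∑ j, ∑ k, β j w * conj (β k w) * conj (dop I (e j) (dop (-I) (e k) φ) w)).re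
        * Real.exp (-(φr w))) μ :=
    off ((Complex.continuous_re.comp (continuous_finsetSum _ fun j _ ↦ continuous_finsetSum _ fun k _ ↦
      (((hβ j)).continuous.mul (contDiff_conj ((hβ k))).continuous).mul
      (contDiff_conj (dop_contDiff (dop_contDiff cφ))).continuous)).mul cexp) fun w hw ↦ by
      simp [z0 w hw]
  have pt : ∀ w, (∑ j, ‖β j w‖ ^ 2) * (Real.exp (-φr w) / (h w) ^ 2) ≤
     (2 * (‖tdv s c A e β w‖ ^ 2 * Real.exp (-φr w)) +
      (∑ j, ∑ k, β j w * conj (β k w) * conj (dop I (e j) (dop (-I) (e k) φ) w)).re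
        * Real.exp (-(φr w))) - ‖∑ j, wad φ (e j) (β j) w‖ ^ 2 * Real.exp (-φr w) := fun w ↦ by
    by_cases hw : w ∈ K
    swap
    · simp [z0 w hw, wad, zd w hw, z1 w hw]
    have hwc : s w < c := by have := hKa w hw; linarith
    have hev : ∀ᶠ x in nhds w, φ x = ((A / (c - s x) : ℝ) : ℂ) := by
      filter_upwards [heq w hw] with x hx
      simp only [hφ, hφr, hx]
    have H := hess_phi hs hwc hev
    set t := c - s w with ht
    have tp : 0 < t := by linarith
    have tT : t ≤ T := hT w hwc
    rw [(heq w hw).self_of_nhds]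
    set σ : ℂ := ∑ j, β j w * dop (-I) (e j) S w with hσ
    have k1 : ∑ j, wad φ (e j) (β j) w = tdv s c A e β w - ((2 / t : ℝ) : ℂ) * σ := by
      rw [hσ, mul_sum, tdv, ← Finset.sum_sub_distrib]
      refine sum_congr rfl fun j _ ↦ ?_
      rw [wad, (H (e j) (e j)).1, kap, ← ht]
      push_cast
      ring
    have k2 : (∑ j, ∑ k, β j w * conj (β k w) * conj (dop I (e j) (dop (-I) (e k) φ) w)).re
       = A / t ^ 2 * (∑ j, ∑ k, β j w * conj (β k w) * conj (dop I (e j) (dop (-I) (e k) S) w)).re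
        + 2 * A / t ^ 3 * ‖σ‖ ^ 2 := by
      have : ∑ j, ∑ k, β j w * conj (β k w) * conj (dop I (e j) (dop (-I) (e k) φ) w)
       = ((A / t ^ 2 : ℝ) : ℂ) * (∑ j, ∑ k, β j w * conj (β k w) * conj (dop I (e j) (dop (-I) (e k) S) w))
        + ((2 * A / t ^ 3 : ℝ) : ℂ) * (σ * conj σ) := by
        rw [hσ, map_sum, Finset.sum_mul_sum, mul_sum, mul_sum, ← sum_add_distrib]
        refine sum_congr rfl fun j _ ↦ ?_
        rw [mul_sum, mul_sum, ← sum_add_distrib]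
        refine sum_congr rfl fun k _ ↦ ?_
        rw [(H (e j) (e k)).2]
        simp only [map_add, map_mul, conj_ofReal]
        rw [hS, conj_dop_real (hs.differentiable (by simp) w) I, conj_I]
        ring
      rw [this, Complex.mul_conj, add_re, re_ofReal_mul, ← Complex.ofReal_mul, ofReal_re,
        normSq_eq_norm_sq]
    have k3 := hL w hwc fun j ↦ β j w
    rw [k1, k2]
    have k4 : ‖tdv s c A e β w - ((2 / t : ℝ) : ℂ) * σ‖ ^ 2 ≤ 2 * ‖tdv s c A e β w‖ ^ 2 + 8 / t ^ 2 * ‖σ‖ ^ 2 := by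
      have h1 := norm_sub_le (tdv s c A e β w) (((2 / t : ℝ) : ℂ) * σ)
      have h2 : ‖((2 / t : ℝ) : ℂ) * σ‖ = 2 / t * ‖σ‖ := by
        rw [norm_mul, norm_real, norm_of_nonneg (by positivity)]
      rw [h2] at h1
      have h3 : 8 / t ^ 2 * ‖σ‖ ^ 2 = 2 * (2 / t * ‖σ‖) ^ 2 := by field_simp; ring
      rw [h3]
      nlinarith [sq_nonneg (‖tdv s c A e β w‖ - 2 / t * ‖σ‖), norm_nonneg (tdv s c A e β w - ((2 / t : ℝ) : ℂ) * σ), norm_nonneg (tdv s c A e β w)]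
    have k5 : 8 / t ^ 2 * ‖σ‖ ^ 2 ≤ 2 * A / t ^ 3 * ‖σ‖ ^ 2 := by
      gcongr ?_ * _
      rw [div_le_div_iff₀ (by positivity) (by positivity)]
      nlinarith [pow_pos tp 2, mul_le_mul_of_nonneg_right (le_trans (mul_le_mul_of_nonneg_left tT (by norm_num : (0:ℝ) ≤ 4)) hA1) (pow_pos tp 2).le]
    have sq0 : 0 ≤ ∑ j, ‖β j w‖ ^ 2 := sum_nonneg fun _ _ ↦ by positivity
    have k6 : (∑ j, ‖β j w‖ ^ 2) / t ^ 2 ≤ A / t ^ 2 * (∑ j, ∑ k, β j w * conj (β k w) * conj (dop I (e j) (dop (-I) (e k) S) w)).re := by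
      rw [div_mul_eq_mul_div]
      gcongr
      nlinarith
    have ep := exp_pos (-φr w)
    have : (∑ j, ‖β j w‖ ^ 2) * (Real.exp (-φr w) / t ^ 2) = (∑ j, ‖β j w‖ ^ 2) / t ^ 2 * Real.exp (-φr w) := by ring
    rw [this, ← mul_assoc, ← add_mul, ← sub_mul]
    refine mul_le_mul_of_nonneg_right ?_ ep.le
    linarith
  have mono := integral_mono I1 (((I2.const_mul 2).add I4).sub I3) pt
  rw [integral_sub' ((I2.const_mul 2).add I4) I3, integral_add' (I2.const_mul 2) I4, integral_const_mul] at mono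
  simp_rw [f1, g2, g3]
  linarith
end

section

def mol0 (r : ℝ) (y : Cn n) : ℝ := smoothTransition (1 - ‖y‖ ^ 2 / r ^ 2)

def mol (r : ℝ) (y : Cn n) : ℝ := mol0 r y / ∫ x : Cn n, mol0 r x

lemma mol0_contDiff (r : ℝ) : ContDiff ℝ ∞ (mol0 (n := n) r) := by
  unfold mol0
  refine Real.smoothTransition.contDiff.comp ?_
  exact contDiff_const.sub ((contDiff_norm_sq ℝ).div_const _)

lemma mol0_zero {r : ℝ} (hr : 0 < r) {y : Cn n} (hy : r ≤ ‖y‖) : mol0 r y = 0 := by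
  apply Real.smoothTransition.zero_of_nonpos
  rw [sub_nonpos, one_le_div (by positivity)]
  gcongr

lemma mol0_compact {r : ℝ} (hr : 0 < r) : HasCompactSupport (mol0 (n := n) r) := by
  refine HasCompactSupport.intro (isCompact_closedBall 0 r) fun x hx ↦ mol0_zero hr ?_
  simp at hx
  exact hx.le

lemma mol0_int_pos {r : ℝ} (hr : 0 < r) : 0 < ∫ x : Cn n, mol0 r x := by
  refine (mol0_contDiff r).continuous.integral_pos_of_hasCompactSupport_nonneg_nonzero (mol0_compact hr)
    (fun x ↦ Real.smoothTransition.nonneg _) (x := 0) ?_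
  simp [mol0]

lemma mol_contDiff (r : ℝ) : ContDiff ℝ ∞ (mol (n := n) r) := (mol0_contDiff r).div_const _

lemma mol_zero {r : ℝ} (hr : 0 < r) {y : Cn n} (hy : r ≤ ‖y‖) : mol r y = 0 := by
  simp [mol, mol0_zero hr hy]

lemma mol_compact {r : ℝ} (hr : 0 < r) : HasCompactSupport (mol (n := n) r) := by
  refine HasCompactSupport.intro (isCompact_closedBall 0 r) fun x hx ↦ mol_zero hr ?_
  simp at hx
  exact hx.le

lemma mol_nonneg {r : ℝ} (hr : 0 < r) (y : Cn n) : 0 ≤ mol r y :=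
  div_nonneg (Real.smoothTransition.nonneg _) (mol0_int_pos hr).le

lemma mol_integrable {r : ℝ} (hr : 0 < r) : Integrable (mol (n := n) r) :=
  (mol_contDiff r).continuous.integrable_of_hasCompactSupport (mol_compact hr)

lemma mol_int {r : ℝ} (hr : 0 < r) : ∫ y : Cn n, mol r y = 1 := by
  unfold mol
  rw [integral_div, div_self (mol0_int_pos hr).ne']

lemma mol_rot (r : ℝ) {ζ : ℂ} (hζ : ‖ζ‖ = 1) (y : Cn n) : mol r (ζ • y) = mol r y := by
  simp [mol, mol0, norm_smul, hζ]

lemma mol_neg (r : ℝ) (y : Cn n) : mol r (-y) = mol r y := by simp [mol, mol0]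

variable {F : Type*} [NormedAddCommGroup F] [NormedSpace ℝ F]

def moll (r : ℝ) (g : Cn n → F) (w : Cn n) : F := ∫ y, mol r (w - y) • g y

lemma moll_eq_conv (r : ℝ) (g : Cn n → F) :
    moll r g = convolution g (mol r) (ContinuousLinearMap.lsmul ℝ ℝ).flip volume := by
  ext w; simp [moll, convolution]

lemma moll_swap (r : ℝ) (g : Cn n → F) (w : Cn n) : moll r g w = ∫ y, mol r y • g (w - y) := by
  rw [moll_eq_conv, convolution_eq_swap]; simp

lemma moll_contDiff [CompleteSpace F] {r : ℝ} (hr : 0 < r) {g : Cn n → F} (hg : LocallyIntegrable g) :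
    ContDiff ℝ ∞ (moll r g) := by
  rw [moll_eq_conv]
  exact (mol_compact hr).contDiff_convolution_right _ hg (mol_contDiff r)

lemma moll_integrable {r : ℝ} (hr : 0 < r) {g : Cn n → F} (hg : LocallyIntegrable g) (w : Cn n) :
    Integrable (fun y ↦ mol r (w - y) • g y) := by
  have := (mol_compact hr).convolutionExists_right (ContinuousLinearMap.lsmul ℝ ℝ).flip hg (mol_contDiff r).continuous w
  simpa [ConvolutionExistsAt] using this

def mtest (r : ℝ) (w : Cn n) (y : Cn n) : ℂ := (mol r (w - y) : ℂ)

lemma mtest_contDiff (r : ℝ) (w : Cn n) : ContDiff ℝ ∞ (mtest r w) :=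
  Complex.ofRealCLM.contDiff.comp ((mol_contDiff r).comp (contDiff_const.sub contDiff_id))

lemma mtest_tsupport {r : ℝ} (hr : 0 < r) (w : Cn n) : tsupport (mtest r w) ⊆ closedBall w r := by
  refine closure_minimal (fun y hy ↦ ?_) isClosed_closedBall
  by_contra h
  apply hy
  simp only [mem_closedBall, not_le, dist_comm y w, dist_eq_norm] at h
  simp [mtest, mol_zero hr h.le]

lemma mtest_compact {r : ℝ} (hr : 0 < r) (w : Cn n) : HasCompactSupport (mtest r w) :=
  (isCompact_closedBall w r).of_isClosed_subset (isClosed_tsupport _) (mtest_tsupport hr w)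

lemma moll_eq_mtest (r : ℝ) (g : Cn n → ℂ) (w : Cn n) : moll r g w = ∫ y, mtest r w y * g y := by
  simp [moll, mtest]

lemma dop_moll {r : ℝ} (hr : 0 < r) {g : Cn n → ℂ} (hg : LocallyIntegrable g) (c : ℂ) (v w : Cn n) :
    dop c v (moll r g) w = - ∫ y, dop c v (mtest r w) y * g y := by
  have h := ((mol_compact hr).hasFDerivAt_convolution_right (ContinuousLinearMap.lsmul ℝ ℝ).flip hg
    ((mol_contDiff r).of_le ENat.LEInfty.out) w)
  have h1 : ContDiff ℝ 1 (mol (n := n) r) := (mol_contDiff r).of_le ENat.LEInfty.out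
  rw [← moll_eq_conv] at h
  have hx : ∀ x, fderiv ℝ (moll r g) w x = ∫ y, (fderiv ℝ (mol r) (w - y) x : ℂ) * g y := by
    intro x
    rw [h.fderiv, convolution_precompR_apply _ hg ((mol_compact hr).fderiv ℝ) (h1.continuous_fderiv one_ne_zero)]
    simp [convolution]
  have hm : ∀ y x, fderiv ℝ (mtest r w) y x = -(fderiv ℝ (mol r) (w - y) x : ℂ) := by
    intro y x
    have a1 : HasFDerivAt (fun y ↦ w - y) (-ContinuousLinearMap.id ℝ (Cn n)) y := (hasFDerivAt_id y).const_sub w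
    have a2 : HasFDerivAt (mol (n := n) r) (fderiv ℝ (mol r) (w - y)) (w - y) :=
      ((mol_contDiff r).differentiable (by simp) _).hasFDerivAt
    have := (Complex.ofRealCLM.hasFDerivAt.comp y (a2.comp y a1)).fderiv
    have h' : fderiv ℝ (mtest r w) y = _ := this
    rw [h']; simp
  have i : ∀ x, Integrable fun y ↦ (fderiv ℝ (mol r) (w - y) x : ℂ) * g y := fun x ↦ by
    have := ((mol_compact hr).fderiv_apply ℝ x).convolutionExists_right (ContinuousLinearMap.lsmul ℝ ℝ).flip hg
      ((h1.continuous_fderiv one_ne_zero).clm_apply continuous_const) w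
    simpa [ConvolutionExistsAt] using this
  unfold dop
  rw [hx, hx, ← integral_neg, ← integral_const_mul, ← integral_add (i _) ((i _).const_mul _), ← integral_div]
  refine integral_congr_ae (Eventually.of_forall fun y ↦ ?_)
  simp only [hm]
  ring

lemma moll_support {r : ℝ} (hr : 0 < r) {g : Cn n → F} {K : Set (Cn n)} (hK : ∀ y ∉ K, g y = 0)
    {w : Cn n} (hw : ∀ y ∈ K, r ≤ ‖w - y‖) : moll r g w = 0 := by
  unfold moll
  rw [integral_eq_zero_of_ae]
  refine Eventually.of_forall fun y ↦ ?_
  by_cases h : y ∈ K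
  · simp [mol_zero hr (hw y h)]
  · simp [hK y h]

lemma cs_prob {r : ℝ} (hr : 0 < r) {f : Cn n → ℝ≥0∞} (hf : AEMeasurable f) :
    (∫⁻ y, ENNReal.ofReal (mol r y) * f y) ^ 2 ≤ ∫⁻ y, ENNReal.ofReal (mol r y) * f y ^ 2 := by
  have hm : Measurable fun y : Cn n ↦ ENNReal.ofReal (mol r y) := (mol_contDiff r).continuous.measurable.ennreal_ofReal
  have h := ENNReal.lintegral_mul_le_Lp_mul_Lq (μ := (volume : Measure (Cn n))) Real.HolderConjugate.two_two
    (f := fun y ↦ ENNReal.ofReal (mol r y) ^ (1/2 : ℝ)) (g := fun y ↦ ENNReal.ofReal (mol r y) ^ (1/2 : ℝ) * f y)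
    (hm.pow_const _).aemeasurable ((hm.pow_const _).aemeasurable.mul hf)
  have e0 : ∀ a : ℝ≥0∞, a ^ (1/2:ℝ) * a ^ (1/2:ℝ) = a := fun a ↦ by
    rw [← ENNReal.rpow_add_of_nonneg _ _ (by norm_num) (by norm_num)]; norm_num
  have e1 : ∀ y, ((fun y ↦ ENNReal.ofReal (mol r y) ^ (1/2 : ℝ)) * (fun y ↦ ENNReal.ofReal (mol r y) ^ (1/2 : ℝ) * f y) : Cn n → ℝ≥0∞) y
    = ENNReal.ofReal (mol r y) * f y := fun y ↦ by
    simp only [Pi.mul_apply]; rw [← mul_assoc, e0]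
  have e2 : ∀ y : Cn n, (ENNReal.ofReal (mol r y) ^ (1/2 : ℝ)) ^ (2:ℝ) = ENNReal.ofReal (mol r y) := fun y ↦ by
    rw [← ENNReal.rpow_mul]; norm_num
  have e3 : ∫⁻ y : Cn n, ENNReal.ofReal (mol r y) = 1 := by
    rw [← ofReal_integral_eq_lintegral_ofReal (mol_integrable hr) (Eventually.of_forall (mol_nonneg hr)), mol_int hr]
    simp
  have e4 : ∀ y : Cn n, (ENNReal.ofReal (mol r y) ^ (1/2 : ℝ) * f y) ^ (2:ℝ) = ENNReal.ofReal (mol r y) * f y ^ 2 := fun y ↦ by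
    rw [ENNReal.mul_rpow_of_nonneg _ _ (by norm_num), e2]; norm_num
  simp_rw [e1, e2, e3, e4] at h
  rw [ENNReal.one_rpow, one_mul] at h
  calc _ ≤ ((∫⁻ y, ENNReal.ofReal (mol r y) * f y ^ 2) ^ (1/2:ℝ)) ^ 2 := by gcongr
    _ = _ := by rw [pow_two, e0]

lemma transl_L2 {g : Cn n → ℂ} (hg : MemLp g 2) :
    Tendsto (fun y : Cn n ↦ ∫⁻ w, ‖g (w - y) - g w‖ₑ ^ 2) (𝓝 0) (𝓝 0) := by
  have mp : ∀ y : Cn n, MeasurePreserving (fun w : Cn n ↦ w - y) := fun y ↦ measurePreserving_sub_right volume y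
  let G : Cn n → C(Cn n, Cn n) := fun y ↦ ⟨fun w ↦ w - y, by fun_prop⟩
  have hG : Continuous G := ContinuousMap.continuous_of_continuous_uncurry _ (by
    show Continuous fun p : Cn n × Cn n ↦ p.2 - p.1
    fun_prop)
  have key := (continuous_const (y := hg.toLp g)).compMeasurePreservingLp hG (fun y ↦ mp y) (by simp)
  have k0 := key.tendsto 0
  have h0 : Lp.compMeasurePreserving (G 0) (mp 0) (hg.toLp g) = hg.toLp g := by
    apply Lp.ext
    filter_upwards [Lp.coeFn_compMeasurePreserving (hg.toLp g) (mp 0)] with w hw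
    have hw' : (Lp.compMeasurePreserving (G 0) (mp 0) (hg.toLp g)) w = (hg.toLp g) (w - 0) := hw
    rw [hw', sub_zero]
  rw [h0, tendsto_iff_edist_tendsto_0] at k0
  have e : ∀ y, edist (Lp.compMeasurePreserving (G y) (mp y) (hg.toLp g)) (hg.toLp g) ^ 2
      = ∫⁻ w, ‖g (w - y) - g w‖ₑ ^ 2 := fun y ↦ by
    rw [Lp.edist_def, eLpNorm_eq_lintegral_rpow_enorm_toReal (by norm_num) (by norm_num)]
    simp only [ENNReal.toReal_ofNat]
    rw [← ENNReal.rpow_natCast, ← ENNReal.rpow_mul, show (1 / 2 * ((2:ℕ):ℝ)) = 1 by norm_num, ENNReal.rpow_one]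
    refine lintegral_congr_ae ?_
    have hq : (fun w ↦ (hg.toLp g) (w - y)) =ᵐ[volume] fun w ↦ g (w - y) :=
      (mp y).quasiMeasurePreserving.ae_eq_comp hg.coeFn_toLp
    filter_upwards [Lp.coeFn_compMeasurePreserving (hg.toLp g) (mp y), hg.coeFn_toLp, hq] with w h1 h2 h3
    have h1' : (Lp.compMeasurePreserving (G y) (mp y) (hg.toLp g)) w = (hg.toLp g) (w - y) := h1
    have h4 : (Lp.compMeasurePreserving (G y) (mp y) (hg.toLp g) - hg.toLp g : Cn n → ℂ) w = g (w - y) - g w := by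
      rw [Pi.sub_apply, h1', h2, h3]
    rw [h4]
    norm_num
  simp_rw [← e]
  have := (ENNReal.continuous_pow 2).tendsto 0 |>.comp k0
  simpa [Function.comp_def] using this

lemma moll_L2 {g : Cn n → ℂ} (hm : Measurable g) (hg : MemLp g 2) :
    Tendsto (fun r : ℝ ↦ ∫⁻ w, ‖moll r g w - g w‖ₑ ^ 2) (𝓝[>] 0) (𝓝 0) := by
  have hloc : LocallyIntegrable g := hg.locallyIntegrable (by norm_num)
  rw [ENNReal.tendsto_nhds_zero]
  intro ε hε
  have h1 := (ENNReal.tendsto_nhds_zero.1 (transl_L2 hg)) ε hε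
  obtain ⟨r0, hr0, hb⟩ := Metric.eventually_nhds_iff.1 h1
  filter_upwards [Ioo_mem_nhdsGT hr0] with r hr
  have hrp : 0 < r := hr.1
  have pt : ∀ w, ‖moll r g w - g w‖ₑ ^ 2 ≤ ∫⁻ y, ENNReal.ofReal (mol r y) * ‖g (w - y) - g w‖ₑ ^ 2 := fun w ↦ by
    have hi : Integrable fun y ↦ mol r y • g (w - y) := by
      have := (moll_integrable hrp hloc w).comp_sub_left w
      simpa using this
    have hi2 : Integrable fun y : Cn n ↦ mol r y • g w := (mol_integrable hrp).smul_const _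
    have : moll r g w - g w = ∫ y, mol r y • (g (w - y) - g w) := by
      simp_rw [smul_sub]
      rw [integral_sub hi hi2, ← moll_swap, integral_smul_const, mol_int hrp, one_smul]
    rw [this]
    refine le_trans (pow_le_pow_left₀ (by positivity) (enorm_integral_le_lintegral_enorm _) 2) ?_
    refine le_trans (le_of_eq ?_) (cs_prob hrp (f := fun y ↦ ‖g (w - y) - g w‖ₑ) ?_)
    · congr 1
      refine lintegral_congr fun y ↦ ?_
      rw [enorm_smul, Real.enorm_eq_ofReal (mol_nonneg hrp y)]
    · exact ((hm.comp (measurable_const.sub measurable_id)).sub_const _).enorm.aemeasurable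
  calc ∫⁻ w, ‖moll r g w - g w‖ₑ ^ 2 ≤ ∫⁻ w, ∫⁻ y, ENNReal.ofReal (mol r y) * ‖g (w - y) - g w‖ₑ ^ 2 := lintegral_mono pt
    _ = ∫⁻ y, ∫⁻ w, ENNReal.ofReal (mol r y) * ‖g (w - y) - g w‖ₑ ^ 2 := by
      rw [lintegral_lintegral_swap]
      refine Measurable.aemeasurable ?_
      have m1 : Measurable fun p : Cn n × Cn n ↦ ENNReal.ofReal (mol r p.2) :=
        (((mol_contDiff r).continuous.comp continuous_snd).measurable).ennreal_ofReal
      have m2 : Measurable fun p : Cn n × Cn n ↦ ‖g (p.1 - p.2) - g p.1‖ₑ ^ 2 :=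
        (((hm.comp (measurable_fst.sub measurable_snd)).sub (hm.comp measurable_fst)).enorm).pow_const 2
      exact m1.mul m2
    _ ≤ ∫⁻ y : Cn n, ENNReal.ofReal (mol r y) * ε := by
      refine lintegral_mono fun y ↦ ?_
      rw [lintegral_const_mul' _ _ ENNReal.ofReal_ne_top]
      by_cases hy : r ≤ ‖y‖
      · simp [mol_zero hrp hy]
      · gcongr
        apply hb
        rw [dist_zero_right]
        push Not at hy
        exact hy.trans hr.2
    _ = ε := by
      rw [lintegral_mul_const _ (mol_contDiff r).continuous.measurable.ennreal_ofReal, ← ofReal_integral_eq_lintegral_ofReal (mol_integrable hrp) (Eventually.of_forall (mol_nonneg hrp)), mol_int hrp]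
      simp
end

section

lemma esq_eq (a : ℂ) : ‖a‖ₑ ^ 2 = ENNReal.ofReal (‖a‖ ^ 2) := by
  rw [← ofReal_norm_eq_enorm, ENNReal.ofReal_pow (norm_nonneg _)]

lemma esq_add (a b : ℂ) : ‖a + b‖ₑ ^ 2 ≤ 2 * ‖a‖ₑ ^ 2 + 2 * ‖b‖ₑ ^ 2 := by
  rw [esq_eq, esq_eq, esq_eq, show (2:ℝ≥0∞) = ENNReal.ofReal 2 by simp, ← ENNReal.ofReal_mul (by norm_num),
    ← ENNReal.ofReal_mul (by norm_num), ← ENNReal.ofReal_add (by positivity) (by positivity)]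
  apply ENNReal.ofReal_le_ofReal
  nlinarith [norm_add_le a b, norm_nonneg (a + b), sq_nonneg (‖a‖ - ‖b‖)]

lemma esq_sub (a b : ℂ) : ‖a‖ₑ ^ 2 ≤ 2 * ‖b‖ₑ ^ 2 + 2 * ‖b - a‖ₑ ^ 2 := by
  have := esq_add b (-(b - a))
  rwa [enorm_neg, show b + -(b - a) = a by ring] at this

lemma esq_sum (f : Fin n → ℂ) : ‖∑ j, f j‖ₑ ^ 2 ≤ n * ∑ j, ‖f j‖ₑ ^ 2 := by
  have h1 : ‖∑ j, f j‖ ^ 2 ≤ n * ∑ j, ‖f j‖ ^ 2 := by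
    have := sq_sum_le_card_mul_sum_sq (s := (Finset.univ : Finset (Fin n))) (f := fun j ↦ ‖f j‖)
    simp at this
    exact le_trans (pow_le_pow_left₀ (norm_nonneg _) (norm_sum_le _ _) 2) this
  simp_rw [esq_eq]
  rw [← ENNReal.ofReal_sum_of_nonneg (fun i _ ↦ by positivity), ← ENNReal.ofReal_natCast, ← ENNReal.ofReal_mul (by positivity)]
  exact ENNReal.ofReal_le_ofReal h1

lemma esq_mul (a b : ℂ) : ‖a * b‖ₑ ^ 2 = ‖a‖ₑ ^ 2 * ‖b‖ₑ ^ 2 := by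
  rw [enorm_mul, mul_pow]

structure SU (e : Fin n → Cn n) (s : Cn n → ℝ) (c A m T : ℝ) : Prop where
  hs : ContDiff ℝ ∞ s
  hT : ∀ w, s w < c → c - s w ≤ T
  hA1 : 4 * T ≤ A
  hA2 : 1 ≤ A * m
  hA : 0 < A
  hL : ∀ w, s w < c → ∀ b : Fin n → ℂ, m * ∑ j, ‖b j‖ ^ 2 ≤
      (∑ j, ∑ k, b j * conj (b k) * conj (dop I (e j) (dop (-I) (e k) fun w ↦ (s w : ℂ)) w)).re
  hb : Bornology.IsBounded {w | s w < c}

def w1 (s : Cn n → ℝ) (c A : ℝ) (w : Cn n) : ℝ≥0∞ := ENNReal.ofReal (om s c A w)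
def w2 (s : Cn n → ℝ) (c A : ℝ) (w : Cn n) : ℝ≥0∞ := ENNReal.ofReal (om s c A w / (c - s w) ^ 2)

section wts
variable {s : Cn n → ℝ} {c A : ℝ}

lemma om_nonneg (w : Cn n) : 0 ≤ om s c A w := by unfold om; split_ifs <;> positivity
lemma om_le (hA : 0 < A) (w : Cn n) : om s c A w ≤ 1 := by
  unfold om; split_ifs with h
  · rw [Real.exp_le_one_iff, neg_nonpos]; exact div_nonneg hA.le (by linarith)
  · norm_num
lemma om_meas (hs : Continuous s) : Measurable (om s c A) := by
  unfold om
  refine Measurable.ite (isOpen_lt hs continuous_const).measurableSet ?_ measurable_const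
  have := hs.measurable
  fun_prop
lemma om2_le (hA : 0 < A) (w : Cn n) : om s c A w / (c - s w) ^ 2 ≤ 2 / A ^ 2 := by
  unfold om; split_ifs with h
  · have ht : 0 < c - s w := by linarith
    have h1 := Real.quadratic_le_exp_of_nonneg (x := A / (c - s w)) (by positivity)
    rw [Real.exp_neg, div_le_div_iff₀ (by positivity) (by positivity), inv_mul_le_iff₀ (exp_pos _)]
    have h2 : A ^ 2 = (A / (c - s w)) ^ 2 * (c - s w) ^ 2 := by field_simp
    rw [h2]
    have h3 : 0 ≤ A / (c - s w) := by positivity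
    nlinarith [sq_nonneg (c - s w), mul_le_mul_of_nonneg_right h1 (sq_nonneg (c - s w))]
  · simp; positivity
lemma w1_meas (hs : Continuous s) : Measurable (w1 s c A) := (om_meas hs).ennreal_ofReal
lemma w2_meas (hs : Continuous s) : Measurable (w2 s c A) := by
  have := om_meas (c := c) (A := A) hs
  have := hs.measurable
  unfold w2
  fun_prop
lemma w1_le (hA : 0 < A) (w : Cn n) : w1 s c A w ≤ 1 := by
  rw [← ENNReal.ofReal_one]; exact ENNReal.ofReal_le_ofReal (om_le hA w)
lemma w2_le (hA : 0 < A) (w : Cn n) : w2 s c A w ≤ ENNReal.ofReal (2 / A ^ 2) := 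
  ENNReal.ofReal_le_ofReal (om2_le hA w)
lemma w2_zero {w : Cn n} (h : c ≤ s w) : w2 s c A w = 0 := by simp [w2, om, not_lt.2 h]
lemma w1_zero {w : Cn n} (h : c ≤ s w) : w1 s c A w = 0 := by simp [w1, om, not_lt.2 h]

end wts

def ctr (s : Cn n → ℝ) (c a : ℝ) (w : Cn n) : ℝ := smoothTransition ((c - s w) / a - 1)
def ctf (s : Cn n → ℝ) (c a : ℝ) (w : Cn n) : ℂ := (ctr s c a w : ℂ)

section ct
variable {s : Cn n → ℝ} {c a : ℝ}
lemma ctr_contDiff (hs : ContDiff ℝ ∞ s) : ContDiff ℝ ∞ (ctr s c a) := by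
  unfold ctr
  refine Real.smoothTransition.contDiff.comp ?_
  fun_prop
lemma ctf_contDiff (hs : ContDiff ℝ ∞ s) : ContDiff ℝ ∞ (ctf s c a) := contDiff_ofReal' (ctr_contDiff hs)
lemma ctf_zero (ha : 0 < a) {w : Cn n} (h : c - s w ≤ a) : ctf s c a w = 0 := by
  unfold ctf ctr
  rw [Real.smoothTransition.zero_of_nonpos]
  · simp
  · rw [sub_nonpos, div_le_one ha]; exact h
lemma ctf_one (ha : 0 < a) {w : Cn n} (h : 2 * a ≤ c - s w) : ctf s c a w = 1 := by
  unfold ctf ctr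
  rw [Real.smoothTransition.one_of_one_le]
  · simp
  · rw [le_sub_iff_add_le, le_div_iff₀ ha]; linarith
lemma ctf_norm (w : Cn n) : ‖ctf s c a w‖ ≤ 1 := by
  unfold ctf ctr
  rw [norm_real, norm_of_nonneg (Real.smoothTransition.nonneg _)]
  exact Real.smoothTransition.le_one _
lemma ctf_tsupport (hs : Continuous s) (ha : 0 < a) : tsupport (ctf s c a) ⊆ {w | a ≤ c - s w} := by
  refine closure_minimal (fun w hw ↦ ?_) (isClosed_le continuous_const (continuous_const.sub hs))
  by_contra h
  have h : ¬ a ≤ c - s w := h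
  exact hw (ctf_zero ha (not_le.1 h).le)
lemma sub_compact (hs : Continuous s) (ha : 0 < a) (hb : Bornology.IsBounded {w : Cn n | s w < c}) :
    IsCompact {w | a ≤ c - s w} := by
  refine Metric.isCompact_of_isClosed_isBounded (isClosed_le continuous_const (continuous_const.sub hs)) (hb.subset ?_)
  intro w hw
  have : a ≤ c - s w := hw
  show s w < c
  linarith
lemma ctf_compact (hs : Continuous s) (ha : 0 < a) (hb : Bornology.IsBounded {w : Cn n | s w < c}) :
    HasCompactSupport (ctf s c a) :=
  (sub_compact hs ha hb).of_isClosed_subset (isClosed_tsupport _) (ctf_tsupport hs ha)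
end ct

lemma basic_lint {e : Fin n → Cn n} {s : Cn n → ℝ} {c A m T : ℝ} (S : SU e s c A m T)
    {β : Fin n → Cn n → ℂ} (hβ : ∀ j, ContDiff ℝ ∞ (β j)) (sβ : ∀ j, HasCompactSupport (β j))
    (tβ : ∀ j, tsupport (β j) ⊆ {w | s w < c}) :
    ∫⁻ w, (∑ j, ‖β j w‖ₑ ^ 2) * w2 s c A w ≤
      (2 * ∫⁻ w, ‖tdv s c A e β w‖ₑ ^ 2 * w1 s c A w)
      + ∫⁻ w, (∑ j, ∑ k, ‖crl e β j k w‖ₑ ^ 2) * w1 s c A w := by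
  have h := basic_est (volume : Measure (Cn n)) e S.hs S.hT S.hA1 S.hA2 S.hA S.hL hβ sβ tβ
  have i1 : Integrable fun w ↦ (∑ j, ‖β j w‖ ^ 2) * (om s c A w / (c - s w) ^ 2) := by
    refine Integrable.mul_bdd (c := 2 / A ^ 2) (f := fun w ↦ (∑ j, ‖β j w‖ ^ 2)) ?_ ?_ ?_
    · refine Continuous.integrable_of_hasCompactSupport ?_ ?_
      · have := fun j ↦ (hβ j).continuous
        fun_prop
      · refine HasCompactSupport.intro (isCompact_iUnion fun j ↦ sβ j) fun x hx ↦ ?_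
        refine Finset.sum_eq_zero fun j _ ↦ ?_
        rw [image_eq_zero_of_notMem_tsupport fun hj ↦ hx (mem_iUnion.2 ⟨j, hj⟩)]
        simp
    · have := om_meas (c := c) (A := A) S.hs.continuous
      have := S.hs.continuous.measurable
      exact Measurable.aestronglyMeasurable (by fun_prop)
    · refine Eventually.of_forall fun w ↦ ?_
      rw [norm_of_nonneg (div_nonneg (om_nonneg w) (sq_nonneg _))]
      exact om2_le S.hA w
  have n1 : ∀ w, 0 ≤ (∑ j, ‖β j w‖ ^ 2) * (om s c A w / (c - s w) ^ 2) := fun w ↦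
    mul_nonneg (sum_nonneg fun j _ ↦ by positivity) (div_nonneg (om_nonneg w) (sq_nonneg _))
  have gen : ∀ f : Cn n → ℝ, (∀ w, 0 ≤ f w) → ENNReal.ofReal (∫ w, f w) ≤ ∫⁻ w, ENNReal.ofReal (f w) := fun f hf ↦ by
    by_cases hi : Integrable f
    · rw [ofReal_integral_eq_lintegral_ofReal hi (Eventually.of_forall hf)]
    · rw [integral_undef hi]; simp
  have h' := ENNReal.ofReal_le_ofReal h
  rw [ofReal_integral_eq_lintegral_ofReal i1 (Eventually.of_forall n1)] at h'
  have e1 : ∀ w, (∑ j, ‖β j w‖ₑ ^ 2) * w2 s c A w = ENNReal.ofReal ((∑ j, ‖β j w‖ ^ 2) * (om s c A w / (c - s w) ^ 2)) := fun w ↦ by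
    rw [ENNReal.ofReal_mul (sum_nonneg fun j _ ↦ by positivity), ENNReal.ofReal_sum_of_nonneg (fun i _ ↦ by positivity)]
    simp_rw [esq_eq]; rfl
  simp_rw [e1]
  refine h'.trans ((ENNReal.ofReal_add_le).trans (add_le_add ?_ ?_))
  · rw [ENNReal.ofReal_mul (by norm_num), ENNReal.ofReal_ofNat]
    refine mul_le_mul_right ((gen _ fun w ↦ mul_nonneg (sq_nonneg _) (om_nonneg w)).trans (le_of_eq ?_)) _
    refine lintegral_congr fun w ↦ ?_
    rw [ENNReal.ofReal_mul (by positivity), esq_eq]; rfl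
  · refine (ENNReal.ofReal_le_ofReal (mul_le_of_le_one_left (integral_nonneg fun w ↦ mul_nonneg (sum_nonneg fun j _ ↦ sum_nonneg fun k _ ↦ by positivity) (om_nonneg w)) (by norm_num))).trans ?_
    refine (gen _ fun w ↦ mul_nonneg (sum_nonneg fun j _ ↦ sum_nonneg fun k _ ↦ by positivity) (om_nonneg w)).trans (le_of_eq ?_)
    refine lintegral_congr fun w ↦ ?_
    rw [ENNReal.ofReal_mul (sum_nonneg fun j _ ↦ sum_nonneg fun k _ ↦ by positivity), ENNReal.ofReal_sum_of_nonneg (fun i _ ↦ sum_nonneg fun k _ ↦ by positivity)]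
    congr 1
    refine sum_congr rfl fun j _ ↦ ?_
    rw [ENNReal.ofReal_sum_of_nonneg (fun i _ ↦ by positivity)]
    simp_rw [esq_eq]

lemma gL2 {e : Fin n → Cn n} {s : Cn n → ℝ} {c A m T : ℝ} (S : SU e s c A m T) {g : Cn n → ℂ}
    (gm : Measurable g) (gi : ∫⁻ w, ‖g w‖ₑ ^ 2 * w2 s c A w < ⊤) {φ : Cn n → ℂ} (hφ : Continuous φ)
    {a : ℝ} (ha : 0 < a) (hz : ∀ w, c - s w < a → φ w = 0) :
    MemLp (fun w ↦ φ w * g w) 2 ∧ Integrable (fun w ↦ φ w * g w) := by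
  have cK := sub_compact S.hs.continuous ha S.hb
  have h2 : MemLp (fun w ↦ φ w * g w) 2 := by
    refine ⟨(hφ.measurable.mul gm).aestronglyMeasurable, ?_⟩
    rw [eLpNorm_lt_top_iff_lintegral_rpow_enorm_lt_top (by norm_num) (by norm_num)]
    obtain ⟨M, hM⟩ := cK.exists_bound_of_continuousOn hφ.continuousOn
    have : ∀ w, ‖φ w * g w‖ₑ ^ (2:ℝ≥0∞).toReal ≤ ENNReal.ofReal (M ^ 2 * (T ^ 2 * Real.exp (A / a))) * (‖g w‖ₑ ^ 2 * w2 s c A w) := fun w ↦ by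
      simp only [ENNReal.toReal_ofNat, ENNReal.rpow_ofNat]
      by_cases hw : c - s w < a
      · simp [hz w hw]
      push Not at hw
      have ht : 0 < c - s w := by linarith
      have hsc : s w < c := by linarith
      have hTw := S.hT w hsc
      rw [esq_mul, mul_comm (‖g w‖ₑ ^ 2), ← mul_assoc]
      gcongr
      rw [esq_eq, w2, ← ENNReal.ofReal_mul (by positivity)]
      apply ENNReal.ofReal_le_ofReal
      have h1 : 1 ≤ (T ^ 2 * Real.exp (A / a)) * (om s c A w / (c - s w) ^ 2) := by
        rw [om, if_pos hsc]
        have : Real.exp (-(A / a)) ≤ Real.exp (-(A / (c - s w))) := by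
          apply Real.exp_le_exp.2
          rw [neg_le_neg_iff]
          exact div_le_div_of_nonneg_left S.hA.le ha hw
        calc (1:ℝ) = Real.exp (A / a) * Real.exp (-(A / a)) := by rw [← Real.exp_add]; simp
          _ ≤ Real.exp (A / a) * Real.exp (-(A / (c - s w))) := by gcongr
          _ = ((c - s w) ^ 2 * Real.exp (A / a)) * (Real.exp (-(A / (c - s w))) / (c - s w) ^ 2) := by field_simp
          _ ≤ _ := by gcongr
      calc ‖φ w‖ ^ 2 ≤ M ^ 2 := by gcongr; exact hM w hw
        _ = M ^ 2 * 1 := by ring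
        _ ≤ M ^ 2 * ((T ^ 2 * Real.exp (A / a)) * (om s c A w / (c - s w) ^ 2)) := by gcongr
        _ = _ := by ring
    refine lt_of_le_of_lt (lintegral_mono this) ?_
    rw [lintegral_const_mul' _ _ ENNReal.ofReal_ne_top]
    exact ENNReal.mul_lt_top ENNReal.ofReal_lt_top gi
  refine ⟨h2, ?_⟩
  have h3 := (h2.locallyIntegrable (by norm_num)).integrableOn_isCompact cK
  rwa [integrableOn_iff_integrable_of_support_subset] at h3
  intro w hw
  by_contra h
  have h : ¬ a ≤ c - s w := h
  exact hw (by simp [hz w (not_le.1 h)])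

end

section

structure TF (s : Cn n → ℝ) (c : ℝ) (f : Cn n → ℂ) : Prop where
  cd : ContDiff ℝ ∞ f
  cs : HasCompactSupport f
  ts : tsupport f ⊆ {w | s w < c}

structure WK (e : Fin n → Cn n) (s : Cn n → ℝ) (c A : ℝ) (G : Fin n → Cn n → ℂ) (q : Cn n → ℂ) : Prop where
  gm : ∀ j, Measurable (G j)
  gi : ∀ j, ∫⁻ w, ‖G j w‖ₑ ^ 2 * w2 s c A w < ⊤
  qc : Continuous q
  cl : ∀ f, TF s c f → ∀ j k, ∫ w, (G j w * dop I (e k) f w - G k w * dop I (e j) f w) = 0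
  dv : ∀ f, TF s c f → ∫ w, (∑ j, G j w * (dop (-I) (e j) f w + f w * kap s c A (e j) w)) = - ∫ w, q w * f w

variable {e : Fin n → Cn n} {s : Cn n → ℝ} {c A m T : ℝ} {G : Fin n → Cn n → ℂ} {q : Cn n → ℂ} {a : ℝ}

def kc (e : Fin n → Cn n) (s : Cn n → ℝ) (c A a : ℝ) (j : Fin n) (w : Cn n) : ℂ :=
  kap s c A (e j) w * ctf s c (a / 4) w

lemma kc_cont (S : SU e s c A m T) (ha : 0 < a) (j : Fin n) : Continuous (kc e s c A a j) := by
  refine continuous_of_tsupport fun w hw ↦ ?_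
  have hw' : a / 4 ≤ c - s w := ctf_tsupport S.hs.continuous (by positivity)
    (closure_mono (fun x hx ↦ right_ne_zero_of_mul hx) hw)
  have h1 : ContinuousAt (dop (-I) (e j) fun w ↦ (s w : ℂ)) w :=
    (dop_contDiff (contDiff_ofReal' S.hs)).continuous.continuousAt
  have h2 : ContinuousAt s w := S.hs.continuous.continuousAt
  have h3 : ContinuousAt (ctf s c (a/4)) w := (ctf_contDiff S.hs).continuous.continuousAt
  have h4 : c - s w ≠ 0 := by intro h; linarith
  unfold kc kap
  refine (h1.mul ?_).mul h3
  refine Complex.continuous_ofReal.continuousAt.comp ?_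
  exact (continuousAt_const.div ((continuousAt_const.sub h2).pow 2) (pow_ne_zero 2 h4)).sub
    (continuousAt_const.div (continuousAt_const.sub h2) h4)

lemma kc_bdd (S : SU e s c A m T) (ha : 0 < a) : ∃ M : ℝ, ∀ j w, ‖kc e s c A a j w‖ ≤ M := by
  have : ∀ j, ∃ M, ∀ w, ‖kc e s c A a j w‖ ≤ M := fun j ↦ by
    have h : HasCompactSupport (kc e s c A a j) :=
      (ctf_compact S.hs.continuous (a := a / 4) (by positivity) S.hb).mul_left
    obtain ⟨M, hM⟩ := h.exists_bound_of_continuous (kc_cont S ha j)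
    exact ⟨M, hM⟩
  choose M hM using this
  refine ⟨∑ j, |M j|, fun j w ↦ (hM j w).trans ((le_abs_self _).trans ?_)⟩
  exact Finset.single_le_sum (f := fun j ↦ |M j|) (fun i _ ↦ abs_nonneg _) (Finset.mem_univ j)

lemma kc_eq (ha : 0 < a) {w : Cn n} (hw : a / 2 ≤ c - s w) (j : Fin n) : kc e s c A a j w = kap s c A (e j) w := by
  rw [kc, ctf_one (by positivity) (by linarith), mul_one]

def Ph (e : Fin n → Cn n) (s : Cn n → ℝ) (c : ℝ) (G : Fin n → Cn n → ℂ) (q : Cn n → ℂ) (a : ℝ) (w : Cn n) : ℂ :=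
  ctf s c a w * q w + ∑ j, dop (-I) (e j) (ctf s c a) w * G j w
def Qh (e : Fin n → Cn n) (s : Cn n → ℝ) (c : ℝ) (G : Fin n → Cn n → ℂ) (a : ℝ) (j k : Fin n) (w : Cn n) : ℂ :=
  dop I (e k) (ctf s c a) w * G j w - dop I (e j) (ctf s c a) w * G k w

lemma dctf_zero (hs : Continuous s) (ha : 0 < a) {w : Cn n} (h : c - s w < a) (d : ℂ) (v : Cn n) : dop d v (ctf s c a) w = 0 := by
  by_contra hh
  have : a ≤ c - s w := ctf_tsupport hs ha (dop_support hh)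
  linarith

lemma tf_mtest (S : SU e s c A m T) (ha : 0 < a) (r : ℝ) (w : Cn n) : TF s c (fun y ↦ ctf s c a y * mtest r w y) := by
  have h1 := ctf_compact S.hs.continuous ha S.hb
  refine ⟨(ctf_contDiff S.hs).mul (mtest_contDiff r w), h1.mul_right, ?_⟩
  refine (tsupport_mul_subset_left).trans ((ctf_tsupport S.hs.continuous ha).trans fun x hx ↦ ?_)
  have : a ≤ c - s x := hx
  show s x < c
  linarith

lemma Ph_L2 (S : SU e s c A m T) (K : WK e s c A G q) (ha : 0 < a) :
    MemLp (fun w ↦ Ph e s c G q a w + ∑ j, kc e s c A a j w * (ctf s c a w * G j w)) 2 := by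
  have c1 := (ctf_contDiff (c := c) (a := a) S.hs).continuous
  unfold Ph
  refine MemLp.add (MemLp.add ?_ (memLp_finsetSum _ fun j _ ↦ ?_)) (memLp_finsetSum _ fun j _ ↦ ?_)
  · exact (c1.mul K.qc).memLp_of_hasCompactSupport (ctf_compact S.hs.continuous ha S.hb).mul_right
  · exact (gL2 S (K.gm j) (K.gi j) (dop_contDiff (ctf_contDiff S.hs)).continuous ha
      fun w hw ↦ dctf_zero S.hs.continuous ha hw _ _).1
  · have := (gL2 S (K.gm j) (K.gi j) ((kc_cont S ha j).mul c1) ha fun w hw ↦ by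
      show (_ : ℂ) * ctf s c a w = 0
      rw [ctf_zero ha hw.le, mul_zero]).1
    simpa [mul_assoc] using this

lemma Qh_L2 (S : SU e s c A m T) (K : WK e s c A G q) (ha : 0 < a) (j k : Fin n) :
    MemLp (Qh e s c G a j k) 2 := by
  unfold Qh
  refine MemLp.sub ?_ ?_
  · exact (gL2 S (K.gm j) (K.gi j) (dop_contDiff (ctf_contDiff S.hs)).continuous ha
      fun w hw ↦ dctf_zero S.hs.continuous ha hw _ _).1
  · exact (gL2 S (K.gm k) (K.gi k) (dop_contDiff (ctf_contDiff S.hs)).continuous ha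
      fun w hw ↦ dctf_zero S.hs.continuous ha hw _ _).1

lemma H_L2 (S : SU e s c A m T) (K : WK e s c A G q) (ha : 0 < a) (j : Fin n) :
    MemLp (fun w ↦ ctf s c a w * G j w) 2 :=
  (gL2 S (K.gm j) (K.gi j) (ctf_contDiff S.hs).continuous ha fun w hw ↦ ctf_zero ha hw.le).1

lemma int_aux (S : SU e s c A m T) (K : WK e s c A G q) (ha : 0 < a) (j : Fin n) {φ : Cn n → ℂ} (hφ : Continuous φ) :
    Integrable fun y ↦ φ y * (ctf s c a y * G j y) := by
  have := (gL2 S (K.gm j) (K.gi j) (hφ.mul (ctf_contDiff (c := c) (a := a) S.hs).continuous) ha fun w hw ↦ by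
      show (_ : ℂ) * ctf s c a w = 0
      rw [ctf_zero ha hw.le, mul_zero]).2
  simpa [mul_assoc] using this

lemma int_aux2 (S : SU e s c A m T) (K : WK e s c A G q) (ha : 0 < a) (j : Fin n) {φ : Cn n → ℂ} (hφ : Continuous φ)
    (d : ℂ) (v : Cn n) :
    Integrable fun y ↦ φ y * (dop d v (ctf s c a) y * G j y) := by
  have := (gL2 S (K.gm j) (K.gi j) (hφ.mul (dop_contDiff (ctf_contDiff (c := c) (a := a) S.hs)).continuous) ha fun w hw ↦ by
      show _ * dop d v (ctf s c a) w = _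
      rw [dctf_zero S.hs.continuous ha hw, mul_zero]).2
  simpa [mul_assoc] using this

lemma div_moll (S : SU e s c A m T) (K : WK e s c A G q) (ha : 0 < a) {r : ℝ} (hr : 0 < r) (w : Cn n) :
    ∑ j, dop (-I) (e j) (moll r fun y ↦ ctf s c a y * G j y) w
      = moll r (fun w ↦ Ph e s c G q a w + ∑ j, kc e s c A a j w * (ctf s c a w * G j w)) w := by
  have hd := K.dv _ (tf_mtest S ha r w)
  have cm := (mtest_contDiff r w)
  have ce := ctf_contDiff (c := c) (a := a) S.hs
  have i1 : Integrable fun y ↦ mtest r w y * (ctf s c a y * q y) :=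
    (integrable_cs _ (cm.continuous.mul (ce.continuous.mul K.qc)) (mtest_compact hr w).mul_right)
  have i2 : ∀ j, Integrable fun y ↦ mtest r w y * (dop (-I) (e j) (ctf s c a) y * G j y) :=
    fun j ↦ int_aux2 S K ha j cm.continuous _ _
  have i3 : ∀ j, Integrable fun y ↦ mtest r w y * (kc e s c A a j y * (ctf s c a y * G j y)) := fun j ↦ by
    simpa [mul_assoc] using int_aux S K ha j (cm.continuous.mul (kc_cont S ha j))
  have i4 : ∀ j, Integrable fun y ↦ dop (-I) (e j) (mtest r w) y * (ctf s c a y * G j y) :=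
    fun j ↦ int_aux S K ha j (dop_contDiff cm).continuous
  have e1 : ∀ y, (∑ j, G j y * (dop (-I) (e j) (fun y ↦ ctf s c a y * mtest r w y) y
      + ctf s c a y * mtest r w y * kap s c A (e j) y))
      = ∑ j, (mtest r w y * (dop (-I) (e j) (ctf s c a) y * G j y) +
        (dop (-I) (e j) (mtest r w) y * (ctf s c a y * G j y)
        + mtest r w y * (kc e s c A a j y * (ctf s c a y * G j y)))) := fun y ↦ by
    refine sum_congr rfl fun j _ ↦ ?_
    rw [dop_mul (ce.differentiable (by simp) y) (cm.differentiable (by simp) y)]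
    by_cases hy : c - s y ≤ a
    · rw [ctf_zero ha hy]; ring
    · rw [kc_eq ha (by linarith)]; ring
  simp_rw [e1] at hd
  have i5 : ∀ j, Integrable fun y ↦ mtest r w y * (dop (-I) (e j) (ctf s c a) y * G j y) +
        (dop (-I) (e j) (mtest r w) y * (ctf s c a y * G j y)
        + mtest r w y * (kc e s c A a j y * (ctf s c a y * G j y))) := fun j ↦ (i2 j).add ((i4 j).add (i3 j))
  have i6 : ∀ j, Integrable fun y ↦ mtest r w y * (dop (-I) (e j) (ctf s c a) y * G j y) +
        mtest r w y * (kc e s c A a j y * (ctf s c a y * G j y)) := fun j ↦ (i2 j).add (i3 j)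
  rw [integral_finsetSum _ fun j _ ↦ i5 j] at hd
  have e2 : ∀ j, dop (-I) (e j) (moll r fun y ↦ ctf s c a y * G j y) w
      = - ∫ y, dop (-I) (e j) (mtest r w) y * (ctf s c a y * G j y) := fun j ↦
    dop_moll hr ((H_L2 S K ha j).locallyIntegrable (by norm_num)) _ _ _
  simp_rw [e2]
  rw [moll_eq_mtest]
  have e3 : ∀ y, mtest r w y * (Ph e s c G q a y + ∑ j, kc e s c A a j y * (ctf s c a y * G j y))
     = mtest r w y * (ctf s c a y * q y) + ∑ j, (mtest r w y * (dop (-I) (e j) (ctf s c a) y * G j y) +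
       mtest r w y * (kc e s c A a j y * (ctf s c a y * G j y))) := fun y ↦ by
    rw [Ph, sum_add_distrib, ← mul_sum, ← mul_sum]; ring
  simp_rw [e3]
  rw [integral_add i1 (integrable_finsetSum _ fun j _ ↦ i6 j), integral_finsetSum _ fun j _ ↦ i6 j]
  have e4 : ∫ y, q y * (ctf s c a y * mtest r w y) = ∫ y, mtest r w y * (ctf s c a y * q y) := by
    congr 1; ext y; ring
  rw [e4] at hd
  have e5 : ∀ j, ∫ y, (mtest r w y * (dop (-I) (e j) (ctf s c a) y * G j y) +
        (dop (-I) (e j) (mtest r w) y * (ctf s c a y * G j y)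
        + mtest r w y * (kc e s c A a j y * (ctf s c a y * G j y)))) =
     (∫ y, (mtest r w y * (dop (-I) (e j) (ctf s c a) y * G j y) +
       mtest r w y * (kc e s c A a j y * (ctf s c a y * G j y)))) + ∫ y, dop (-I) (e j) (mtest r w) y * (ctf s c a y * G j y) := fun j ↦ by
    rw [← integral_add (i6 j) (i4 j)]
    congr 1; ext y; ring
  simp_rw [e5] at hd
  rw [sum_add_distrib] at hd
  rw [Finset.sum_neg_distrib]
  linear_combination -hd

lemma crl_moll (S : SU e s c A m T) (K : WK e s c A G q) (ha : 0 < a) {r : ℝ} (hr : 0 < r) (j k : Fin n) (w : Cn n) :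
    crl e (fun j ↦ moll r fun y ↦ ctf s c a y * G j y) j k w = moll r (Qh e s c G a j k) w := by
  have hd := K.cl _ (tf_mtest S ha r w) j k
  have cm := (mtest_contDiff r w)
  have ce := ctf_contDiff (c := c) (a := a) S.hs
  have i2 : ∀ j k, Integrable fun y ↦ mtest r w y * (dop I (e k) (ctf s c a) y * G j y) :=
    fun j k ↦ int_aux2 S K ha j cm.continuous _ _
  have i4 : ∀ j k, Integrable fun y ↦ dop I (e k) (mtest r w) y * (ctf s c a y * G j y) :=
    fun j k ↦ int_aux S K ha j (dop_contDiff cm).continuous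
  have e1 : ∀ j k y, G j y * dop I (e k) (fun y ↦ ctf s c a y * mtest r w y) y
      = mtest r w y * (dop I (e k) (ctf s c a) y * G j y) +
        dop I (e k) (mtest r w) y * (ctf s c a y * G j y) := fun j k y ↦ by
    rw [dop_mul (ce.differentiable (by simp) y) (cm.differentiable (by simp) y)]
    ring
  simp_rw [e1] at hd
  have e2 : ∀ j k, dop I (e k) (moll r fun y ↦ ctf s c a y * G j y) w
      = - ∫ y, dop I (e k) (mtest r w) y * (ctf s c a y * G j y) := fun j k ↦
    dop_moll hr ((H_L2 S K ha j).locallyIntegrable (by norm_num)) _ _ _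
  have i5 : ∀ j k, Integrable fun y ↦ mtest r w y * (dop I (e k) (ctf s c a) y * G j y) +
        dop I (e k) (mtest r w) y * (ctf s c a y * G j y) := fun j k ↦ (i2 _ _).add (i4 _ _)
  rw [integral_sub (i5 _ _) (i5 _ _), integral_add (i2 _ _) (i4 _ _), integral_add (i2 _ _) (i4 _ _)] at hd
  rw [crl, e2, e2, moll_eq_mtest]
  have e3 : ∀ y, mtest r w y * Qh e s c G a j k y = mtest r w y * (dop I (e k) (ctf s c a) y * G j y)
     - mtest r w y * (dop I (e j) (ctf s c a) y * G k y) := fun y ↦ by rw [Qh]; ring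
  simp_rw [e3]
  rw [integral_sub (i2 _ _) (i2 _ _)]
  linear_combination -hd

end

section

variable {e : Fin n → Cn n} {s : Cn n → ℝ} {c A m T : ℝ} {G : Fin n → Cn n → ℂ} {q : Cn n → ℂ} {a : ℝ}

lemma esq_int {f g : Cn n → ℂ} {W : Cn n → ℝ≥0∞} {B : ℝ≥0∞} (hg : Measurable g)
    (hWm : Measurable W) (hW : ∀ w, W w ≤ B) (hB : B ≠ ⊤) :
    ∫⁻ w, ‖f w‖ₑ ^ 2 * W w ≤ 2 * (∫⁻ w, ‖g w‖ₑ ^ 2 * W w) + 2 * B * ∫⁻ w, ‖g w - f w‖ₑ ^ 2 := by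
  have m1 : Measurable fun w ↦ 2 * (‖g w‖ₑ ^ 2 * W w) := ((hg.enorm.pow_const 2).mul hWm).const_mul 2
  rw [← lintegral_const_mul' _ _ (by norm_num), ← lintegral_const_mul' _ _ (by finiteness), ← lintegral_add_left m1]
  refine lintegral_mono fun w ↦ ?_
  calc _ ≤ (2 * ‖g w‖ₑ ^ 2 + 2 * ‖g w - f w‖ₑ ^ 2) * W w := by gcongr; exact esq_sub _ _
    _ = 2 * (‖g w‖ₑ ^ 2 * W w) + 2 * ‖g w - f w‖ₑ ^ 2 * W w := by ring
    _ ≤ 2 * (‖g w‖ₑ ^ 2 * W w) + 2 * ‖g w - f w‖ₑ ^ 2 * B := by gcongr; exact hW w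
    _ = _ := by ring

lemma lsum1 {f : Fin n → Cn n → ℂ} (hf : ∀ j, Measurable (f j)) {W : Cn n → ℝ≥0∞} (hW : Measurable W) :
    ∫⁻ w, (∑ j, ‖f j w‖ₑ ^ 2) * W w = ∑ j, ∫⁻ w, ‖f j w‖ₑ ^ 2 * W w := by
  simp_rw [sum_mul]
  exact lintegral_finsetSum _ fun j _ ↦ ((hf j).enorm.pow_const 2).mul hW

lemma lsum2 {f : Fin n → Fin n → Cn n → ℂ} (hf : ∀ j k, Measurable (f j k)) {W : Cn n → ℝ≥0∞} (hW : Measurable W) :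
    ∫⁻ w, (∑ j, ∑ k, ‖f j k w‖ₑ ^ 2) * W w = ∑ j, ∑ k, ∫⁻ w, ‖f j k w‖ₑ ^ 2 * W w := by
  have : ∀ j k, Measurable fun w ↦ ‖f j k w‖ₑ ^ 2 := fun j k ↦ (hf j k).enorm.pow_const 2
  simp_rw [sum_mul]
  rw [lintegral_finsetSum _ fun j _ ↦ by fun_prop]
  refine sum_congr rfl fun j _ ↦ lintegral_finsetSum _ fun k _ ↦ (this j k).mul hW

lemma Ph_meas (S : SU e s c A m T) (K : WK e s c A G q) : Measurable (Ph e s c G q a) := by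
  have h1 := (ctf_contDiff (c := c) (a := a) S.hs).continuous.measurable
  have h2 : ∀ j, Measurable (dop (-I) (e j) (ctf s c a)) := fun j ↦ 
    (dop_contDiff (ctf_contDiff (c := c) (a := a) S.hs)).continuous.measurable
  have h3 := K.gm
  have h4 := K.qc.measurable
  unfold Ph
  exact (h1.mul h4).add (Finset.measurable_fun_sum _ fun j _ ↦ (h2 j).mul (h3 j))

lemma Qh_meas (S : SU e s c A m T) (K : WK e s c A G q) (j k : Fin n) : Measurable (Qh e s c G a j k) := by
  have h2 : ∀ j, Measurable (dop (I) (e j) (ctf s c a)) := fun j ↦ 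
    (dop_contDiff (ctf_contDiff (c := c) (a := a) S.hs)).continuous.measurable
  exact ((h2 k).mul (K.gm j)).sub ((h2 j).mul (K.gm k))

lemma weak_step1 (S : SU e s c A m T) (K : WK e s c A G q) (ha : 0 < a) :
    ∫⁻ w, (∑ j, ‖ctf s c a w * G j w‖ₑ ^ 2) * w2 s c A w ≤
      8 * (∫⁻ w, ‖Ph e s c G q a w‖ₑ ^ 2 * w1 s c A w)
      + 4 * ∫⁻ w, (∑ j, ∑ k, ‖Qh e s c G a j k w‖ₑ ^ 2) * w1 s c A w := by
  have hsc := S.hs.continuous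
  have ce := ctf_contDiff (c := c) (a := a) S.hs
  obtain ⟨M, hM⟩ := kc_bdd S ha
  set H : Fin n → Cn n → ℂ := fun j w ↦ ctf s c a w * G j w with hH
  have Hm : ∀ j, Measurable (H j) := fun j ↦ ce.continuous.measurable.mul (K.gm j)
  set P : Cn n → ℂ := fun w ↦ Ph e s c G q a w + ∑ j, kc e s c A a j w * (ctf s c a w * G j w) with hP
  have Pm : Measurable P := (Ph_meas S K).add (Finset.measurable_fun_sum _ fun j _ ↦ (kc_cont S ha j).measurable.mul (Hm j))
  have PL := Ph_L2 S K ha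
  have lH : ∀ j, LocallyIntegrable (H j) := fun j ↦ (H_L2 S K ha j).locallyIntegrable (by norm_num)
  have cβ : ∀ r > 0, ∀ j, ContDiff ℝ ∞ (moll r (H j)) := fun r hr j ↦ moll_contDiff hr (lH j)
  set B := ENNReal.ofReal (2 / A ^ 2)
  set E1 : ℝ → ℝ≥0∞ := fun r ↦ ∑ j, ∫⁻ w, ‖moll r (H j) w - H j w‖ₑ ^ 2 with hE1
  set E2 : ℝ → ℝ≥0∞ := fun r ↦ ∫⁻ w, ‖moll r P w - P w‖ₑ ^ 2 with hE2
  set E3 : ℝ → ℝ≥0∞ := fun r ↦ ∑ j, ∑ k, ∫⁻ w, ‖moll r (Qh e s c G a j k) w - Qh e s c G a j k w‖ₑ ^ 2 with hE3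
  have t1 : Tendsto E1 (𝓝[>] 0) (𝓝 0) := by
    have := tendsto_finsetSum (Finset.univ : Finset (Fin n)) fun j _ ↦ moll_L2 (Hm j) (H_L2 S K ha j)
    simpa using this
  have t2 : Tendsto E2 (𝓝[>] 0) (𝓝 0) := moll_L2 Pm PL
  have t3 : Tendsto E3 (𝓝[>] 0) (𝓝 0) := by
    have := tendsto_finsetSum (Finset.univ : Finset (Fin n)) fun j _ ↦ tendsto_finsetSum (Finset.univ : Finset (Fin n)) fun k _ ↦ moll_L2 (Qh_meas S K j k) (Qh_L2 S K ha j k)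
    simpa using this
  set X := (∫⁻ w, ‖Ph e s c G q a w‖ₑ ^ 2 * w1 s c A w)
  set Y := ∫⁻ w, (∑ j, ∑ k, ‖Qh e s c G a j k w‖ₑ ^ 2) * w1 s c A w with hY
  set Z := ∫⁻ w, (∑ j, ‖H j w‖ₑ ^ 2) * w2 s c A w with hZ
  have cK := sub_compact hsc ha S.hb
  obtain ⟨r0, hr0, hsub⟩ := cK.exists_cthickening_subset_open (t := {w | a / 2 < c - s w})
    (isOpen_lt continuous_const (continuous_const.sub hsc)) (fun w hw ↦ by
      have : a ≤ c - s w := hw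
      show a / 2 < c - s w
      linarith)
  have main : ∀ r ∈ Ioo 0 r0, Z ≤ 8 * X + 4 * Y + (2 * B * E1 r + (8 * (2 * E2 r + 2 * (n * ENNReal.ofReal (M ^ 2)) * E1 r) + 4 * E3 r)) := by
    intro r hr
    have hrp : 0 < r := hr.1
    have zero : ∀ j w, ¬ (a / 2 < c - s w) → moll r (H j) w = 0 := fun j w hw ↦ by
      refine moll_support hrp (K := {w | a ≤ c - s w}) (fun y hy ↦ ?_) fun y hy ↦ ?_
      · have hy : ¬ a ≤ c - s y := hy
        simp [hH, ctf_zero ha (not_le.1 hy).le]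
      · by_contra hlt
        push Not at hlt
        refine hw (hsub ?_)
        refine mem_cthickening_of_dist_le w y _ _ hy ?_
        rw [dist_eq_norm]
        exact (hlt.trans hr.2).le
    have ts : ∀ j, tsupport (moll r (H j)) ⊆ {w | a / 2 ≤ c - s w} := fun j ↦ by
      refine closure_minimal (fun w hw ↦ ?_) (isClosed_le continuous_const (continuous_const.sub hsc))
      by_contra h
      have h : ¬ a / 2 ≤ c - s w := h
      exact hw (zero j w fun h' ↦ h h'.le)
    have cs : ∀ j, HasCompactSupport (moll r (H j)) := fun j ↦
      (sub_compact hsc (a := a / 2) (by positivity) S.hb).of_isClosed_subset (isClosed_tsupport _) (ts j)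
    have bl := basic_lint S (β := fun j ↦ moll r (H j)) (cβ r hrp) cs (fun j ↦ (ts j).trans fun w hw ↦ by
      have : a / 2 ≤ c - s w := hw
      show s w < c
      linarith)
    have td : ∀ w, tdv s c A e (fun j ↦ moll r (H j)) w
        = moll r P w - ∑ j, kc e s c A a j w * moll r (H j) w := fun w ↦ by
      rw [tdv, Finset.sum_sub_distrib, div_moll S K ha hrp]
      congr 1
      refine sum_congr rfl fun j _ ↦ ?_
      by_cases hw : a / 2 < c - s w
      · rw [kc_eq ha hw.le]; ring
      · rw [zero j w hw]; simp
    have mβ : ∀ j, Measurable (moll r (H j)) := fun j ↦ (cβ r hrp j).continuous.measurable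
    have mP : Measurable (moll r P) := (moll_contDiff hrp (PL.locallyIntegrable (by norm_num))).continuous.measurable
    have s1 : Z ≤ 2 * (∫⁻ w, (∑ j, ‖moll r (H j) w‖ₑ ^ 2) * w2 s c A w) + 2 * B * E1 r := by
      rw [hZ, lsum1 Hm (w2_meas hsc), lsum1 mβ (w2_meas hsc), hE1, mul_sum, mul_sum, ← sum_add_distrib]
      exact sum_le_sum fun j _ ↦ esq_int (mβ j) (w2_meas hsc) (w2_le S.hA) ENNReal.ofReal_ne_top
    have s2 : ∫⁻ w, ‖tdv s c A e (fun j ↦ moll r (H j)) w‖ₑ ^ 2 * w1 s c A w ≤ 2 * X + 2 * (2 * E2 r + 2 * (n * ENNReal.ofReal (M ^ 2)) * E1 r) := by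
      refine (esq_int (Ph_meas (a := a) S K) (w1_meas hsc) (w1_le S.hA) ENNReal.one_ne_top).trans ?_
      rw [mul_one]
      gcongr
      have m1 : Measurable fun w ↦ 2 * ‖moll r P w - P w‖ₑ ^ 2 := ((mP.sub Pm).enorm.pow_const 2).const_mul 2
      have e1 : E1 r = ∫⁻ w, ∑ j, ‖moll r (H j) w - H j w‖ₑ ^ 2 := by
        have : ∀ j, Measurable fun w ↦ ‖moll r (H j) w - H j w‖ₑ ^ 2 := fun j ↦ ((mβ j).sub (Hm j)).enorm.pow_const 2
        rw [lintegral_finsetSum _ fun j _ ↦ this j]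
      rw [e1, hE2, ← lintegral_const_mul' _ _ (by norm_num), ← lintegral_const_mul' _ _ (by finiteness), ← lintegral_add_left m1]
      refine lintegral_mono fun w ↦ ?_
      rw [td]
      have : Ph e s c G q a w - (moll r P w - ∑ j, kc e s c A a j w * moll r (H j) w)
         = -((moll r P w - P w)) + ∑ j, kc e s c A a j w * (moll r (H j) w - H j w) := by
        simp_rw [mul_sub]
        rw [Finset.sum_sub_distrib]
        simp only [hP, hH]
        ring
      rw [this]
      refine (esq_add _ _).trans ?_
      rw [enorm_neg, mul_assoc 2]
      gcongr
      refine (esq_sum _).trans ?_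
      rw [mul_assoc, mul_sum (a := ENNReal.ofReal (M ^ 2))]
      refine mul_le_mul_right (sum_le_sum fun j _ ↦ ?_) _
      rw [esq_mul]
      gcongr
      rw [esq_eq]
      exact ENNReal.ofReal_le_ofReal (by gcongr; exact hM j w)
    have s3 : ∫⁻ w, (∑ j, ∑ k, ‖crl e (fun j ↦ moll r (H j)) j k w‖ₑ ^ 2) * w1 s c A w ≤ 2 * Y + 2 * E3 r := by
      have mq : ∀ j k, Measurable (Qh e s c G a j k) := Qh_meas S K
      have mq' : ∀ j k, Measurable (moll r (Qh e s c G a j k)) := fun j k ↦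
        (moll_contDiff hrp ((Qh_L2 S K ha j k).locallyIntegrable (by norm_num))).continuous.measurable
      have : ∀ j k w, crl e (fun j ↦ moll r (H j)) j k w = moll r (Qh e s c G a j k) w := crl_moll S K ha hrp
      simp_rw [this]
      rw [lsum2 mq' (w1_meas hsc), hY, lsum2 mq (w1_meas hsc), hE3]
      simp_rw [mul_sum]
      rw [← sum_add_distrib]
      refine sum_le_sum fun j _ ↦ ?_
      rw [← sum_add_distrib]
      refine sum_le_sum fun k _ ↦ ?_
      refine (esq_int (mq j k) (w1_meas hsc) (w1_le S.hA) ENNReal.one_ne_top).trans ?_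
      rw [mul_one]
      simp_rw [← neg_sub (moll r (Qh e s c G a j k) _), enorm_neg]
      exact le_rfl
    calc Z ≤ _ := s1
      _ ≤ 2 * (2 * (2 * X + 2 * (2 * E2 r + 2 * (n * ENNReal.ofReal (M ^ 2)) * E1 r)) + (2 * Y + 2 * E3 r)) + 2 * B * E1 r := by
        gcongr
        exact bl.trans (by gcongr)
      _ = _ := by ring
  have lim : Tendsto (fun r ↦ 8 * X + 4 * Y + (2 * B * E1 r + (8 * (2 * E2 r + 2 * (n * ENNReal.ofReal (M ^ 2)) * E1 r) + 4 * E3 r))) (𝓝[>] 0) (𝓝 (8 * X + 4 * Y)) := by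
    have c0 : ∀ (E : ℝ → ℝ≥0∞) (b : ℝ≥0∞), b ≠ ⊤ → Tendsto E (𝓝[>] 0) (𝓝 0) → Tendsto (fun r ↦ b * E r) (𝓝[>] 0) (𝓝 0) := fun E b hb h ↦ by
      simpa using ENNReal.Tendsto.const_mul h (Or.inr hb)
    have h12 : Tendsto (fun r ↦ 2 * E2 r + 2 * (n * ENNReal.ofReal (M ^ 2)) * E1 r) (𝓝[>] 0) (𝓝 0) := by
      simpa using (c0 E2 2 (by norm_num) t2).add (c0 E1 (2 * (n * ENNReal.ofReal (M ^ 2))) (by finiteness) t1)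
    have := (c0 E1 (2 * B) (by finiteness) t1).add ((c0 _ 8 (by norm_num) h12).add (c0 E3 4 (by norm_num) t3))
    simpa using this.const_add (8 * X + 4 * Y)
  refine ge_of_tendsto lim ?_
  filter_upwards [Ioo_mem_nhdsGT hr0] with r hr using main r hr

end

section

variable {e : Fin n → Cn n} {s : Cn n → ℝ} {c A m T : ℝ} {G : Fin n → Cn n → ℂ} {q : Cn n → ℂ} {a : ℝ}

lemma st_deriv_bdd : ∃ C : ℝ, 0 ≤ C ∧ ∀ x, |deriv smoothTransition x| ≤ C := by
  have hc : Continuous (deriv smoothTransition) :=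
    (Real.smoothTransition.contDiff (n := 1)).continuous_deriv le_rfl
  have hs : HasCompactSupport (deriv smoothTransition) := by
    refine HasCompactSupport.intro (isCompact_Icc (a := (0:ℝ)) (b := 1)) fun x hx ↦ ?_
    rcases lt_or_ge x 0 with h | h
    · have : smoothTransition =ᶠ[𝓝 x] fun _ ↦ 0 := by
        filter_upwards [gt_mem_nhds h] with y hy using Real.smoothTransition.zero_of_nonpos hy.le
      rw [this.deriv_eq]; simp
    · have h1 : 1 < x := by
        by_contra h'
        exact hx ⟨h, not_lt.1 h'⟩
      have : smoothTransition =ᶠ[𝓝 x] fun _ ↦ 1 := by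
        filter_upwards [lt_mem_nhds h1] with y hy using Real.smoothTransition.one_of_one_le hy.le
      rw [this.deriv_eq]; simp
  obtain ⟨C, hC⟩ := hs.exists_bound_of_continuous hc
  exact ⟨C, (norm_nonneg _).trans (hC 0), hC⟩

lemma dctf_bound (S : SU e s c A m T) : ∃ L : ℝ, ∀ a > 0, ∀ d : ℂ, ‖d‖ = 1 → ∀ j w,
    ‖dop d (e j) (ctf s c a) w‖ₑ ^ 2 * w1 s c A w ≤
      ENNReal.ofReal L * (w2 s c A w * {w | c - s w ≤ 2 * a}.indicator 1 w) := by
  obtain ⟨C, C0, hC⟩ := st_deriv_bdd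
  have hb : ∀ j, ∃ M, ∀ w ∈ closure {w | s w < c}, ‖fderiv ℝ (fun w ↦ (s w : ℂ)) w‖ * ‖e j‖ ≤ M := fun j ↦ by
    have := (S.hb.closure : Bornology.IsBounded (closure {w | s w < c}))
    have hc : IsCompact (closure {w | s w < c}) := Metric.isCompact_of_isClosed_isBounded isClosed_closure this
    have cf : Continuous fun w ↦ ‖fderiv ℝ (fun w ↦ (s w : ℂ)) w‖ * ‖e j‖ :=
      (((contDiff_ofReal' S.hs).continuous_fderiv (by simp)).norm).mul continuous_const
    obtain ⟨M, hM⟩ := hc.exists_bound_of_continuousOn cf.continuousOn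
    exact ⟨M, fun w hw ↦ (le_abs_self _).trans (hM w hw)⟩
  choose M hM using hb
  set M' := ∑ j, |M j|
  have hM' : ∀ j, |M j| ≤ M' := fun j ↦ Finset.single_le_sum (f := fun j ↦ |M j|) (fun i _ ↦ abs_nonneg _) (Finset.mem_univ j)
  refine ⟨(2 * C * M') ^ 2, fun a ha d hd j w ↦ ?_⟩
  by_cases hsc : s w < c
  swap
  · simp [w1_zero (not_lt.1 hsc)]
  by_cases h1 : c - s w < a
  · simp [dctf_zero S.hs.continuous ha h1]
  by_cases h2 : c - s w ≤ 2 * a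
  swap
  · have : ctf s c a =ᶠ[𝓝 w] fun _ ↦ 1 := by
      have : ∀ᶠ x in 𝓝 w, 2 * a < c - s x :=
        (continuous_const.sub S.hs.continuous : Continuous fun w ↦ c - s w).continuousAt.eventually (lt_mem_nhds (not_le.1 h2))
      filter_upwards [this] with x hx using ctf_one ha hx.le
    rw [dop_congr this]
    simp [dop]
  rw [indicator_of_mem (by exact h2), Pi.one_apply, mul_one]
  have ht : 0 < c - s w := by linarith
  have hd1 : dop d (e j) (ctf s c a) w = _ := dop_real_comp (g := fun x ↦ smoothTransition ((c - x) / a - 1)) (s := s) (w := w)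
    (g' := deriv smoothTransition ((c - s w) / a - 1) * (-1 / a)) (by
      have h3 : HasDerivAt (fun x ↦ (c - x) / a - 1) (-1 / a) (s w) := ((hasDerivAt_id (s w)).const_sub c |>.div_const a).sub_const 1
      have h4 := ((Real.smoothTransition.contDiff (n := 1)).differentiable one_ne_zero ((c - s w) / a - 1)).hasDerivAt
      exact h4.comp (s w) h3) (S.hs.differentiable (by simp) w) d (e j)
  have hn : ‖dop d (e j) (ctf s c a) w‖ ≤ 2 * C * M' / (c - s w) := by
    rw [hd1, norm_mul, norm_real, norm_mul]
    have h5 : ‖dop d (e j) (fun w ↦ (s w : ℂ)) w‖ ≤ M' := by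
      refine le_trans ?_ ((hM j w (subset_closure hsc)).trans ((le_abs_self _).trans (hM' j)))
      unfold dop
      rw [norm_div]
      have := (fderiv ℝ (fun w ↦ (s w : ℂ)) w).le_opNorm (e j)
      have h6 := (fderiv ℝ (fun w ↦ (s w : ℂ)) w).le_opNorm (I • e j)
      rw [norm_smul, Complex.norm_I, one_mul] at h6
      rw [div_le_iff₀ (by simp)]
      refine (norm_add_le _ _).trans ?_
      rw [norm_mul, hd, one_mul, Complex.norm_ofNat]
      linarith
    have h7 : ‖(-1 / a : ℝ)‖ ≤ 2 / (c - s w) := by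
      rw [norm_div, norm_neg, norm_one, norm_of_nonneg ha.le, div_le_div_iff₀ ha ht]; linarith
    calc _ ≤ C * (2 / (c - s w)) * M' := by
          gcongr
          exact hC _
      _ = _ := by ring
  rw [esq_eq, w1, w2, ← ENNReal.ofReal_mul (by positivity), ← ENNReal.ofReal_mul (by positivity)]
  apply ENNReal.ofReal_le_ofReal
  have : ‖dop d (e j) (ctf s c a) w‖ ^ 2 ≤ (2 * C * M' / (c - s w)) ^ 2 := by gcongr
  calc _ ≤ (2 * C * M' / (c - s w)) ^ 2 * om s c A w := by gcongr; exact om_nonneg w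
    _ = _ := by field_simp

lemma weak_est (S : SU e s c A m T) (K : WK e s c A G q) :
    ∫⁻ w, (∑ j, ‖G j w‖ₑ ^ 2) * w2 s c A w ≤ 16 * ∫⁻ w, ‖q w‖ₑ ^ 2 * w1 s c A w := by
  obtain ⟨L, hL⟩ := dctf_bound S
  have hsc := S.hs.continuous
  set g : Cn n → ℝ≥0∞ := fun w ↦ (∑ j, ‖G j w‖ₑ ^ 2) * w2 s c A w with hg
  have gm : Measurable g := (Finset.measurable_fun_sum _ fun j _ ↦ (K.gm j).enorm.pow_const 2).mul (w2_meas hsc)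
  have gfin : ∫⁻ w, g w ≠ ⊤ := by
    rw [hg, lsum1 K.gm (w2_meas hsc)]
    exact (ENNReal.sum_lt_top.2 fun j _ ↦ K.gi j).ne
  set In : ℝ → Cn n → ℝ≥0∞ := fun a ↦ {w | c - s w ≤ 2 * a}.indicator 1 with hI
  have Im : ∀ a, Measurable (In a) := fun a ↦ measurable_one.indicator
    (isClosed_le (continuous_const.sub hsc) continuous_const).measurableSet
  set R : ℝ → ℝ≥0∞ := fun a ↦ ∫⁻ w, g w * In a w with hR
  have Ile : ∀ a w, In a w ≤ 1 := fun a w ↦ indicator_le_self' (fun _ _ ↦ by simp) w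
  have hRlim : Tendsto R (𝓝[>] 0) (𝓝 0) := by
    have := tendsto_lintegral_filter_of_dominated_convergence (l := 𝓝[>] (0:ℝ)) (μ := (volume : Measure (Cn n)))
      (F := fun a w ↦ g w * In a w) (f := fun _ ↦ 0) g
      (Eventually.of_forall fun a ↦ gm.mul (Im a)) (Eventually.of_forall fun a ↦ Eventually.of_forall fun w ↦ by
        calc g w * In a w ≤ g w * 1 := by gcongr; exact Ile a w
          _ = g w := mul_one _) gfin (Eventually.of_forall fun w ↦ by
        by_cases h : s w < c
        · refine tendsto_const_nhds.congr' ?_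
          have : (0:ℝ) < (c - s w) / 2 := by linarith
          filter_upwards [Ioo_mem_nhdsGT this] with a ha
          have : In a w = 0 := indicator_of_notMem (by
            intro (h' : c - s w ≤ 2 * a)
            linarith [ha.2]) _
          simp [this]
        · have : g w = 0 := by simp [hg, w2_zero (not_lt.1 h)]
          simp [this])
    simpa using this
  set X := ∫⁻ w, ‖q w‖ₑ ^ 2 * w1 s c A w with hX
  set l := ENNReal.ofReal L with hl
  have main : ∀ a > 0, ∫⁻ w, g w ≤ 16 * X + (R a + (16 * n * l * R a + 16 * n * l * R a)) := by
    intro a ha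
    have h1 := weak_step1 S K ha
    have b1 : ∫⁻ w, g w ≤ R a + ∫⁻ w, (∑ j, ‖ctf s c a w * G j w‖ₑ ^ 2) * w2 s c A w := by
      have gI : Measurable fun w ↦ g w * In a w := gm.mul (Im a)
      simp only [hR]
      rw [← lintegral_add_left gI]
      refine lintegral_mono fun w ↦ ?_
      by_cases h : c - s w ≤ 2 * a
      · have : In a w = 1 := indicator_of_mem (by exact h) _
        rw [this, mul_one]; exact le_self_add
      · rw [ctf_one ha (not_le.1 h).le]
        simp only [one_mul]
        exact le_add_self
    have b2 : ∫⁻ w, ‖Ph e s c G q a w‖ₑ ^ 2 * w1 s c A w ≤ 2 * X + 2 * n * l * R a := by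
      have m1 : Measurable fun w ↦ 2 * (‖q w‖ₑ ^ 2 * w1 s c A w) :=
        ((K.qc.measurable.enorm.pow_const 2).mul (w1_meas hsc)).const_mul 2
      rw [hX, hR, ← lintegral_const_mul' _ _ (by norm_num), ← lintegral_const_mul' _ _ (by finiteness), ← lintegral_add_left m1]
      refine lintegral_mono fun w ↦ ?_
      calc ‖Ph e s c G q a w‖ₑ ^ 2 * w1 s c A w
          ≤ (2 * ‖ctf s c a w * q w‖ₑ ^ 2 + 2 * (n * ∑ j, ‖dop (-I) (e j) (ctf s c a) w * G j w‖ₑ ^ 2)) * w1 s c A w := by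
            gcongr
            refine (esq_add _ _).trans ?_
            gcongr
            exact esq_sum _
        _ = 2 * (‖ctf s c a w * q w‖ₑ ^ 2 * w1 s c A w) + 2 * n * ∑ j, ‖G j w‖ₑ ^ 2 * (‖dop (-I) (e j) (ctf s c a) w‖ₑ ^ 2 * w1 s c A w) := by
            have : ∑ j, ‖dop (-I) (e j) (ctf s c a) w * G j w‖ₑ ^ 2 * w1 s c A w = ∑ j, ‖G j w‖ₑ ^ 2 * (‖dop (-I) (e j) (ctf s c a) w‖ₑ ^ 2 * w1 s c A w) :=
              sum_congr rfl fun j _ ↦ by rw [esq_mul]; ring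
            rw [← this, ← sum_mul]; ring
        _ ≤ 2 * (‖q w‖ₑ ^ 2 * w1 s c A w) + 2 * n * ∑ j, ‖G j w‖ₑ ^ 2 * (l * (w2 s c A w * In a w)) := by
            refine add_le_add ?_ (mul_le_mul_right (sum_le_sum fun j _ ↦ mul_le_mul_right (hL a ha _ (by simp) _ _) _) _)
            gcongr
            · rw [enorm_mul]
              calc _ ≤ 1 * ‖q w‖ₑ := by
                    gcongr
                    rw [← ofReal_norm_eq_enorm, ← ENNReal.ofReal_one]
                    exact ENNReal.ofReal_le_ofReal (ctf_norm w)
                _ = _ := one_mul _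
        _ = _ := by
            rw [← sum_mul]
            ring
    have b3 : ∫⁻ w, (∑ j, ∑ k, ‖Qh e s c G a j k w‖ₑ ^ 2) * w1 s c A w ≤ 4 * n * l * R a := by
      rw [hR, ← lintegral_const_mul' _ _ (by finiteness)]
      refine lintegral_mono fun w ↦ ?_
      calc (∑ j, ∑ k, ‖Qh e s c G a j k w‖ₑ ^ 2) * w1 s c A w = ∑ j, ∑ k, ‖Qh e s c G a j k w‖ₑ ^ 2 * w1 s c A w := by
            simp_rw [sum_mul]
        _ ≤ ∑ j, ∑ k, (2 * ‖G j w‖ₑ ^ 2 + 2 * ‖G k w‖ₑ ^ 2) * (l * (w2 s c A w * In a w)) := by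
            refine sum_le_sum fun j _ ↦ sum_le_sum fun k _ ↦ ?_
            have h3 := esq_add (dop I (e k) (ctf s c a) w * G j w) (-(dop I (e j) (ctf s c a) w * G k w))
            rw [enorm_neg, ← sub_eq_add_neg, esq_mul, esq_mul] at h3
            calc _ ≤ (2 * (‖dop I (e k) (ctf s c a) w‖ₑ ^ 2 * ‖G j w‖ₑ ^ 2) + 2 * (‖dop I (e j) (ctf s c a) w‖ₑ ^ 2 * ‖G k w‖ₑ ^ 2)) * w1 s c A w := by
                  gcongr; exact h3
              _ = 2 * ‖G j w‖ₑ ^ 2 * (‖dop I (e k) (ctf s c a) w‖ₑ ^ 2 * w1 s c A w) + 2 * ‖G k w‖ₑ ^ 2 * (‖dop I (e j) (ctf s c a) w‖ₑ ^ 2 * w1 s c A w) := by ring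
              _ ≤ 2 * ‖G j w‖ₑ ^ 2 * (l * (w2 s c A w * In a w)) + 2 * ‖G k w‖ₑ ^ 2 * (l * (w2 s c A w * In a w)) := by
                  exact add_le_add (mul_le_mul_right (hL a ha _ (by simp) _ _) _) (mul_le_mul_right (hL a ha _ (by simp) _ _) _)
              _ = _ := by ring
        _ = _ := by
            simp_rw [← sum_mul, sum_add_distrib, ← mul_sum]
            simp only [Finset.sum_const, Finset.card_univ, Fintype.card_fin, nsmul_eq_mul, ← mul_sum, hg]
            ring
    calc ∫⁻ w, g w ≤ _ := b1
      _ ≤ R a + (8 * (2 * X + 2 * n * l * R a) + 4 * (4 * n * l * R a)) := by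
        gcongr
        exact h1.trans (by gcongr)
      _ = _ := by ring
  have lim : Tendsto (fun a ↦ 16 * X + (R a + (16 * n * l * R a + 16 * n * l * R a))) (𝓝[>] 0) (𝓝 (16 * X)) := by
    have c0 : Tendsto (fun r ↦ 16 * n * l * R r) (𝓝[>] 0) (𝓝 0) := by
      simpa using ENNReal.Tendsto.const_mul hRlim (Or.inr (by finiteness : 16 * n * l ≠ ⊤))
    have := hRlim.add (c0.add c0)
    simpa using this.const_add (16 * X)
  refine ge_of_tendsto lim ?_
  filter_upwards [self_mem_nhdsWithin] with a ha using main a ha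

end

section

variable {e : Fin n → Cn n} {s : Cn n → ℝ} {c A m T : ℝ}

lemma TF.dop {f : Cn n → ℂ} (h : TF s c f) (d : ℂ) (v : Cn n) : TF s c (dop d v f) :=
  ⟨dop_contDiff h.cd, dop_compact h.cs, dop_tsupport.trans h.ts⟩

lemma TF.mulD {f g : Cn n → ℂ} (h : TF s c f) (hg : ∀ w, s w < c → ContDiffAt ℝ ∞ g w) : TF s c (fun w ↦ f w * g w) := by
  refine ⟨contDiff_iff_contDiffAt.2 fun w ↦ ?_, h.cs.mul_right, tsupport_mul_subset_left.trans h.ts⟩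
  by_cases hw : w ∈ tsupport f
  · exact h.cd.contDiffAt.mul (hg w (h.ts hw))
  · have := notMem_tsupport_iff_eventuallyEq.1 hw
    refine (contDiffAt_const (c := 0)).congr_of_eventuallyEq ?_
    filter_upwards [this] with x hx
    simp [hx]

lemma TF.conj {f : Cn n → ℂ} (h : TF s c f) : TF s c (fun w ↦ conj (f w)) := by
  refine ⟨contDiff_conj h.cd, h.cs.comp_left (g := fun z ↦ (starRingEnd ℂ) z) (map_zero _), ?_⟩
  refine (closure_mono fun x hx ↦ ?_).trans h.ts
  intro h0; exact hx (by simp [h0])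

lemma TF.add {f g : Cn n → ℂ} (h : TF s c f) (h' : TF s c g) : TF s c (f + g) :=
  ⟨h.cd.add h'.cd, h.cs.add h'.cs, (tsupport_add _ _).trans (union_subset h.ts h'.ts)⟩

lemma TF.smul {f : Cn n → ℂ} (h : TF s c f) (a : ℂ) : TF s c (a • f) :=
  ⟨h.cd.const_smul a, h.cs.smul_left (f := fun _ ↦ a), (tsupport_smul_subset_right (fun _ ↦ a) f).trans h.ts⟩

lemma TF.zero : TF s c 0 := ⟨contDiff_const, HasCompactSupport.zero, by simp⟩

lemma TF.out {f : Cn n → ℂ} (h : TF s c f) {w : Cn n} (hw : ¬ s w < c) : f w = 0 := by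
  by_contra h0; exact hw (h.ts (subset_tsupport _ h0))

lemma TF.fin {f : Cn n → ℂ} (h : TF s c f) {W : Cn n → ℝ≥0∞} {B : ℝ≥0∞} (hB : B ≠ ⊤) (hW : ∀ w, W w ≤ B) :
    ∫⁻ w, ‖f w‖ₑ ^ 2 * W w < ⊤ := by
  have h1 : MemLp f 2 := h.cd.continuous.memLp_of_hasCompactSupport h.cs
  have h2 := (eLpNorm_lt_top_iff_lintegral_rpow_enorm_lt_top (by norm_num) (by norm_num)).1 h1.2
  simp only [ENNReal.toReal_ofNat, ENNReal.rpow_ofNat] at h2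
  calc _ ≤ ∫⁻ w, ‖f w‖ₑ ^ 2 * B := by gcongr; exact hW _
    _ = (∫⁻ w, ‖f w‖ₑ ^ 2) * B := lintegral_mul_const' _ _ hB
    _ < ⊤ := ENNReal.mul_lt_top h2 hB.lt_top

def W2 (s : Cn n → ℝ) (c A : ℝ) (w : Cn n) : ℂ := ((om s c A w / (c - s w) ^ 2 : ℝ) : ℂ)
def iW (s : Cn n → ℝ) (c A : ℝ) (w : Cn n) : ℂ := (((c - s w) ^ 2 * Real.exp (A / (c - s w)) : ℝ) : ℂ)

lemma iW_smooth (hs : ContDiff ℝ ∞ s) {w : Cn n} (hw : s w < c) : ContDiffAt ℝ ∞ (iW s c A) w := by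
  have h1 : ContDiffAt ℝ ∞ (fun w ↦ c - s w) w := contDiffAt_const.sub hs.contDiffAt
  have h2 : ContDiffAt ℝ ∞ (fun w ↦ (c - s w) ^ 2 * Real.exp (A / (c - s w))) w :=
    (h1.pow 2).mul (contDiffAt_const.div h1 (by linarith)).exp
  exact Complex.ofRealCLM.contDiff.contDiffAt.comp w h2

lemma W2_ev (hs : Continuous s) {w : Cn n} (hw : s w < c) : W2 s c A =ᶠ[𝓝 w] fun w ↦ ((Real.exp (-(A / (c - s w))) / (c - s w) ^ 2 : ℝ) : ℂ) := by
  filter_upwards [hs.continuousAt.eventually (gt_mem_nhds hw)] with x hx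
  simp only [W2, om, if_pos hx]

lemma W2_smooth (hs : ContDiff ℝ ∞ s) {w : Cn n} (hw : s w < c) : ContDiffAt ℝ ∞ (W2 s c A) w := by
  have h1 : ContDiffAt ℝ ∞ (fun w ↦ c - s w) w := contDiffAt_const.sub hs.contDiffAt
  have h2 : ContDiffAt ℝ ∞ (fun w ↦ Real.exp (-(A / (c - s w))) / (c - s w) ^ 2) w :=
    ((contDiffAt_const.div h1 (by linarith)).neg.exp).div (h1.pow 2) (pow_ne_zero 2 (by linarith))
  exact (Complex.ofRealCLM.contDiff.contDiffAt.comp w h2).congr_of_eventuallyEq (W2_ev hs.continuous hw)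

lemma W2_iW {w : Cn n} (hw : s w < c) : W2 s c A w * iW s c A w = 1 := by
  have : c - s w ≠ 0 := by linarith
  simp only [W2, iW, om, if_pos hw, Real.exp_neg]
  rw [← Complex.ofReal_mul, ← Complex.ofReal_one]
  congr 1
  field_simp

lemma dop_W2 (hs : ContDiff ℝ ∞ s) {w : Cn n} (hw : s w < c) (v : Cn n) :
    dop (-I) v (W2 s c A) w = - (W2 s c A w * kap s c A v w) := by
  have ht : c - s w ≠ 0 := by linarith
  rw [dop_congr (W2_ev hs.continuous hw)]
  have h0 : HasDerivAt (fun x ↦ c - x) (-1) (s w) := (hasDerivAt_id (s w)).const_sub c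
  have h1 : HasDerivAt (fun x ↦ Real.exp (-(A / (c - x))) / (c - x) ^ 2)
      ((Real.exp (-(A / (c - s w))) / (c - s w) ^ 2) * -(A / (c - s w) ^ 2 - 2 / (c - s w))) (s w) := by
    have h2 : HasDerivAt (fun x ↦ -(A / (c - x))) (-(A / (c - s w) ^ 2)) (s w) := by
      have := ((hasDerivAt_const (s w) A).div h0 ht).neg
      refine this.congr_deriv ?_
      field_simp; ring
    refine (h2.exp.div (h0.pow 2) (pow_ne_zero 2 ht)).congr_deriv ?_
    simp only [Pi.pow_apply]
    field_simp; push_cast; ring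
  rw [dop_real_comp h1 (hs.differentiable (by simp) w)]
  simp only [W2, kap, om, if_pos hw]
  push_cast; ring

lemma tf_key (hs : ContDiff ℝ ∞ s) {F : Cn n → ℂ} (h : TF s c F) (v w : Cn n) :
    dop (-I) v (fun w ↦ F w * W2 s c A w) w = W2 s c A w * (dop (-I) v F w - F w * kap s c A v w) := by
  by_cases hw : s w < c
  · rw [dop_mul (h.cd.differentiable (by simp) w) ((W2_smooth hs hw).differentiableAt (by simp)), dop_W2 hs hw]
    ring
  · have h1 := ((h.mulD (g := W2 s c A) fun w hw ↦ W2_smooth hs hw).dop (-I) v).out hw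
    rw [h1]
    simp [W2, om, hw]

lemma riesz_abs {B H : Type*} [AddCommGroup B] [Module ℂ B] [NormedAddCommGroup H] [InnerProductSpace ℂ H] [CompleteSpace H]
    (τ : B →ₗ[ℂ] H) (l : B →ₗ[ℂ] ℂ) {C : ℝ} (C0 : 0 ≤ C) (hC : ∀ b, ‖l b‖ ≤ C * ‖τ b‖) :
    ∃ u : H, ‖u‖ ≤ C ∧ ∀ b, l b = inner ℂ u (τ b) := by
  have hk : LinearMap.ker τ ≤ LinearMap.ker l := fun b hb ↦ by
    have hb' : τ b = 0 := hb
    have := hC b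
    rw [hb', norm_zero, mul_zero] at this
    exact norm_le_zero_iff.1 this
  let l' : LinearMap.range τ →ₗ[ℂ] ℂ := ((LinearMap.ker τ).liftQ l hk).comp (τ.quotKerEquivRange.symm : _ →ₗ[ℂ] _)
  have hl' : ∀ b, l' ⟨τ b, b, rfl⟩ = l b := fun b ↦ by
    have : τ.quotKerEquivRange.symm ⟨τ b, b, rfl⟩ = (LinearMap.ker τ).mkQ b := by
      rw [LinearEquiv.symm_apply_eq]; rfl
    simp only [l', LinearMap.comp_apply, LinearEquiv.coe_coe, this]
    simp
  have hb : ∀ x, ‖l' x‖ ≤ C * ‖x‖ := by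
    rintro ⟨_, b, rfl⟩
    rw [hl']; exact hC b
  obtain ⟨g, hg, hn⟩ := exists_extension_norm_eq _ (l'.mkContinuous C hb)
  refine ⟨(InnerProductSpace.toDual ℂ H).symm g, ?_, fun b ↦ ?_⟩
  · rw [LinearIsometryEquiv.norm_map, hn]
    exact LinearMap.mkContinuous_norm_le _ C0 _
  · rw [InnerProductSpace.toDual_symm_apply]
    have := hg ⟨τ b, b, rfl⟩
    simp only [LinearMap.mkContinuous_apply] at this
    rw [this, hl']

def mkLin {B X V : Type*} [MeasurableSpace X] {μ : Measure X} [NormedAddCommGroup V] [NormedSpace ℂ V] [AddCommGroup B] [Module ℂ B]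
    (T : B →ₗ[ℂ] (X → V)) (hT : ∀ b, MemLp (T b) 2 μ) : B →ₗ[ℂ] Lp V 2 μ where
  toFun b := (hT b).toLp
  map_add' a b := by rw [← MemLp.toLp_add]; congr 1; exact map_add T a b
  map_smul' a b := by rw [RingHom.id_apply, ← MemLp.toLp_const_smul]; congr 1; exact map_smul T a b

lemma lp_sq {X V : Type*} [MeasurableSpace X] {μ : Measure X} [NormedAddCommGroup V] {f : X → V} (hf : MemLp f 2 μ) :
    ENNReal.ofReal (‖hf.toLp‖ ^ 2) = ∫⁻ w, ‖f w‖ₑ ^ 2 ∂μ := by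
  rw [Lp.norm_toLp, ENNReal.ofReal_pow ENNReal.toReal_nonneg, ENNReal.ofReal_toReal hf.2.ne,
    eLpNorm_eq_lintegral_rpow_enorm_toReal (by norm_num) (by norm_num)]
  simp only [ENNReal.toReal_ofNat, ENNReal.rpow_ofNat]
  rw [← ENNReal.rpow_natCast, ← ENNReal.rpow_mul]
  simp

def vec (g : Fin n → Cn n → ℂ) (w : Cn n) : Cn n := WithLp.toLp 2 fun j ↦ g j w

lemma vec_sq (g : Fin n → Cn n → ℂ) (w : Cn n) : ‖vec g w‖ₑ ^ 2 = ∑ j, ‖g j w‖ₑ ^ 2 := by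
  simp_rw [esq_eq]
  rw [← ENNReal.ofReal_sum_of_nonneg (fun _ _ ↦ by positivity), ← ofReal_norm_eq_enorm, ← ENNReal.ofReal_pow (norm_nonneg _), EuclideanSpace.norm_sq_eq]
  rfl

lemma vec_inner (g : Fin n → Cn n → ℂ) (w y : Cn n) : inner ℂ (vec g w) y = ∑ j, y j * conj (g j w) := by
  simp [PiLp.inner_apply, vec, RCLike.inner_apply]

lemma vec_meas {g : Fin n → Cn n → ℂ} (hg : ∀ j, Measurable (g j)) : Measurable (vec g) :=
  (PiLp.continuous_toLp 2 _).measurable.comp (measurable_pi_lambda _ hg)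

lemma vec_memLp (hs : Continuous s) {g : Fin n → Cn n → ℂ} (hg : ∀ j, Measurable (g j)) (gi : ∀ j, ∫⁻ w, ‖g j w‖ₑ ^ 2 * w2 s c A w < ⊤) :
    MemLp (vec g) 2 (volume.withDensity (w2 s c A)) := by
  refine ⟨(vec_meas hg).aestronglyMeasurable, ?_⟩
  rw [eLpNorm_lt_top_iff_lintegral_rpow_enorm_lt_top (by norm_num) (by norm_num)]
  simp only [ENNReal.toReal_ofNat, ENNReal.rpow_ofNat]
  rw [lintegral_withDensity_eq_lintegral_mul _ (w2_meas hs) ((vec_meas hg).enorm.pow_const 2)]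
  simp only [Pi.mul_apply, vec_sq, mul_comm (w2 s c A _)]
  rw [lsum1 hg (w2_meas hs)]
  exact ENNReal.sum_lt_top.2 fun j _ ↦ gi j

end

section

variable {e : Fin n → Cn n} {s : Cn n → ℝ} {c A m T : ℝ}

lemma int_w2 (hs : Continuous s) (g : Cn n → ℂ) : ∫ w, g w ∂(volume.withDensity (w2 s c A)) = ∫ w, W2 s c A w * g w := by
  rw [integral_withDensity_eq_integral_toReal_smul (w2_meas hs) (Eventually.of_forall fun w ↦ ENNReal.ofReal_lt_top)]
  refine integral_congr_ae (Eventually.of_forall fun w ↦ ?_)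
  simp only [w2, W2]
  rw [ENNReal.toReal_ofReal (div_nonneg (om_nonneg w) (sq_nonneg _)), Complex.real_smul]

lemma int_w1 (hs : Continuous s) (g : Cn n → ℂ) : ∫ w, g w ∂(volume.withDensity (w1 s c A)) = ∫ w, (om s c A w : ℂ) * g w := by
  rw [integral_withDensity_eq_integral_toReal_smul (w1_meas hs) (Eventually.of_forall fun w ↦ ENNReal.ofReal_lt_top)]
  refine integral_congr_ae (Eventually.of_forall fun w ↦ ?_)
  simp only [w1]
  rw [ENNReal.toReal_ofReal (om_nonneg w), Complex.real_smul]

abbrev H2 (s : Cn n → ℝ) (c A : ℝ) := Lp (Cn n) 2 (volume.withDensity (w2 s c A))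

lemma H2_inner (hs : Continuous s) {g : Fin n → Cn n → ℂ} (hg : MemLp (vec g) 2 (volume.withDensity (w2 s c A))) (x : H2 s c A) :
    inner ℂ hg.toLp x = ∫ w, W2 s c A w * ∑ j, (x : Cn n → Cn n) w j * conj (g j w) := by
  rw [L2.inner_def, ← int_w2 hs]
  refine integral_congr_ae ?_
  filter_upwards [hg.coeFn_toLp] with w hw
  rw [hw, vec_inner]

lemma H2_inner' (hs : Continuous s) {g h : Fin n → Cn n → ℂ} (hg : MemLp (vec g) 2 (volume.withDensity (w2 s c A)))
    (hh : MemLp (vec h) 2 (volume.withDensity (w2 s c A))) :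
    inner ℂ hg.toLp hh.toLp = ∫ w, W2 s c A w * ∑ j, h j w * conj (g j w) := by
  rw [L2.inner_def, ← int_w2 hs]
  refine integral_congr_ae ?_
  filter_upwards [hg.coeFn_toLp, hh.coeFn_toLp] with w hw hw'
  rw [hw, hw', vec_inner]
  rfl

lemma H2_meas (x : H2 s c A) (j : Fin n) : Measurable fun w ↦ (x : Cn n → Cn n) w j :=
  (EuclideanSpace.proj (𝕜 := ℂ) j).continuous.measurable.comp (Lp.stronglyMeasurable x).measurable

lemma H2_sq (hs : Continuous s) (x : H2 s c A) : ∫⁻ w, (∑ j, ‖(x : Cn n → Cn n) w j‖ₑ ^ 2) * w2 s c A w = ENNReal.ofReal (‖x‖ ^ 2) := by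
  have h := lp_sq (Lp.memLp x)
  rw [Lp.toLp_coeFn] at h
  rw [h, lintegral_withDensity_eq_lintegral_mul _ (w2_meas hs) ((Lp.stronglyMeasurable x).measurable.enorm.pow_const 2)]
  refine lintegral_congr fun w ↦ ?_
  rw [Pi.mul_apply, mul_comm, ← vec_sq (fun j w ↦ (x : Cn n → Cn n) w j)]
  rfl

lemma tf_memLp (S : SU e s c A m T) {β : Fin n → Cn n → ℂ} (h : ∀ j, TF s c (β j)) :
    MemLp (vec β) 2 (volume.withDensity (w2 s c A)) :=
  vec_memLp S.hs.continuous (fun j ↦ (h j).cd.continuous.measurable) fun j ↦ (h j).fin (by finiteness) (w2_le S.hA)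

def crf (e : Fin n → Cn n) (s : Cn n → ℝ) (c A : ℝ) (f : Cn n → ℂ) (j k : Fin n) (i : Fin n) (w : Cn n) : ℂ :=
  (if i = j then conj (dop I (e k) f w) * iW s c A w else 0) - (if i = k then conj (dop I (e j) f w) * iW s c A w else 0)

lemma tf_crf (S : SU e s c A m T) {f : Cn n → ℂ} (h : TF s c f) (j k i : Fin n) : TF s c (crf e s c A f j k i) := by
  have h1 : ∀ l, TF s c fun w ↦ conj (dop I (e l) f w) * iW s c A w := fun l ↦
    (h.dop I (e l)).conj.mulD fun w hw ↦ iW_smooth S.hs hw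
  have h2 : ∀ (P : Prop) [Decidable P] (l : Fin n), TF s c fun w ↦ if P then conj (dop I (e l) f w) * iW s c A w else 0 := fun P _ l ↦ by
    by_cases hP : P
    · simpa [hP] using h1 l
    · simp only [hP, if_false]; exact TF.zero
  have := (h2 (i = j) k).add ((h2 (i = k) j).smul (-1))
  convert this using 1
  ext w
  simp [crf, sub_eq_add_neg]

lemma crf_sum (x : Cn n) {f : Cn n → ℂ} (h : TF s c f) (j k : Fin n) (w : Cn n) :
    W2 s c A w * ∑ i, x i * conj (crf e s c A f j k i w) = x j * dop I (e k) f w - x k * dop I (e j) f w := by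
  have h0 : ∀ i, x i * conj (crf e s c A f j k i w) = (if i = j then x i * (dop I (e k) f w * iW s c A w) else 0) -
      (if i = k then x i * (dop I (e j) f w * iW s c A w) else 0) := fun i ↦ by
    have : conj (iW s c A w) = iW s c A w := conj_ofReal _
    unfold crf
    split_ifs <;> simp [this]
    ring
  simp_rw [h0, Finset.sum_sub_distrib]
  simp only [Finset.sum_ite_eq', Finset.mem_univ, if_true]
  by_cases hw : s w < c
  · have := W2_iW (A := A) hw
    linear_combination (x j * dop I (e k) f w - x k * dop I (e j) f w) * this
  · rw [(h.dop I (e k)).out hw, (h.dop I (e j)).out hw]; simp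

lemma TF.ibp {f g : Cn n → ℂ} (h : TF s c f) (h' : TF s c g) (d : ℂ) (v : Cn n) :
    ∫ w, f w * CE.dop d v g w = - ∫ w, CE.dop d v f w * g w := dop_ibp (volume) h.cd h'.cd h.cs

lemma TF.int {f : Cn n → ℂ} (h : TF s c f) : Integrable f := integrable_cs volume h.cd.continuous h.cs

def TB (s : Cn n → ℝ) (c : ℝ) : Submodule ℂ (Fin n → Cn n → ℂ) where
  carrier := {β | ∀ j, TF s c (β j)}
  add_mem' h h' j := (h j).add (h' j)
  zero_mem' _ := TF.zero
  smul_mem' a _ h j := (h j).smul a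

lemma kap_smooth (S : SU e s c A m T) {w : Cn n} (hw : s w < c) (v : Cn n) : ContDiffAt ℝ ∞ (kap s c A v) w := by
  have h1 : ContDiffAt ℝ ∞ (fun w ↦ c - s w) w := contDiffAt_const.sub S.hs.contDiffAt
  have ht : c - s w ≠ 0 := by linarith
  have h2 : ContDiffAt ℝ ∞ (fun w ↦ A / (c - s w) ^ 2 - 2 / (c - s w)) w :=
    (contDiffAt_const.div (h1.pow 2) (pow_ne_zero 2 ht)).sub (contDiffAt_const.div h1 ht)
  exact (dop_contDiff (contDiff_ofReal' S.hs)).contDiffAt.mul (Complex.ofRealCLM.contDiff.contDiffAt.comp w h2)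

lemma tf_tdv1 (S : SU e s c A m T) {f : Cn n → ℂ} (h : TF s c f) (v : Cn n) :
    TF s c fun w ↦ dop (-I) v f w - f w * kap s c A v w := by
  have := (h.dop (-I) v).add ((h.mulD (g := kap s c A v) fun w hw ↦ kap_smooth S hw v).smul (-1))
  convert this using 1
  ext w; simp [sub_eq_add_neg]

lemma TF.sum {f : Fin n → Cn n → ℂ} (h : ∀ j, TF s c (f j)) (t : Finset (Fin n)) : TF s c (fun w ↦ ∑ j ∈ t, f j w) := by
  induction t using Finset.induction_on with
  | empty => simp only [Finset.sum_empty]; exact TF.zero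
  | insert a t ha ih =>
    simp_rw [Finset.sum_insert ha]
    exact (h a).add ih

lemma tf_tdv (S : SU e s c A m T) {β : Fin n → Cn n → ℂ} (h : ∀ j, TF s c (β j)) : TF s c (tdv s c A e β) :=
  TF.sum (fun j ↦ tf_tdv1 S (h j) (e j)) Finset.univ

def KS (e : Fin n → Cn n) (s : Cn n → ℝ) (c A : ℝ) : Submodule ℂ (H2 s c A) :=
  (Submodule.span ℂ {x | ∃ f j k, ∃ h : MemLp (vec (crf e s c A f j k)) 2 (volume.withDensity (w2 s c A)), TF s c f ∧ x = h.toLp})ᗮ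

lemma mem_KS {x : H2 s c A} : x ∈ KS e s c A ↔ ∀ f j k, ∀ h : MemLp (vec (crf e s c A f j k)) 2 (volume.withDensity (w2 s c A)), TF s c f → inner ℂ h.toLp x = 0 := by
  unfold KS
  rw [Submodule.mem_orthogonal]
  refine ⟨fun H f j k h hf ↦ H _ (Submodule.subset_span ⟨f, j, k, h, hf, rfl⟩), fun H u hu ↦ ?_⟩
  induction hu using Submodule.span_induction with
  | mem u hu => obtain ⟨f, j, k, h, hf, rfl⟩ := hu; exact H f j k h hf
  | zero => simp
  | add a b _ _ ha hb => rw [inner_add_left, ha, hb, add_zero]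
  | smul a b _ hb => rw [inner_smul_left, hb, mul_zero]

lemma mem_KS_toLp (S : SU e s c A m T) {g : Fin n → Cn n → ℂ} (hg : MemLp (vec g) 2 (volume.withDensity (w2 s c A)))
    (hc : ∀ f, TF s c f → ∀ j k, ∫ w, (g j w * dop I (e k) f w - g k w * dop I (e j) f w) = 0) :
    hg.toLp ∈ KS e s c A := by
  rw [mem_KS]
  intro f j k h hf
  rw [H2_inner' S.hs.continuous h hg, ← hc f hf j k]
  refine integral_congr_ae (Eventually.of_forall fun w ↦ ?_)
  exact crf_sum (vec g w) hf j k w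

lemma dbar_mem (S : SU e s c A m T) {H : Cn n → ℂ} (hH : TF s c H) :
    (tf_memLp S fun j ↦ hH.dop I (e j)).toLp ∈ KS e s c A := by
  refine mem_KS_toLp S _ fun f hf j k ↦ ?_
  have i1 : ∀ j k, Integrable fun w ↦ dop I (e j) H w * dop I (e k) f w := fun j k ↦
    ((hH.dop _ _).mulD fun w _ ↦ (hf.dop _ _).cd.contDiffAt).int
  rw [integral_sub (i1 j k) (i1 k j)]
  have i2 : ∀ j k, ∫ w, dop I (e j) H w * dop I (e k) f w = - ∫ w, H w * dop I (e j) (dop I (e k) f) w := fun j k ↦ by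
    rw [hH.ibp (hf.dop _ _), neg_neg]
  rw [i2, i2, sub_eq_zero]
  refine congrArg Neg.neg (integral_congr_ae (Eventually.of_forall fun w ↦ ?_))
  have := dop_comm (c := I) (d := I) (v := e j) (u := e k) (hf.cd.of_le ENat.LEInfty.out : ContDiff ℝ 2 f) w
  simp only [this]

lemma proj_WK (S : SU e s c A m T) {β : Fin n → Cn n → ℂ} (h : ∀ j, TF s c (β j)) {x : H2 s c A} (hx : x ∈ KS e s c A)
    (hp : ∀ y ∈ KS e s c A, inner ℂ y x = inner ℂ y (tf_memLp S h).toLp) :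
    WK e s c A (fun j w ↦ (x : Cn n → Cn n) w j) (tdv s c A e β) := by
  have hs := S.hs.continuous
  refine ⟨H2_meas x, fun j ↦ ?_, (tf_tdv S h).cd.continuous, fun f hf j k ↦ ?_, fun f hf ↦ ?_⟩
  · refine lt_of_le_of_lt ?_ ((H2_sq hs x).le.trans_lt ENNReal.ofReal_lt_top)
    gcongr with w
    exact Finset.single_le_sum (f := fun j ↦ ‖(x : Cn n → Cn n) w j‖ₑ ^ 2) (fun _ _ ↦ by simp) (Finset.mem_univ j)
  · have h1 := mem_KS.1 hx f j k (tf_memLp S (tf_crf S hf j k)) hf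
    rw [H2_inner hs] at h1
    rw [← h1]
    refine integral_congr_ae (Eventually.of_forall fun w ↦ ?_)
    exact (crf_sum _ hf j k w).symm
  · have tF : TF s c fun w ↦ f w * iW s c A w := hf.mulD fun w hw ↦ iW_smooth S.hs hw
    have tH := tF.conj
    have key : ∀ w j, W2 s c A w * conj (dop I (e j) (fun w ↦ conj (f w * iW s c A w)) w) = dop (-I) (e j) f w + f w * kap s c A (e j) w := fun w j ↦ by
      have h2 := dop_conj (c := -I) (v := e j) (tH.cd.differentiable (by simp) w)
      have h2' : conj (dop I (e j) (fun w ↦ conj (f w * iW s c A w)) w) = dop (-I) (e j) (fun w ↦ f w * iW s c A w) w := by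
        simp only [Complex.conj_conj, map_neg, conj_I, neg_neg] at h2
        exact h2.symm
      rw [h2']
      by_cases hw : s w < c
      · have h3 := tf_key (A := A) S.hs tF (e j) w
        have h4 : (fun w ↦ f w * iW s c A w * W2 s c A w) = f := by
          ext y
          by_cases hy : s y < c
          · rw [mul_assoc, mul_comm (iW s c A y), W2_iW hy, mul_one]
          · simp [hf.out hy]
        rw [h4] at h3
        have := W2_iW (A := A) hw
        rw [h3]
        linear_combination (f w * kap s c A (e j) w) * this
      · rw [(tF.dop _ _).out hw, (hf.dop _ _).out hw, hf.out hw]; simp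
    have h5 := hp _ (dbar_mem S tH)
    rw [H2_inner hs, H2_inner' hs] at h5
    have hsum : ∀ y : Fin n → ℂ, ∀ w, W2 s c A w * ∑ j, y j * conj (dop I (e j) (fun w ↦ conj (f w * iW s c A w)) w) = ∑ j, y j * (dop (-I) (e j) f w + f w * kap s c A (e j) w) := fun y w ↦ by
      rw [mul_sum]
      refine sum_congr rfl fun j _ ↦ ?_
      rw [← key]; ring
    rw [integral_congr_ae (Eventually.of_forall fun w ↦ hsum _ w),
      integral_congr_ae (Eventually.of_forall fun w ↦ hsum (fun j ↦ β j w) w)] at h5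
    rw [h5]
    have i1 : ∀ j, Integrable fun w ↦ β j w * dop (-I) (e j) f w := fun j ↦ ((h j).mulD fun w _ ↦ (hf.dop _ _).cd.contDiffAt).int
    have i2 : ∀ j, Integrable fun w ↦ dop (-I) (e j) (β j) w * f w := fun j ↦ (((h j).dop _ _).mulD fun w _ ↦ hf.cd.contDiffAt).int
    have i3 : ∀ j, Integrable fun w ↦ β j w * f w * kap s c A (e j) w := fun j ↦ 
      (((h j).mulD fun w _ ↦ hf.cd.contDiffAt).mulD fun w hw ↦ kap_smooth S hw _).int
    have e1 : ∫ w, (∑ j, β j w * (dop (-I) (e j) f w + f w * kap s c A (e j) w)) = ∑ j, ((∫ w, β j w * dop (-I) (e j) f w) + ∫ w, β j w * f w * kap s c A (e j) w) := by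
      simp_rw [mul_add, ← mul_assoc]
      refine (integral_finsetSum _ fun j _ ↦ (i1 j).add (i3 j)).trans ?_
      exact sum_congr rfl fun j _ ↦ integral_add (i1 j) (i3 j)
    have e2 : ∫ w, tdv s c A e β w * f w = ∑ j, ((∫ w, dop (-I) (e j) (β j) w * f w) - ∫ w, β j w * f w * kap s c A (e j) w) := by
      have : ∀ w, tdv s c A e β w * f w = ∑ j, (dop (-I) (e j) (β j) w * f w - β j w * f w * kap s c A (e j) w) := fun w ↦ by
        rw [tdv, sum_mul]
        exact sum_congr rfl fun j _ ↦ by ring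
      simp_rw [this]
      refine (integral_finsetSum _ fun j _ ↦ (i2 j).sub (i3 j)).trans ?_
      exact sum_congr rfl fun j _ ↦ integral_sub (i2 j) (i3 j)
    rw [e1, e2, ← Finset.sum_neg_distrib]
    refine sum_congr rfl fun j _ ↦ ?_
    rw [(h j).ibp hf]; ring

end

section

variable {e : Fin n → Cn n} {s : Cn n → ℝ} {c A m T : ℝ}

lemma tdv_memLp (S : SU e s c A m T) {β : Fin n → Cn n → ℂ} (h : ∀ j, TF s c (β j)) :
    MemLp (tdv s c A e β) 2 (volume.withDensity (w1 s c A)) := by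
  have ht := tf_tdv S h
  refine ⟨ht.cd.continuous.aestronglyMeasurable, ?_⟩
  rw [eLpNorm_lt_top_iff_lintegral_rpow_enorm_lt_top (by norm_num) (by norm_num)]
  simp only [ENNReal.toReal_ofNat, ENNReal.rpow_ofNat]
  rw [lintegral_withDensity_eq_lintegral_mul _ (w1_meas S.hs.continuous) (ht.cd.continuous.measurable.enorm.pow_const 2)]
  simp only [Pi.mul_apply, mul_comm (w1 s c A _)]
  exact ht.fin ENNReal.one_ne_top (w1_le S.hA)

lemma tdv_sq (S : SU e s c A m T) {β : Fin n → Cn n → ℂ} (h : ∀ j, TF s c (β j)) :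
    ENNReal.ofReal (‖(tdv_memLp S h).toLp‖ ^ 2) = ∫⁻ w, ‖tdv s c A e β w‖ₑ ^ 2 * w1 s c A w := by
  rw [lp_sq, lintegral_withDensity_eq_lintegral_mul _ (w1_meas S.hs.continuous) ((tf_tdv S h).cd.continuous.measurable.enorm.pow_const 2)]
  simp only [Pi.mul_apply, mul_comm (w1 s c A _)]

lemma main_bound (S : SU e s c A m T) {β : Fin n → Cn n → ℂ} (h : ∀ j, TF s c (β j)) {y : H2 s c A} (hy : y ∈ KS e s c A) :
    ‖inner ℂ y (tf_memLp S h).toLp‖ ≤ 4 * ‖y‖ * ‖(tdv_memLp S h).toLp‖ := by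
  haveI : (KS e s c A).HasOrthogonalProjection := by unfold KS; infer_instance
  set b := (tf_memLp S h).toLp
  set x : H2 s c A := (KS e s c A).starProjection b
  have hx : x ∈ KS e s c A := Submodule.starProjection_apply_mem _ _
  have hp : ∀ y ∈ KS e s c A, inner ℂ y x = inner ℂ y b := fun y hy ↦ by
    rw [← Submodule.inner_starProjection_left_eq_right, Submodule.starProjection_eq_self_iff.2 hy]
  have hw := weak_est S (proj_WK S h hx hp)
  rw [H2_sq S.hs.continuous, ← tdv_sq S h, show (16:ℝ≥0∞) = ENNReal.ofReal 16 by simp, ← ENNReal.ofReal_mul (by norm_num),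
    ENNReal.ofReal_le_ofReal_iff (by positivity)] at hw
  have h2 : ‖x‖ ≤ 4 * ‖(tdv_memLp S h).toLp‖ := by
    refine abs_le_of_sq_le_sq' ?_ (by positivity) |>.2
    rw [mul_pow, show (4:ℝ) ^ 2 = 16 by norm_num]; exact hw
  rw [← hp y hy]
  calc _ ≤ ‖y‖ * ‖x‖ := norm_inner_le_norm _ _
    _ ≤ ‖y‖ * (4 * ‖(tdv_memLp S h).toLp‖) := by gcongr
    _ = _ := by ring

theorem dbar_weak (S : SU e s c A m T) {α : Fin n → Cn n → ℂ} (αm : ∀ j, Measurable (α j))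
    (αi : ∀ j, ∫⁻ w, ‖α j w‖ₑ ^ 2 * w2 s c A w < ⊤)
    (αc : ∀ f, TF s c f → ∀ j k, ∫ w, (α j w * dop I (e k) f w - α k w * dop I (e j) f w) = 0) :
    ∃ u : Cn n → ℂ, Measurable u ∧ ∫⁻ w, ‖u w‖ₑ ^ 2 * w1 s c A w ≤ 16 * ∫⁻ w, (∑ j, ‖α j w‖ₑ ^ 2) * w2 s c A w ∧
      ∀ f, TF s c f → ∀ j, ∫ w, α j w * f w = ∫ w, u w * ((c - s w) ^ 2 : ℝ) * dop I (e j) f w := by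
  have hs := S.hs.continuous
  have hα := vec_memLp hs αm αi
  have hK := mem_KS_toLp S hα αc
  let Tv : TB s c →ₗ[ℂ] (Cn n → Cn n) := 
    { toFun := fun b ↦ vec b.1, map_add' := fun a b ↦ rfl, map_smul' := fun a b ↦ rfl }
  have hTv : ∀ b, MemLp (Tv b) 2 (volume.withDensity (w2 s c A)) := fun b ↦ tf_memLp S b.2
  let Tt : TB s c →ₗ[ℂ] (Cn n → ℂ) := 
    { toFun := fun b ↦ tdv s c A e b.1
      map_add' := fun a b ↦ by
        ext w
        show tdv s c A e (a.1 + b.1) w = tdv s c A e a.1 w + tdv s c A e b.1 w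
        unfold tdv
        rw [← sum_add_distrib]
        refine sum_congr rfl fun j _ ↦ ?_
        have : dop (-I) (e j) ((a.1 + b.1) j) w = _ := dop_add ((a.2 j).cd.differentiable (by simp) w) ((b.2 j).cd.differentiable (by simp) w)
        rw [this, Pi.add_apply, Pi.add_apply]
        ring
      map_smul' := fun a b ↦ by
        ext w
        show tdv s c A e (a • b.1) w = a * tdv s c A e b.1 w
        unfold tdv
        rw [mul_sum]
        refine sum_congr rfl fun j _ ↦ ?_
        have : dop (-I) (e j) ((a • b.1) j) w = a * dop (-I) (e j) (b.1 j) w := by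
          unfold dop
          have : fderiv ℝ ((a • b.1) j) w = a • fderiv ℝ (b.1 j) w := fderiv_const_smul ((b.2 j).cd.differentiable (by simp) w) a
          rw [this]; simp; ring
        rw [this]; simp; ring }
  have hTt : ∀ b, MemLp (Tt b) 2 (volume.withDensity (w1 s c A)) := fun b ↦ tdv_memLp S b.2
  obtain ⟨u, hu, hub⟩ := riesz_abs (mkLin Tt hTt) ((innerₛₗ ℂ hα.toLp).comp (mkLin Tv hTv)) (C := 4 * ‖hα.toLp‖) (by positivity)
    (fun b ↦ main_bound S b.2 hK)
  refine ⟨u, (Lp.stronglyMeasurable u).measurable, ?_, fun f hf j ↦ ?_⟩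
  · have h := lp_sq (Lp.memLp u)
    rw [Lp.toLp_coeFn, lintegral_withDensity_eq_lintegral_mul _ (w1_meas hs) ((Lp.stronglyMeasurable u).measurable.enorm.pow_const 2)] at h
    simp only [Pi.mul_apply, mul_comm (w1 s c A _)] at h
    have h2 := lp_sq hα
    rw [lintegral_withDensity_eq_lintegral_mul _ (w2_meas hs) ((vec_meas αm).enorm.pow_const 2)] at h2
    simp only [Pi.mul_apply, vec_sq, mul_comm (w2 s c A _)] at h2
    rw [← h, ← h2, show (16:ℝ≥0∞) = ENNReal.ofReal 16 by simp, ← ENNReal.ofReal_mul (by norm_num)]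
    refine ENNReal.ofReal_le_ofReal ?_
    calc ‖u‖ ^ 2 ≤ (4 * ‖hα.toLp‖) ^ 2 := by gcongr
      _ = _ := by ring
  · have tF : TF s c fun w ↦ conj (f w) * iW s c A w := hf.conj.mulD fun w hw ↦ iW_smooth S.hs hw
    have tb : ∀ i, TF s c ((fun i w ↦ if i = j then conj (f w) * iW s c A w else 0 : Fin n → Cn n → ℂ) i) := fun i ↦ by
      by_cases hij : i = j
      · simpa only [hij, if_true] using tF
      · simp only [hij, if_false]; exact TF.zero
    have h1 := hub ⟨_, tb⟩
    have h2 : (innerₛₗ ℂ hα.toLp).comp (mkLin Tv hTv) ⟨_, tb⟩ = inner ℂ hα.toLp (tf_memLp S tb).toLp := rfl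
    have h3 : mkLin Tt hTt ⟨_, tb⟩ = (tdv_memLp S tb).toLp := rfl
    rw [h2, h3, H2_inner' hs, L2.inner_def] at h1
    have h4 : ∫ a, inner ℂ ((u : Cn n → ℂ) a) (((tdv_memLp S tb).toLp : Cn n → ℂ) a) ∂(volume.withDensity (w1 s c A)) = 
      ∫ w, conj (u w * ((c - s w) ^ 2 : ℝ) * dop I (e j) f w) := by
      rw [integral_congr_ae (g := fun w ↦ inner ℂ ((u : Cn n → ℂ) w) (dop (-I) (e j) (fun w ↦ conj (f w) * iW s c A w) w - (conj (f w) * iW s c A w) * kap s c A (e j) w)), int_w1 hs]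
      · refine integral_congr_ae (Eventually.of_forall fun w ↦ ?_)
        have hk := tf_key (A := A) S.hs tF (e j) w
        have h5 : (fun w ↦ conj (f w) * iW s c A w * W2 s c A w) = fun w ↦ conj (f w) := by
          ext y
          by_cases hy : s y < c
          · rw [mul_assoc, mul_comm (iW s c A y), W2_iW hy, mul_one]
          · simp [hf.out hy]
        rw [h5, dop_conj (hf.cd.differentiable (by simp) w)] at hk
        simp only [map_neg, conj_I, neg_neg] at hk
        simp only [RCLike.inner_apply, map_mul, conj_ofReal, hk]
        by_cases hw : s w < c
        · have : (om s c A w : ℂ) = ((c - s w) ^ 2 : ℝ) * W2 s c A w := by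
            have : c - s w ≠ 0 := by linarith
            rw [W2, ← Complex.ofReal_mul]
            congr 1; field_simp
          rw [this]; ring
        · simp [om, W2, hw]
      · filter_upwards [(tdv_memLp S tb).coeFn_toLp] with w hw
        rw [hw]
        congr 1
        rw [tdv, Finset.sum_eq_single j]
        · simp
        · intro i _ hij
          simp [hij, dop]
        · simp
    rw [h4, integral_conj] at h1
    have h6 : ∫ w, W2 s c A w * ∑ i, (if i = j then conj (f w) * iW s c A w else 0) * conj (α i w) = ∫ w, conj (α j w * f w) := by
      refine integral_congr_ae (Eventually.of_forall fun w ↦ ?_)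
      simp only [ite_mul, zero_mul, Finset.sum_ite_eq', Finset.mem_univ, if_true, map_mul]
      by_cases hw : s w < c
      · have := W2_iW (A := A) hw
        linear_combination (conj (f w) * conj (α j w)) * this
      · simp [hf.out hw]
    rw [h6, integral_conj] at h1
    exact (starRingEnd ℂ).injective h1

end

section
variable {F : Type*} [NormedAddCommGroup F] [NormedSpace ℝ F]

lemma mol_swap {r : ℝ} (hr : 0 < r) {g : Cn n → F} {φ : ℝ → Cn n → Cn n}
    (hg : Continuous fun q : ℝ × Cn n ↦ g (φ q.1 q.2)) :
    ∫ θ in (0:ℝ)..2 * Real.pi, ∫ y, mol r y • g (φ θ y)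
      = ∫ y, mol r y • ∫ θ in (0:ℝ)..2 * Real.pi, g (φ θ y) := by
  have hp : (0:ℝ) ≤ 2 * Real.pi := by positivity
  rw [intervalIntegral_integral_swap]
  · simp_rw [intervalIntegral.integral_smul]
  · obtain ⟨M, hM⟩ := ((isCompact_Icc (a := (0:ℝ)) (b := 2 * Real.pi)).prod
      (isCompact_closedBall (0 : Cn n) r)).exists_bound_of_continuousOn hg.continuousOn
    have h2 : Integrable (fun q : ℝ × Cn n ↦ (M : ℝ) * mol r q.2)
        ((volume.restrict (Set.uIoc 0 (2 * Real.pi))).prod volume) := by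
      haveI : IsFiniteMeasure (volume.restrict (uIoc 0 (2 * Real.pi))) := ⟨by simp [uIoc_of_le hp]; finiteness⟩
      have := (integrable_const (μ := volume.restrict (Set.uIoc 0 (2 * Real.pi))) M).mul_prod (mol_integrable (n := n) hr)
      exact this
    refine h2.mono' ?_ ?_
    · have c2 : Continuous fun q : ℝ × Cn n ↦ mol r q.2 • g (φ q.1 q.2) :=
        ((mol_contDiff r).continuous.comp continuous_snd).smul hg
      exact c2.aestronglyMeasurable
    · have : ∀ᵐ q ∂((volume.restrict (Set.uIoc 0 (2 * Real.pi))).prod (volume : Measure (Cn n))), q.1 ∈ Set.uIoc 0 (2 * Real.pi) :=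
        Measure.quasiMeasurePreserving_fst.ae (ae_restrict_mem measurableSet_uIoc)
      filter_upwards [this] with q hq
      rw [uIoc_of_le hp] at hq
      rw [Function.uncurry, norm_smul, norm_of_nonneg (mol_nonneg hr _), mul_comm]
      by_cases h : ‖q.2‖ ≤ r
      · exact mul_le_mul_of_nonneg_right (hM q ⟨⟨hq.1.le, hq.2⟩, by simpa using h⟩) (mol_nonneg hr _)
      · simp [mol_zero hr (not_le.1 h).le]

lemma moll_rot {r : ℝ} (g : Cn n → F) (w : Cn n) {ζ : ℂ} (hζ : ‖ζ‖ = 1) :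
    moll r g w = ∫ y, mol r y • g (w + ζ • y) := by
  rw [moll_swap]
  have hu : ‖-ζ‖ = 1 := by rw [norm_neg, hζ]
  let L : Cn n ≃ₗᵢ[ℝ] Cn n :=
    { LinearEquiv.smulOfNeZero ℂ (Cn n) (-ζ) (by rw [← norm_ne_zero_iff, hu]; norm_num) |>.restrictScalars ℝ with
      norm_map' := fun x ↦ by
        show ‖(-ζ) • x‖ = ‖x‖
        rw [norm_smul, hu, one_mul] }
  have hL : ∀ x, L x = (-ζ) • x := fun x ↦ rfl
  have := L.measurePreserving.integral_comp L.toHomeomorph.measurableEmbedding (fun y ↦ mol r y • g (w - y))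
  rw [← this]
  simp_rw [hL, mol_rot r hu]
  simp

lemma moll_mean [CompleteSpace F] {r : ℝ} (hr : 0 < r) {g : Cn n → F} (hg : Continuous g) (w : Cn n) :
    moll r g w = ∫ y, mol r y • ((2 * Real.pi)⁻¹ • ∫ θ in (0:ℝ)..2 * Real.pi, g (w + circleMap 0 1 θ • y)) := by
  have hp : (2 * Real.pi) ≠ 0 := by positivity
  have h1 := mol_swap (φ := fun θ y ↦ w + circleMap 0 1 θ • y) (g := g) hr (by
    have := continuous_circleMap 0 1
    fun_prop)
  have h2 : ∫ θ in (0:ℝ)..2 * Real.pi, ∫ y, mol r y • g (w + circleMap 0 1 θ • y)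
      = (2 * Real.pi) • moll r g w := by
    rw [intervalIntegral.integral_congr (g := fun _ ↦ moll r g w)]
    · rw [intervalIntegral.integral_const, sub_zero]
    · intro θ _
      exact (moll_rot g w (by simp)).symm
  rw [integral_congr_ae (g := fun y ↦ (2 * Real.pi)⁻¹ • (mol r y • ∫ θ in (0:ℝ)..2 * Real.pi, g (w + circleMap 0 1 θ • y)))
    (Eventually.of_forall fun y ↦ smul_comm _ _ _), integral_smul, ← h1, h2, smul_smul, inv_mul_cancel₀ hp, one_smul]

lemma moll_holo {r : ℝ} (hr : 0 < r) {g : Cn n → ℂ} (hg : Continuous g) {w : Cn n}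
    (hd : ∀ y ∈ closedBall w r, DifferentiableAt ℂ g y) : moll r g w = g w := by
  rw [moll_mean hr hg]
  have : ∀ y : Cn n, mol r y • ((2 * Real.pi)⁻¹ • ∫ θ in (0:ℝ)..2 * Real.pi, g (w + circleMap 0 1 θ • y)) = mol r y • g w := by
    intro y
    by_cases h : ‖y‖ ≤ r
    · congr 1
      have h3 := DiffContOnCl.circleAverage (f := fun ζ : ℂ ↦ g (w + ζ • y)) (c := 0) (R := 1) (by
        apply DifferentiableOn.diffContOnCl
        intro ζ hζ
        have hζ' : ‖ζ‖ ≤ 1 := by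
          have := closure_ball_subset_closedBall hζ
          simpa using this
        apply DifferentiableAt.differentiableWithinAt
        refine DifferentiableAt.comp ζ (g := g) (hd _ ?_) (by fun_prop)
        simp only [mem_closedBall, dist_self_add_left, norm_smul]
        nlinarith [norm_nonneg y, norm_nonneg ζ])
      simp only [zero_smul, add_zero] at h3
      exact h3
    · simp [mol_zero hr (not_le.1 h).le]
  simp_rw [this, integral_smul_const, mol_int hr, one_smul]

lemma moll_bound {r : ℝ} (hr : 0 < r) {g : Cn n → ℂ} {M : ℝ} (hM : ∀ y, ‖g y‖ ≤ M) (w : Cn n) :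
    ‖moll r g w‖ ≤ M := by
  rw [moll_swap]
  refine (norm_integral_le_of_norm_le ((mol_integrable hr).mul_const M) (Eventually.of_forall fun y ↦ ?_)).trans ?_
  · rw [norm_smul, norm_of_nonneg (mol_nonneg hr _)]
    exact mul_le_mul_of_nonneg_left (hM _) (mol_nonneg hr _)
  · rw [integral_mul_const, mol_int hr, one_mul]

lemma moll_bound2 {r : ℝ} (hr : 0 < r) : ∃ K : ℝ≥0, ∀ g : Cn n → ℂ, Measurable g → ∀ w,
    ‖moll r g w‖ₑ ^ 2 ≤ K * ∫⁻ y, ‖g y‖ₑ ^ 2 := by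
  obtain ⟨K, hK⟩ := (mol_compact (n := n) hr).exists_bound_of_continuous (mol_contDiff r).continuous
  refine ⟨K.toNNReal, fun g hg w ↦ ?_⟩
  rw [moll_swap]
  have h1 : ‖∫ y, mol r y • g (w - y)‖ₑ ≤ ∫⁻ y, ENNReal.ofReal (mol r y) * ‖g (w - y)‖ₑ := by
    refine (enorm_integral_le_lintegral_enorm _).trans (lintegral_mono fun y ↦ ?_)
    show ‖mol r y • g (w - y)‖ₑ ≤ _
    rw [enorm_smul, Real.enorm_eq_ofReal (mol_nonneg hr _)]
  refine (pow_le_pow_left₀ bot_le h1 2).trans ((cs_prob hr (by fun_prop)).trans ?_)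
  rw [← lintegral_sub_left_eq_self (fun y ↦ ‖g y‖ₑ ^ 2) w, ← lintegral_const_mul _ (by fun_prop)]
  refine lintegral_mono fun y ↦ ?_
  refine mul_le_mul_left ?_ _
  show ENNReal.ofReal (mol r y) ≤ ENNReal.ofReal K
  exact ENNReal.ofReal_le_ofReal ((le_abs_self _).trans (hK y))

end

section

def levH (D : Cn n →L[ℝ] Cn n →L[ℝ] ℝ) (u v : Cn n) : ℂ :=
  ((D u v + D (I • u) (I • v) : ℝ) + I * (D u (I • v) - D (I • u) v : ℝ)) / 4

lemma csmul_eq (c : ℂ) (u : Cn n) : c • u = c.re • u + c.im • (I • u) := by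
  conv_lhs => rw [← Complex.re_add_im c]
  rw [add_smul, mul_smul, Complex.coe_smul, Complex.coe_smul]

lemma I_smul_I (u : Cn n) : I • I • u = -u := by rw [smul_smul]; simp

lemma I_smul_real (a : ℝ) (u : Cn n) : I • a • u = a • I • u := smul_comm _ _ _

def levL (D : Cn n →L[ℝ] Cn n →L[ℝ] ℝ) (v : Cn n) : Cn n →ₗ[ℂ] ℂ where
  toFun u := levH D u v
  map_add' x y := by simp only [levH, smul_add, map_add, ContinuousLinearMap.add_apply]; push_cast; ring
  map_smul' c x := by
    show levH D (c • x) v = c * levH D x v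
    simp only [levH]
    rw [csmul_eq c x]
    simp only [smul_add, map_add, ContinuousLinearMap.add_apply, I_smul_real, I_smul_I, map_smul,
      ContinuousLinearMap.smul_apply, smul_eq_mul, map_neg, ContinuousLinearMap.neg_apply]
    push_cast
    conv_rhs => rw [← Complex.re_add_im c]
    ring_nf
    rw [Complex.I_sq]; ring

lemma levH_conj {D : Cn n →L[ℝ] Cn n →L[ℝ] ℝ} (hD : ∀ x y, D x y = D y x) (u v : Cn n) :
    conj (levH D u v) = levH D v u := by
  simp only [levH, map_div₀, map_add, map_mul, conj_ofReal, conj_I, hD v, hD (I • v), map_ofNat]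
  push_cast; ring

lemma levH_re (D : Cn n →L[ℝ] Cn n →L[ℝ] ℝ) (u : Cn n) : (levH D u u).re = (D u u + D (I • u) (I • u)) / 4 := by
  simp [levH, Complex.div_re]

lemma levH_sum {D : Cn n →L[ℝ] Cn n →L[ℝ] ℝ} (hD : ∀ x y, D x y = D y x) (e : Fin n → Cn n) (b : Fin n → ℂ) :
    ∑ j, ∑ k, b j * conj (b k) * levH D (e j) (e k) = levH D (∑ j, b j • e j) (∑ j, b j • e j) := by
  have h1 : ∀ v, levH D (∑ j, b j • e j) v = ∑ j, b j * levH D (e j) v := fun v ↦ by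
    have := map_sum (levL D v) (fun j ↦ b j • e j) Finset.univ
    simp only [map_smul] at this
    exact this
  rw [h1]
  refine sum_congr rfl fun j _ ↦ ?_
  rw [← levH_conj hD, h1, map_sum, mul_sum]
  refine sum_congr rfl fun k _ ↦ ?_
  rw [map_mul, levH_conj hD]; ring

lemma levi_dop {s : Cn n → ℝ} (hs : ContDiff ℝ ∞ s) (w : Cn n) (e : Fin n → Cn n) (b : Fin n → ℂ) :
    (∑ j, ∑ k, b j * conj (b k) * conj (dop I (e j) (dop (-I) (e k) fun w ↦ (s w : ℂ)) w)).re
      = (levH (fderiv ℝ (fderiv ℝ s) w) (∑ j, b j • e j) (∑ j, b j • e j)).re := by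
  have h2 : ContDiff ℝ 2 s := hs.of_le ENat.LEInfty.out
  have hD : ∀ x y, fderiv ℝ (fderiv ℝ s) w x y = fderiv ℝ (fderiv ℝ s) w y x :=
    fun x y ↦ (h2.contDiffAt.isSymmSndFDerivAt (by simp)).eq x y
  rw [← levH_sum hD]
  congr 1
  refine sum_congr rfl fun j _ ↦ sum_congr rfl fun k _ ↦ ?_
  congr 1
  have h1 : Differentiable ℝ (fderiv ℝ s) := (h2.fderiv_right (m := 1) (by norm_num)).differentiable (by norm_num)
  have e1 : fderiv ℝ (fun w ↦ (s w : ℂ)) = fun w ↦ Complex.ofRealCLM.comp (fderiv ℝ s w) := by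
    ext1 w
    exact (Complex.ofRealCLM.hasFDerivAt.comp w (h2.differentiable (by norm_num) w).hasFDerivAt).fderiv
  have e2 : ∀ x y, fderiv ℝ (fderiv ℝ fun w ↦ (s w : ℂ)) w x y = (fderiv ℝ (fderiv ℝ s) w x y : ℂ) := by
    intro x y
    rw [e1]
    have := ((ContinuousLinearMap.compL ℝ (Cn n) ℝ ℂ ofRealCLM).hasFDerivAt.comp w (h1 w).hasFDerivAt).fderiv
    have h3 : fderiv ℝ (fun w ↦ Complex.ofRealCLM.comp (fderiv ℝ s w)) w = _ := this
    rw [h3]; simp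
  rw [dop_expand _ _ ((contDiff_ofReal' hs).of_le ENat.LEInfty.out)]
  simp only [e2, levH, map_div₀, map_add, map_mul, conj_ofReal, conj_I, map_neg, map_ofNat]
  push_cast; ring_nf; rw [Complex.I_sq]; ring

lemma taylor2 {E : Type*} [NormedAddCommGroup E] [NormedSpace ℝ E] {g : E → ℝ} (hg : ContDiff ℝ 2 g) (w : E)
    {ε : ℝ} (hε : 0 < ε) : ∃ δ > 0, ∀ h, ‖h‖ < δ →
      |g (w + h) - g w - fderiv ℝ g w h - fderiv ℝ (fderiv ℝ g) w h h / 2| ≤ ε * ‖h‖ ^ 2 := by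
  have hD : ∀ x y, fderiv ℝ (fderiv ℝ g) w x y = fderiv ℝ (fderiv ℝ g) w y x :=
    fun x y ↦ (hg.contDiffAt.isSymmSndFDerivAt (by simp)).eq x y
  set D := fderiv ℝ (fderiv ℝ g) w with hDd
  have h1 : HasFDerivAt (fderiv ℝ g) D w :=
    ((hg.fderiv_right (m := 1) (by norm_num)).differentiable (by norm_num) w).hasFDerivAt
  have h2 := (hasFDerivAt_iff_isLittleO_nhds_zero.1 h1).def hε
  obtain ⟨δ, hδ, hb⟩ := Metric.eventually_nhds_iff.1 h2
  refine ⟨δ, hδ, fun h hh ↦ ?_⟩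
  let G : E → ℝ := fun x ↦ g (w + x) - g w - fderiv ℝ g w x - D x x / 2
  have hG : ∀ x, HasFDerivAt G (fderiv ℝ g (w + x) - fderiv ℝ g w - D x) x := by
    intro x
    have a1 : HasFDerivAt (fun x ↦ g (w + x)) (fderiv ℝ g (w + x)) x := by
      have := (hg.differentiable (by norm_num) (w + x)).hasFDerivAt.comp x ((hasFDerivAt_id x).const_add w)
      simpa [Function.comp_def] using this
    have a2 := D.hasFDerivAt.clm_apply (hasFDerivAt_id x) (x := x)
    have := ((a1.sub_const (g w)).sub (fderiv ℝ g w).hasFDerivAt).sub (a2.mul_const (1/2 : ℝ))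
    refine HasFDerivAt.congr_fderiv (this.congr_of_eventuallyEq (f₁ := G) (Eventually.of_forall fun y ↦ ?_)) ?_
    · simp [G]; ring
    · ext y
      simp [hD y x]; ring
  have := (convex_ball (0 : E) δ |>.inter (convex_closedBall 0 ‖h‖)).norm_image_sub_le_of_norm_hasFDerivWithin_le (f := G)
    (f' := fun x ↦ fderiv ℝ g (w + x) - fderiv ℝ g w - D x) (C := ε * ‖h‖)
    (fun x _ ↦ (hG x).hasFDerivWithinAt) (fun x hx ↦ by
      have := hb (y := x) (by simpa using hx.1)
      exact this.trans (mul_le_mul_of_nonneg_left (by simpa using hx.2) hε.le)) (x := 0) (y := h)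
      ⟨by simpa using hδ, by simp⟩ ⟨by simpa using hh, by simp⟩
  simp only [G, add_zero, sub_self, map_zero, sub_zero, zero_div, norm_eq_abs] at this
  rw [pow_two, ← mul_assoc]
  exact this

lemma levi_nonneg {g : Cn n → ℝ} (hg : ContDiff ℝ 2 g) (w X : Cn n) {t0 : ℝ} (ht0 : 0 < t0)
    (hsub : ∀ t, 0 < t → t < t0 → g w ≤ (2 * Real.pi)⁻¹ * ∫ θ in (0:ℝ)..2 * Real.pi, g (w + (t * circleMap 0 1 θ) • X)) :
    0 ≤ fderiv ℝ (fderiv ℝ g) w X X + fderiv ℝ (fderiv ℝ g) w (I • X) (I • X) := by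
  set D := fderiv ℝ (fderiv ℝ g) w with hDd
  apply le_of_forall_pos_le_add
  intro ε hε
  obtain ⟨δ, hδ, ht⟩ := taylor2 hg w (ε := ε / (4 * (‖X‖ ^ 2 + 1))) (by positivity)
  simp only [← hDd] at ht
  set ε' := ε / (4 * (‖X‖ ^ 2 + 1)) with he
  have he' : ε' * ‖X‖ ^ 2 ≤ ε / 4 := by
    rw [he, div_mul_eq_mul_div, div_le_div_iff₀ (by positivity) (by norm_num)]
    nlinarith [sq_nonneg ‖X‖]
  obtain ⟨t, t1, t2, t3⟩ : ∃ t, 0 < t ∧ t < t0 ∧ t * (‖X‖ + 1) < δ :=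
    ⟨min t0 (δ / (‖X‖ + 1)) / 2, by positivity, by
      have := min_le_left t0 (δ / (‖X‖ + 1)); linarith, by
      have := min_le_right t0 (δ / (‖X‖ + 1))
      have h1 : min t0 (δ / (‖X‖ + 1)) / 2 < δ / (‖X‖ + 1) := by
        have : 0 < δ / (‖X‖ + 1) := by positivity
        linarith
      rwa [lt_div_iff₀ (by positivity)] at h1⟩
  have hs := hsub t t1 t2
  have hpi := Real.pi_pos
  have key : ∀ θ : ℝ, g (w + (t * circleMap 0 1 θ) • X) ≤ g w + t * (Real.cos θ * fderiv ℝ g w X + Real.sin θ * fderiv ℝ g w (I • X))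
      + t ^ 2 / 2 * (Real.cos θ ^ 2 * D X X + Real.sin θ ^ 2 * D (I • X) (I • X) + Real.sin θ * Real.cos θ * (D X (I • X) + D (I • X) X))
      + t ^ 2 * (ε / 4) := by
    intro θ
    have hn : ‖((t * circleMap 0 1 θ : ℂ)) • X‖ = t * ‖X‖ := by
      rw [norm_smul, norm_mul]; simp [abs_of_pos t1]
    have h1 := ht ((t * circleMap 0 1 θ : ℂ) • X) (by rw [hn]; nlinarith)
    rw [hn, mul_pow] at h1
    have h2 : ((t * circleMap 0 1 θ : ℂ)) • X = t • (Real.cos θ • X + Real.sin θ • (I • X)) := by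
      rw [csmul_eq, smul_add, smul_smul, smul_smul]
      simp [circleMap]
    have h3 := (abs_le.1 h1).2
    have h4 : ε' * (t ^ 2 * ‖X‖ ^ 2) ≤ t ^ 2 * (ε / 4) := by nlinarith [sq_nonneg t]
    have h5 : fderiv ℝ g w ((t * circleMap 0 1 θ : ℂ) • X) = t * (Real.cos θ * fderiv ℝ g w X + Real.sin θ * fderiv ℝ g w (I • X)) := by
      rw [h2]; simp; ring
    have h6 : D ((t * circleMap 0 1 θ : ℂ) • X) ((t * circleMap 0 1 θ : ℂ) • X) = t ^ 2 * (Real.cos θ ^ 2 * D X X + Real.sin θ ^ 2 * D (I • X) (I • X) + Real.sin θ * Real.cos θ * (D X (I • X) + D (I • X) X)) := by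
      rw [h2]; simp; ring
    rw [h5, h6] at h3
    linarith
  have hcm := continuous_circleMap 0 1
  have hgc := hg.continuous
  have hi := intervalIntegral.integral_mono_on (a := 0) (b := 2 * Real.pi) (by positivity) (μ := volume)
    (Continuous.intervalIntegrable (by fun_prop) _ _) (Continuous.intervalIntegrable (by fun_prop) _ _) (fun θ _ ↦ key θ)
  have hval : ∫ θ in (0:ℝ)..2 * Real.pi, (g w + t * (Real.cos θ * fderiv ℝ g w X + Real.sin θ * fderiv ℝ g w (I • X))
      + t ^ 2 / 2 * (Real.cos θ ^ 2 * D X X + Real.sin θ ^ 2 * D (I • X) (I • X) + Real.sin θ * Real.cos θ * (D X (I • X) + D (I • X) X))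
      + t ^ 2 * (ε / 4)) = 2 * Real.pi * g w + t ^ 2 / 2 * (Real.pi * D X X + Real.pi * D (I • X) (I • X)) + 2 * Real.pi * (t ^ 2 * (ε / 4)) := by
    rw [intervalIntegral.integral_add (Continuous.intervalIntegrable (by fun_prop) _ _) (Continuous.intervalIntegrable (by fun_prop) _ _),
      intervalIntegral.integral_add (Continuous.intervalIntegrable (by fun_prop) _ _) (Continuous.intervalIntegrable (by fun_prop) _ _),
      intervalIntegral.integral_add (Continuous.intervalIntegrable (by fun_prop) _ _) (Continuous.intervalIntegrable (by fun_prop) _ _),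
      intervalIntegral.integral_const_mul, intervalIntegral.integral_const_mul,
      intervalIntegral.integral_add (Continuous.intervalIntegrable (by fun_prop) _ _) (Continuous.intervalIntegrable (by fun_prop) _ _),
      intervalIntegral.integral_add (Continuous.intervalIntegrable (by fun_prop) _ _) (Continuous.intervalIntegrable (by fun_prop) _ _),
      intervalIntegral.integral_add (Continuous.intervalIntegrable (by fun_prop) _ _) (Continuous.intervalIntegrable (by fun_prop) _ _)]
    simp only [intervalIntegral.integral_mul_const, integral_cos, integral_sin, integral_cos_sq, integral_sin_sq,
      integral_sin_mul_cos₁, intervalIntegral.integral_const]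
    simp [Real.sin_two_pi, Real.cos_two_pi]; ring
  rw [hval] at hi
  have h7 := mul_le_mul_of_nonneg_left hs (by positivity : (0:ℝ) ≤ 2 * Real.pi)
  rw [← mul_assoc, mul_inv_cancel₀ (by positivity), one_mul] at h7
  have h8 : 0 ≤ (Real.pi * t ^ 2 / 2) * (D X X + D (I • X) (I • X) + ε) := by nlinarith
  have h9 := nonneg_of_mul_nonneg_right h8 (by positivity)
  linarith

end

section

lemma log_lip {ε0 : ℝ} (h0 : 0 < ε0) {a b : ℝ} (ha : ε0 ≤ a) (hb : ε0 ≤ b) :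
    Real.log a - Real.log b ≤ |a - b| / ε0 := by
  have hb0 : 0 < b := by linarith
  rw [← Real.log_div (by linarith) hb0.ne']
  refine (Real.log_le_sub_one_of_pos (div_pos (by linarith) hb0)).trans ?_
  rw [div_sub_one hb0.ne']
  refine (div_le_div_of_nonneg_right (le_abs_self _) hb0.le).trans ?_
  exact div_le_div_of_nonneg_left (abs_nonneg _) h0 hb

lemma fderiv_normsq (m : ℝ) (w x y : Cn n) :
    fderiv ℝ (fderiv ℝ fun z : Cn n ↦ m * ‖z‖ ^ 2) w x y = m * (2 * inner ℝ x y) := by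
  have e1 : (fderiv ℝ fun z : Cn n ↦ m * ‖z‖ ^ 2) = fun z ↦ (m • (2 : ℝ) • innerSL ℝ) z := by
    ext1 z
    have := ((hasStrictFDerivAt_norm_sq z).hasFDerivAt.const_mul m).fderiv
    rw [this, ← Nat.cast_smul_eq_nsmul ℝ 2]; rfl
  rw [e1, ContinuousLinearMap.fderiv]
  rfl

theorem psc_SU (e : Fin n → Cn n) (he : ∀ b : Fin n → ℂ, ‖∑ j, b j • e j‖ ^ 2 = ∑ j, ‖b j‖ ^ 2) {U K : Set (Cn n)}
    (hU : IsPseudoconvex U) (hn : Uᶜ.Nonempty) (hb : Bornology.IsBounded U)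
    (hK : IsCompact K) (hKU : K ⊆ U) : ∃ s c A m T, SU e s c A m T ∧ K ⊆ {w | s w < c} ∧ {w | s w < c} ⊆ U := by
  obtain ⟨hUo, -, hsm⟩ := hU
  set d : Cn n → ℝ := fun z ↦ infDist z Uᶜ with hd
  have dc : Continuous d := continuous_infDist_pt _
  have dU : ∀ z, 0 < d z → z ∈ U := by
    intro z hz
    by_contra h
    have : d z = 0 := infDist_zero_of_mem h
    linarith
  obtain ⟨d0, hd0, hdK⟩ : ∃ d0 > 0, ∀ z ∈ K, d0 ≤ d z := by
    rcases K.eq_empty_or_nonempty with rfl | hne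
    · exact ⟨1, one_pos, by simp⟩
    · obtain ⟨z, hz, hmin⟩ := hK.exists_isMinOn hne dc.continuousOn
      refine ⟨d z, ?_, hmin⟩
      exact (hUo.isClosed_compl.notMem_iff_infDist_pos hn).1 (by simpa using hKU hz)
  obtain ⟨ε0, he0, hed⟩ : ∃ ε0 > 0, ε0 = d0 / 16 := ⟨d0 / 16, by positivity, rfl⟩
  set ut : Cn n → ℝ := fun z ↦ -Real.log (max (d z) ε0) with hut
  have utc : Continuous ut := by
    refine (Continuous.log (dc.max continuous_const) fun z ↦ ?_).neg
    exact (lt_of_lt_of_le he0 (le_max_right _ _)).ne'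
  have utl : ∀ z y, |ut z - ut y| ≤ dist z y / ε0 := by
    have h1 : ∀ z y, |max (d z) ε0 - max (d y) ε0| ≤ dist z y := fun z y ↦
      (abs_max_sub_max_le_abs _ _ _).trans ((lipschitz_infDist_pt Uᶜ).dist_le_mul z y |>.trans (by simp))
    intro z y
    rw [abs_le]
    have h2 := log_lip he0 (le_max_right (d z) ε0) (le_max_right (d y) ε0)
    have h3 := log_lip he0 (le_max_right (d y) ε0) (le_max_right (d z) ε0)
    have h4 := div_le_div_of_nonneg_right (h1 z y) he0.le
    have h5 := div_le_div_of_nonneg_right (h1 y z) he0.le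
    rw [dist_comm y z] at h5
    simp only [hut]
    constructor <;> linarith
  obtain ⟨r, hr, hre⟩ : ∃ r > 0, r = ε0 / 4 := ⟨ε0 / 4, by positivity, rfl⟩
  set g := moll r ut with hg
  have gC : ContDiff ℝ ∞ g := moll_contDiff hr utc.locallyIntegrable
  have gi : ∀ w, Integrable fun y ↦ mol r y • ut (w - y) := fun w ↦
    Continuous.integrable_of_hasCompactSupport (by have := (mol_contDiff (n := n) r).continuous; fun_prop) (mol_compact hr).smul_right
  have gu : ∀ w, |g w - ut w| ≤ 1 / 4 := by
    intro w
    have h1 : g w - ut w = ∫ y, mol r y • (ut (w - y) - ut w) := by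
      simp_rw [smul_sub]
      rw [integral_sub (gi w) ((mol_integrable hr).smul_const _), integral_smul_const, mol_int hr, one_smul, hg, moll_swap]
    rw [h1, ← norm_eq_abs]
    refine (norm_integral_le_of_norm_le ((mol_integrable hr).mul_const (1/4)) (Eventually.of_forall fun y ↦ ?_)).trans ?_
    · rw [norm_smul, norm_of_nonneg (mol_nonneg hr _)]
      by_cases h : ‖y‖ ≤ r
      · refine mul_le_mul_of_nonneg_left ((utl _ _).trans ?_) (mol_nonneg hr _)
        rw [div_le_iff₀ he0]
        simp only [dist_self_sub_left]
        linarith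
      · simp [mol_zero hr (not_le.1 h).le]
    · rw [integral_mul_const, mol_int hr, one_mul]
  obtain ⟨R, hR0, hR⟩ := hb.subset_ball_lt 0 0
  obtain ⟨m, hm, hmR⟩ : ∃ m > 0, m * R ^ 2 ≤ 1 / 4 := ⟨1 / (4 * R ^ 2), by positivity, by field_simp; exact le_refl _⟩
  set s : Cn n → ℝ := fun z ↦ g z + m * ‖z‖ ^ 2 with hs
  have qC : ContDiff ℝ ∞ fun z : Cn n ↦ m * ‖z‖ ^ 2 := contDiff_const.mul (contDiff_norm_sq ℝ)
  have sC : ContDiff ℝ ∞ s := gC.add qC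
  set c := -Real.log d0 + 1 with hc
  have he2 : Real.exp (-(5/4)) > 1 / 4 := by
    rw [Real.exp_neg, gt_iff_lt, one_div, inv_lt_inv₀ (by norm_num) (exp_pos _)]
    have h1 := Real.exp_one_lt_d9
    have h2 : Real.exp (5/4) = Real.exp 1 * Real.exp (1/4) := by rw [← Real.exp_add]; norm_num
    have h3 : Real.exp (1/4) ≤ 1 / (1 - 1/4) := Real.exp_bound_div_one_sub_of_interval (by norm_num) (by norm_num)
    rw [h2]
    nlinarith [exp_pos 1, exp_pos (1/4)]
  have sd : ∀ w, s w < c → d0 / 4 < d w := by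
    intro w hw
    have h1 := (abs_le.1 (gu w)).1
    have h2 : 0 ≤ m * ‖w‖ ^ 2 := by positivity
    have h3 : -Real.log (max (d w) ε0) < -Real.log d0 + 5/4 := by
      have : s w = g w + m * ‖w‖ ^ 2 := rfl
      have : ut w = -Real.log (max (d w) ε0) := rfl
      linarith
    have h4 : Real.log (d0 / 4) < Real.log (max (d w) ε0) := by
      have h5 : Real.log (d0 / 4) < Real.log (d0 * Real.exp (-(5/4))) := Real.log_lt_log (by positivity) (by nlinarith)
      rw [Real.log_mul hd0.ne' (exp_pos _).ne', Real.log_exp] at h5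
      linarith
    have h6 := (Real.log_lt_log_iff (by positivity) (lt_of_lt_of_le he0 (le_max_right _ _))).1 h4
    rcases lt_max_iff.1 h6 with h | h
    · exact h
    · linarith
  have sU : {w | s w < c} ⊆ U := fun w hw ↦ dU w (by linarith [sd w hw])
  have hsub : ∀ w, s w < c → ∀ X t, 0 < t → t * (‖X‖ + 1) < r →
      g w ≤ (2 * Real.pi)⁻¹ * ∫ θ in (0:ℝ)..2 * Real.pi, g (w + (t * circleMap 0 1 θ) • X) := by
    intro w hw X t ht htX
    have dl : ∀ y h : Cn n, ‖y‖ ≤ r → ‖h‖ ≤ r → ε0 < d (w - y + h) := by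
      intro y h hy hh
      have h1 := (lipschitz_infDist_pt Uᶜ).dist_le_mul w (w - y + h)
      rw [dist_eq_norm w, show w - (w - y + h) = y - h by abel] at h1
      simp only [NNReal.coe_one, one_mul] at h1
      have h2 := norm_sub_le y h
      have h3 := (abs_le.1 (Real.dist_eq _ _ ▸ h1)).2
      have := sd w hw
      simp only [hd] at this ⊢
      linarith
    have nl : ∀ l : ℂ, ‖l‖ ≤ t → ‖l • X‖ ≤ r := by
      intro l hl
      rw [norm_smul]
      nlinarith [norm_nonneg X, norm_nonneg l]
    have hcm := continuous_circleMap 0 1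
    have ncm : ∀ θ, ‖(t * circleMap 0 1 θ : ℂ)‖ ≤ t := fun θ ↦ by simp [abs_of_pos ht]
    have h1 : ∀ y, ‖y‖ ≤ r → ut (w - y) ≤ (2 * Real.pi)⁻¹ * ∫ θ in (0:ℝ)..2 * Real.pi, ut (w + (t * circleMap 0 1 θ) • X - y) := by
      intro y hy
      have ute : ∀ h : Cn n, ‖h‖ ≤ r → ut (w - y + h) = -Real.log (infDist (w - y + h) Uᶜ) := by
        intro h hh
        simp only [hut]
        rw [max_eq_left (dl y h hy hh).le]
      have h2 := hsm (w - y) (dU _ (by have := dl y 0 hy (by simpa using hr.le); rw [add_zero] at this; linarith)) X t ht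
        (fun l hl ↦ dU _ (by have := dl y (l • X) hy (nl l hl); linarith))
      have h0 := ute 0 (by simpa using hr.le)
      rw [add_zero] at h0
      rw [← h0, one_div] at h2
      refine h2.trans (le_of_eq ?_)
      congr 1
      refine intervalIntegral.integral_congr fun θ _ ↦ ?_
      have e1 : (t * circleMap 0 1 θ : ℂ) = (t : ℂ) * Complex.exp (θ * I) := by simp [circleMap]
      rw [e1]
      have := ute (((t : ℂ) * Complex.exp (θ * I)) • X) (by rw [← e1]; exact nl _ (ncm θ))
      rw [← this]
      congr 1; abel
    have h2 := mol_swap (r := r) (g := ut) (φ := fun θ y ↦ w + (t * circleMap 0 1 θ) • X - y) hr (by fun_prop)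
    have h3 : ∀ θ, ∫ y, mol r y • ut (w + (t * circleMap 0 1 θ) • X - y) = g (w + (t * circleMap 0 1 θ) • X) := fun θ ↦ (moll_swap _ _ _).symm
    simp_rw [h3] at h2
    rw [h2, hg, moll_swap, ← integral_const_mul]
    refine integral_mono (gi w) ?_ fun y ↦ ?_
    · refine Continuous.integrable_of_hasCompactSupport ?_ ?_
      · have h4 : Continuous fun y : Cn n ↦ ∫ θ in (0:ℝ)..2 * Real.pi, ut (w + (t * circleMap 0 1 θ) • X - y) :=
          intervalIntegral.continuous_parametric_intervalIntegral_of_continuous' (f := fun y θ ↦ ut (w + (t * circleMap 0 1 θ) • X - y)) (by unfold Function.uncurry; fun_prop) _ _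
        have := (mol_contDiff (n := n) r).continuous
        fun_prop
      · exact ((mol_compact hr).smul_right).mul_left
    · by_cases h : ‖y‖ ≤ r
      · have := mul_le_mul_of_nonneg_left (h1 y h) (mol_nonneg hr y)
        simp only [smul_eq_mul]
        linarith
      · simp [mol_zero hr (not_le.1 h).le]
  obtain ⟨B, hB⟩ := (isCompact_closedBall (0 : Cn n) R).exists_bound_of_continuousOn (f := fun w ↦ c - s w)
    (by have := sC.continuous; fun_prop)
  refine ⟨s, c, max (max (4 * B) m⁻¹) 1, m, B, ⟨sC, fun w hw ↦ ?_, ?_, ?_, ?_, ?_, hb.subset sU⟩, ?_, sU⟩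
  · exact (le_abs_self _).trans (hB w (ball_subset_closedBall (hR (sU hw))))
  · exact (le_max_left _ _).trans (le_max_left _ _)
  · have : m⁻¹ ≤ max (max (4 * B) m⁻¹) 1 := (le_max_right _ _).trans (le_max_left _ _)
    calc 1 = m⁻¹ * m := (inv_mul_cancel₀ hm.ne').symm
      _ ≤ _ := mul_le_mul_of_nonneg_right this hm.le
  · exact lt_of_lt_of_le one_pos (le_max_right _ _)
  · intro w hw b
    rw [levi_dop sC, levH_re, ← he b]
    set X := ∑ j, b j • e j with hX
    have g2 : ContDiff ℝ 2 g := gC.of_le ENat.LEInfty.out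
    have h1 := levi_nonneg g2 w X (t0 := r / (‖X‖ + 1)) (by positivity)
      (fun t ht htt ↦ hsub w hw X t ht (by rwa [lt_div_iff₀ (by positivity)] at htt))
    have dg : Differentiable ℝ (fderiv ℝ g) := (g2.fderiv_right (m := 1) (by norm_num)).differentiable (by norm_num)
    have q2 : ContDiff ℝ 2 fun z : Cn n ↦ m * ‖z‖ ^ 2 := qC.of_le ENat.LEInfty.out
    have dq : Differentiable ℝ (fderiv ℝ fun z : Cn n ↦ m * ‖z‖ ^ 2) := (q2.fderiv_right (m := 1) (by norm_num)).differentiable (by norm_num)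
    have e1 : fderiv ℝ s = fun z ↦ fderiv ℝ g z + fderiv ℝ (fun z : Cn n ↦ m * ‖z‖ ^ 2) z := by
      ext1 z
      exact fderiv_fun_add (gC.differentiable (by simp) z) (qC.differentiable (by simp) z)
    rw [e1, fderiv_fun_add (dg w) (dq w)]
    simp only [ContinuousLinearMap.add_apply, fderiv_normsq, real_inner_self_eq_norm_sq, norm_smul, Complex.norm_I, one_mul]
    linarith
  · intro w hw
    show g w + m * ‖w‖ ^ 2 < c
    have h1 := (abs_le.1 (gu w)).2
    have h2 : ut w ≤ -Real.log d0 := by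
      simp only [hut, neg_le_neg_iff]
      exact Real.log_le_log hd0 ((hdK w hw).trans (le_max_left _ _))
    have h3 : ‖w‖ ^ 2 ≤ R ^ 2 := by
      have := hR (hKU hw)
      rw [mem_ball_zero_iff] at this
      exact pow_le_pow_left₀ (norm_nonneg _) this.le 2
    have h4 := mul_le_mul_of_nonneg_left h3 hm.le
    linarith

end

section
variable {e : Fin n → Cn n} {s : Cn n → ℝ} {c A m T : ℝ}

theorem dbar_moll (S : SU e s c A m T) {K : Set (Cn n)} (hK : IsCompact K) (hKs : K ⊆ {w | s w < c}) :
    ∃ a > 0, ∃ r0 > 0, (∀ w ∈ cthickening (2 * r0) K, 2 * a ≤ c - s w) ∧ ∀ r, 0 < r → r ≤ r0 → ∃ C : ℝ, 0 ≤ C ∧ 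
      ∀ α : Fin n → Cn n → ℂ, (∀ j, Measurable (α j)) → ∀ B : ℝ, (∀ j w, s w < c → ‖α j w‖ ≤ B) → 0 ≤ B →
      (∀ f, TF s c f → ∀ j k, ∫ w, (α j w * dop I (e k) f w - α k w * dop I (e j) f w) = 0) →
      ∃ V : Cn n → ℂ, ContDiff ℝ ∞ V ∧ (∀ w, ‖V w‖ ≤ C * B) ∧
        ∀ w ∈ cthickening r0 K, ∀ j, dop I (e j) V w = moll r (α j) w := by
  have hs := S.hs.continuous
  obtain ⟨r1, hr1, hr1K⟩ := hK.exists_cthickening_subset_open (isOpen_lt hs continuous_const) hKs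
  have cK := hK.cthickening (r := r1)
  obtain ⟨a, ha, haK⟩ : ∃ a > 0, ∀ w ∈ cthickening r1 K, 2 * a ≤ c - s w := by
    rcases (cthickening r1 K).eq_empty_or_nonempty with h | hne
    · exact ⟨1, one_pos, by simp [h]⟩
    · obtain ⟨z, hz, hmin⟩ := cK.exists_isMinOn hne (f := fun w ↦ c - s w) (by fun_prop)
      have : s z < c := hr1K hz
      refine ⟨(c - s z) / 2, by linarith, fun w hw ↦ ?_⟩
      have : c - s z ≤ c - s w := hmin hw
      linarith
  refine ⟨a, ha, r1 / 2, by positivity, by rwa [show 2 * (r1 / 2) = r1 by ring], fun r hr hrr ↦ ?_⟩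
  obtain ⟨k1, hk1⟩ := moll_bound2 (n := n) hr
  have hvol : volume {w | s w < c} < ⊤ := S.hb.measure_lt_top
  set Q : ℝ≥0∞ := k1 * (ENNReal.ofReal (T ^ 4 * Real.exp (A / a)) * (16 * (n * (ENNReal.ofReal (2 / A ^ 2) * volume {w | s w < c})))) with hQ
  have hQt : Q < ⊤ := by
    rw [hQ]
    finiteness
  refine ⟨Real.sqrt Q.toReal, Real.sqrt_nonneg _, fun α αm B hB hB0 αc ↦ ?_⟩
  have hi : ∀ j, ∫⁻ w, ‖α j w‖ₑ ^ 2 * w2 s c A w ≤ ENNReal.ofReal (B ^ 2) * (ENNReal.ofReal (2 / A ^ 2) * volume {w | s w < c}) := by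
    intro j
    calc _ ≤ ∫⁻ w, indicator {w | s w < c} (fun _ ↦ ENNReal.ofReal (B ^ 2) * ENNReal.ofReal (2 / A ^ 2)) w := by
          refine lintegral_mono fun w ↦ ?_
          by_cases hw : s w < c
          · rw [indicator_of_mem (show w ∈ {w | s w < c} from hw)]
            refine mul_le_mul' ?_ (w2_le S.hA w)
            rw [esq_eq]
            exact ENNReal.ofReal_le_ofReal (pow_le_pow_left₀ (norm_nonneg _) (hB j w hw) 2)
          · simp [w2_zero (not_lt.1 hw)]
      _ = _ := by
          rw [lintegral_indicator (isOpen_lt hs continuous_const).measurableSet, setLIntegral_const, mul_assoc]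
  obtain ⟨u, um, ui, uw⟩ := dbar_weak S αm (fun j ↦ (hi j).trans_lt (by finiteness)) αc
  set v : Cn n → ℂ := fun w ↦ ctf s c a w * (u w * ((c - s w) ^ 2 : ℝ)) with hv
  have vm : Measurable v := by
    have h1 := (ctf_contDiff (c := c) (a := a) S.hs).continuous.measurable
    have h2 := hs.measurable
    have h3 : Measurable fun w ↦ (((c - s w) ^ 2 : ℝ) : ℂ) := Complex.measurable_ofReal.comp (by fun_prop)
    exact h1.mul (um.mul h3)
  have vb : ∫⁻ w, ‖v w‖ₑ ^ 2 ≤ ENNReal.ofReal (T ^ 4 * Real.exp (A / a)) * ∫⁻ w, ‖u w‖ₑ ^ 2 * w1 s c A w := by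
    rw [← lintegral_const_mul' _ _ ENNReal.ofReal_ne_top]
    refine lintegral_mono fun w ↦ ?_
    by_cases hw : c - s w < a
    · simp [hv, ctf_zero ha hw.le]
    push Not at hw
    have ht : 0 < c - s w := by linarith
    have hsc : s w < c := by linarith
    have hTw := S.hT w hsc
    rw [mul_comm (‖u w‖ₑ ^ 2), ← mul_assoc, w1, esq_eq, esq_eq, ← ENNReal.ofReal_mul (by positivity), ← ENNReal.ofReal_mul (mul_nonneg (by positivity) (om_nonneg w))]
    apply ENNReal.ofReal_le_ofReal
    have e1 : ‖v w‖ ≤ ‖u w‖ * (c - s w) ^ 2 := by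
      rw [hv, norm_mul, norm_mul, norm_real, norm_of_nonneg (by positivity)]
      exact (mul_le_of_le_one_left (by positivity) (ctf_norm w))
    have e2 : 1 ≤ Real.exp (A / a) * om s c A w := by
      rw [om, if_pos hsc, ← Real.exp_add, ← Real.exp_zero]
      apply Real.exp_le_exp.2
      have := div_le_div_of_nonneg_left S.hA.le ha hw
      linarith
    have e3 : (c - s w) ^ 4 ≤ T ^ 4 := pow_le_pow_left₀ ht.le hTw 4
    calc ‖v w‖ ^ 2 ≤ (‖u w‖ * (c - s w) ^ 2) ^ 2 := pow_le_pow_left₀ (norm_nonneg _) e1 2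
      _ = (c - s w) ^ 4 * 1 * ‖u w‖ ^ 2 := by ring
      _ ≤ T ^ 4 * (Real.exp (A / a) * om s c A w) * ‖u w‖ ^ 2 := by
          refine mul_le_mul_of_nonneg_right (mul_le_mul e3 e2 zero_le_one (by positivity)) (by positivity)
      _ = _ := by ring
  have hmm : ∀ j, Measurable fun w ↦ ‖α j w‖ₑ ^ 2 * w2 s c A w := fun j ↦ ((αm j).enorm.pow_const 2).mul (w2_meas hs)
  have vb2 : k1 * ∫⁻ w, ‖v w‖ₑ ^ 2 ≤ ENNReal.ofReal (B ^ 2) * Q := by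
    have h1 : ∫⁻ w, (∑ j, ‖α j w‖ₑ ^ 2) * w2 s c A w ≤ n * (ENNReal.ofReal (B ^ 2) * (ENNReal.ofReal (2 / A ^ 2) * volume {w | s w < c})) := by
      simp_rw [sum_mul]
      rw [lintegral_finsetSum _ fun j _ ↦ hmm j]
      refine (sum_le_sum fun j _ ↦ hi j).trans ?_
      simp
    refine (mul_le_mul_right (vb.trans (mul_le_mul_right (ui.trans (mul_le_mul_right h1 _)) _)) _).trans (le_of_eq ?_)
    rw [hQ]; ring
  have vL : MemLp v 2 := by
    refine ⟨vm.aestronglyMeasurable, ?_⟩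
    rw [eLpNorm_lt_top_iff_lintegral_rpow_enorm_lt_top (by norm_num) (by norm_num)]
    simp only [ENNReal.toReal_ofNat, ENNReal.rpow_ofNat]
    refine vb.trans_lt (ENNReal.mul_lt_top (by finiteness) (ui.trans_lt ?_))
    refine ENNReal.mul_lt_top (by finiteness) ?_
    simp_rw [sum_mul]
    rw [lintegral_finsetSum _ fun j _ ↦ hmm j]
    exact ENNReal.sum_lt_top.2 fun j _ ↦ (hi j).trans_lt (by finiteness)
  have vl : LocallyIntegrable v := vL.locallyIntegrable (by norm_num)
  have mC := moll_contDiff hr vl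
  refine ⟨fun w ↦ - moll r v w, mC.neg, fun w ↦ ?_, fun w hw j ↦ ?_⟩
  · rw [norm_neg]
    have h1 := (hk1 v vm w).trans vb2
    rw [esq_eq, ← ENNReal.ofReal_toReal hQt.ne, ← ENNReal.ofReal_mul (by positivity), ENNReal.ofReal_le_ofReal_iff (by positivity)] at h1
    have h2 := Real.sqrt_le_sqrt h1
    rw [Real.sqrt_sq (norm_nonneg _), Real.sqrt_mul (by positivity), Real.sqrt_sq hB0] at h2
    linarith
  · have hball : ∀ y ∈ closedBall w r, 2 * a ≤ c - s y := by
      intro y hy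
      apply haK
      refine cthickening_cthickening_subset (show (0:ℝ) ≤ r1 / 2 by positivity) (show (0:ℝ) ≤ r1 / 2 by positivity) K |>.trans (by rw [add_halves]) ?_
      exact (closedBall_subset_cthickening hw (r1 / 2)) (closedBall_subset_closedBall hrr hy)
    have ht : TF s c (mtest r w) := ⟨mtest_contDiff r w, mtest_compact hr w, (mtest_tsupport hr w).trans fun y hy ↦ by
      have := hball y hy
      show s y < c
      linarith⟩
    have h1 : dop I (e j) (fun w ↦ - moll r v w) w = - dop I (e j) (moll r v) w := by
      unfold dop
      rw [fderiv_fun_neg]; simp; ring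
    rw [h1, dop_moll hr vl, neg_neg, moll_eq_mtest]
    have h2 := uw _ ht j
    rw [integral_congr_ae (g := fun y ↦ α j y * mtest r w y) (Eventually.of_forall fun y ↦ mul_comm _ _), h2]
    refine integral_congr_ae (Eventually.of_forall fun y ↦ ?_)
    by_cases hy : y ∈ closedBall w r
    · simp only [hv]
      rw [ctf_one ha (hball y hy)]; ring
    · have : dop I (e j) (mtest r w) y = 0 := by
        by_contra h0
        exact hy (mtest_tsupport hr w (dop_support h0))
      simp [this]

end

section
variable {e : Fin n → Cn n} {s : Cn n → ℝ} {c A m T : ℝ}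

def cut (p : Cn n) (a b : ℝ) (w : Cn n) : ℂ := ((smoothTransition ((b ^ 2 - ‖w - p‖ ^ 2) / (b ^ 2 - a ^ 2)) : ℝ) : ℂ)

lemma cut_contDiff (p : Cn n) (a b : ℝ) : ContDiff ℝ ∞ (cut p a b) := by
  refine contDiff_ofReal' (Real.smoothTransition.contDiff.comp ?_)
  exact (contDiff_const.sub ((contDiff_id.sub contDiff_const).norm_sq ℝ)).div_const _

lemma cut_one {p : Cn n} {a b : ℝ} (ha : 0 ≤ a) (hab : a < b) {w : Cn n} (hw : ‖w - p‖ ≤ a) : cut p a b w = 1 := by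
  rw [cut, Real.smoothTransition.one_of_one_le, Complex.ofReal_one]
  rw [one_le_div (by nlinarith)]
  nlinarith [norm_nonneg (w - p)]

lemma cut_zero {p : Cn n} {a b : ℝ} (ha : 0 ≤ a) (hab : a < b) {w : Cn n} (hw : b ≤ ‖w - p‖) : cut p a b w = 0 := by
  rw [cut, Real.smoothTransition.zero_of_nonpos, Complex.ofReal_zero]
  apply div_nonpos_of_nonpos_of_nonneg <;> nlinarith [norm_nonneg (w - p)]

lemma cut_norm {p : Cn n} {a b : ℝ} (w : Cn n) : ‖cut p a b w‖ ≤ 1 := by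
  rw [cut, norm_real, norm_of_nonneg (Real.smoothTransition.nonneg _)]
  exact Real.smoothTransition.le_one _

lemma cut_norm' {p : Cn n} {a b : ℝ} (w : Cn n) : ‖1 - cut p a b w‖ ≤ 1 := by
  rw [cut, ← Complex.ofReal_one, ← Complex.ofReal_sub, norm_real, norm_of_nonneg (sub_nonneg.2 (Real.smoothTransition.le_one _))]
  linarith [Real.smoothTransition.nonneg ((b ^ 2 - ‖w - p‖ ^ 2) / (b ^ 2 - a ^ 2))]

lemma dop_loc_const {d : ℂ} {v : Cn n} {f : Cn n → ℂ} {w : Cn n} (k : ℂ) (h : f =ᶠ[nhds w] fun _ ↦ k) : dop d v f w = 0 := by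
  rw [dop_congr h]; simp [dop]

def shl (p : Cn n) (t : ℝ) (w : Cn n) : ℂ := cut p (42 * t) (44 * t) w * (1 - cut p (16 * t) (20 * t) w)

lemma shl_one {p : Cn n} {t : ℝ} (ht : 0 < t) {w : Cn n} (h1 : 20 * t ≤ ‖w - p‖) (h2 : ‖w - p‖ ≤ 42 * t) : shl p t w = 1 := by
  rw [shl, cut_one (by positivity) (by linarith) h2, cut_zero (by positivity) (by linarith) h1]; simp

lemma shl_zero {p : Cn n} {t : ℝ} (ht : 0 < t) {w : Cn n} (h : ‖w - p‖ ≤ 16 * t ∨ 44 * t ≤ ‖w - p‖) : shl p t w = 0 := by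
  rcases h with h | h
  · rw [shl, cut_one (a := 16 * t) (by positivity) (by linarith) h]; simp
  · rw [shl, cut_zero (b := 44 * t) (by positivity) (by linarith) h]; simp

lemma shl_norm {p : Cn n} {t : ℝ} (w : Cn n) : ‖shl p t w‖ ≤ 1 := by
  rw [shl, norm_mul]
  exact mul_le_one₀ (cut_norm w) (norm_nonneg _) (cut_norm' w)

lemma cont_nsub (p : Cn n) : Continuous fun w : Cn n ↦ ‖w - p‖ := (continuous_id.sub continuous_const).norm

lemma shl_smooth {p : Cn n} {t : ℝ} (ht : 0 < t) {P : Cn n → ℂ} (hP : ContDiff ℝ ∞ P)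
    (h0 : ∀ w, s w < c → 15 * t ≤ ‖w - p‖ → ‖w - p‖ ≤ 45 * t → P w ≠ 0) (w : Cn n) (hw : s w < c) :
    ContDiffAt ℝ ∞ (fun w ↦ shl p t w * (P w)⁻¹) w := by
  have hc : ContDiff ℝ ∞ (shl p t) := (cut_contDiff _ _ _).mul (contDiff_const.sub (cut_contDiff _ _ _))
  have cn := cont_nsub p
  rcases lt_or_ge ‖w - p‖ (15 * t) with h1 | h1
  · refine (contDiffAt_const (c := (0:ℂ))).congr_of_eventuallyEq ?_
    filter_upwards [(isOpen_lt cn continuous_const).mem_nhds (show ‖w - p‖ < 16 * t by linarith)] with y hy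
    rw [shl_zero ht (Or.inl (le_of_lt hy)), zero_mul]
  rcases lt_or_ge (45 * t) ‖w - p‖ with h2 | h2
  · refine (contDiffAt_const (c := (0:ℂ))).congr_of_eventuallyEq ?_
    filter_upwards [(isOpen_lt continuous_const cn).mem_nhds (show 44 * t < ‖w - p‖ by linarith)] with y hy
    rw [shl_zero ht (Or.inr (le_of_lt hy)), zero_mul]
  exact hc.contDiffAt.mul (hP.contDiffAt.inv (h0 w hw h1 h2))

def afm (p : Cn n) (t : ℝ) (P : Cn n → ℂ) (v w : Cn n) : ℂ := dop I v (cut p (30 * t) (40 * t)) w * (P w)⁻¹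

lemma dcut_zero {p : Cn n} {t : ℝ} (ht : 0 < t) (v : Cn n) {w : Cn n} (h : ‖w - p‖ < 30 * t ∨ 40 * t < ‖w - p‖) :
    dop I v (cut p (30 * t) (40 * t)) w = 0 := by
  have cn := cont_nsub p
  rcases h with h | h
  · refine dop_loc_const 1 ?_
    filter_upwards [(isOpen_lt cn continuous_const).mem_nhds h] with y hy
    exact cut_one (by positivity) (by linarith) (le_of_lt hy)
  · refine dop_loc_const 0 ?_
    filter_upwards [(isOpen_lt continuous_const cn).mem_nhds h] with y hy
    exact cut_zero (by positivity) (by linarith) (le_of_lt hy)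

lemma dop_shl {p : Cn n} {t : ℝ} (ht : 0 < t) {P : Cn n → ℂ} (hPd : Differentiable ℂ P)
    {w : Cn n} (h1 : 20 * t < ‖w - p‖) (h2 : ‖w - p‖ < 42 * t) (h : P w ≠ 0) {f : Cn n → ℂ} (hf : DifferentiableAt ℝ f w) (v : Cn n) :
    dop I v (fun y ↦ f y * (shl p t y * (P y)⁻¹)) w = dop I v f w * (P w)⁻¹ := by
  have cn := cont_nsub p
  have hi : DifferentiableAt ℂ (fun y ↦ (P y)⁻¹) w := (hPd w).inv h
  rw [dop_congr (g := fun y ↦ f y * (P y)⁻¹), dop_mul hf (hi.restrictScalars ℝ), dop_complex hi, mul_zero, add_zero]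
  filter_upwards [(isOpen_lt continuous_const cn).mem_nhds h1, (isOpen_lt cn continuous_const).mem_nhds h2] with y h1 h2
  rw [shl_one ht (le_of_lt h1) (le_of_lt h2), one_mul]

lemma afm_closed {p : Cn n} {t : ℝ} (ht : 0 < t) {P : Cn n → ℂ} (hP : ContDiff ℝ ∞ P) (hPd : Differentiable ℂ P)
    (h0 : ∀ w, s w < c → 15 * t ≤ ‖w - p‖ → ‖w - p‖ ≤ 45 * t → P w ≠ 0) {f : Cn n → ℂ} (hf : TF s c f) (u v : Cn n) :
    ∫ w, (afm p t P u w * dop I v f w - afm p t P v w * dop I u f w) = 0 := by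
  have hg := hf.mulD (shl_smooth ht hP h0)
  set g : Cn n → ℂ := fun w ↦ f w * (shl p t w * (P w)⁻¹) with hgd
  set χ := cut p (30 * t) (40 * t) with hχ
  have hχc : ContDiff ℝ ∞ χ := cut_contDiff _ _ _
  have key : ∀ u v w, afm p t P u w * dop I v f w = dop I v g w * dop I u χ w := by
    intro u v w
    by_cases h : ‖w - p‖ < 30 * t ∨ 40 * t < ‖w - p‖
    · rw [afm, dcut_zero ht u h, zero_mul, zero_mul, mul_zero]
    push Not at h
    by_cases hw : s w < c
    · rw [afm, dop_shl ht hPd (by linarith) (by linarith) (h0 w hw (by linarith) (by linarith)) (hf.cd.differentiable (by simp) w)]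
      ring
    · rw [(hf.dop I v).out hw, (hg.dop I v).out hw]; ring
  have ib : ∀ u v, ∫ w, dop I v g w * dop I u χ w = - ∫ w, g w * dop I v (dop I u χ) w := by
    intro u v
    rw [dop_ibp volume hg.cd (dop_contDiff hχc) hg.cs, neg_neg]
  have i1 : ∀ u v, Integrable fun w ↦ dop I v g w * dop I u χ w := fun u v ↦
    integrable_cs volume ((dop_contDiff hg.cd).continuous.mul (dop_contDiff hχc).continuous) (dop_compact hg.cs).mul_right
  simp_rw [key]
  rw [integral_sub (i1 _ _) (i1 _ _), ib, ib, sub_eq_zero]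
  congr 1
  refine integral_congr_ae (.of_forall fun w ↦ ?_)
  simp only
  rw [dop_comm (hχc.of_le ENat.LEInfty.out)]

lemma dop_basis {f : Cn n → ℂ} {w : Cn n} (hf : DifferentiableAt ℝ f w)
    (h : ∀ j, dop I (EuclideanSpace.single j (1:ℂ)) f w = 0) : DifferentiableAt ℂ f w := by
  refine differentiableAt_of_dop hf fun v ↦ ?_
  have hsm : ∀ (b : ℂ) (u : Cn n), dop I u f w = 0 → dop I (b • u) f w = 0 := by
    intro b u hu
    have e1 : b • u = b.re • u + b.im • (I • u) := csmul_eq b u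
    have e2 : I • (b • u) = b.re • (I • u) - b.im • u := by
      rw [e1, smul_add, I_smul_real, I_smul_real, I_smul_I, smul_neg, sub_eq_add_neg]
    have : dop I (b • u) f w = (b.re - I * b.im) * dop I u f w := by
      have hm : ∀ (x : ℝ) y, fderiv ℝ f w (x • y) = x * fderiv ℝ f w y := fun x y ↦ by simp
      rw [dop, e2, e1, dop, map_add, map_sub, hm, hm, hm, hm]
      linear_combination (b.im * fderiv ℝ f w (I • u) / 2) * Complex.I_sq
    rw [this, hu, mul_zero]
  have hv : v = ∑ j, v j • EuclideanSpace.single j (1:ℂ) := by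
    ext i; simp [Finset.sum_apply, Pi.single_apply]
  rw [hv]
  have hadd : ∀ t : Finset (Fin n), dop I (∑ j ∈ t, v j • EuclideanSpace.single j (1:ℂ)) f w = 0 := by
    intro t
    induction t using Finset.cons_induction with
    | empty => simp [dop]
    | cons a t ha ih =>
      rw [Finset.sum_cons]
      have h1 := hsm (v a) _ (h a)
      rw [dop] at h1 ih ⊢
      rw [smul_add, map_add, map_add]
      linear_combination h1 + ih
  exact hadd _

end

section

theorem fz (hn : 0 < n) {Ω : Set (Cn n)} (hb : Bornology.IsBounded Ω) (hS : HasSteinBasis Ω) {p : Cn n} (hp : p ∈ closure Ω)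
    {t L c' : ℝ} (ht : 0 < t) (hL : 0 ≤ L) (hc' : 0 < c') : ∃ C r0 : ℝ, 0 < C ∧ 0 < r0 ∧ ∀ P : Cn n → ℂ, ContDiff ℝ ∞ P → Differentiable ℂ P →
      (∀ x ∈ ball p (60 * t), ∀ y ∈ ball p (60 * t), ‖P x - P y‖ ≤ L * ‖x - y‖) →
      (∀ w ∈ closure Ω, 10 * t ≤ ‖w - p‖ → ‖w - p‖ ≤ 50 * t → c' ≤ ‖P w‖) →
      (∀ w ∈ Ω, ‖w - p‖ < 50 * t → P w ≠ 0) →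
      ∃ F V : Cn n → ℂ, DifferentiableOn ℂ F Ω ∧ (∀ w ∈ Ω, ‖w - p‖ < 20 * t → F w = (P w)⁻¹ - V w) ∧
        (∀ w ∈ Ω, 20 * t ≤ ‖w - p‖ → ‖F w‖ ≤ C) ∧ (∀ w, ‖V w‖ ≤ C) ∧ DifferentiableOn ℂ V (ball p r0) := by
  set η := min t (c' / (2 * (L + 1))) with hη
  have η0 : 0 < η := lt_min ht (by positivity)
  have ηt : η ≤ t := min_le_left _ _
  have ηL : L * η ≤ c' / 2 := by
    have : η * (L + 1) ≤ c' / 2 := by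
      calc η * (L + 1) ≤ c' / (2 * (L + 1)) * (L + 1) := mul_le_mul_of_nonneg_right (min_le_right _ _) (by positivity)
        _ = c' / 2 := by field_simp
    nlinarith
  obtain ⟨U, hU, hKU, hUW⟩ := hS (thickening η Ω) isOpen_thickening (closure_subset_thickening η0 Ω)
  have Ub : Bornology.IsBounded U := hb.thickening.subset hUW
  have : Nonempty (Fin n) := ⟨⟨0, hn⟩⟩
  have Uc : Uᶜ.Nonempty := by
    rw [nonempty_compl]
    rintro rfl
    exact NormedSpace.unbounded_univ ℂ (Cn n) Ub
  set e : Fin n → Cn n := fun j ↦ EuclideanSpace.single j (1:ℂ) with he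
  have he1 : ∀ b : Fin n → ℂ, ‖∑ j, b j • e j‖ ^ 2 = ∑ j, ‖b j‖ ^ 2 := by
    intro b
    have : ∑ j, b j • e j = WithLp.toLp 2 b := by
      ext i; simp [he, Pi.single_apply]
    rw [this, EuclideanSpace.norm_sq_eq]
  have cK : IsCompact (closure Ω) := hb.isCompact_closure
  obtain ⟨s, c, A, m, T, S, hKs, hsU⟩ := psc_SU e he1 hU Uc Ub cK hKU
  have hDW : ∀ w, s w < c → ∃ x ∈ Ω, ‖w - x‖ < η := fun w hw ↦ by
    obtain ⟨x, hx, h⟩ := mem_thickening_iff.1 (hUW (hsU hw))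
    exact ⟨x, hx, by rwa [← dist_eq_norm]⟩
  obtain ⟨a, ha, r1, hr1, hcs, H⟩ := dbar_moll S cK hKs
  set r := min r1 t / 2 with hr
  have r0 : 0 < r := by rw [hr]; positivity
  have rr1 : r ≤ r1 / 2 := by rw [hr]; linarith [min_le_left r1 t]
  have rt : r ≤ t / 2 := by rw [hr]; linarith [min_le_right r1 t]
  obtain ⟨C, hC, H⟩ := H r r0 (by linarith)
  set χ := cut p (30 * t) (40 * t) with hχ
  have hχc : ContDiff ℝ ∞ χ := cut_contDiff _ _ _
  have hχs : HasCompactSupport χ := by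
    refine HasCompactSupport.intro (isCompact_closedBall p (40 * t)) fun w hw ↦ ?_
    rw [mem_closedBall, dist_eq_norm, not_le] at hw
    exact cut_zero (by positivity) (by linarith) hw.le
  obtain ⟨B0, hB0, hB⟩ : ∃ B0 : ℝ, 0 ≤ B0 ∧ ∀ j w, ‖dop I (e j) χ w‖ ≤ B0 := by
    have h1 : ∀ j, ∃ b : ℝ, ∀ w, ‖dop I (e j) χ w‖ ≤ b := fun j ↦
      (dop_contDiff hχc).continuous.bounded_above_of_compact_support (dop_compact hχs)
    choose b hb using h1
    refine ⟨∑ j, |b j|, by positivity, fun j w ↦ (hb j w).trans ((le_abs_self _).trans ?_)⟩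
    exact Finset.single_le_sum (f := fun j ↦ |b j|) (fun _ _ ↦ abs_nonneg _) (Finset.mem_univ j)
  set B := B0 * (2 / c') with hBd
  have cn := cont_nsub p
  refine ⟨2 / c' + C * B + 1, min r1 t, by positivity, lt_min hr1 ht, fun P hP hPd hlip hsh hnz ↦ ?_⟩
  have hPD : ∀ w, s w < c → 15 * t ≤ ‖w - p‖ → ‖w - p‖ ≤ 45 * t → c' / 2 ≤ ‖P w‖ := by
    intro w hw h1 h2
    obtain ⟨x, hx, hwx⟩ := hDW w hw
    have n1 : ‖w - p‖ ≤ ‖w - x‖ + ‖x - p‖ := norm_sub_le_norm_sub_add_norm_sub _ _ _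
    have n2 : ‖x - p‖ ≤ ‖x - w‖ + ‖w - p‖ := norm_sub_le_norm_sub_add_norm_sub _ _ _
    rw [norm_sub_rev x w] at n2
    have h3 := hsh x (subset_closure hx) (by linarith) (by linarith)
    have h4 := hlip x (by rw [mem_ball, dist_eq_norm]; linarith) w (by rw [mem_ball, dist_eq_norm]; linarith)
    rw [norm_sub_rev x w] at h4
    have h5 := norm_sub_norm_le (P x) (P w)
    have h6 : L * ‖w - x‖ ≤ L * η := mul_le_mul_of_nonneg_left hwx.le hL
    linarith
  have hPi : ∀ w, s w < c → 15 * t ≤ ‖w - p‖ → ‖w - p‖ ≤ 45 * t → ‖(P w)⁻¹‖ ≤ 2 / c' := fun w hw h1 h2 ↦ by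
    rw [norm_inv, ← inv_div]
    exact inv_anti₀ (by positivity) (hPD w hw h1 h2)
  have h0 : ∀ w, s w < c → 15 * t ≤ ‖w - p‖ → ‖w - p‖ ≤ 45 * t → P w ≠ 0 := fun w hw h1 h2 h ↦ by
    have := hPD w hw h1 h2
    rw [h, norm_zero] at this
    linarith
  set α : Fin n → Cn n → ℂ := fun j ↦ afm p t P (e j) with hα
  have αm : ∀ j, Measurable (α j) := fun j ↦ (dop_contDiff hχc).continuous.measurable.mul hP.continuous.measurable.inv
  have αB : ∀ j w, s w < c → ‖α j w‖ ≤ B := by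
    intro j w hw
    by_cases h : ‖w - p‖ < 30 * t ∨ 40 * t < ‖w - p‖
    · rw [hα]; simp only; rw [afm, dcut_zero ht _ h, zero_mul, norm_zero]; positivity
    push Not at h
    rw [hα]; simp only; rw [afm, norm_mul]
    exact mul_le_mul (hB j w) (hPi w hw (by linarith) (by linarith)) (norm_nonneg _) hB0
  obtain ⟨V, hVc, hVB, hVd⟩ := H α αm B αB (by positivity) fun f hf j k ↦ afm_closed ht hP hPd h0 hf (e j) (e k)
  have hctf : TF s c (ctf s c a) := ⟨ctf_contDiff S.hs, ctf_compact S.hs.continuous ha S.hb, (ctf_tsupport S.hs.continuous ha).trans fun w hw ↦ by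
    have : a ≤ c - s w := hw
    show s w < c
    linarith⟩
  have hq1 : TF s c fun w ↦ ctf s c a w * χ w := hctf.mulD fun w _ ↦ hχc.contDiffAt
  have hQ := hq1.mulD (shl_smooth ht hP h0)
  set Q : Cn n → ℂ := fun w ↦ ctf s c a w * χ w * (shl p t w * (P w)⁻¹) with hQd
  have hQB : ∀ w, ‖Q w‖ ≤ 2 / c' := by
    intro w
    by_cases hw : s w < c
    swap
    · rw [hQ.out hw, norm_zero]; positivity
    by_cases h : ‖w - p‖ ≤ 16 * t ∨ 44 * t ≤ ‖w - p‖
    · rw [hQd]; simp only; rw [shl_zero ht h]; simp; positivity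
    push Not at h
    rw [hQd]; simp only; rw [norm_mul, norm_mul, norm_mul]
    have h1 := mul_le_one₀ (ctf_norm (s := s) (c := c) (a := a) w) (norm_nonneg _) (cut_norm (p := p) (a := 30 * t) (b := 40 * t) w)
    have h2 := mul_le_mul (shl_norm (p := p) (t := t) w) (hPi w hw (by linarith) (by linarith)) (norm_nonneg _) zero_le_one
    rw [one_mul] at h2
    exact (mul_le_mul h1 h2 (by positivity) zero_le_one).trans (by rw [one_mul])
  have hcb : ∀ w ∈ cthickening r1 (closure Ω), ∀ y ∈ closedBall w r, ∀ᶠ x in 𝓝 y, 2 * a ≤ c - s x := by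
    intro w hw y hy
    filter_upwards [ball_mem_nhds y r0] with x hx
    apply hcs
    have : x ∈ closedBall w r1 := by
      rw [mem_closedBall] at hy ⊢; rw [mem_ball] at hx
      linarith [dist_triangle x y w]
    refine cthickening_cthickening_subset hr1.le hr1.le _ |>.trans (by rw [two_mul]) ?_
    exact closedBall_subset_cthickening hw r1 this
  have nb : ∀ w : Cn n, ∀ y ∈ closedBall w r, ‖w - p‖ - t / 2 ≤ ‖y - p‖ ∧ ‖y - p‖ ≤ ‖w - p‖ + t / 2 := by
    intro w y hy
    rw [mem_closedBall, dist_eq_norm] at hy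
    have n1 : ‖w - p‖ ≤ ‖w - y‖ + ‖y - p‖ := norm_sub_le_norm_sub_add_norm_sub _ _ _
    have n2 : ‖y - p‖ ≤ ‖y - w‖ + ‖w - p‖ := norm_sub_le_norm_sub_add_norm_sub _ _ _
    rw [norm_sub_rev w y] at n1
    constructor <;> linarith
  have Qdop : ∀ w ∈ cthickening r1 (closure Ω), 22 * t < ‖w - p‖ → ∀ y ∈ closedBall w r, ∀ j, dop I (e j) Q y = α j y := by
    intro w hw hwp y hy j
    have hyp := nb w y hy
    have hys : s y < c := by linarith [(hcb w hw y hy).self_of_nhds]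
    by_cases h : 40 * t < ‖y - p‖
    · rw [hα]; simp only; rw [afm, dcut_zero ht _ (Or.inr h), zero_mul]
      refine dop_loc_const 0 ?_
      filter_upwards [(isOpen_lt continuous_const cn).mem_nhds h] with x hx
      rw [hQd]; simp only; rw [hχ, cut_zero (by positivity) (by linarith) (le_of_lt hx)]; simp
    push Not at h
    rw [hQd, dop_shl ht hPd (by linarith) (by linarith) (h0 y hys (by linarith) (by linarith)) (hq1.cd.differentiable (by simp) y), hα]
    simp only; rw [afm]
    congr 1
    refine dop_congr ?_
    filter_upwards [hcb w hw y hy] with x hx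
    rw [ctf_one ha hx, one_mul]
  have mQc : ContDiff ℝ ∞ (moll r Q) := moll_contDiff r0 hQ.cd.continuous.locallyIntegrable
  have mQd : ∀ w ∈ cthickening r1 (closure Ω), 22 * t < ‖w - p‖ → ∀ j, dop I (e j) (moll r Q) w = moll r (α j) w := by
    intro w hw hwp j
    rw [dop_moll r0 hQ.cd.continuous.locallyIntegrable, ← dop_ibp volume (mtest_contDiff r w) hQ.cd (mtest_compact r0 w), moll_eq_mtest]
    refine integral_congr_ae (.of_forall fun y ↦ ?_)
    simp only
    by_cases hy : y ∈ closedBall w r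
    · rw [Qdop w hw hwp y hy]
    · rw [image_eq_zero_of_notMem_tsupport (f := mtest r w) fun h ↦ hy (mtest_tsupport r0 w h)]; simp
  have mα : ∀ w, ‖w - p‖ < 28 * t → ∀ j, moll r (α j) w = 0 := by
    intro w hw j
    refine moll_support r0 (K := {y | 30 * t ≤ ‖y - p‖}) (fun y hy ↦ ?_) fun y hy ↦ ?_
    · rw [mem_setOf_eq, not_le] at hy
      rw [hα]; simp only; rw [afm, dcut_zero ht _ (Or.inl hy), zero_mul]
    · rw [mem_setOf_eq] at hy
      have n2 : ‖y - p‖ ≤ ‖y - w‖ + ‖w - p‖ := norm_sub_le_norm_sub_add_norm_sub _ _ _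
      rw [norm_sub_rev]; linarith
  have hsub : ∀ {w}, w ∈ Ω → w ∈ cthickening r1 (closure Ω) := fun h ↦ self_subset_cthickening _ (subset_closure h)
  have Vhol : ∀ w ∈ cthickening r1 (closure Ω), ‖w - p‖ < 28 * t → DifferentiableAt ℂ V w := fun w hw h ↦
    dop_basis (hVc.differentiable (by simp) w) fun j ↦ by rw [hVd w hw j, mα w h]
  have mQ1 : ∀ w ∈ Ω, 22 * t < ‖w - p‖ → ‖w - p‖ < 28 * t → moll r Q w = (P w)⁻¹ := by
    intro w hw h1 h2
    have ev : ∀ y ∈ closedBall w r, ∀ᶠ x in 𝓝 y, Q x = (P x)⁻¹ := by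
      intro y hy
      have hyp := nb w y hy
      filter_upwards [hcb w (hsub hw) y hy, (isOpen_lt continuous_const cn).mem_nhds (show 20 * t < ‖y - p‖ by linarith),
        (isOpen_lt cn continuous_const).mem_nhds (show ‖y - p‖ < 30 * t by linarith)] with x hx h1 h2
      rw [hQd]; simp only
      rw [ctf_one ha hx, hχ, cut_one (by positivity) (by linarith) h2.le, shl_one ht h1.le (by linarith)]; simp
    rw [moll_holo r0 hQ.cd.continuous, (ev w (mem_closedBall_self r0.le)).self_of_nhds]
    intro y hy
    have hyp := nb w y hy
    have hys : s y < c := by linarith [(hcb w (hsub hw) y hy).self_of_nhds]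
    exact ((hPd y).inv (h0 y hys (by linarith) (by linarith))).congr_of_eventuallyEq (ev y hy)
  refine ⟨fun w ↦ if ‖w - p‖ < 25 * t then (P w)⁻¹ - V w else moll r Q w - V w, V, fun w hw ↦ ?_, fun w hw h ↦ ?_, fun w hw h ↦ ?_, fun w ↦ ?_, fun w hw ↦ ?_⟩
  · rcases lt_or_ge ‖w - p‖ (25 * t) with h | h
    · refine DifferentiableAt.differentiableWithinAt ?_
      refine (((hPd w).inv (hnz w hw (by linarith))).sub (Vhol w (hsub hw) (by linarith))).congr_of_eventuallyEq ?_
      filter_upwards [(isOpen_lt cn continuous_const).mem_nhds h] with y hy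
      exact if_pos hy
    · have hd : DifferentiableAt ℂ (fun w ↦ moll r Q w - V w) w := by
        have d1 := mQc.differentiable (by simp) w
        have d2 := hVc.differentiable (by simp) w
        refine dop_basis (d1.sub d2) fun j ↦ ?_
        have := dop_sub (c := I) (v := e j) d1 d2
        rw [mQd w (hsub hw) (by linarith), hVd w (hsub hw), sub_self] at this
        exact this
      refine hd.differentiableWithinAt.congr_of_eventuallyEq ?_ (if_neg (not_lt.2 h))
      filter_upwards [mem_nhdsWithin_of_mem_nhds ((isOpen_lt continuous_const cn).mem_nhds (show 22 * t < ‖w - p‖ by linarith)), self_mem_nhdsWithin] with y hy hyΩ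
      split_ifs with h1
      · rw [mQ1 y hyΩ hy (by linarith)]
      · rfl
  · simp only; rw [if_pos (by linarith)]
  · simp only; split_ifs with h1
    · have := norm_sub_le ((P w)⁻¹) (V w)
      linarith [hVB w, hPi w (hKs (subset_closure hw)) (by linarith) (by linarith)]
    · have := norm_sub_le (moll r Q w) (V w)
      linarith [hVB w, moll_bound r0 hQB w]
  · have : 0 ≤ 2 / c' := by positivity
    linarith [hVB w]
  · rw [mem_ball, dist_eq_norm] at hw
    refine (Vhol w ?_ (by linarith [min_le_right r1 t])).differentiableWithinAt
    refine closedBall_subset_cthickening hp r1 ?_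
    rw [mem_closedBall, dist_eq_norm]; linarith [min_le_left r1 t]

end

section

def HC (ε : ℝ) : ℕ → ∀ {E F : Type} [NormedAddCommGroup E] [NormedSpace ℝ E] [NormedAddCommGroup F] [NormedSpace ℝ F], (E → F) → E → Prop
  | 0, _, _, _, _, _, _, f, x => ∃ C : ℝ, ∀ᶠ q in 𝓝 (x, x), ‖f q.1 - f q.2‖ ≤ C * ‖q.1 - q.2‖ ^ ε
  | m + 1, _, _, _, _, _, _, f, x => (∀ᶠ y in 𝓝 x, DifferentiableAt ℝ f y) ∧ HC ε m (fderiv ℝ f) x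

variable {E F G H : Type} [NormedAddCommGroup E] [NormedSpace ℝ E] [NormedAddCommGroup F] [NormedSpace ℝ F]
  [NormedAddCommGroup G] [NormedSpace ℝ G] [NormedAddCommGroup H] [NormedSpace ℝ H] {ε : ℝ} {m : ℕ} {x : E} {f f' : E → F}

lemma ev_diag {P : E × E → Prop} (h : ∀ᶠ q in 𝓝 (x, x), P q) : ∀ᶠ y in 𝓝 x, P (y, x) :=
  (Continuous.prodMk continuous_id continuous_const : Continuous fun y : E ↦ (y, x)).continuousAt.eventually h

lemma ev_two {P : E → Prop} (h : ∀ᶠ y in 𝓝 x, P y) : ∀ᶠ q in 𝓝 (x, x), P q.1 ∧ P q.2 := by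
  rw [nhds_prod_eq]; exact (h.prod_inl _).and (h.prod_inr _)

lemma HC.cont (hε : 0 < ε) (h : HC ε m f x) : ContinuousAt f x := by
  cases m with
  | zero =>
    obtain ⟨C, hC⟩ := h
    rw [ContinuousAt, tendsto_iff_norm_sub_tendsto_zero]
    refine squeeze_zero' (.of_forall fun _ ↦ norm_nonneg _) (ev_diag hC) ?_
    have : ContinuousAt (fun y ↦ C * ‖y - x‖ ^ ε) x := by
      refine continuousAt_const.mul (ContinuousAt.rpow_const (by fun_prop) (Or.inr hε.le))
    simpa [ContinuousAt, Real.zero_rpow hε.ne'] using this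
  | succ m => exact h.1.self_of_nhds.continuousAt

lemma HC.bdd (hε : 0 < ε) (h : HC ε m f x) : ∃ M : ℝ, 0 ≤ M ∧ ∀ᶠ y in 𝓝 x, ‖f y‖ ≤ M := by
  refine ⟨‖f x‖ + 1, by positivity, ?_⟩
  filter_upwards [(h.cont hε).norm.eventually_lt_const (lt_add_one _)] with y hy using hy.le

lemma HC.zero' (h : HC ε 0 f x) : ∃ C : ℝ, 0 ≤ C ∧ ∀ᶠ q in 𝓝 (x, x), ‖f q.1 - f q.2‖ ≤ C * ‖q.1 - q.2‖ ^ ε := by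
  obtain ⟨C, hC⟩ := h
  refine ⟨|C|, abs_nonneg _, hC.mono fun q hq ↦ hq.trans ?_⟩
  exact mul_le_mul_of_nonneg_right (le_abs_self _) (by positivity)

lemma HC.congr (h : HC ε m f x) (he : f' =ᶠ[𝓝 x] f) : HC ε m f' x := by
  induction m generalizing F with
  | zero =>
    obtain ⟨C, hC⟩ := h
    refine ⟨C, ?_⟩
    filter_upwards [hC, ev_two he] with q h1 h2
    rwa [h2.1, h2.2]
  | succ m ih =>
    refine ⟨?_, ih h.2 he.fderiv⟩
    filter_upwards [h.1, he.eventuallyEq_nhds] with y h1 h2 using h1.congr_of_eventuallyEq h2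

lemma HC.add (h : HC ε m f x) (h' : HC ε m f' x) : HC ε m (fun y ↦ f y + f' y) x := by
  induction m generalizing F with
  | zero =>
    obtain ⟨C, hC⟩ := h
    obtain ⟨C', hC'⟩ := h'
    refine ⟨C + C', ?_⟩
    filter_upwards [hC, hC'] with q h1 h2
    rw [add_sub_add_comm, add_mul]
    exact (norm_add_le _ _).trans (add_le_add h1 h2)
  | succ m ih =>
    refine ⟨(h.1.and h'.1).mono fun y hy ↦ hy.1.add hy.2, (ih h.2 h'.2).congr ?_⟩
    filter_upwards [h.1, h'.1] with y h1 h2 using fderiv_fun_add h1 h2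

lemma lip_hc (h1 : ε ≤ 1) {K : ℝ≥0} {t : Set E} (ht : t ∈ 𝓝 x) (h : LipschitzOnWith K f t) : HC ε 0 f x := by
  refine ⟨K, ?_⟩
  have hd : ∀ᶠ q : E × E in 𝓝 (x, x), ‖q.1 - q.2‖ ≤ 1 := by
    have : ContinuousAt (fun q : E × E ↦ ‖q.1 - q.2‖) (x, x) := by fun_prop
    exact (this.eventually_lt_const (u := 1) (by simp)).mono fun _ h ↦ h.le
  filter_upwards [ev_two ht, hd] with q hq hd
  refine (h.norm_sub_le hq.1 hq.2).trans (mul_le_mul_of_nonneg_left ?_ K.2)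
  conv_lhs => rw [← Real.rpow_one ‖q.1 - q.2‖]
  rcases (norm_nonneg (q.1 - q.2)).eq_or_lt with h0 | h0
  · rw [← h0, Real.zero_rpow one_ne_zero]; positivity
  · exact rpow_le_rpow_of_exponent_ge h0 hd h1

lemma HC.strict (hε : 0 < ε) (h : HC ε (m + 1) f x) : HasStrictFDerivAt f (fderiv ℝ f x) x :=
  hasStrictFDerivAt_of_hasFDerivAt_of_continuousAt (h.1.mono fun _ hy ↦ hy.hasFDerivAt) (h.2.cont hε)

lemma HC.lip (hε : 0 < ε) (h : HC ε (m + 1) f x) : HC 1 0 f x := by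
  obtain ⟨K, s, hs, hK⟩ := (h.strict hε).exists_lipschitzOnWith
  exact lip_hc le_rfl hs hK

lemma HC.lower (hε : 0 < ε) (h1 : ε ≤ 1) (h : HC ε (m + 1) f x) : HC ε m f x := by
  induction m generalizing F with
  | zero =>
    obtain ⟨K, s, hs, hK⟩ := (h.strict hε).exists_lipschitzOnWith
    exact lip_hc h1 hs hK
  | succ m ih => exact ⟨h.1, ih h.2⟩

lemma HC.of_contDiff (h1 : ε ≤ 1) (h : ContDiffAt ℝ (m + 1) f x) : HC ε m f x := by
  induction m generalizing F with
  | zero =>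
    obtain ⟨K, s, hs, hK⟩ := ContDiffAt.exists_lipschitzOnWith (𝕂 := ℝ) (by simpa using h)
    exact lip_hc h1 hs hK
  | succ m ih =>
    refine ⟨?_, ih (h.fderiv_right (by norm_cast))⟩
    exact (h.eventually (by norm_cast; simp)).mono fun y hy ↦ hy.differentiableAt (by norm_cast)

lemma HC.of_smooth (h1 : ε ≤ 1) (h : ContDiffAt ℝ ∞ f x) : HC ε m f x :=
  HC.of_contDiff h1 (h.of_le (by exact_mod_cast le_top))

lemma HC.bilin (hε : 0 < ε) (h1 : ε ≤ 1) (B : F →L[ℝ] G →L[ℝ] H) {g : E → G} (hf : HC ε m f x) (hg : HC ε m g x) :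
    HC ε m (fun y ↦ B (f y) (g y)) x := by
  induction m generalizing F G H with
  | zero =>
    obtain ⟨M, hM, bM⟩ := hf.bdd hε
    obtain ⟨M', hM', bM'⟩ := hg.bdd hε
    obtain ⟨C, hC, bC⟩ := hf.zero'
    obtain ⟨C', hC', bC'⟩ := hg.zero'
    refine ⟨‖B‖ * (M * C' + C * M'), ?_⟩
    filter_upwards [bC, bC', ev_two bM, ev_two bM'] with q c1 c2 c3 c4
    have : B (f q.1) (g q.1) - B (f q.2) (g q.2) = B (f q.1) (g q.1 - g q.2) + B (f q.1 - f q.2) (g q.2) := by simp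
    rw [this]
    refine (norm_add_le_of_le (B.le_opNorm₂ _ _) (B.le_opNorm₂ _ _)).trans ?_
    calc _ = ‖B‖ * (‖f q.1‖ * ‖g q.1 - g q.2‖ + ‖f q.1 - f q.2‖ * ‖g q.2‖) := by ring
      _ ≤ ‖B‖ * (M * (C' * ‖q.1 - q.2‖ ^ ε) + (C * ‖q.1 - q.2‖ ^ ε) * M') := by
          gcongr
          exacts [c3.1, c4.2]
      _ = _ := by ring
  | succ m ih =>
    refine ⟨?_, ((ih (B.precompR E) (hf.lower hε h1) hg.2).add (ih (B.precompL E) hf.2 (hg.lower hε h1))).congr ?_⟩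
    · filter_upwards [hf.1, hg.1] with y h1 h2
      exact (B.hasFDerivAt_of_bilinear h1.hasFDerivAt h2.hasFDerivAt).differentiableAt
    · filter_upwards [hf.1, hg.1] with y h1 h2 using B.fderiv_of_bilinear h1 h2

lemma HC.comp (hε : 0 < ε) (h1 : ε ≤ 1) {g : F → G} (hg : HC ε m g (f x)) (hf : HC ε m f x) (hl : HC 1 0 f x) :
    HC ε m (fun y ↦ g (f y)) x := by
  have hc := hl.cont one_pos
  induction m generalizing G with
  | zero =>
    obtain ⟨C, hC, bC⟩ := hg.zero'
    obtain ⟨K, hK, bK⟩ := hl.zero'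
    refine ⟨C * K ^ ε, ?_⟩
    have : ContinuousAt (fun q : E × E ↦ (f q.1, f q.2)) (x, x) :=
      (ContinuousAt.comp (x := (x, x)) (g := f) hc continuousAt_fst).prodMk (ContinuousAt.comp (x := (x, x)) (g := f) hc continuousAt_snd)
    filter_upwards [bK, this.eventually bC] with q c1 c2
    refine c2.trans ?_
    rw [mul_assoc, ← Real.mul_rpow hK (norm_nonneg _)]
    rw [Real.rpow_one] at c1
    exact mul_le_mul_of_nonneg_left (Real.rpow_le_rpow (norm_nonneg _) c1 hε.le) hC
  | succ m ih =>
    refine ⟨?_, ((ih hg.2 (hf.lower hε h1)).bilin hε h1 (ContinuousLinearMap.compL ℝ E F G) hf.2).congr ?_⟩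
    · filter_upwards [hf.1, hc.eventually hg.1] with y h1 h2 using h2.comp y h1
    · filter_upwards [hf.1, hc.eventually hg.1] with y h1 h2 using fderiv_comp y h2 h1

lemma HC.smooth (hε : 0 < ε) (h1 : ε ≤ 1) {g : F → G} (hg : ContDiffAt ℝ ∞ g (f x)) (hf : HC ε m f x) :
    HC ε m (fun y ↦ g (f y)) x := by
  induction m generalizing F G with
  | zero =>
    obtain ⟨C, hC, bC⟩ := hf.zero'
    obtain ⟨K, hK, bK⟩ := (HC.of_smooth (m := 0) (le_refl (1:ℝ)) hg).zero'
    refine ⟨K * C, ?_⟩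
    have hc := hf.cont hε
    have : ContinuousAt (fun q : E × E ↦ (f q.1, f q.2)) (x, x) :=
      (ContinuousAt.comp (x := (x, x)) (g := f) hc continuousAt_fst).prodMk (ContinuousAt.comp (x := (x, x)) (g := f) hc continuousAt_snd)
    filter_upwards [bC, this.eventually bK] with q c1 c2
    rw [Real.rpow_one] at c2
    rw [mul_assoc]
    exact c2.trans (mul_le_mul_of_nonneg_left c1 hK)
  | succ m ih => exact HC.comp hε h1 (.of_smooth h1 hg) hf (hf.lip hε)

lemma HC.inv (hε : 0 < ε) (h1 : ε ≤ 1) [CompleteSpace E] (hf : HC ε (m + 1) f x) (e : E ≃L[ℝ] F) (he : fderiv ℝ f x = e) :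
    ∃ G : F → E, G (f x) = x ∧ HC ε (m + 1) G (f x) ∧ (∀ᶠ y in 𝓝 (f x), f (G y) = y) ∧ (∀ᶠ w in 𝓝 x, G (f w) = w) := by
  have hs : HasStrictFDerivAt f (e : E →L[ℝ] F) x := by rw [← he]; exact hf.strict hε
  set G := hs.localInverse f e x with hG
  have hl := hs.eventually_left_inverse
  have hr := hs.eventually_right_inverse
  have hGs := hs.to_localInverse
  simp only [← hG] at hl hr hGs
  have hx : G (f x) = x := hl.self_of_nhds
  have hGl : HC 1 0 G (f x) := by
    obtain ⟨K, s, hs, hK⟩ := hGs.exists_lipschitzOnWith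
    exact lip_hc le_rfl hs hK
  have hc : ContinuousAt G (f x) := hGs.continuousAt
  have hc' : Tendsto G (𝓝 (f x)) (𝓝 x) := by rw [ContinuousAt, hx] at hc; exact hc
  have hD : ∀ᶠ y in 𝓝 (f x), HasFDerivAt G (fderiv ℝ f (G y)).inverse y := by
    have q1 : ∀ᶠ w in 𝓝 x, fderiv ℝ f w ∈ range ((↑) : (E ≃L[ℝ] F) → E →L[ℝ] F) := by
      refine (hf.2.cont hε).eventually_mem ?_
      rw [he]; exact ContinuousLinearEquiv.nhds e
    have q2 : ∀ᶠ y in 𝓝 (f x), ContinuousAt G y := by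
      obtain ⟨K, s, hs, hK⟩ := hGs.exists_lipschitzOnWith
      exact (eventually_mem_nhds_iff.2 hs).mono fun y hy ↦ hK.continuousOn.continuousAt hy
    filter_upwards [hc'.eventually q1, hc'.eventually hf.1, q2, hr.eventually_nhds] with y h1 h2 h3 h4
    obtain ⟨e', he'⟩ := h1
    rw [← he', ContinuousLinearMap.inverse_equiv]
    refine HasFDerivAt.of_local_left_inverse h3 ?_ h4
    rw [he']; exact h2.hasFDerivAt
  have main : ∀ j ≤ m + 1, HC ε j G (f x) := by
    intro j
    induction j with
    | zero =>
      intro _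
      obtain ⟨K, s, hs, hK⟩ := hGs.exists_lipschitzOnWith
      exact lip_hc h1 hs hK
    | succ j ih =>
      intro hj
      refine ⟨hD.mono fun y hy ↦ hy.differentiableAt, ?_⟩
      have low : ∀ i, HC ε (j + i) (fderiv ℝ f) x → HC ε j (fderiv ℝ f) x := by
        intro i
        induction i with
        | zero => exact id
        | succ i ih => exact fun h ↦ ih (HC.lower hε h1 h)
      have h2 : HC ε j (fderiv ℝ f) (G (f x)) := by
        rw [hx]; refine low (m - j) ?_; rw [Nat.add_sub_cancel' (by omega)]; exact hf.2
      refine (HC.smooth hε h1 (g := ContinuousLinearMap.inverse) ?_ (HC.comp hε h1 h2 (ih (by omega)) hGl)).congr (hD.mono fun y hy ↦ hy.fderiv)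
      rw [hx, he]; exact contDiffAt_map_inverse e
  exact ⟨G, hx, main _ le_rfl, hr, hl⟩

lemma HC.of_iter (hε : 0 < ε) (h : ContDiffAt ℝ m f x)
    (hh : ∃ C : ℝ, ∀ᶠ q in 𝓝 (x, x), ‖iteratedFDeriv ℝ m f q.1 - iteratedFDeriv ℝ m f q.2‖ ≤ C * ‖q.1 - q.2‖ ^ ε) : HC ε m f x := by
  induction m generalizing F with
  | zero =>
    obtain ⟨C, hC⟩ := hh
    refine ⟨C, hC.mono fun q hq ↦ ?_⟩
    rw [iteratedFDeriv_zero_eq_comp, ← dist_eq_norm] at hq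
    have := (continuousMultilinearCurryFin0 ℝ E F).symm.dist_map (f q.1) (f q.2)
    rw [← dist_eq_norm, ← this]; exact hq
  | succ m ih =>
    refine ⟨(h.eventually (by norm_cast; simp)).mono fun y hy ↦ hy.differentiableAt (by norm_cast), ih (h.fderiv_right (by norm_cast)) ?_⟩
    obtain ⟨C, hC⟩ := hh
    refine ⟨C, hC.mono fun q hq ↦ ?_⟩
    rw [iteratedFDeriv_succ_eq_comp_right, iteratedFDeriv_succ_eq_comp_right, Function.comp_apply, Function.comp_apply, ← dist_eq_norm] at hq
    have := (continuousMultilinearCurryRightEquiv' ℝ m E F).symm.dist_map (iteratedFDeriv ℝ m (fun y ↦ fderiv ℝ f y) q.1)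
      (iteratedFDeriv ℝ m (fun y ↦ fderiv ℝ f y) q.2)
    rw [← dist_eq_norm, ← this]; exact hq

end

section

variable {E : Type} [NormedAddCommGroup E] [InnerProductSpace ℝ E] [FiniteDimensional ℝ E]

lemma sd0 {ε : ℝ} (hε : 0 < ε) (h1 : ε ≤ 1) {m : ℕ} {ρ : E → ℝ} {p : E} (hρ : HC ε (m + 2) ρ p) (h0 : ρ p = 0) (hd : fderiv ℝ ρ p ≠ 0) :
    ∃ (ν π : E → E) (r : E → ℝ) (φ : ℝ), 0 < φ ∧ HC ε (m + 1) ν p ∧ HC ε (m + 1) π p ∧ HC ε (m + 2) r p ∧ π p = p ∧ r p = 0 ∧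
      (∀ᶠ w in 𝓝 p, ‖ν w‖ = 1) ∧ (∀ x, fderiv ℝ ρ p x = φ * inner ℝ (ν p) x) ∧
      (∀ x, inner ℝ (ν p) x = 0 → fderiv ℝ (fderiv ℝ ρ) p x x = φ * inner ℝ (fderiv ℝ ν p x) x) ∧
      (∀ᶠ y in 𝓝 p, y = π y + r y • ν (π y) ∧ ρ (π y) = 0) ∧
      (∀ᶠ y in 𝓝 p, fderiv ℝ r y = innerSL ℝ (ν (π y))) ∧
      (∀ᶠ q : E × ℝ in 𝓝 (p, 0), ρ q.1 = 0 → r (q.1 + q.2 • ν q.1) = q.2) := by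
  set g : E → E := fun w ↦ (InnerProductSpace.toDual ℝ E).symm (fderiv ℝ ρ w) with hg
  have gi : ∀ w x, inner ℝ (g w) x = fderiv ℝ ρ w x := fun w x ↦ by simp [hg]
  have gp : g p ≠ 0 := by simpa [hg] using hd
  have hgH : HC ε (m + 1) g p := HC.smooth hε h1 (g := fun l ↦ (InnerProductSpace.toDual ℝ E).symm l)
    (InnerProductSpace.toDual ℝ E).symm.contDiff.contDiffAt hρ.2
  set ν : E → E := fun w ↦ ‖g w‖⁻¹ • g w with hν
  have hνH : HC ε (m + 1) ν p := by
    refine HC.smooth hε h1 (g := fun x : E ↦ ‖x‖⁻¹ • x) ?_ hgH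
    exact ((contDiffAt_norm ℝ gp).inv (norm_ne_zero_iff.2 gp)).smul contDiffAt_id
  have g0 : ∀ᶠ w in 𝓝 p, g w ≠ 0 := (hgH.cont hε).eventually_ne gp
  have ν1 : ∀ᶠ w in 𝓝 p, ‖ν w‖ = 1 := by
    filter_upwards [g0] with w hw
    rw [hν]; simp [norm_smul, hw]
  have νi : ∀ᶠ w in 𝓝 p, ∀ x, fderiv ℝ ρ w x = ‖g w‖ * inner ℝ (ν w) x := by
    filter_upwards [g0] with w hw x
    have := norm_ne_zero_iff.2 hw
    rw [hν, inner_smul_left, gi]; simp; field_simp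
  set φ := ‖g p‖ with hφ
  have φ0 : 0 < φ := norm_pos_iff.2 gp
  set Θ : E × ℝ → E × ℝ := fun q ↦ (q.1 + q.2 • ν q.1, ρ q.1) with hΘ
  have sm : ∀ {F : Type} [NormedAddCommGroup F] [NormedSpace ℝ F] (L : E × ℝ →L[ℝ] F) (j : ℕ) (q : E × ℝ), HC ε j (fun q ↦ L q) q :=
    fun L j q ↦ HC.of_smooth h1 L.contDiff.contDiffAt
  have c1 : HC ε (m + 1) (fun q : E × ℝ ↦ ν q.1) (p, 0) :=
    HC.comp hε h1 hνH (sm (.fst ℝ E ℝ) _ _) ((sm (.fst ℝ E ℝ) 1 _).lip hε)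
  have c2 : HC ε (m + 1) (fun q : E × ℝ ↦ ρ q.1) (p, 0) :=
    HC.comp hε h1 (hρ.lower hε h1) (sm (.fst ℝ E ℝ) _ _) ((sm (.fst ℝ E ℝ) 1 _).lip hε)
  have hΘH : HC ε (m + 1) Θ (p, 0) := by
    have c3 := (sm (.fst ℝ E ℝ) (m + 1) (p, 0)).add ((sm (.snd ℝ E ℝ) (m + 1) (p, 0)).bilin hε h1 (ContinuousLinearMap.lsmul ℝ ℝ) c1)
    have c4 := (HC.smooth hε h1 (ContinuousLinearMap.inl ℝ E ℝ).contDiff.contDiffAt c3).add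
      (HC.smooth hε h1 (ContinuousLinearMap.inr ℝ E ℝ).contDiff.contDiffAt c2)
    refine c4.congr (.of_forall fun q ↦ ?_)
    simp [hΘ]
  have dν := hνH.1.self_of_nhds.hasFDerivAt
  have dρ := hρ.1.self_of_nhds.hasFDerivAt
  have dΘ : HasFDerivAt Θ (((ContinuousLinearMap.fst ℝ E ℝ) + ((0:ℝ) • (fderiv ℝ ν p).comp (.fst ℝ E ℝ) +
      (ContinuousLinearMap.snd ℝ E ℝ).smulRight (ν p))).prod ((fderiv ℝ ρ p).comp (.fst ℝ E ℝ))) (p, 0) := by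
    have e1 : HasFDerivAt (fun q : E × ℝ ↦ q.1) (ContinuousLinearMap.fst ℝ E ℝ) (p, 0) := hasFDerivAt_fst
    have e2 : HasFDerivAt (fun q : E × ℝ ↦ q.2) (ContinuousLinearMap.snd ℝ E ℝ) (p, 0) := hasFDerivAt_snd
    exact (e1.add (e2.smul (HasFDerivAt.comp (p, 0) (f := fun q : E × ℝ ↦ q.1) (g := ν) dν e1))).prodMk
      (HasFDerivAt.comp (p, 0) (f := fun q : E × ℝ ↦ q.1) (g := ρ) dρ e1)
  have inj : Function.Injective (fderiv ℝ Θ (p, 0)) := by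
    rw [injective_iff_map_eq_zero]
    rintro ⟨h, s⟩ hh
    rw [dΘ.fderiv] at hh
    simp only [ContinuousLinearMap.prod_apply, Prod.mk_eq_zero, ContinuousLinearMap.add_apply, ContinuousLinearMap.coe_fst', zero_smul, ContinuousLinearMap.zero_apply, zero_add,
      ContinuousLinearMap.smulRight_apply, ContinuousLinearMap.coe_snd', ContinuousLinearMap.comp_apply] at hh
    obtain ⟨hh1, hh2⟩ := hh
    have hh3 : h = -(s • ν p) := eq_neg_of_add_eq_zero_left hh1
    rw [νi.self_of_nhds, hh3, inner_neg_right, inner_smul_right, real_inner_self_eq_norm_sq, ν1.self_of_nhds] at hh2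
    have : s = 0 := by
      have := φ0.ne'
      simpa [gp] using hh2
    simp [hh3, this]
  let e : (E × ℝ) ≃L[ℝ] (E × ℝ) := (LinearEquiv.ofInjectiveEndo (fderiv ℝ Θ (p, 0) : E × ℝ →ₗ[ℝ] E × ℝ) inj).toContinuousLinearEquiv
  obtain ⟨G, G0, GH, Gr, Gl⟩ := hΘH.inv hε h1 e (by ext <;> rfl)
  have Θp : Θ (p, 0) = (p, 0) := by simp [hΘ, h0]
  rw [Θp] at G0 GH Gr
  have ic : ∀ y : E, ContDiffAt ℝ ∞ (fun y : E ↦ (y, (0:ℝ))) y := fun y ↦ by fun_prop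
  have icH : ∀ j, HC ε j (fun y : E ↦ (y, (0:ℝ))) p := fun j ↦ HC.of_smooth h1 (ic p)
  have icc : Tendsto (fun y : E ↦ (y, (0:ℝ))) (𝓝 p) (𝓝 (p, 0)) := (ic p).continuousAt
  have G1 : HC ε (m + 1) (fun y : E ↦ G (y, 0)) p := HC.comp hε h1 (f := fun y : E ↦ (y, (0:ℝ))) GH (icH _) ((icH 1).lip hε)
  set π : E → E := fun y ↦ (G (y, 0)).1 with hπ
  set r : E → ℝ := fun y ↦ (G (y, 0)).2 with hr
  have πH : HC ε (m + 1) π p := HC.smooth hε h1 (g := Prod.fst) contDiffAt_fst G1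
  have rH : HC ε (m + 1) r p := HC.smooth hε h1 (g := Prod.snd) contDiffAt_snd G1
  have πp : π p = p := by simp [hπ, G0]
  have rp : r p = 0 := by simp [hr, G0]
  have πc : Tendsto π (𝓝 p) (𝓝 p) := by have := πH.cont hε; rwa [ContinuousAt, πp] at this
  have id1 : ∀ᶠ y in 𝓝 p, y = π y + r y • ν (π y) ∧ ρ (π y) = 0 := by
    filter_upwards [icc.eventually Gr] with y hy
    exact ⟨(congrArg Prod.fst hy).symm, congrArg Prod.snd hy⟩
  have νdν : ∀ᶠ w in 𝓝 p, ∀ x, inner ℝ (ν w) (fderiv ℝ ν w x) = 0 := by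
    filter_upwards [ν1.eventually_nhds, hνH.1] with w hw hw2 x
    have e1 : HasFDerivAt (fun w ↦ inner ℝ (ν w) (ν w)) (0 : E →L[ℝ] ℝ) w := by
      refine (hasFDerivAt_const (1:ℝ) w).congr_of_eventuallyEq ?_
      filter_upwards [hw] with y hy
      rw [real_inner_self_eq_norm_sq, hy, one_pow]
    have e2 := hw2.hasFDerivAt.inner ℝ hw2.hasFDerivAt
    have := congrArg (fun L ↦ L x) (e1.unique e2)
    simp [fderivInnerCLM_apply, real_inner_comm] at this
    linarith [real_inner_comm (ν w) (fderiv ℝ ν w x)]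
  have ddec : ∀ᶠ y in 𝓝 p, ∀ x, x = fderiv ℝ π y x + (r y • fderiv ℝ ν (π y) (fderiv ℝ π y x) + fderiv ℝ r y x • ν (π y)) := by
    filter_upwards [id1.eventually_nhds, πH.1, rH.1, πc.eventually hνH.1] with y h1 h2 h3 h4 x
    have e1 := h2.hasFDerivAt.add (h3.hasFDerivAt.smul (HasFDerivAt.comp y h4.hasFDerivAt h2.hasFDerivAt))
    have e2 : HasFDerivAt (fun y ↦ y) (ContinuousLinearMap.id ℝ E) y := hasFDerivAt_id y
    have e3 := e2.unique (e1.congr_of_eventuallyEq (h1.mono fun y hy ↦ hy.1))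
    have := congrArg (fun L ↦ L x) e3
    simpa using this
  have dr : ∀ᶠ y in 𝓝 p, fderiv ℝ r y = innerSL ℝ (ν (π y)) := by
    filter_upwards [ddec, id1.eventually_nhds, πH.1, πc.eventually hρ.1, πc.eventually g0, πc.eventually νi, πc.eventually ν1, πc.eventually νdν] with y h1 h2 h3 h4 h5 h6 h7 h8
    ext x
    have e1 := congrArg (inner ℝ (ν (π y))) (h1 x)
    have e2 : fderiv ℝ ρ (π y) (fderiv ℝ π y x) = 0 := by
      have e3 : HasFDerivAt (fun y ↦ ρ (π y)) (0 : E →L[ℝ] ℝ) y :=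
        (hasFDerivAt_const (0:ℝ) y).congr_of_eventuallyEq (h2.mono fun y hy ↦ hy.2)
      have := congrArg (fun L ↦ L x) (e3.unique (HasFDerivAt.comp y h4.hasFDerivAt h3.hasFDerivAt))
      simpa using this.symm
    rw [h6] at e2
    have e4 : inner ℝ (ν (π y)) (fderiv ℝ π y x) = 0 := by
      rcases mul_eq_zero.1 e2 with h | h
      · exact absurd (norm_eq_zero.1 h) h5
      · exact h
    rw [inner_add_right, inner_add_right, inner_smul_right, inner_smul_right, h8, e4, real_inner_self_eq_norm_sq, h7] at e1
    simp only [innerSL_apply_apply]; linarith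
  refine ⟨ν, π, r, φ, φ0, hνH, πH, ?_, πp, rp, ν1, νi.self_of_nhds, ?_, id1, dr, ?_⟩
  · refine ⟨rH.1, HC.congr (f := fun y ↦ innerSL ℝ (ν (π y))) ?_ dr⟩
    have : HC ε (m + 1) (fun y ↦ ν (π y)) p := HC.comp hε h1 (by rw [πp]; exact hνH) πH (πH.lip hε)
    exact HC.smooth hε h1 (g := innerSL ℝ) (innerSL ℝ).contDiff.contDiffAt this
  · intro x hx
    have dg : DifferentiableAt ℝ (fun w ↦ ‖g w‖) p := (hgH.1.self_of_nhds).norm ℝ gp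
    have e1 : HasFDerivAt (fun w ↦ fderiv ℝ ρ w x) _ p :=
      (dg.hasFDerivAt.mul (dν.inner ℝ (hasFDerivAt_const x p))).congr_of_eventuallyEq (νi.mono fun w hw ↦ hw x)
    have e2 : HasFDerivAt (fun w ↦ fderiv ℝ ρ w x) _ p := hρ.2.1.self_of_nhds.hasFDerivAt.clm_apply (hasFDerivAt_const x p)
    have := congrArg (fun L ↦ L x) (e2.unique e1)
    simp [fderivInnerCLM_apply, hx] at this
    rw [this]
  · filter_upwards [Gl] with q hq h
    have : Θ q = (q.1 + q.2 • ν q.1, 0) := by rw [hΘ]; simp [h]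
    rw [hr]; simp only; rw [← this, hq]

theorem sd {ε : ℝ} (hε : 0 < ε) (h1 : ε ≤ 1) {m : ℕ} {ρ : E → ℝ} {p : E} (hρ : HC ε (m + 2) ρ p) (hd : fderiv ℝ ρ p ≠ 0)
    {Ω : Set E} (ho : IsOpen Ω) (hpf : p ∈ frontier Ω) (hs : ∀ᶠ w in 𝓝 p, (w ∈ Ω ↔ ρ w < 0)) :
    ∃ (r : E → ℝ) (φ : ℝ), 0 < φ ∧ HC ε (m + 2) r p ∧ r p = 0 ∧ (∀ᶠ w in 𝓝 p, (w ∈ Ω ↔ r w < 0)) ∧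
      (∀ᶠ w in 𝓝 p, w ∈ Ω → infDist w (frontier Ω) = - r w) ∧ (∀ x, fderiv ℝ ρ p x = φ * fderiv ℝ r p x) ∧ fderiv ℝ r p ≠ 0 ∧
      (∀ x, fderiv ℝ r p x = 0 → fderiv ℝ (fderiv ℝ ρ) p x x = φ * fderiv ℝ (fderiv ℝ r) p x x) := by
  have ρcont : ∀ᶠ w in 𝓝 p, ContinuousAt ρ w := hρ.1.mono fun w hw ↦ hw.continuousAt
  have fr0 : ∀ᶠ w in 𝓝 p, w ∈ frontier Ω → ρ w = 0 := by
    filter_upwards [hs.eventually_nhds, ρcont] with w h2 h3 h4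
    rw [ho.frontier_eq] at h4
    refine le_antisymm ?_ (not_lt.1 fun h ↦ h4.2 (h2.self_of_nhds.2 h))
    by_contra hc
    push Not at hc
    obtain ⟨y, hy, hy2⟩ := ((mem_closure_iff_frequently.1 h4.1).and_eventually ((h3.eventually_const_lt hc).and h2)).exists
    exact absurd (hy2.2.1 hy) (not_lt.2 hy2.1.le)
  have h0 : ρ p = 0 := fr0.self_of_nhds hpf
  obtain ⟨ν, π, r, φ, φ0, νH, πH, rH, πp, rp, ν1, dρ, hess, id1, dr, uniq⟩ := sd0 hε h1 hρ h0 hd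
  have πc : Tendsto π (𝓝 p) (𝓝 p) := by have := πH.cont hε; rwa [ContinuousAt, πp] at this
  have drp : ∀ x, fderiv ℝ r p x = inner ℝ (ν p) x := fun x ↦ by rw [dr.self_of_nhds, πp]; rfl
  have sgn : ∀ᶠ y in 𝓝 p, |ρ y - r y * (φ * inner ℝ (ν p) (ν (π y)))| ≤ φ / 4 * |r y| ∧ 1 / 2 ≤ inner ℝ (ν p) (ν (π y)) := by
    have l1 := (hρ.strict hε).isLittleO.def (c := φ / 4) (by positivity)
    have l2 : Tendsto (fun y ↦ (y, π y)) (𝓝 p) (𝓝 (p, p)) := by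
      rw [nhds_prod_eq]; exact tendsto_id.prodMk πc
    have l3 : ∀ᶠ w in 𝓝 p, (1/2 : ℝ) < inner ℝ (ν p) (ν w) := by
      have : ContinuousAt (fun w ↦ inner ℝ (ν p) (ν w)) p := continuousAt_const.inner (νH.cont hε)
      refine this.eventually_const_lt ?_
      simp only [real_inner_self_eq_norm_sq, ν1.self_of_nhds]; norm_num
    filter_upwards [l2.eventually l1, id1, πc.eventually l3, πc.eventually ν1] with y a1 a2 a3 a4
    refine ⟨?_, a3.le⟩
    have e : y - π y = r y • ν (π y) := by rw [sub_eq_iff_eq_add']; exact a2.1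
    simp only [e, a2.2, dρ, inner_smul_right, norm_smul, a4, norm_eq_abs, smul_eq_mul, mul_one, sub_zero] at a1
    convert a1 using 3; ring
  have sg1 : ∀ᶠ y in 𝓝 p, (r y < 0 ↔ ρ y < 0) ∧ (ρ y = 0 → r y = 0) := by
    filter_upwards [sgn] with y hy
    obtain ⟨a, b⟩ := hy
    rw [abs_le] at a
    obtain ⟨a1, a2⟩ := a
    have k : φ / 2 ≤ φ * inner ℝ (ν p) (ν (π y)) := by nlinarith
    set d := φ * inner ℝ (ν p) (ν (π y))
    rcases lt_trichotomy (r y) 0 with h | h | h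
    · rw [abs_of_neg h] at a1 a2
      have : ρ y < 0 := by nlinarith
      exact ⟨⟨fun _ ↦ this, fun _ ↦ h⟩, fun h' ↦ absurd h' this.ne⟩
    · rw [h] at a1 a2 ⊢
      simp at a1 a2
      have : ρ y = 0 := by linarith
      simp [this]
    · rw [abs_of_pos h] at a1 a2
      have : 0 < ρ y := by nlinarith
      exact ⟨⟨fun h' ↦ absurd h' h.le.not_gt, fun h' ↦ absurd h' this.le.not_gt⟩, fun h' ↦ absurd h' this.ne'⟩
  have sg2 : ∀ᶠ w in 𝓝 p, (w ∈ Ω ↔ r w < 0) := by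
    filter_upwards [hs, sg1] with w h2 h3 using h2.trans h3.1.symm
  have tof : ∀ᶠ w in 𝓝 p, ρ w = 0 → w ∈ frontier Ω := by
    have u1 : ∀ᶠ w in 𝓝 p, ∀ᶠ t : ℝ in 𝓝 0, ρ w = 0 → r (w + t • ν w) = t := by
      have := uniq; rw [nhds_prod_eq] at this; exact this.curry
    filter_upwards [u1, sg2.eventually_nhds, hs] with w k1 k2 k3 k4
    rw [ho.frontier_eq]
    refine ⟨?_, fun h ↦ by rw [k3, k4] at h; exact lt_irrefl _ h⟩
    have tl : Tendsto (fun t : ℝ ↦ w + t • ν w) (𝓝 0) (𝓝 w) := by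
      have : Continuous (fun t : ℝ ↦ w + t • ν w) := by fun_prop
      simpa using this.tendsto 0
    rw [mem_closure_iff_frequently]
    have k5 : ∀ᶠ t : ℝ in 𝓝[<] 0, w + t • ν w ∈ Ω := by
      filter_upwards [nhdsWithin_le_nhds k1, nhdsWithin_le_nhds (tl.eventually k2), self_mem_nhdsWithin] with t m1 m2 m3
      rw [m2, m1 k4]; exact m3
    exact (tl.mono_left nhdsWithin_le_nhds).frequently k5.frequently
  have rc := rH.cont hε
  refine ⟨r, φ, φ0, rH, rp, sg2, ?_, fun x ↦ by rw [dρ, drp], ?_, ?_⟩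
  · obtain ⟨η, η0, hη⟩ := Metric.eventually_nhds_iff_ball.1 (fr0.and (sg1.and ((rH.1.and dr).and (πc.eventually ν1))))
    have rlip : ∀ x ∈ ball p η, ∀ y ∈ ball p η, r y - r x ≤ ‖y - x‖ := by
      intro x hx y hy
      have := (convex_ball p η).norm_image_sub_le_of_norm_fderiv_le (f := r) (C := 1) (𝕜 := ℝ) (fun w hw ↦ (hη w hw).2.2.1.1)
        (fun w hw ↦ by rw [(hη w hw).2.2.1.2, innerSL_apply_norm, (hη w hw).2.2.2]) hx hy
      rw [one_mul] at this
      exact (le_abs_self _).trans this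
    have e1 : ∀ᶠ w in 𝓝 p, - r w < η / 2 := (rc.neg).eventually_lt_const (by simp [rp, η0])
    filter_upwards [ball_mem_nhds p (half_pos η0), e1, sg2, πc.eventually tof, id1, πc.eventually ν1] with z z1 z2 z3 z4 z5 z6 z7
    have rz := z3.1 z7
    refine le_antisymm ?_ ((le_infDist ⟨p, hpf⟩).2 fun q hq ↦ ?_)
    · refine (infDist_le_dist_of_mem (z4 z5.2)).trans (le_of_eq ?_)
      have e : z - π z = r z • ν (π z) := by rw [sub_eq_iff_eq_add']; exact z5.1
      rw [dist_eq_norm, e, norm_smul, z6, mul_one, norm_eq_abs, abs_of_neg rz]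
    · by_cases hqb : q ∈ ball p η
      · have rq : r q = 0 := (hη q hqb).2.1.2 ((hη q hqb).1 hq)
        have := rlip z (ball_subset_ball (by linarith) z1) q hqb
        rw [dist_comm, dist_eq_norm]; linarith
      · rw [mem_ball, not_lt] at hqb
        rw [mem_ball] at z1
        have := dist_triangle q z p
        rw [dist_comm z q]; linarith
  · intro h
    have := drp (ν p)
    rw [h, real_inner_self_eq_norm_sq, ν1.self_of_nhds] at this
    simp at this
  · intro x hx
    rw [drp] at hx
    rw [hess x hx]
    congr 1
    have ep : fderiv ℝ π p x = x := by
      have e1 := (πH.1.self_of_nhds.hasFDerivAt).add ((rH.1.self_of_nhds.hasFDerivAt).smul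
        (HasFDerivAt.comp p (g := ν) (by rw [πp]; exact νH.1.self_of_nhds.hasFDerivAt) πH.1.self_of_nhds.hasFDerivAt))
      have e2 : HasFDerivAt (fun y ↦ y) (ContinuousLinearMap.id ℝ E) p := hasFDerivAt_id p
      have := congrArg (fun L ↦ L x) (e2.unique (e1.congr_of_eventuallyEq (id1.mono fun y hy ↦ hy.1)))
      simpa [rp, drp, hx] using this.symm
    have e1 : HasFDerivAt (fun w ↦ fderiv ℝ r w x) _ p :=
      ((HasFDerivAt.comp p (g := ν) (by rw [πp]; exact νH.1.self_of_nhds.hasFDerivAt) πH.1.self_of_nhds.hasFDerivAt).inner ℝ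
        (hasFDerivAt_const x p)).congr_of_eventuallyEq (dr.mono fun w hw ↦ by simp only [hw]; rfl)
    have e2 : HasFDerivAt (fun w ↦ fderiv ℝ r w x) _ p := rH.2.1.self_of_nhds.hasFDerivAt.clm_apply (hasFDerivAt_const x p)
    have := congrArg (fun L ↦ L x) (e2.unique e1)
    simp [fderivInnerCLM_apply, ep] at this
    exact this.symm

end

section

variable {E F : Type} [NormedAddCommGroup E] [NormedSpace ℝ E] [NormedAddCommGroup F] [NormedSpace ℝ F]

lemma mvt_pow {g : E → F} {z h : E} {C s : ℝ} (hC : 0 ≤ C) (hs : 0 ≤ s) (hd : ∀ w, ‖w - z‖ ≤ ‖h‖ → DifferentiableAt ℝ g w)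
    (hb : ∀ w, ‖w - z‖ ≤ ‖h‖ → ‖fderiv ℝ g w‖ ≤ C * ‖w - z‖ ^ s) : ‖g (z + h) - g z‖ ≤ C * ‖h‖ ^ (1 + s) := by
  have h1 := (convex_closedBall z ‖h‖).norm_image_sub_le_of_norm_fderiv_le (f := g) (𝕜 := ℝ) (C := C * ‖h‖ ^ s) (x := z) (y := z + h)
    (fun w hw ↦ hd w (by rwa [mem_closedBall_iff_norm] at hw))
    (fun w hw ↦ by
      rw [mem_closedBall_iff_norm] at hw
      exact (hb w hw).trans (mul_le_mul_of_nonneg_left (Real.rpow_le_rpow (norm_nonneg _) hw hs) hC))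
    (by simp) (by simp)
  rcases eq_or_ne h 0 with rfl | hh
  · simp; positivity
  · rw [Real.rpow_add (norm_pos_iff.2 hh), Real.rpow_one]
    rw [add_sub_cancel_left] at h1
    linarith

lemma tay1 {ε : ℝ} (hε : 0 < ε) {f : E → F} {p : E} (hf : HC ε 1 f p) :
    ∃ C η, 0 ≤ C ∧ 0 < η ∧ ∀ z ∈ ball p η, ∀ h : E, ‖h‖ < η → ‖f (z + h) - f z - fderiv ℝ f z h‖ ≤ C * ‖h‖ ^ (1 + ε) := by
  obtain ⟨C, hC, h2⟩ := hf.2.zero'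
  rw [nhds_prod_eq, Filter.eventually_prod_iff] at h2
  obtain ⟨p1, k1, p2, k2, k3⟩ := h2
  obtain ⟨η, η0, hη⟩ := Metric.eventually_nhds_iff_ball.1 (hf.1.and (k1.and k2))
  refine ⟨C, η / 2, hC, half_pos η0, fun z hz h hh ↦ ?_⟩
  have hin : ∀ w, ‖w - z‖ ≤ ‖h‖ → w ∈ ball p η := by
    intro w hw
    rw [mem_ball] at *
    have := dist_triangle w z p
    rw [dist_eq_norm w z] at this; linarith
  have hz' := hin z (by simp)
  have dg : ∀ w, ‖w - z‖ ≤ ‖h‖ → HasFDerivAt (fun w ↦ f w - fderiv ℝ f z w) (fderiv ℝ f w - fderiv ℝ f z) w := fun w hw ↦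
    (hη w (hin w hw)).1.hasFDerivAt.sub (fderiv ℝ f z).hasFDerivAt
  have := mvt_pow (g := fun w ↦ f w - fderiv ℝ f z w) (z := z) (h := h) hC hε.le (fun w hw ↦ (dg w hw).differentiableAt)
    (fun w hw ↦ by rw [(dg w hw).fderiv]; exact k3 (hη w (hin w hw)).2.1 (hη z hz').2.2)
  rw [map_add] at this
  convert this using 2; abel

lemma tay2 {ε : ℝ} (hε : 0 < ε) {f : E → F} {p : E} (hf : HC ε 2 f p) :
    ∃ C η, 0 ≤ C ∧ 0 < η ∧ ∀ z ∈ ball p η, ∀ h : E, ‖h‖ < η →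
      ‖f (z + h) - f z - fderiv ℝ f z h - (1/2 : ℝ) • fderiv ℝ (fderiv ℝ f) z h h‖ ≤ C * ‖h‖ ^ (1 + (1 + ε)) := by
  obtain ⟨C, η1, hC, h1, h2⟩ := tay1 hε hf.2
  obtain ⟨η2, h3, h4⟩ := Metric.eventually_nhds_iff_ball.1 (hf.1.eventually_nhds.and hf.2.1)
  set η := min η1 η2 with hη
  have a1 : η ≤ η1 := min_le_left _ _
  have a2 : η ≤ η2 := min_le_right _ _
  have η0 : 0 < η := lt_min h1 h3
  refine ⟨C, η / 2, hC, half_pos η0, fun z hz h hh ↦ ?_⟩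
  have hin : ∀ w, ‖w - z‖ ≤ ‖h‖ → w ∈ ball p η2 := by
    intro w hw
    rw [mem_ball] at *
    have := dist_triangle w z p
    rw [dist_eq_norm w z] at this; linarith
  obtain ⟨b1, b2⟩ := h4 z (hin z (by simp))
  set D := fderiv ℝ (fderiv ℝ f) z with hD
  have sym : ∀ x y, D x y = D y x := fun x y ↦
    second_derivative_symmetric_of_eventually (f' := fderiv ℝ f) (b1.mono fun w hw ↦ hw.hasFDerivAt) b2.hasFDerivAt x y
  have dg : ∀ w, ‖w - z‖ ≤ ‖h‖ → HasFDerivAt (fun w ↦ f w - fderiv ℝ f z w - (1/2 : ℝ) • D (w - z) (w - z)) (fderiv ℝ f w - fderiv ℝ f z - D (w - z)) w := by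
    intro w hw
    have e0 : HasFDerivAt (fun w ↦ w - z) (ContinuousLinearMap.id ℝ E) w := (hasFDerivAt_id w).sub_const z
    have e1 := (((h4 w (hin w hw)).1.self_of_nhds.hasFDerivAt.sub (fderiv ℝ f z).hasFDerivAt).sub ((D.hasFDerivAt_of_bilinear e0 e0).const_smul (1/2 : ℝ)))
    refine e1.congr_fderiv ?_
    ext x
    have t3 : D x (w - z) = D (w - z) x := sym x (w - z)
    generalize w - z = u at t3 ⊢
    simp only [ContinuousLinearMap.precompR_apply, ContinuousLinearMap.precompL_apply, ContinuousLinearMap.compL_apply, ContinuousLinearMap.comp_apply, ContinuousLinearMap.sub_apply, ContinuousLinearMap.smul_apply,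
      ContinuousLinearMap.add_apply, ContinuousLinearMap.id_apply, t3]
    module
  have := mvt_pow (z := z) (h := h) hC (by linarith : 0 ≤ 1 + ε) (fun w hw ↦ (dg w hw).differentiableAt)
    (fun w hw ↦ by
      rw [(dg w hw).fderiv]
      have := h2 z (ball_subset_ball (by linarith) hz) (w - z) (by linarith)
      rwa [add_sub_cancel] at this)
  simp only [map_add, sub_self, add_sub_cancel_left, map_zero, smul_zero, sub_zero] at this
  convert this using 2; abel

lemma tay3 {ε : ℝ} (hε : 0 < ε) {f : E → F} {p : E} (hf : HC ε 3 f p) :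
    ∃ C η, 0 ≤ C ∧ 0 < η ∧ ∀ z ∈ ball p η, ∀ h : E, ‖h‖ < η →
      ‖f (z + h) - f z - fderiv ℝ f z h - (1/2 : ℝ) • fderiv ℝ (fderiv ℝ f) z h h - (1/6 : ℝ) • fderiv ℝ (fderiv ℝ (fderiv ℝ f)) z h h h‖ ≤ C * ‖h‖ ^ (1 + (1 + (1 + ε))) := by
  obtain ⟨C, η1, hC, h1, h2⟩ := tay2 hε hf.2
  obtain ⟨η2, h3, h4⟩ := Metric.eventually_nhds_iff_ball.1 (hf.1.eventually_nhds.eventually_nhds.and (hf.2.1.eventually_nhds.and hf.2.2.1))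
  set η := min η1 η2 with hη
  have a1 : η ≤ η1 := min_le_left _ _
  have a2 : η ≤ η2 := min_le_right _ _
  have η0 : 0 < η := lt_min h1 h3
  refine ⟨C, η / 2, hC, half_pos η0, fun z hz h hh ↦ ?_⟩
  have hin : ∀ w, ‖w - z‖ ≤ ‖h‖ → w ∈ ball p η2 := by
    intro w hw
    rw [mem_ball] at *
    have := dist_triangle w z p
    rw [dist_eq_norm w z] at this; linarith
  obtain ⟨b1, b2, b3⟩ := h4 z (hin z (by simp))
  set D := fderiv ℝ (fderiv ℝ f) z with hD
  set S := fderiv ℝ (fderiv ℝ (fderiv ℝ f)) z with hS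
  have sym' : ∀ᶠ u in 𝓝 z, ∀ x y, fderiv ℝ (fderiv ℝ f) u x y = fderiv ℝ (fderiv ℝ f) u y x := by
    filter_upwards [b1, b2] with u u1 u2 x y
    exact second_derivative_symmetric_of_eventually (f' := fderiv ℝ f) (u1.mono fun w hw ↦ hw.hasFDerivAt) u2.hasFDerivAt x y
  have sym := sym'.self_of_nhds
  have s12 : ∀ x y, S x y = S y x := fun x y ↦
    second_derivative_symmetric_of_eventually (f' := fderiv ℝ (fderiv ℝ f)) (b2.mono fun w hw ↦ hw.hasFDerivAt) b3.hasFDerivAt x y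
  have s23 : ∀ u x y, S u x y = S u y x := by
    intro u x y
    have e : ∀ x y : E, HasFDerivAt (fun w ↦ fderiv ℝ (fderiv ℝ f) w x y) ((S.flip x).flip y) z := by
      intro x y
      have := (b3.hasFDerivAt.clm_apply (hasFDerivAt_const x z)).clm_apply (hasFDerivAt_const y z)
      refine this.congr_fderiv ?_
      ext u; simp [hS]
    have := (e x y).unique ((e y x).congr_of_eventuallyEq (sym'.mono fun w hw ↦ hw x y))
    simpa using congrArg (fun L ↦ L u) this
  have dg : ∀ w, ‖w - z‖ ≤ ‖h‖ → HasFDerivAt (fun w ↦ f w - fderiv ℝ f z w - (1/2 : ℝ) • D (w - z) (w - z) - (1/6 : ℝ) • S (w - z) (w - z) (w - z))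
      (fderiv ℝ f w - fderiv ℝ f z - D (w - z) - (1/2 : ℝ) • S (w - z) (w - z)) w := by
    intro w hw
    have e0 : HasFDerivAt (fun w ↦ w - z) (ContinuousLinearMap.id ℝ E) w := (hasFDerivAt_id w).sub_const z
    have e1 := ((((h4 w (hin w hw)).1.self_of_nhds.self_of_nhds.hasFDerivAt.sub (fderiv ℝ f z).hasFDerivAt).sub ((D.hasFDerivAt_of_bilinear e0 e0).const_smul (1/2 : ℝ))).sub
      (((S.hasFDerivAt_of_bilinear e0 e0).clm_apply e0).const_smul (1/6 : ℝ)))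
    refine e1.congr_fderiv ?_
    ext x
    have t1 : S (w - z) x (w - z) = S (w - z) (w - z) x := s23 _ _ _
    have t2 : S x (w - z) (w - z) = S (w - z) (w - z) x := by rw [s12 x, t1]
    have t3 : D x (w - z) = D (w - z) x := sym x (w - z)
    generalize w - z = u at t1 t2 t3 ⊢
    simp only [ContinuousLinearMap.precompR_apply, ContinuousLinearMap.precompL_apply, ContinuousLinearMap.compL_apply, ContinuousLinearMap.comp_apply, ContinuousLinearMap.sub_apply, ContinuousLinearMap.smul_apply,
      ContinuousLinearMap.add_apply, ContinuousLinearMap.id_apply, ContinuousLinearMap.comp_id, ContinuousLinearMap.flip_apply, t1, t2, t3]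
    module
  have := mvt_pow (z := z) (h := h) hC (by linarith : 0 ≤ 1 + (1 + ε)) (fun w hw ↦ (dg w hw).differentiableAt)
    (fun w hw ↦ by
      rw [(dg w hw).fderiv]
      have := h2 z (ball_subset_ball (by linarith) hz) (w - z) (by linarith)
      rwa [add_sub_cancel] at this)
  simp only [map_add, sub_self, add_sub_cancel_left, map_zero, smul_zero, sub_zero] at this
  convert this using 2; abel

end

section
set_option maxSynthPendingDepth 3

variable {F : Type} [NormedAddCommGroup F] [NormedSpace ℂ F] [NormedSpace ℝ F] [IsScalarTower ℝ ℂ F]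

lemma phi_c (φ : Cn n →L[ℝ] F) (c : ℂ) (X : Cn n) : φ (c • X) = (c.re : ℂ) • φ X + (c.im : ℂ) • φ (I • X) := by
  rw [csmul_eq c X, map_add, map_smul, map_smul]
  congr 1 <;> exact (algebraMap_smul ℂ _ _).symm

lemma phi_Ic (φ : Cn n →L[ℝ] F) (c : ℂ) (X : Cn n) : φ (I • c • X) = (c.re : ℂ) • φ (I • X) - (c.im : ℂ) • φ X := by
  rw [smul_smul, phi_c]
  simp [sub_eq_neg_add]

lemma half_le (φ : Cn n →L[ℝ] F) (X : Cn n) {c : ℂ} (hc : ‖c‖ ≤ 1) : ‖(2:ℂ)⁻¹ • (φ X + c • φ (I • X))‖ ≤ ‖φ‖ * ‖X‖ := by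
  rw [norm_smul]
  have h1 := φ.le_opNorm X
  have h2 := φ.le_opNorm (I • X)
  have h3 := norm_add_le (φ X) (c • φ (I • X))
  rw [norm_smul, Complex.norm_I, one_mul] at h2
  rw [norm_smul c] at h3
  have : ‖c‖ * ‖φ (I • X)‖ ≤ ‖φ (I • X)‖ := mul_le_of_le_one_left (norm_nonneg _) hc
  norm_num; linarith

lemma mod1 (a b i : ℂ) (hi : i * i = -1) (x y : F) :
    (2:ℂ)⁻¹ • ((a • x + b • y) + (-i) • (a • y - b • x)) = (a + b * i) • ((2:ℂ)⁻¹ • (x + (-i) • y)) := by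
  have h1 : a + b * i = (a + b * i) := rfl
  have h2 : ((a + b * i) * -i) = b - a * i := by linear_combination (-b) * hi
  rw [smul_comm, smul_add (a + b * i), smul_smul (a + b * i), h2]
  module

lemma mod2 (a b i : ℂ) (hi : i * i = -1) (x y : F) :
    (2:ℂ)⁻¹ • ((a • x + b • y) + i • (a • y - b • x)) = (a - b * i) • ((2:ℂ)⁻¹ • (x + i • y)) := by
  have := mod1 a b (-i) (by rw [neg_mul_neg, hi]) x y
  rwa [neg_neg, mul_neg, ← sub_eq_add_neg] at this

def linL (φ : Cn n →L[ℝ] F) : Cn n →L[ℂ] F :=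
  LinearMap.mkContinuous
    { toFun := fun X ↦ (2:ℂ)⁻¹ • (φ X + (-I) • φ (I • X))
      map_add' := fun X Y ↦ by simp only [smul_add, map_add]; module
      map_smul' := fun c X ↦ by
        rw [phi_Ic, phi_c φ c X, RingHom.id_apply]
        conv_rhs => rw [← Complex.re_add_im c]
        exact mod1 _ _ _ Complex.I_mul_I _ _ } ‖φ‖ (fun X ↦ half_le φ X (by simp))

def alinL (φ : Cn n →L[ℝ] F) : Cn n →L⋆[ℂ] F :=
  LinearMap.mkContinuous
    { toFun := fun X ↦ (2:ℂ)⁻¹ • (φ X + I • φ (I • X))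
      map_add' := fun X Y ↦ by simp only [smul_add, map_add]; module
      map_smul' := fun c X ↦ by
        rw [phi_Ic, phi_c φ c X]
        have hc : (starRingEnd ℂ) c = (c.re : ℂ) - (c.im : ℂ) * I := by
          apply Complex.ext <;> simp
        rw [hc]
        exact mod2 _ _ _ Complex.I_mul_I _ _ } ‖φ‖ (fun X ↦ half_le φ X (by simp))

lemma linL_apply (φ : Cn n →L[ℝ] F) (X : Cn n) : linL φ X = (2:ℂ)⁻¹ • (φ X + (-I) • φ (I • X)) := rfl
lemma alinL_apply (φ : Cn n →L[ℝ] F) (X : Cn n) : alinL φ X = (2:ℂ)⁻¹ • (φ X + I • φ (I • X)) := rfl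

lemma c_smul (c : ℝ) (x : F) : c • x = (c : ℂ) • x := (algebraMap_smul ℂ _ _).symm

def linLL : (Cn n →L[ℝ] F) →L[ℝ] (Cn n →L[ℂ] F) :=
  LinearMap.mkContinuous
    { toFun := linL
      map_add' := fun φ ψ ↦ by ext X; simp only [linL_apply, add_apply]; module
      map_smul' := fun c φ ↦ by
        ext X; simp only [linL_apply, smul_apply, c_smul, RingHom.id_apply]; module } 1
    (fun φ ↦ ContinuousLinearMap.opNorm_le_bound _ (by positivity) fun X ↦ by rw [one_mul]; exact half_le φ X (by simp))

def alinLL : (Cn n →L[ℝ] F) →L[ℝ] (Cn n →L⋆[ℂ] F) :=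
  LinearMap.mkContinuous
    { toFun := alinL
      map_add' := fun φ ψ ↦ by ext X; simp only [alinL_apply, add_apply]; module
      map_smul' := fun c φ ↦ by
        ext X; simp only [alinL_apply, smul_apply, c_smul, RingHom.id_apply]; module } 1
    (fun φ ↦ ContinuousLinearMap.opNorm_le_bound _ (by positivity) fun X ↦ by rw [one_mul]; exact half_le φ X (by simp))

lemma linLL_apply (φ : Cn n →L[ℝ] F) (X : Cn n) : linLL φ X = (2:ℂ)⁻¹ • (φ X + (-I) • φ (I • X)) := rfl
lemma alinLL_apply (φ : Cn n →L[ℝ] F) (X : Cn n) : alinLL φ X = (2:ℂ)⁻¹ • (φ X + I • φ (I • X)) := rfl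

abbrev ofR1 : (Cn n →L[ℝ] ℝ) →L[ℝ] (Cn n →L[ℝ] ℂ) := ContinuousLinearMap.compL ℝ (Cn n) ℝ ℂ ofRealCLM
abbrev JA : (Cn n →L[ℝ] ℝ) →L[ℝ] (Cn n →L[ℂ] ℂ) := linLL ∘L ofR1
abbrev JQ : (Cn n →L[ℝ] Cn n →L[ℝ] ℝ) →L[ℝ] (Cn n →L[ℂ] Cn n →L[ℂ] ℂ) :=
  linLL ∘L (ContinuousLinearMap.compL ℝ (Cn n) (Cn n →L[ℝ] ℝ) (Cn n →L[ℂ] ℂ) JA)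
abbrev JB : (Cn n →L[ℝ] Cn n →L[ℝ] ℝ) →L[ℝ] (Cn n →L⋆[ℂ] Cn n →L[ℂ] ℂ) :=
  alinLL ∘L (ContinuousLinearMap.compL ℝ (Cn n) (Cn n →L[ℝ] ℝ) (Cn n →L[ℂ] ℂ) JA)
abbrev JT : (Cn n →L[ℝ] Cn n →L[ℝ] Cn n →L[ℝ] ℝ) →L[ℝ] (Cn n →L[ℂ] Cn n →L[ℂ] Cn n →L[ℂ] ℂ) :=
  linLL ∘L (ContinuousLinearMap.compL ℝ (Cn n) (Cn n →L[ℝ] Cn n →L[ℝ] ℝ) (Cn n →L[ℂ] Cn n →L[ℂ] ℂ) JQ)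
abbrev JP : (Cn n →L[ℝ] Cn n →L[ℝ] Cn n →L[ℝ] ℝ) →L[ℝ] (Cn n →L⋆[ℂ] Cn n →L[ℂ] Cn n →L[ℂ] ℂ) :=
  alinLL ∘L (ContinuousLinearMap.compL ℝ (Cn n) (Cn n →L[ℝ] Cn n →L[ℝ] ℝ) (Cn n →L[ℂ] Cn n →L[ℂ] ℂ) JQ)

lemma JA_re (l : Cn n →L[ℝ] ℝ) (h : Cn n) : l h = 2 * (JA l h).re := by
  simp [linLL_apply]

lemma JB_symm (D : Cn n →L[ℝ] Cn n →L[ℝ] ℝ) (hD : ∀ x y, D x y = D y x) (x y : Cn n) : JB D x y = conj (JB D y x) := by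
  simp [linLL_apply, alinLL_apply, hD y x, hD (I • y) x, hD (I • y) (I • x), hD y (I • x)]
  apply Complex.ext <;> simp <;> ring

lemma JQB (D : Cn n →L[ℝ] Cn n →L[ℝ] ℝ) (hD : ∀ x y, D x y = D y x) (h : Cn n) :
    (1/2 : ℝ) * D h h = 2 * (((1/2 : ℂ) • JQ D) h h).re + (JB D h h).re := by
  simp [linLL_apply, alinLL_apply, hD h (I • h)]
  ring

lemma JTP (S : Cn n →L[ℝ] Cn n →L[ℝ] Cn n →L[ℝ] ℝ) (h12 : ∀ x y w, S x y w = S y x w) (h23 : ∀ x y w, S x y w = S x w y) (h : Cn n) :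
    (1/6 : ℝ) * S h h h = 2 * (((1/6 : ℂ) • JT S) h h h).re + 2 * (((1/2 : ℂ) • JP S) h h h).re := by
  simp [linLL_apply, alinLL_apply]
  have e1 : S h h (I • h) = S (I • h) h h := by rw [h23, h12]
  have e2 : S h (I • h) h = S (I • h) h h := by rw [h12]
  have e3 : S h (I • h) (I • h) = S (I • h) (I • h) h := by rw [h12, h23]
  have e4 : S (I • h) h (I • h) = S (I • h) (I • h) h := by rw [h23]
  rw [e3, e4]
  ring

lemma JB_levi (D : Cn n →L[ℝ] Cn n →L[ℝ] ℝ) (h : Cn n) : (JB D h h).re = (D h h + D (I • h) (I • h)) / 4 := by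
  simp [linLL_apply, alinLL_apply]
  ring
end

section
set_option maxSynthPendingDepth 3

lemma sym2 {F : Type} [NormedAddCommGroup F] [NormedSpace ℝ F] {ε : ℝ} {m : ℕ} {f : Cn n → F} {p : Cn n} (hf : HC ε (m + 2) f p) :
    ∀ᶠ z in 𝓝 p, ∀ x y, fderiv ℝ (fderiv ℝ f) z x y = fderiv ℝ (fderiv ℝ f) z y x := by
  filter_upwards [hf.1.eventually_nhds, hf.2.1] with u u1 u2 x y
  exact second_derivative_symmetric_of_eventually (f' := fderiv ℝ f) (u1.mono fun w hw ↦ hw.hasFDerivAt) u2.hasFDerivAt x y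

lemma sym3 {ε : ℝ} {f : Cn n → ℝ} {p : Cn n} (hf : HC ε 3 f p) :
    ∀ᶠ z in 𝓝 p, ∀ u x y, fderiv ℝ (fderiv ℝ (fderiv ℝ f)) z u x y = fderiv ℝ (fderiv ℝ (fderiv ℝ f)) z u y x := by
  filter_upwards [(sym2 (m := 1) hf).eventually_nhds, hf.2.2.1] with z h1 h2 u x y
  have e : ∀ x y : Cn n, HasFDerivAt (fun w ↦ fderiv ℝ (fderiv ℝ f) w x y) (((fderiv ℝ (fderiv ℝ (fderiv ℝ f)) z).flip x).flip y) z := by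
    intro x y
    refine ((h2.hasFDerivAt.clm_apply (hasFDerivAt_const x z)).clm_apply (hasFDerivAt_const y z)).congr_fderiv ?_
    ext u; simp
  have := (e x y).unique ((e y x).congr_of_eventuallyEq (h1.mono fun w hw ↦ hw x y))
  simpa using congrArg (fun L ↦ L u) this

structure Jet (r : Cn n → ℝ) (μ m K C η : ℝ) (z : Cn n) where
  a : Cn n →L[ℂ] ℂ
  q : Cn n →L[ℂ] Cn n →L[ℂ] ℂ
  T : Cn n →L[ℂ] Cn n →L[ℂ] Cn n →L[ℂ] ℂ
  B : Cn n →L⋆[ℂ] Cn n →L[ℂ] ℂ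
  P : Cn n →L⋆[ℂ] Cn n →L[ℂ] Cn n →L[ℂ] ℂ
  n0 : Cn n
  na : ‖a‖ ≤ C
  nq : ‖q‖ ≤ C
  nT : ‖T‖ ≤ C
  nB : ‖B‖ ≤ C
  nP : ‖P‖ ≤ C
  nn : ‖n0‖ ≤ C
  an : a n0 = 1
  sB : ∀ x y, B x y = conj (B y x)
  pos : ∀ X, m * ‖X‖ ^ 2 ≤ (B X X).re + K * ‖a X‖ ^ 2
  tay : ∀ h, ‖h‖ < η → |r (z + h) - (r z + 2 * (a h + q h h + T h h h).re + (B h h).re + 2 * (P h h h).re)| ≤ C * ‖h‖ ^ μ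
  ha : ∀ X, a X = cderiv r z X
  hB : ∀ X, (B X X).re = leviForm r z X

lemma pos_form (a : Cn n →L[ℂ] ℂ) (B : Cn n →L⋆[ℂ] Cn n →L[ℂ] ℂ) (h : ∀ X, X ≠ 0 → a X = 0 → 0 < (B X X).re) :
    ∃ m K : ℝ, 0 < m ∧ 0 < K ∧ ∀ X, m * ‖X‖ ^ 2 ≤ (B X X).re + K * ‖a X‖ ^ 2 := by
  have cB : Continuous fun X : Cn n ↦ (B X X).re := by fun_prop
  have ca : Continuous fun X : Cn n ↦ ‖a X‖ ^ 2 := by fun_prop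
  have hS : IsCompact (sphere (0 : Cn n) 1) := isCompact_sphere 0 1
  obtain ⟨K, hK⟩ : ∃ K : ℕ, sphere (0 : Cn n) 1 ⊆ {X | 0 < (B X X).re + K * ‖a X‖ ^ 2} := by
    refine hS.elim_directed_cover (fun K : ℕ ↦ {X : Cn n | 0 < (B X X).re + K * ‖a X‖ ^ 2}) (fun K ↦ isOpen_lt continuous_const (by fun_prop)) ?_ ?_
    · intro X hX
      have hX0 : X ≠ 0 := by rintro rfl; simp at hX
      rw [mem_iUnion]
      by_cases h0 : a X = 0
      · exact ⟨0, by simpa [h0] using h X hX0 h0⟩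
      · have hp : 0 < ‖a X‖ ^ 2 := by positivity
        obtain ⟨N, hN⟩ := exists_nat_gt (-(B X X).re / ‖a X‖ ^ 2)
        rw [div_lt_iff₀ hp] at hN
        exact ⟨N, by simp only [mem_setOf_eq]; linarith⟩
    · refine directed_of_isDirected_le fun i j hij X hX ↦ ?_
      simp only [mem_setOf_eq] at *
      have : (i:ℝ) * ‖a X‖ ^ 2 ≤ j * ‖a X‖ ^ 2 := by gcongr
      linarith
  obtain ⟨m, m0, hm⟩ : ∃ m : ℝ, 0 < m ∧ ∀ X ∈ sphere (0 : Cn n) 1, m ≤ (B X X).re + K * ‖a X‖ ^ 2 := by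
    rcases (sphere (0 : Cn n) 1).eq_empty_or_nonempty with he | hne
    · exact ⟨1, one_pos, by simp [he]⟩
    · obtain ⟨x, hx, hx2⟩ := hS.exists_isMinOn hne (f := fun X : Cn n ↦ (B X X).re + K * ‖a X‖ ^ 2) (by fun_prop)
      exact ⟨_, hK hx, fun X hX ↦ hx2 hX⟩
  refine ⟨m, K + 1, m0, by positivity, fun X ↦ ?_⟩
  rcases eq_or_ne X 0 with rfl | hX
  · simp
  · have hn : ‖X‖ ≠ 0 := norm_ne_zero_iff.2 hX
    have := hm (((‖X‖⁻¹ : ℝ) : ℂ) • X) (by simp [norm_smul, hn])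
    simp only [map_smul, map_smulₛₗ, conj_ofReal, smul_apply, smul_eq_mul, norm_mul, norm_real, norm_inv, norm_norm, re_ofReal_mul] at this
    have h3 : 0 ≤ ‖a X‖ ^ 2 := by positivity
    have h4 : m * ‖X‖ ^ 2 ≤ ((‖X‖⁻¹ * (‖X‖⁻¹ * (B X X).re) + K * (‖X‖⁻¹ * ‖a X‖) ^ 2)) * ‖X‖ ^ 2 := by gcongr
    have h5 : (‖X‖⁻¹ * (‖X‖⁻¹ * (B X X).re) + K * (‖X‖⁻¹ * ‖a X‖) ^ 2) * ‖X‖ ^ 2 = (B X X).re + K * ‖a X‖ ^ 2 := by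
      field_simp
    linarith

lemma levi_eq {r : Cn n → ℝ} {z : Cn n} (h : DifferentiableAt ℝ (fderiv ℝ r) z) (X : Cn n) :
    leviForm r z X = (JB (fderiv ℝ (fderiv ℝ r) z) X X).re := by
  rw [JB_levi, leviForm]
  have e : ∀ Y, fderiv ℝ (fun w ↦ fderiv ℝ r w Y) z = (fderiv ℝ (fderiv ℝ r) z).flip Y := fun Y ↦ by
    rw [(h.hasFDerivAt.clm_apply (hasFDerivAt_const Y z)).fderiv]; ext; simp
  rw [e, e]; simp

lemma cder_eq (r : Cn n → ℝ) (z X : Cn n) : JA (fderiv ℝ r z) X = cderiv r z X := by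
  simp [cderiv, linLL_apply]; ring

lemma bd_at {G : Type} [NormedAddCommGroup G] {f : Cn n → G} {p : Cn n} (hf : ContinuousAt f p) : ∃ M : ℝ, ∀ᶠ z in 𝓝 p, ‖f z‖ ≤ M :=
  ⟨‖f p‖ + 1, (hf.norm.eventually_lt_const (lt_add_one _)).mono fun _ h ↦ h.le⟩

lemma hot {ε : ℝ} (hε : 0 < ε) {k : ℕ} (hk : k = 0 ∨ k = 1) {r : Cn n → ℝ} {p : Cn n} (hr : HC ε (k + 2) r p) :
    ∃ (T : Cn n → Cn n →L[ℂ] Cn n →L[ℂ] Cn n →L[ℂ] ℂ) (P : Cn n → Cn n →L⋆[ℂ] Cn n →L[ℂ] Cn n →L[ℂ] ℂ)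
      (M C η : ℝ), 0 < η ∧ (∀ᶠ z in 𝓝 p, ‖T z‖ ≤ M) ∧ (∀ᶠ z in 𝓝 p, ‖P z‖ ≤ M) ∧ ∀ᶠ z in 𝓝 p, ∀ h, ‖h‖ < η →
        |r (z + h) - r z - fderiv ℝ r z h - (1/2 : ℝ) * fderiv ℝ (fderiv ℝ r) z h h - (2 * (T z h h h).re + 2 * (P z h h h).re)| ≤ C * ‖h‖ ^ (2 + (k + ε) : ℝ) := by
  rcases hk with rfl | rfl
  · obtain ⟨C, η, C0, η0, h⟩ := tay2 hε hr
    refine ⟨0, 0, 0, C, η, η0, by simp, by simp, ?_⟩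
    filter_upwards [ball_mem_nhds p η0] with z hz w hw
    have := h z hz w hw
    simp only [norm_eq_abs, smul_eq_mul] at this
    simp only [Pi.zero_apply, zero_apply, Complex.zero_re, mul_zero, add_zero, sub_zero]
    convert this using 3; push_cast; ring
  · obtain ⟨C, η, C0, η0, h⟩ := tay3 hε hr
    have c4 : ContinuousAt (fun z ↦ (1/6 : ℂ) • JT (fderiv ℝ (fderiv ℝ (fderiv ℝ r)) z)) p :=
      by
      have : ContinuousAt (fun z ↦ JT (fderiv ℝ (fderiv ℝ (fderiv ℝ r)) z)) p := (JT (n := n)).continuous.continuousAt.comp (hr.2.2.2.cont hε)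
      exact this.const_smul (1/6 : ℂ)
    have c5 : ContinuousAt (fun z ↦ (1/2 : ℂ) • JP (fderiv ℝ (fderiv ℝ (fderiv ℝ r)) z)) p :=
      by
      have : ContinuousAt (fun z ↦ JP (fderiv ℝ (fderiv ℝ (fderiv ℝ r)) z)) p := (JP (n := n)).continuous.continuousAt.comp (hr.2.2.2.cont hε)
      exact this.const_smul (1/2 : ℂ)
    obtain ⟨M4, b4⟩ := bd_at c4
    obtain ⟨M5, b5⟩ := bd_at c5
    refine ⟨_, _, max M4 M5, C, η, η0, b4.mono fun z hz ↦ hz.trans (le_max_left _ _), b5.mono fun z hz ↦ hz.trans (le_max_right _ _), ?_⟩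
    filter_upwards [ball_mem_nhds p η0, sym3 hr, sym2 (m := 0) hr.2] with z hz s1 s2 w hw
    have := h z hz w hw
    simp only [norm_eq_abs, smul_eq_mul] at this
    rw [← JTP _ (fun x y w ↦ congrArg (fun L ↦ L w) (s2 x y)) s1]
    convert this using 3; push_cast; ring

lemma pos_pert {a a' : Cn n →L[ℂ] ℂ} {B B' : Cn n →L⋆[ℂ] Cn n →L[ℂ] ℂ} {m K : ℝ} (m0 : 0 < m) (K0 : 0 < K)
    (h2 : ‖a - a'‖ ^ 2 < m / (8 * K)) (h3 : ‖B - B'‖ < m / 4) {X : Cn n} (u1 : m * ‖X‖ ^ 2 ≤ (B' X X).re + K * ‖a' X‖ ^ 2) :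
    m / 2 * ‖X‖ ^ 2 ≤ (B X X).re + 2 * K * ‖a X‖ ^ 2 := by
  have u2 : (B' X X).re - (B X X).re ≤ m / 4 * ‖X‖ ^ 2 := by
    have v1 : ‖(B - B') X X‖ ≤ ‖B - B'‖ * ‖X‖ * ‖X‖ := ContinuousLinearMap.le_opNorm₂ _ _ _
    have v2 := Complex.abs_re_le_norm ((B - B') X X)
    have v3 := neg_abs_le ((B - B') X X).re
    simp only [sub_apply, sub_re] at v1 v2 v3
    nlinarith [sq_nonneg ‖X‖]
  have u3 : ‖a' X‖ ^ 2 ≤ 2 * ‖a X‖ ^ 2 + 2 * (‖a - a'‖ ^ 2 * ‖X‖ ^ 2) := by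
    have v1 : ‖a' X‖ ≤ ‖a X‖ + ‖a - a'‖ * ‖X‖ := by
      have := (a - a').le_opNorm X
      rw [sub_apply] at this
      have := norm_sub_norm_le (a' X) (a X)
      rw [norm_sub_rev] at this; linarith
    calc ‖a' X‖ ^ 2 ≤ (‖a X‖ + ‖a - a'‖ * ‖X‖) ^ 2 := by gcongr
      _ ≤ _ := by nlinarith [sq_nonneg (‖a X‖ - ‖a - a'‖ * ‖X‖)]
  have u4 : K * (2 * (‖a - a'‖ ^ 2 * ‖X‖ ^ 2)) ≤ m / 4 * ‖X‖ ^ 2 := by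
    have : K * ‖a - a'‖ ^ 2 ≤ m / 8 := by
      have := mul_le_mul_of_nonneg_left h2.le K0.le
      have e : K * (m / (8 * K)) = m / 8 := by field_simp
      linarith
    nlinarith [sq_nonneg ‖X‖]
  nlinarith [mul_le_mul_of_nonneg_left u3 K0.le]

theorem jets {ε : ℝ} (hε : 0 < ε) {k : ℕ} (hk : k = 0 ∨ k = 1) {r : Cn n → ℝ} {p : Cn n} (hr : HC ε (k + 2) r p) (hd : fderiv ℝ r p ≠ 0)
    (hL : ∀ X, X ≠ 0 → cderiv r p X = 0 → 0 < leviForm r p X) :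
    ∃ m K C η : ℝ, 0 < m ∧ 0 < K ∧ 1 ≤ C ∧ 0 < η ∧ ∀ z ∈ ball p η, Nonempty (Jet r (2 + (k + ε)) m K C η z) := by
  obtain ⟨m, K, m0, K0, hmK⟩ := pos_form (JA (fderiv ℝ r p)) (JB (fderiv ℝ (fderiv ℝ r) p)) (fun X hX h ↦ by
    rw [← levi_eq hr.2.1.self_of_nhds]; rw [cder_eq] at h; exact hL X hX h)
  obtain ⟨X1, hX1⟩ : ∃ X1, JA (fderiv ℝ r p) X1 = 1 := by
    obtain ⟨Y, hY⟩ : ∃ Y, JA (fderiv ℝ r p) Y ≠ 0 := by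
      by_contra hc
      push Not at hc
      exact hd (by ext x; rw [JA_re, hc]; simp)
    exact ⟨(JA (fderiv ℝ r p) Y)⁻¹ • Y, by rw [map_smul, smul_eq_mul, inv_mul_cancel₀ hY]⟩
  have c1 : ContinuousAt (fun z ↦ JA (fderiv ℝ r z)) p := (JA (n := n)).continuous.continuousAt.comp (hr.2.cont hε)
  have c2 : ContinuousAt (fun z ↦ JB (fderiv ℝ (fderiv ℝ r) z)) p := (JB (n := n)).continuous.continuousAt.comp (hr.2.2.cont hε)
  have c3 : ContinuousAt (fun z ↦ JQ (fderiv ℝ (fderiv ℝ r) z)) p := (JQ (n := n)).continuous.continuousAt.comp (hr.2.2.cont hε)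
  obtain ⟨M1, b1⟩ := bd_at c1
  obtain ⟨M2, b2⟩ := bd_at c2
  obtain ⟨M3, b3⟩ := bd_at c3
  have e1 : ∀ᶠ z in 𝓝 p, 1 / 2 < ‖JA (fderiv ℝ r z) X1‖ := by
    have : ContinuousAt (fun z ↦ ‖JA (fderiv ℝ r z) X1‖) p := (c1.clm_apply continuousAt_const).norm
    exact this.eventually_const_lt (by simp only [hX1]; norm_num)
  have e2 : ∀ᶠ z in 𝓝 p, ‖JA (fderiv ℝ r z) - JA (fderiv ℝ r p)‖ ^ 2 < m / (8 * K) := by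
    have : ContinuousAt (fun z ↦ ‖JA (fderiv ℝ r z) - JA (fderiv ℝ r p)‖ ^ 2) p := ((c1.sub continuousAt_const).norm).pow 2
    exact this.eventually_lt_const (by simp; positivity)
  have e3 : ∀ᶠ z in 𝓝 p, ‖JB (fderiv ℝ (fderiv ℝ r) z) - JB (fderiv ℝ (fderiv ℝ r) p)‖ < m / 4 := by
    have : ContinuousAt (fun z ↦ ‖JB (fderiv ℝ (fderiv ℝ r) z) - JB (fderiv ℝ (fderiv ℝ r) p)‖) p := (c2.sub continuousAt_const).norm
    exact this.eventually_lt_const (by simp; positivity)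
  have hpos : ∀ᶠ z in 𝓝 p, ∀ X, m / 2 * ‖X‖ ^ 2 ≤ (JB (fderiv ℝ (fderiv ℝ r) z) X X).re + 2 * K * ‖JA (fderiv ℝ r z) X‖ ^ 2 := by
    filter_upwards [e2, e3] with z h2 h3 X
    exact pos_pert m0 K0 h2 h3 (hmK X)
  obtain ⟨T, P, M4, C5, η5, hη5, b4, b5, b6⟩ := hot hε hk hr
  have all := ((b1.and (b2.and b3)).and (e1.and hpos)).and ((b4.and (b5.and b6)).and ((sym2 hr).and hr.2.1))
  obtain ⟨η6, hη6, h6⟩ := Metric.eventually_nhds_iff_ball.1 all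
  have M1p : 0 ≤ M1 := (norm_nonneg _).trans b1.self_of_nhds
  have M2p : 0 ≤ M2 := (norm_nonneg _).trans b2.self_of_nhds
  have M3p : 0 ≤ M3 := (norm_nonneg _).trans b3.self_of_nhds
  have M4p : 0 ≤ M4 := (norm_nonneg _).trans b4.self_of_nhds
  have X1p := norm_nonneg X1
  have C5p := abs_nonneg C5
  refine ⟨m / 2, 2 * K, 1 + M1 + M2 + M3 + M4 + 2 * ‖X1‖ + |C5|, min η5 η6, by positivity, by positivity, by linarith, lt_min hη5 hη6, fun z hz ↦ ?_⟩
  obtain ⟨⟨⟨d1, d2, d3⟩, d4, d5⟩, ⟨d6, d7, d8⟩, d9, d10⟩ := h6 z (ball_subset_ball (min_le_right _ _) hz)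
  have nz : JA (fderiv ℝ r z) X1 ≠ 0 := by intro h; rw [h, norm_zero] at d4; linarith
  refine ⟨{ a := JA (fderiv ℝ r z), q := (1/2 : ℂ) • JQ (fderiv ℝ (fderiv ℝ r) z), T := T z, B := JB (fderiv ℝ (fderiv ℝ r) z), P := P z
            n0 := (JA (fderiv ℝ r z) X1)⁻¹ • X1
            na := by linarith, nT := by linarith, nB := by linarith, nP := by linarith
            nq := ?_, nn := ?_
            an := by rw [map_smul, smul_eq_mul, inv_mul_cancel₀ nz]
            sB := JB_symm _ d9
            pos := d5
            tay := ?_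
            ha := cder_eq r z
            hB := fun X ↦ (levi_eq d10 X).symm }⟩
  · rw [norm_smul, show ‖(1/2 : ℂ)‖ = 1/2 by norm_num]
    have := norm_nonneg (JQ (fderiv ℝ (fderiv ℝ r) z))
    linarith
  · rw [norm_smul, norm_inv]
    have : ‖JA (fderiv ℝ r z) X1‖⁻¹ ≤ 2 := by
      have := inv_anti₀ (by norm_num) d4.le
      simpa using this
    have := mul_le_mul_of_nonneg_right this X1p
    linarith
  · intro h hh
    have v := d8 h (hh.trans_le (min_le_left _ _))
    rw [JA_re, JQB _ d9] at v
    refine le_trans (le_of_eq ?_) (v.trans (mul_le_mul_of_nonneg_right ?_ (by positivity)))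
    · congr 1; simp only [add_re]; ring
    · linarith [le_abs_self C5]
end

section
set_option maxSynthPendingDepth 3

def Jet.A {r : Cn n → ℝ} {μ m K C η : ℝ} {z : Cn n} (J : Jet r μ m K C η z) (h : Cn n) : ℂ :=
  J.a h + J.q h h + J.T h h h

def Jet.G {r : Cn n → ℝ} {μ m K C η : ℝ} {z : Cn n} (J : Jet r μ m K C η z) (X : Cn n) : ℝ :=
  (J.B X X).re + K * ‖J.a X‖ ^ 2

def Jet.b2 {r : Cn n → ℝ} {μ m K C η : ℝ} {z : Cn n} (J : Jet r μ m K C η z) (h : Cn n) : ℝ :=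
  J.G h + 2 * (J.P h h h).re + C ^ 2 / m * ‖h‖ ^ 4

def Jet.Y {r : Cn n → ℝ} {μ m K C η : ℝ} {z : Cn n} (J : Jet r μ m K C η z) (X h : Cn n) : ℂ :=
  J.B X h + K * (conj (J.a X) * J.a h) + J.P X h h

section
variable {r : Cn n → ℝ} {μ m K C η : ℝ} {z : Cn n} (J : Jet r μ m K C η z)

lemma Jet.bP (x y w : Cn n) : ‖J.P x y w‖ ≤ C * ‖x‖ * ‖y‖ * ‖w‖ :=
  ((J.P x y).le_opNorm w).trans (by gcongr; exact ((J.P x).le_opNorm y).trans (by gcongr; exact (J.P.le_opNorm x).trans (by gcongr; exact J.nP)))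
lemma Jet.bT (x y w : Cn n) : ‖J.T x y w‖ ≤ C * ‖x‖ * ‖y‖ * ‖w‖ :=
  ((J.T x y).le_opNorm w).trans (by gcongr; exact ((J.T x).le_opNorm y).trans (by gcongr; exact (J.T.le_opNorm x).trans (by gcongr; exact J.nT)))
lemma Jet.bq (x y : Cn n) : ‖J.q x y‖ ≤ C * ‖x‖ * ‖y‖ :=
  ((J.q x).le_opNorm y).trans (by gcongr; exact (J.q.le_opNorm x).trans (by gcongr; exact J.nq))
lemma Jet.bB (x y : Cn n) : ‖J.B x y‖ ≤ C * ‖x‖ * ‖y‖ :=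
  ((J.B x).le_opNorm y).trans (by gcongr; exact (J.B.le_opNorm x).trans (by gcongr; exact J.nB))
lemma Jet.ba (x : Cn n) : ‖J.a x‖ ≤ C * ‖x‖ := (J.a.le_opNorm x).trans (by gcongr; exact J.na)

lemma Jet.posG (X : Cn n) : m * ‖X‖ ^ 2 ≤ J.G X := J.pos X

lemma Jet.Ynn (hm : 0 < m) (h y : Cn n) : 0 ≤ J.G y + 2 * (J.P y h h).re + C ^ 2 / m * ‖h‖ ^ 4 := by
  have h1 := J.pos y
  have h2 := J.bP y h h
  have h3 := (abs_le.1 (Complex.abs_re_le_norm (J.P y h h))).1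
  have h4 : C ^ 2 / m * ‖h‖ ^ 4 = m * (C / m * ‖h‖ ^ 2) ^ 2 := by field_simp
  have h5 : 0 ≤ m * (‖y‖ - C / m * ‖h‖ ^ 2) ^ 2 := by positivity
  have h6 : m * (‖y‖ - C / m * ‖h‖ ^ 2) ^ 2 = m * ‖y‖ ^ 2 - 2 * (C * ‖y‖ * ‖h‖ * ‖h‖) + m * (C / m * ‖h‖ ^ 2) ^ 2 := by
    field_simp
    ring
  unfold Jet.G
  linarith

lemma Jet.expand (h X : Cn n) (s : ℂ) (c : ℝ) : J.G (h - s • X) + 2 * (J.P (h - s • X) h h).re + c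
    = (J.G h + 2 * (J.P h h h).re + c) - 2 * (conj s * J.Y X h).re + ‖s‖ ^ 2 * J.G X := by
  have e1 : ∀ w : ℂ, ‖w‖ ^ 2 = (conj w * w).re := fun w ↦ by
    rw [← normSq_eq_conj_mul_self, ofReal_re, normSq_eq_norm_sq]
  have e2 : ∀ w : ℂ, (conj w).re = w.re := Complex.conj_re
  have e3 : (s * J.B h X).re = (conj s * J.B X h).re := by
    rw [J.sB h X, ← e2]; simp
  have e4 : (s * (conj (J.a h) * J.a X)).re = (conj s * (conj (J.a X) * J.a h)).re := by
    rw [← e2]; simp; ring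
  have e5 : (conj s * s * J.B X X).re = (conj s * s).re * (J.B X X).re := by
    rw [← normSq_eq_conj_mul_self, re_ofReal_mul, ofReal_re]
  have e6 : (conj s * s * (conj (J.a X) * J.a X)).re = (conj s * s).re * (conj (J.a X) * J.a X).re := by
    rw [← normSq_eq_conj_mul_self, re_ofReal_mul, ofReal_re]
  have e7 : (conj s * J.Y X h).re = (conj s * J.B X h).re + K * (conj s * (conj (J.a X) * J.a h)).re + (conj s * J.P X h h).re := by
    rw [← re_ofReal_mul, ← add_re, ← add_re]; unfold Jet.Y; congr 1; ring
  have e8 : (J.B (h - s • X) (h - s • X)).re = (J.B h h).re - (s * J.B h X).re - (conj s * J.B X h).re + (conj s * s * J.B X X).re := by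
    rw [← sub_re, ← sub_re, ← add_re]; congr 1
    simp; ring
  have e9 : ‖J.a (h - s • X)‖ ^ 2 = ‖J.a h‖ ^ 2 - (s * (conj (J.a h) * J.a X)).re - (conj s * (conj (J.a X) * J.a h)).re + (conj s * s * (conj (J.a X) * J.a X)).re := by
    rw [e1, e1 (J.a h), ← sub_re, ← sub_re, ← add_re]; congr 1
    simp; ring
  have e10 : (J.P (h - s • X) h h).re = (J.P h h h).re - (conj s * J.P X h h).re := by
    rw [← sub_re]; congr 1; simp
  unfold Jet.G
  rw [e8, e9, e10, e7, e3, e4, e5, e6, e1 s, e1 (J.a X)]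
  ring

lemma Jet.cs (hm : 0 < m) (X h : Cn n) : ‖J.Y X h‖ ^ 2 ≤ J.G X * J.b2 h := by
  have hb : 0 ≤ J.b2 h := J.Ynn hm h h
  have hG : 0 ≤ J.G X := le_trans (by positivity) (J.pos X)
  have key : ∀ t : ℝ, 0 ≤ (‖J.Y X h‖ ^ 2 * J.G X) * (t * t) + (-2 * ‖J.Y X h‖ ^ 2) * t + J.b2 h := by
    intro t
    have h1 := J.Ynn hm h (h - ((t : ℂ) * J.Y X h) • X)
    rw [J.expand] at h1
    have h2 : (conj ((t : ℂ) * J.Y X h) * J.Y X h).re = t * ‖J.Y X h‖ ^ 2 := by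
      rw [map_mul, conj_ofReal, mul_assoc, re_ofReal_mul, ← normSq_eq_conj_mul_self, ofReal_re, normSq_eq_norm_sq]
    have h3 : ‖(t : ℂ) * J.Y X h‖ ^ 2 = t ^ 2 * ‖J.Y X h‖ ^ 2 := by
      rw [norm_mul, mul_pow, norm_real, norm_eq_abs, sq_abs]
    rw [h2, h3] at h1
    unfold Jet.b2
    linarith
  have := discrim_le_zero key
  unfold discrim at this
  rcases eq_or_ne (‖J.Y X h‖ ^ 2) 0 with h0 | h0
  · rw [h0]; positivity
  · have hp : 0 < ‖J.Y X h‖ ^ 2 := lt_of_le_of_ne (by positivity) (Ne.symm h0)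
    have h4 : ‖J.Y X h‖ ^ 2 * ‖J.Y X h‖ ^ 2 ≤ ‖J.Y X h‖ ^ 2 * (J.G X * J.b2 h) := by nlinarith
    exact le_of_mul_le_mul_left h4 hp

lemma Jet.num (hm : 0 < m) (X h : Cn n) {δ : ℝ} (hδ : 0 ≤ δ) (F : ℂ) :
    ‖(1 + δ * F) * conj (J.a X) + δ * F * J.Y X h‖ ^ 2 ≤ (‖1 + δ * F‖ ^ 2 + δ * ‖F‖ ^ 2 * J.b2 h) * (‖J.a X‖ ^ 2 + δ * J.G X) := by
  have hb : 0 ≤ J.b2 h := J.Ynn hm h h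
  have hG : 0 ≤ J.G X := le_trans (by positivity) (J.pos X)
  have h1 := J.cs hm X h
  have h2 : ‖(1 + δ * F) * conj (J.a X) + δ * F * J.Y X h‖ ≤ ‖1 + δ * F‖ * ‖J.a X‖ + δ * ‖F‖ * ‖J.Y X h‖ := by
    refine (norm_add_le _ _).trans (le_of_eq ?_)
    rw [norm_mul, norm_mul, norm_mul, norm_real, norm_of_nonneg hδ, RCLike.norm_conj]
  have h3 : ‖J.Y X h‖ ≤ √(J.G X) * √(J.b2 h) := by
    rw [← Real.sqrt_mul hG]; exact Real.le_sqrt_of_sq_le h1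
  have h4 := sq_sqrt hG
  have h5 := sq_sqrt hb
  have h6 := sq_sqrt hδ
  have h7 : ‖(1 + δ * F) * conj (J.a X) + δ * F * J.Y X h‖ ≤ ‖1 + δ * F‖ * ‖J.a X‖ + (√δ * ‖F‖ * √(J.b2 h)) * (√δ * √(J.G X)) := by
    refine h2.trans ?_
    have : δ * ‖F‖ * ‖J.Y X h‖ ≤ δ * ‖F‖ * (√(J.G X) * √(J.b2 h)) := by gcongr
    have e : (√δ * ‖F‖ * √(J.b2 h)) * (√δ * √(J.G X)) = (√δ) ^ 2 * ‖F‖ * (√(J.G X) * √(J.b2 h)) := by ring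
    rw [e, h6]; linarith
  calc _ ≤ (‖1 + δ * F‖ * ‖J.a X‖ + (√δ * ‖F‖ * √(J.b2 h)) * (√δ * √(J.G X))) ^ 2 := by gcongr
    _ ≤ (‖1 + δ * F‖ ^ 2 + (√δ * ‖F‖ * √(J.b2 h)) ^ 2) * (‖J.a X‖ ^ 2 + (√δ * √(J.G X)) ^ 2) := by
      nlinarith [sq_nonneg (‖1 + δ * F‖ * (√δ * √(J.G X)) - (√δ * ‖F‖ * √(J.b2 h)) * ‖J.a X‖)]
    _ = _ := by rw [mul_pow, mul_pow, mul_pow, h4, h5, h6]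

lemma Jet.b2_le (hm : 0 < m) (hK : 0 ≤ K) (h : Cn n) :
    J.b2 h ≤ (C + K * C ^ 2 + 2 * C * ‖h‖ + C ^ 2 / m * ‖h‖ ^ 2) * ‖h‖ ^ 2 := by
  have h1 := (Complex.re_le_norm _).trans (J.bB h h)
  have h2 := (Complex.re_le_norm _).trans (J.bP h h h)
  have h3 : ‖J.a h‖ ^ 2 ≤ (C * ‖h‖) ^ 2 := by gcongr; exact J.ba h
  have h4 := mul_le_mul_of_nonneg_left h3 hK
  unfold Jet.b2 Jet.G
  nlinarith

lemma Jet.Alip {h h' : Cn n} (hC : 0 ≤ C) (h1 : ‖h‖ ≤ 1) (h2 : ‖h'‖ ≤ 1) : ‖J.A h - J.A h'‖ ≤ 6 * C * ‖h - h'‖ := by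
  have e : J.A h - J.A h' = J.a (h - h') + (J.q (h - h') h + J.q h' (h - h')) + (J.T (h - h') h h + J.T h' (h - h') h + J.T h' h' (h - h')) := by
    unfold Jet.A; simp; ring
  rw [e]
  have b1 := J.ba (h - h')
  have b2 : ‖J.q (h - h') h‖ ≤ C * ‖h - h'‖ * 1 := (J.bq _ _).trans (by gcongr)
  have b3 : ‖J.q h' (h - h')‖ ≤ C * 1 * ‖h - h'‖ := (J.bq _ _).trans (by gcongr)
  have b4 : ‖J.T (h - h') h h‖ ≤ C * ‖h - h'‖ * 1 * 1 := (J.bT _ _ _).trans (by gcongr)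
  have b5 : ‖J.T h' (h - h') h‖ ≤ C * 1 * ‖h - h'‖ * 1 := (J.bT _ _ _).trans (by gcongr)
  have b6 : ‖J.T h' h' (h - h')‖ ≤ C * 1 * 1 * ‖h - h'‖ := (J.bT _ _ _).trans (by gcongr)
  refine (norm_add₃_le).trans ?_
  have := norm_add_le (J.q (h - h') h) (J.q h' (h - h'))
  have := norm_add₃_le (a := J.T (h - h') h h) (b := J.T h' (h - h') h) (c := J.T h' h' (h - h'))
  linarith

end
end

section
set_option maxSynthPendingDepth 3

variable {r : Cn n → ℝ} {e m K C η : ℝ}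

lemma rpow_split {x : ℝ} (hx : 0 ≤ x) (he : 0 < e) : x ^ (2 + 2 * e) = x ^ 2 * x ^ (2 * e) := by
  rw [Real.rpow_add_of_nonneg hx (by norm_num) (by positivity), rpow_two]

lemma Jet.tay_le {z : Cn n} (J : Jet r (2 + 2 * e) m K C η z) {h : Cn n} (hh : ‖h‖ < η) (hr : r (z + h) ≤ 0) :
    2 * (J.A h).re + (J.B h h).re + 2 * (J.P h h h).re + r z ≤ C * ‖h‖ ^ (2 + 2 * e) := by
  have := (abs_le.1 (J.tay h hh)).1
  unfold Jet.A
  linarith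

lemma small_r (hm : 0 < m) (hη : 0 < η) (he : 0 < e) (K C : ℝ) :
    ∃ x1, 0 < x1 ∧ x1 ≤ 1 ∧ x1 ≤ η ∧ ∀ x, 0 ≤ x → x < x1 → K * C * x ≤ 1 / 2 ∧ (2 * K * C ^ 2 + 2 * C) * x ≤ m / 4 ∧ C * x ^ (2 * e) ≤ m / 4 := by
  have c1 : ContinuousAt (fun x : ℝ ↦ K * C * x) 0 := by fun_prop
  have c2 : ContinuousAt (fun x : ℝ ↦ (2 * K * C ^ 2 + 2 * C) * x) 0 := by fun_prop
  have c3 : ContinuousAt (fun x : ℝ ↦ C * x ^ (2 * e)) 0 := (Real.continuousAt_rpow_const 0 (2 * e) (Or.inr (by positivity))).const_mul C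
  have e1 := c1.eventually_lt_const (u := 1 / 2) (by simp)
  have e2 := c2.eventually_lt_const (u := m / 4) (by simp; positivity)
  have e3 := c3.eventually_lt_const (u := m / 4) (by simp only [Real.zero_rpow (show 2 * e ≠ 0 by positivity)]; simp; positivity)
  obtain ⟨x1, hx1, hx⟩ := Metric.eventually_nhds_iff_ball.1 (e1.and (e2.and e3))
  refine ⟨min x1 (min 1 η), by positivity, (min_le_right _ _).trans (min_le_left _ _), (min_le_right _ _).trans (min_le_right _ _), fun x h0 h1 ↦ ?_⟩
  obtain ⟨a1, a2, a3⟩ := hx x (by simp only [Real.ball_eq_Ioo, mem_Ioo]; constructor <;> linarith [min_le_left x1 (min 1 η)])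
  exact ⟨a1.le, a2.le, a3.le⟩

lemma Jet.Rlow (hC : 0 ≤ C) (hK : 0 ≤ K) (he : 0 < e) {z : Cn n} (J : Jet r (2 + 2 * e) m K C η z) {h : Cn n} (hh : ‖h‖ < η) (hx1 : ‖h‖ ≤ 1)
    (hr : r (z + h) ≤ 0) (hδ : r z ≤ 0)
    (s1 : K * C * ‖h‖ ≤ 1 / 2) (s2 : (2 * K * C ^ 2 + 2 * C) * ‖h‖ ≤ m / 4) (s3 : C * ‖h‖ ^ (2 * e) ≤ m / 4) :
    min 1 m / 5 * (-r z + ‖h‖ ^ 2) ≤ ‖J.A h + r z‖ := by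
  have h0 := J.tay_le hh hr
  rw [rpow_split (norm_nonneg h) he] at h0
  have h1 := J.pos h
  have h2 := J.bP h h h
  have h3 := (abs_le.1 (Complex.abs_re_le_norm (J.P h h h))).1
  have h4 := (abs_le.1 (Complex.abs_re_le_norm (J.A h + r z))).1
  simp only [add_re, ofReal_re] at h4
  have h5 : ‖J.a h‖ ≤ ‖J.A h + r z‖ - r z + 2 * C * ‖h‖ ^ 2 := by
    have e1 : J.a h = (J.A h + r z) - r z - J.q h h - J.T h h h := by unfold Jet.A; ring
    have e2 := norm_sub_le ((J.A h + r z) - r z - J.q h h) (J.T h h h)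
    have e3 := norm_sub_le ((J.A h + r z) - r z) (J.q h h)
    have e4 := norm_sub_le (J.A h + r z) (r z : ℂ)
    rw [norm_real, Real.norm_of_nonpos hδ] at e4
    have e5 := J.bq h h
    have e6 : ‖J.T h h h‖ ≤ C * ‖h‖ * ‖h‖ * 1 := (J.bT h h h).trans (by gcongr)
    have e7 := congrArg norm e1
    linarith
  have h6 : K * ‖J.a h‖ ^ 2 ≤ K * C * ‖h‖ * (‖J.A h + r z‖ - r z + 2 * C * ‖h‖ ^ 2) := by
    calc K * ‖J.a h‖ ^ 2 = K * (‖J.a h‖ * ‖J.a h‖) := by ring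
      _ ≤ K * ((C * ‖h‖) * (‖J.A h + r z‖ - r z + 2 * C * ‖h‖ ^ 2)) := by gcongr; exact J.ba h
      _ = _ := by ring
  have n1 := norm_nonneg (J.A h + r z)
  have n2 : 0 ≤ ‖h‖ ^ 2 := by positivity
  have h7 : K * C * ‖h‖ * (‖J.A h + r z‖ - r z) ≤ 1 / 2 * (‖J.A h + r z‖ - r z) := mul_le_mul_of_nonneg_right s1 (by linarith)
  have h8 := mul_le_mul_of_nonneg_right s2 n2
  have h9 := mul_le_mul_of_nonneg_right s3 n2
  have h10 : -r z / 2 + m / 2 * ‖h‖ ^ 2 ≤ 5 / 2 * ‖J.A h + r z‖ := by linarith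
  have h11 : min 1 m * (-r z) ≤ 1 * (-r z) := mul_le_mul_of_nonneg_right (min_le_left _ _) (by linarith)
  have h12 : min 1 m * ‖h‖ ^ 2 ≤ m * ‖h‖ ^ 2 := mul_le_mul_of_nonneg_right (min_le_right _ _) n2
  linarith

lemma pow_trade {δ x : ℝ} (hδ : 0 < δ) (hx : 0 ≤ x) (he : 0 < e) (he1 : e ≤ 1) : δ * x ^ (2 + 2 * e) ≤ δ ^ e * (δ + x ^ 2) ^ 2 := by
  have y0 : (0:ℝ) ≤ x ^ 2 := by positivity
  have y1 : 0 < δ + x ^ 2 := by positivity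
  have e1 : x ^ (2 + 2 * e) = (x ^ 2) ^ (1 + e) := by
    rw [← rpow_two, ← Real.rpow_mul hx]; congr 1; ring
  have e2 : δ = δ ^ e * δ ^ (1 - e) := by rw [← Real.rpow_add hδ]; simp
  have e3 : (δ + x ^ 2) ^ 2 = (δ + x ^ 2) ^ (1 - e) * (δ + x ^ 2) ^ (1 + e) := by
    rw [← Real.rpow_add y1, ← rpow_two]; congr 1; ring
  rw [e1, e3]
  calc δ * (x ^ 2) ^ (1 + e) = δ ^ e * (δ ^ (1 - e) * (x ^ 2) ^ (1 + e)) := by rw [← mul_assoc, ← e2]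
    _ ≤ _ := by
      gcongr
      · exact le_add_of_nonneg_right y0
      · exact le_add_of_nonneg_left hδ.le

lemma near_scalar {A V : ℂ} {δ x c b C2 D : ℝ} (hδ : 0 < δ) (hδ1 : δ ≤ 1) (hc : 0 < c) (hx1 : x ≤ 1) (he : 0 < e) (he1 : e ≤ 1)
    (hx : 0 ≤ x) (hV : ‖V‖ ≤ C2) (hD : 0 ≤ D) (hb : 0 ≤ b) (hR : c * (δ + x ^ 2) ≤ ‖A - δ‖) (hbx : b ≤ D * x ^ 2)
    (hE : 2 * A.re - δ + b ≤ D * x ^ (2 + 2 * e) + D * (‖A - δ‖ + δ + x ^ 2) ^ 2 + D * x ^ 4) :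
    ‖1 + δ * ((A - δ)⁻¹ - V)‖ ^ 2 + δ * ‖(A - δ)⁻¹ - V‖ ^ 2 * b ≤
      1 + (2 * C2 * (1 + 1 / c) + C2 ^ 2 + D * (2 * C2 / c + C2 ^ 2) + D / c ^ 2 + D * (1 + 1 / c) ^ 2 + D / c ^ 2) * δ ^ e := by
  have hs : 0 < δ + x ^ 2 := by positivity
  have hRp : 0 < ‖A - δ‖ := lt_of_lt_of_le (by positivity) hR
  have C20 : 0 ≤ C2 := (norm_nonneg V).trans hV
  set R := A - (δ : ℂ) with hRd
  have hR0 : R ≠ 0 := norm_pos_iff.1 hRp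
  set u := ‖R‖⁻¹ with hu
  have u0 : 0 < u := by positivity
  have us : (δ + x ^ 2) * u ≤ 1 / c := by
    rw [hu, le_div_iff₀ hc, mul_comm, ← mul_assoc]
    exact (mul_inv_le_iff₀ hRp).2 (by linarith)
  have uR : ‖R‖ * u = 1 := mul_inv_cancel₀ hRp.ne'
  have du : δ * u ≤ 1 / c := le_trans (by nlinarith [sq_nonneg x]) us
  have xu : x ^ 2 * u ≤ 1 / c := le_trans (by nlinarith [sq_nonneg x]) us
  have dde : δ ≤ δ ^ e := by simpa using rpow_le_rpow_of_exponent_ge hδ hδ1 he1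
  have hA : ‖A‖ ≤ ‖R‖ + δ := by
    have : A = R + δ := by rw [hRd]; ring
    rw [this]; refine (norm_add_le _ _).trans ?_
    rw [norm_real, norm_of_nonneg hδ.le]
  have hAu : ‖A‖ * u ≤ 1 + 1 / c := by nlinarith
  have t1 : ‖1 + δ * (R⁻¹ - V)‖ ≤ ‖A‖ * u + δ * C2 := by
    have : 1 + δ * (R⁻¹ - V) = A * R⁻¹ - δ * V := by
      have : A = R + δ := by rw [hRd]; ring
      rw [this]; field_simp; ring
    rw [this]; refine (norm_sub_le _ _).trans ?_
    rw [norm_mul, norm_mul, norm_inv, norm_real, norm_of_nonneg hδ.le]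
    gcongr
  have t2 : ‖R⁻¹ - V‖ ≤ u + C2 := (norm_sub_le _ _).trans (by rw [norm_inv]; gcongr)
  have k1 : ‖1 + δ * (R⁻¹ - V)‖ ^ 2 ≤ ‖A‖ ^ 2 * u ^ 2 + (2 * C2 * (1 + 1 / c) + C2 ^ 2) * δ := by
    calc _ ≤ (‖A‖ * u + δ * C2) ^ 2 := by gcongr
      _ = ‖A‖ ^ 2 * u ^ 2 + δ * (2 * C2 * (‖A‖ * u)) + δ * (δ * C2 ^ 2) := by ring
      _ ≤ ‖A‖ ^ 2 * u ^ 2 + δ * (2 * C2 * (1 + 1 / c)) + δ * (1 * C2 ^ 2) := by gcongr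
      _ = _ := by ring
  have bu : b * u ≤ D / c := by
    calc b * u ≤ D * x ^ 2 * u := by gcongr
      _ = D * (x ^ 2 * u) := by ring
      _ ≤ D * (1 / c) := by gcongr
      _ = _ := by ring
  have bD : b ≤ D := hbx.trans (by nlinarith [pow_le_one₀ hx hx1 (n := 2)])
  have k2 : δ * ‖R⁻¹ - V‖ ^ 2 * b ≤ δ * b * u ^ 2 + D * (2 * C2 / c + C2 ^ 2) * δ := by
    calc _ ≤ δ * (u + C2) ^ 2 * b := by gcongr
      _ = δ * b * u ^ 2 + δ * (2 * C2 * (b * u)) + δ * (C2 ^ 2 * b) := by ring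
      _ ≤ δ * b * u ^ 2 + δ * (2 * C2 * (D / c)) + δ * (C2 ^ 2 * D) := by gcongr
      _ = _ := by ring
  have sq : ‖A‖ ^ 2 = ‖R‖ ^ 2 + δ * (2 * A.re - δ) := by
    rw [hRd, ← normSq_eq_norm_sq, ← normSq_eq_norm_sq, Complex.normSq_apply, Complex.normSq_apply]
    simp; ring
  have k3 : (‖A‖ ^ 2 + δ * b) * u ^ 2 = 1 + δ * u ^ 2 * (2 * A.re - δ + b) := by
    rw [sq]
    have : ‖R‖ ^ 2 * u ^ 2 = 1 := by rw [← mul_pow, uR, one_pow]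
    linear_combination this
  have k4 : δ * u ^ 2 * (2 * A.re - δ + b) ≤ δ * u ^ 2 * (D * x ^ (2 + 2 * e) + D * (‖R‖ + δ + x ^ 2) ^ 2 + D * x ^ 4) := by gcongr
  have k5 : δ * u ^ 2 * x ^ (2 + 2 * e) ≤ δ ^ e / c ^ 2 := by
    calc δ * u ^ 2 * x ^ (2 + 2 * e) = u ^ 2 * (δ * x ^ (2 + 2 * e)) := by ring
      _ ≤ u ^ 2 * (δ ^ e * (δ + x ^ 2) ^ 2) := mul_le_mul_of_nonneg_left (pow_trade hδ hx he he1) (by positivity)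
      _ = δ ^ e * ((δ + x ^ 2) * u) ^ 2 := by ring
      _ ≤ δ ^ e * (1 / c) ^ 2 := by gcongr
      _ = _ := by ring
  have k6 : δ * u ^ 2 * (‖R‖ + δ + x ^ 2) ^ 2 ≤ (1 + 1 / c) ^ 2 * δ := by
    calc δ * u ^ 2 * (‖R‖ + δ + x ^ 2) ^ 2 = (‖R‖ * u + (δ + x ^ 2) * u) ^ 2 * δ := by ring
      _ ≤ _ := by rw [uR]; gcongr
  have k7 : δ * u ^ 2 * x ^ 4 ≤ δ / c ^ 2 := by
    calc δ * u ^ 2 * x ^ 4 = (x ^ 2 * u) ^ 2 * δ := by ring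
      _ ≤ (1 / c) ^ 2 * δ := by gcongr
      _ = _ := by ring
  have k8 := mul_le_mul_of_nonneg_left k5 hD
  have k9 := mul_le_mul_of_nonneg_left k6 hD
  have k10 := mul_le_mul_of_nonneg_left k7 hD
  set S := 2 * C2 * (1 + 1 / c) + C2 ^ 2 + D * (2 * C2 / c + C2 ^ 2) + D * (1 + 1 / c) ^ 2 + D / c ^ 2 with hS
  have S0 : 0 ≤ S := by positivity
  have k11 : S * δ ≤ S * δ ^ e := by gcongr
  have k12 : ‖1 + δ * (R⁻¹ - V)‖ ^ 2 + δ * ‖R⁻¹ - V‖ ^ 2 * b ≤ 1 + S * δ + D / c ^ 2 * δ ^ e := by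
    have x1 : D * (δ ^ e / c ^ 2) = D / c ^ 2 * δ ^ e := by ring
    rw [x1] at k8
    have x3 : S * δ = (2 * C2 * (1 + 1 / c) + C2 ^ 2) * δ + D * (2 * C2 / c + C2 ^ 2) * δ + D * ((1 + 1 / c) ^ 2 * δ) + D * (δ / c ^ 2) := by rw [hS]; ring
    have x4 : δ * u ^ 2 * (D * x ^ (2 + 2 * e) + D * (‖R‖ + δ + x ^ 2) ^ 2 + D * x ^ 4) = D * (δ * u ^ 2 * x ^ (2 + 2 * e)) + D * (δ * u ^ 2 * (‖R‖ + δ + x ^ 2) ^ 2) + D * (δ * u ^ 2 * x ^ 4) := by ring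
    have x5 : (‖A‖ ^ 2 + δ * b) * u ^ 2 = ‖A‖ ^ 2 * u ^ 2 + δ * b * u ^ 2 := by ring
    rw [x4] at k4
    rw [x5] at k3
    clear_value S
    generalize D * (δ * u ^ 2 * x ^ (2 + 2 * e)) = g1 at *
    generalize D * (δ * u ^ 2 * (‖R‖ + δ + x ^ 2) ^ 2) = g2 at *
    generalize D * (δ * u ^ 2 * x ^ 4) = g3 at *
    generalize δ * u ^ 2 * (2 * A.re - δ + b) = g4 at *
    generalize D * (2 * C2 / c + C2 ^ 2) * δ = g5 at *
    generalize (2 * C2 * (1 + 1 / c) + C2 ^ 2) * δ = g6 at *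
    generalize D * ((1 + 1 / c) ^ 2 * δ) = g7 at *
    linarith only [k1, k2, k3, k4, k8, k9, k10, x3]
  refine k12.trans ?_
  have x6 : (2 * C2 * (1 + 1 / c) + C2 ^ 2 + D * (2 * C2 / c + C2 ^ 2) + D / c ^ 2 + D * (1 + 1 / c) ^ 2 + D / c ^ 2) * δ ^ e = S * δ ^ e + D / c ^ 2 * δ ^ e := by rw [hS]; ring
  linarith only [k11, x6]

end

section
set_option maxSynthPendingDepth 3

variable {r : Cn n → ℝ} {e m K C η : ℝ}

lemma Jet.near (hm : 0 < m) (hK : 0 ≤ K) (hC : 1 ≤ C) (he : 0 < e) (he1 : e ≤ 1) {C2 : ℝ} (hC2 : 0 ≤ C2) : ∃ C3, 0 ≤ C3 ∧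
    ∀ {z : Cn n} (J : Jet r (2 + 2 * e) m K C η z) {h : Cn n} (_ : ‖h‖ < η) (_ : ‖h‖ ≤ 1)
    (_ : r (z + h) ≤ 0) (_ : r z < 0) (_ : -r z ≤ 1) (_ : min 1 m / 5 * (-r z + ‖h‖ ^ 2) ≤ ‖J.A h + r z‖) (V : ℂ) (_ : ‖V‖ ≤ C2),
    ‖1 + ((-r z : ℝ) : ℂ) * ((J.A h + r z)⁻¹ - V)‖ ^ 2 + (-r z) * ‖(J.A h + r z)⁻¹ - V‖ ^ 2 * J.b2 h ≤ 1 + C3 * (-r z) ^ e := by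
  set c := min 1 m / 5 with hc
  have c0 : 0 < c := by have := lt_min one_pos hm; positivity
  set D := 3 * C + 4 * K * C ^ 2 + C ^ 2 / m with hD
  have D0 : 0 ≤ D := by positivity
  refine ⟨2 * C2 * (1 + 1 / c) + C2 ^ 2 + D * (2 * C2 / c + C2 ^ 2) + D / c ^ 2 + D * (1 + 1 / c) ^ 2 + D / c ^ 2, by positivity, ?_⟩
  intro z J h hh h1 hr hz hz1 hR V hV
  have eR : J.A h + r z = J.A h - ((-r z : ℝ) : ℂ) := by push_cast; ring
  rw [eR] at hR ⊢
  have n1 := norm_nonneg h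
  refine near_scalar (x := ‖h‖) (by linarith) hz1 c0 h1 he he1 n1 hV D0 (J.Ynn hm h h) hR ?_ ?_
  · refine (J.b2_le hm hK h).trans ?_
    gcongr
    have k1 : 2 * C * ‖h‖ ≤ 2 * C * 1 := by gcongr
    have k2 : C ^ 2 / m * ‖h‖ ^ 2 ≤ C ^ 2 / m * 1 := by gcongr; exact pow_le_one₀ n1 h1
    have k3 : 0 ≤ K * C ^ 2 := by positivity
    linarith
  · have h0 := J.tay_le hh hr
    have h5 : ‖J.a h‖ ≤ 2 * C * (‖J.A h - ((-r z : ℝ) : ℂ)‖ + -r z + ‖h‖ ^ 2) := by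
      have e1 : J.a h = (J.A h - ((-r z : ℝ) : ℂ)) + ((-r z : ℝ) : ℂ) - J.q h h - J.T h h h := by unfold Jet.A; ring
      have e2 := norm_sub_le ((J.A h - ((-r z : ℝ) : ℂ)) + ((-r z : ℝ) : ℂ) - J.q h h) (J.T h h h)
      have e3 := norm_sub_le ((J.A h - ((-r z : ℝ) : ℂ)) + ((-r z : ℝ) : ℂ)) (J.q h h)
      have e4 := norm_add_le (J.A h - ((-r z : ℝ) : ℂ)) ((-r z : ℝ) : ℂ)
      rw [norm_real, norm_of_nonneg (by linarith)] at e4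
      have e5 := J.bq h h
      have e6 : ‖J.T h h h‖ ≤ C * ‖h‖ * ‖h‖ * 1 := (J.bT h h h).trans (by gcongr)
      have e7 := congrArg norm e1
      have e8 : 1 * (‖J.A h - ((-r z : ℝ) : ℂ)‖ + -r z) ≤ 2 * C * (‖J.A h - ((-r z : ℝ) : ℂ)‖ + -r z) :=
        mul_le_mul_of_nonneg_right (by linarith) (by linarith [norm_nonneg (J.A h - ((-r z : ℝ) : ℂ))])
      linarith
    have h6 : K * ‖J.a h‖ ^ 2 ≤ 4 * K * C ^ 2 * (‖J.A h - ((-r z : ℝ) : ℂ)‖ + -r z + ‖h‖ ^ 2) ^ 2 := by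
      calc K * ‖J.a h‖ ^ 2 ≤ K * (2 * C * (‖J.A h - ((-r z : ℝ) : ℂ)‖ + -r z + ‖h‖ ^ 2)) ^ 2 := by gcongr
        _ = _ := by ring
    have h7 : 4 * K * C ^ 2 * (‖J.A h - ((-r z : ℝ) : ℂ)‖ + -r z + ‖h‖ ^ 2) ^ 2 ≤ D * (‖J.A h - ((-r z : ℝ) : ℂ)‖ + -r z + ‖h‖ ^ 2) ^ 2 := by
      gcongr; rw [hD]; have : 0 ≤ C ^ 2 / m := by positivity
      linarith
    have h8 : C * ‖h‖ ^ (2 + 2 * e) ≤ D * ‖h‖ ^ (2 + 2 * e) := by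
      gcongr; rw [hD]; have : 0 ≤ C ^ 2 / m := by positivity
      have : 0 ≤ 4 * K * C ^ 2 := by positivity
      linarith
    have h9 : C ^ 2 / m * ‖h‖ ^ 4 ≤ D * ‖h‖ ^ 4 := by
      gcongr; rw [hD]; have : 0 ≤ 4 * K * C ^ 2 := by positivity
      linarith
    unfold Jet.b2 Jet.G
    linarith

lemma Jet.far (hm : 0 < m) (hK : 0 ≤ K) (hC : 1 ≤ C) (he1 : e ≤ 1) {C2 Λ : ℝ} (hC2 : 0 ≤ C2) (hΛ : 0 ≤ Λ) : ∃ C3, 0 ≤ C3 ∧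
    ∀ {z : Cn n} (J : Jet r (2 + 2 * e) m K C η z) {h : Cn n} (_ : ‖h‖ ≤ Λ) {δ : ℝ} (_ : 0 < δ) (_ : δ ≤ 1) (F : ℂ) (_ : ‖F‖ ≤ C2),
    ‖1 + (δ : ℂ) * F‖ ^ 2 + δ * ‖F‖ ^ 2 * J.b2 h ≤ 1 + C3 * δ ^ e := by
  refine ⟨2 * C2 + C2 ^ 2 + C2 ^ 2 * ((C + K * C ^ 2 + 2 * C * Λ + C ^ 2 / m * Λ ^ 2) * Λ ^ 2), by positivity, ?_⟩
  intro z J h hh δ d0 d1 F hF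
  have hb := J.b2_le hm hK h
  have hb2 : J.b2 h ≤ (C + K * C ^ 2 + 2 * C * Λ + C ^ 2 / m * Λ ^ 2) * Λ ^ 2 := hb.trans (by gcongr)
  have b0 : 0 ≤ J.b2 h := J.Ynn hm h h
  generalize (C + K * C ^ 2 + 2 * C * Λ + C ^ 2 / m * Λ ^ 2) * Λ ^ 2 = M at *
  have dde : δ ≤ δ ^ e := by simpa using rpow_le_rpow_of_exponent_ge d0 d1 he1
  have M0 := b0.trans hb2
  have k1 : ‖1 + (δ : ℂ) * F‖ ≤ 1 + δ * C2 := by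
    refine (norm_add_le _ _).trans ?_
    rw [norm_mul, norm_real, norm_of_nonneg d0.le, norm_one]; gcongr
  calc _ ≤ (1 + δ * C2) ^ 2 + δ * C2 ^ 2 * M := by gcongr
    _ = 1 + δ * (2 * C2) + δ * (δ * C2 ^ 2) + δ * (C2 ^ 2 * M) := by ring
    _ ≤ 1 + δ * (2 * C2) + δ * (1 * C2 ^ 2) + δ * (C2 ^ 2 * M) := by gcongr
    _ = 1 + (2 * C2 + C2 ^ 2 + C2 ^ 2 * M) * δ := by ring
    _ ≤ _ := by gcongr

lemma Jet.GX {z : Cn n} {μ : ℝ} (J : Jet r μ m K C η z) (X : Cn n) : J.B X X + K * (conj (J.a X) * J.a X) = (J.G X : ℂ) := by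
  have h1 : J.B X X = ((J.B X X).re : ℂ) := by
    apply Complex.ext
    · simp
    · have := congrArg Complex.im (J.sB X X)
      simp only [Complex.conj_im] at this
      simp; linarith
  rw [← normSq_eq_conj_mul_self, normSq_eq_norm_sq, h1]
  unfold Jet.G; push_cast; simp

lemma Jet.dnum {z : Cn n} {μ : ℝ} (J : Jet r μ m K C η z) (hz : r z ≠ 0) {F V : Cn n → ℂ} (hF : DifferentiableAt ℂ F z) (hV : DifferentiableAt ℂ V z)
    (hFV : ∀ᶠ w in 𝓝 z, F w = (J.A (w - z) + r z)⁻¹ - V w) (X : Cn n) :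
    fderiv ℂ (fun w ↦ (1 + ((-r z : ℝ) : ℂ) * F w) * conj (J.a X) + ((-r z : ℝ) : ℂ) * F w * J.Y X (w - z)) z X
      = ((‖J.a X‖ ^ 2 + (-r z) * J.G X) / r z : ℝ) + r z * (fderiv ℂ V z X * conj (J.a X) + V z * J.G X) := by
  have dY : DifferentiableAt ℂ (fun w ↦ J.Y X (w - z)) z := by unfold Jet.Y; fun_prop
  have dg : DifferentiableAt ℂ (fun w ↦ (1 + ((-r z : ℝ) : ℂ) * F w) * conj (J.a X) + ((-r z : ℝ) : ℂ) * F w * J.Y X (w - z)) z := by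
    fun_prop
  have rz : (r z : ℂ) ≠ 0 := by exact_mod_cast hz
  rw [← dg.lineDeriv_eq_fderiv, lineDeriv]
  have hc : ContinuousAt (fun t : ℂ ↦ z + t • X) 0 := by fun_prop
  have hz0 : z + (0 : ℂ) • X = z := by simp
  have hFl : HasDerivAt (fun t : ℂ ↦ F (z + t • X)) (-(J.a X) / (r z : ℂ) ^ 2 - fderiv ℂ V z X) 0 := by
    have h1 : HasDerivAt (fun t : ℂ ↦ t * J.a X + t ^ 2 * J.q X X + t ^ 3 * J.T X X X + r z) (J.a X) 0 := by
      have := ((((hasDerivAt_id (0:ℂ)).mul_const (J.a X)).add (((hasDerivAt_id (0:ℂ)).pow 2).mul_const (J.q X X))).add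
        (((hasDerivAt_id (0:ℂ)).pow 3).mul_const (J.T X X X))).add_const (r z : ℂ)
      exact this.congr_deriv (by simp)
    have h2 := h1.fun_inv (by simpa using rz)
    have h3 : HasDerivAt (fun t : ℂ ↦ V (z + t • X)) (fderiv ℂ V z X) 0 := hV.hasFDerivAt.hasLineDerivAt X
    refine ((h2.sub h3).congr_deriv (by simp)).congr_of_eventuallyEq ?_
    have hc2 : Tendsto (fun t : ℂ ↦ z + t • X) (𝓝 0) (𝓝 z) := by have := hc.tendsto; simp only [hz0] at this; exact this
    filter_upwards [hc2.eventually hFV] with t ht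
    rw [ht]
    simp only [Pi.sub_apply]
    congr 2
    unfold Jet.A; simp; ring
  have hYl : HasDerivAt (fun t : ℂ ↦ J.Y X (z + t • X - z)) (J.G X : ℂ) 0 := by
    have h1 : HasDerivAt (fun t : ℂ ↦ t * (J.G X : ℂ) + t ^ 2 * J.P X X X) (J.G X : ℂ) 0 := by
      have := ((hasDerivAt_id (0:ℂ)).mul_const (J.G X : ℂ)).add (((hasDerivAt_id (0:ℂ)).pow 2).mul_const (J.P X X X))
      exact this.congr_deriv (by simp)
    refine h1.congr_of_eventuallyEq (Eventually.of_forall fun t ↦ ?_)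
    unfold Jet.Y
    rw [← J.GX]
    simp; ring
  have hall := (((hFl.const_mul ((-r z : ℝ) : ℂ)).const_add 1).mul_const (conj (J.a X))).add ((hFl.const_mul ((-r z : ℝ) : ℂ)).mul hYl)
  have hFz : F z = (r z : ℂ)⁻¹ - V z := by
    rw [hFV.self_of_nhds]; simp [Jet.A]
  have hd := hall.deriv
  refine Eq.trans hd ?_
  have hY0 : J.Y X (z + (0:ℂ) • X - z) = 0 := by simp [Jet.Y]
  rw [hY0, hz0, hFz]
  have hn : (‖J.a X‖ ^ 2 : ℂ) = conj (J.a X) * J.a X := by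
    rw [← normSq_eq_conj_mul_self, normSq_eq_norm_sq]; push_cast; rfl
  push_cast
  rw [hn]
  field_simp
  ring
end

section
set_option maxSynthPendingDepth 3

variable {r : Cn n → ℝ} {e m K C η : ℝ}

lemma low_alg {N δ a G x C2 C6 : ℝ} (hm : 0 < m) (hδ : 0 < δ) (hδ1 : δ ≤ 1) (hN : 0 ≤ N) (ha : 0 ≤ a) (hx : 0 ≤ x) (hC2 : 0 ≤ C2) (hC6 : 0 ≤ C6)
    (hNN : N ^ 2 = a ^ 2 + δ * G) (hG : m * x ^ 2 ≤ G) :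
    δ * (C6 * x * a + C2 * G) ≤ (C6 * (1 + 1 / m) + C2) * N ^ 2 := by
  have G0 : 0 ≤ G := le_trans (by positivity) hG
  have h1 : a ^ 2 ≤ N ^ 2 := by rw [hNN]; have := mul_nonneg hδ.le G0; linarith
  have h2 : δ * (m * x ^ 2) ≤ N ^ 2 := by rw [hNN]; have := mul_le_mul_of_nonneg_left hG hδ.le; nlinarith [sq_nonneg a]
  have h3 : δ * G ≤ N ^ 2 := by rw [hNN]; nlinarith [sq_nonneg a]
  have h4 : δ * (x * a) ≤ (1 + 1 / m) * N ^ 2 := by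
    have k1 : 2 * (x * a) * m ≤ m ^ 2 * x ^ 2 + a ^ 2 := by nlinarith [sq_nonneg (m * x - a)]
    have k2 : δ * (m * x ^ 2) * m ≤ N ^ 2 * m := mul_le_mul_of_nonneg_right h2 hm.le
    have k3 : δ * a ^ 2 ≤ 1 * N ^ 2 := mul_le_mul hδ1 h1 (by positivity) (by norm_num)
    have k4 := mul_le_mul_of_nonneg_left k1 hδ.le
    have k5 : (1 + 1 / m) * N ^ 2 * m = N ^ 2 * m + N ^ 2 := by field_simp
    have k6 : 0 ≤ N ^ 2 * m := by positivity
    refine le_of_mul_le_mul_right ?_ hm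
    rw [k5]
    nlinarith [sq_nonneg N]
  have h5 := mul_le_mul_of_nonneg_left h4 hC6
  have h6 := mul_le_mul_of_nonneg_left h3 hC2
  nlinarith

theorem lower (hn : 0 < n) {Ω : Set (Cn n)} (ho : IsOpen Ω) (hb : Bornology.IsBounded Ω) (hS : HasSteinBasis Ω) {p : Cn n} (hp : p ∈ closure Ω)
    (hm : 0 < m) (hK : 0 ≤ K) (hC : 1 ≤ C) (hη : 0 < η) (he : 0 < e) (he1 : e ≤ 1)
    (hcl : ∀ w ∈ closure Ω, ‖w - p‖ < η → r w ≤ 0) (hin : ∀ w ∈ Ω, ‖w - p‖ < η → r w < 0 ∧ -r w ≤ 1) :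
    ∃ C' η' : ℝ, 0 < C' ∧ 0 < η' ∧ ∀ z ∈ Ω, ‖z - p‖ < η' → ∀ J : Jet r (2 + 2 * e) m K C η z, ∀ X, X ≠ 0 →
      ∃ f : Cn n → ℂ, DifferentiableOn ℂ f Ω ∧ MapsTo f Ω (ball 0 1) ∧
        (1 - C' * (-r z) ^ e) * (√(‖J.a X‖ ^ 2 + (-r z) * J.G X) / (-r z)) ≤ ‖fderiv ℂ f z X‖ := by
  obtain ⟨x1, x10, x11, x1η, hx1⟩ := small_r hm hη he K C
  set t := x1 / 100 with ht
  have t0 : 0 < t := by positivity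
  have t1 : 100 * t = x1 := by rw [ht]; ring
  set c := min 1 m / 5 with hc
  have c0 : 0 < c := by have := lt_min one_pos hm; positivity
  obtain ⟨C2, r0, C20, r00, hfz⟩ := fz hn hb hS hp (t := t) (L := 6 * C) (c' := c * (81 * t ^ 2)) t0 (by positivity) (by positivity)
  obtain ⟨Λ, hΛ⟩ := hb.subset_ball p
  obtain ⟨C3, C30, hnear⟩ := Jet.near (n := n) (r := r) (η := η) hm hK hC he he1 C20.le
  obtain ⟨C4, C40, hfar⟩ := Jet.far (n := n) (r := r) (η := η) (Λ := |Λ| + 1) hm hK hC he1 C20.le (by positivity)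
  set C5 := C3 + C4 + 1 with hC5
  have C50 : 0 < C5 := by positivity
  set C6 := 2 * C2 / (r0 / 2) with hC6
  have C60 : 0 ≤ C6 := by positivity
  set C8 := C6 * (1 + 1 / m) + C2 with hC8
  have C80 : 0 < C8 := by positivity
  refine ⟨2 * C5 + C8, min t (r0 / 2), by positivity, by positivity, fun z hz hzp J X hX ↦ ?_⟩
  have hzt : ‖z - p‖ < t := hzp.trans_le (min_le_left _ _)
  have hzr : ‖z - p‖ < r0 / 2 := hzp.trans_le (min_le_right _ _)
  obtain ⟨rz, rz1⟩ := hin z hz (by linarith)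
  have tri : ∀ w : Cn n, ‖w - z‖ ≤ ‖w - p‖ + ‖z - p‖ := fun w ↦ by
    have := norm_sub_le (w - p) (z - p); rwa [sub_sub_sub_cancel_right] at this
  have tri2 : ∀ w : Cn n, ‖w - p‖ ≤ ‖w - z‖ + ‖z - p‖ := fun w ↦ by
    have := norm_add_le (w - z) (z - p); rwa [sub_add_sub_cancel] at this
  have Rl : ∀ w ∈ closure Ω, ‖w - p‖ ≤ 50 * t → c * (-r z + ‖w - z‖ ^ 2) ≤ ‖J.A (w - z) + r z‖ := by
    intro w hw hwp
    have h1 := tri w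
    obtain ⟨s1, s2, s3⟩ := hx1 ‖w - z‖ (norm_nonneg _) (by linarith)
    exact J.Rlow (by linarith) hK he (by linarith) (by linarith) (by rw [add_sub_cancel]; exact hcl w hw (by linarith)) rz.le s1 s2 s3
  have dA : Differentiable ℂ (fun w ↦ J.A (w - z) + (r z : ℂ)) := by unfold Jet.A; fun_prop
  have cA : ContDiff ℂ ∞ (fun w ↦ J.A (w - z) + (r z : ℂ)) := by unfold Jet.A; fun_prop
  obtain ⟨F, V, dF, hF, hFf, hV, dV⟩ := hfz (fun w ↦ J.A (w - z) + r z) (cA.restrict_scalars ℝ) dA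
    (fun x hx y hy ↦ by
      have e1 : J.A (x - z) + (r z : ℂ) - (J.A (y - z) + r z) = J.A (x - z) - J.A (y - z) := by ring
      rw [e1, ← sub_sub_sub_cancel_right x y z]
      rw [mem_ball, dist_eq_norm] at hx hy
      refine J.Alip (by linarith) ?_ ?_
      · linarith [tri x]
      · linarith [tri y])
    (fun w hw h1 h2 ↦ by
      refine le_trans ?_ (Rl w hw h2)
      have : 9 * t ≤ ‖w - z‖ := by linarith [tri2 w]
      have : (9 * t) ^ 2 ≤ ‖w - z‖ ^ 2 := by gcongr
      gcongr
      linarith)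
    (fun w hw h1 ↦ by
      have := Rl w (subset_closure hw) h1.le
      have : 0 < c * (-r z + ‖w - z‖ ^ 2) := by
        have : 0 < -r z := by linarith
        positivity
      exact norm_pos_iff.1 (by linarith))
  have d0 : 0 < -r z := by linarith
  have de0 : 0 < (-r z) ^ e := Real.rpow_pos_of_pos d0 e
  have dde : -r z ≤ (-r z) ^ e := by simpa using rpow_le_rpow_of_exponent_ge d0 rz1 he1
  have bnd : ∀ w ∈ Ω, ‖1 + ((-r z : ℝ) : ℂ) * F w‖ ^ 2 + (-r z) * ‖F w‖ ^ 2 * J.b2 (w - z) ≤ 1 + C5 * (-r z) ^ e := by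
    intro w hw
    rcases lt_or_ge ‖w - p‖ (20 * t) with h | h
    · rw [hF w hw h]
      have h1 := tri w
      refine (hnear J (h := w - z) (by linarith) (by linarith) (by rw [add_sub_cancel]; exact hcl w (subset_closure hw) (by linarith)) rz rz1
        (Rl w (subset_closure hw) (by linarith)) (V w) (hV w)).trans ?_
      rw [hC5]; gcongr; linarith
    · refine (hfar J (h := w - z) ?_ d0 rz1 (F w) (hFf w hw h)).trans ?_
      · have h1 := tri w
        have h2 := hΛ hw
        rw [mem_ball, dist_eq_norm] at h2
        linarith [le_abs_self Λ]
      · rw [hC5]; gcongr; linarith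
  have G0 := J.posG X
  have Xp : 0 < ‖X‖ := norm_pos_iff.2 hX
  have G1 : 0 < J.G X := lt_of_lt_of_le (by positivity) G0
  have N20 : 0 < ‖J.a X‖ ^ 2 + (-r z) * J.G X := by positivity
  set N := √(‖J.a X‖ ^ 2 + (-r z) * J.G X) with hN
  have N0 : 0 < N := Real.sqrt_pos.2 N20
  have NN : N ^ 2 = ‖J.a X‖ ^ 2 + (-r z) * J.G X := sq_sqrt N20.le
  set g : Cn n → ℂ := fun w ↦ (1 + ((-r z : ℝ) : ℂ) * F w) * conj (J.a X) + ((-r z : ℝ) : ℂ) * F w * J.Y X (w - z) with hg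
  have gb : ∀ w ∈ Ω, ‖g w‖ ≤ (1 + C5 * (-r z) ^ e) * N := by
    intro w hw
    have h1 := (J.num hm X (w - z) d0.le (F w)).trans (mul_le_mul_of_nonneg_right (bnd w hw) N20.le)
    rw [← NN] at h1
    refine abs_le_of_sq_le_sq' ?_ (by positivity) |>.2
    refine h1.trans ?_
    rw [mul_pow]
    gcongr
    have : 0 ≤ C5 * (-r z) ^ e := by positivity
    exact le_self_pow₀ (by linarith) two_ne_zero
  set D := N * (1 + 2 * C5 * (-r z) ^ e) with hD
  have D0 : 0 < D := by positivity
  have dg : DifferentiableOn ℂ g Ω := by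
    have dY : Differentiable ℂ (fun w ↦ J.Y X (w - z)) := by unfold Jet.Y; fun_prop
    intro w hw
    have := dF w hw
    have := (dY w).differentiableWithinAt (s := Ω)
    rw [hg]
    fun_prop
  refine ⟨fun w ↦ (D : ℂ)⁻¹ * g w, dg.const_mul _, fun w hw ↦ ?_, ?_⟩
  · rw [mem_ball_zero_iff, norm_mul, norm_inv, norm_real, norm_of_nonneg D0.le, inv_mul_lt_iff₀ D0, mul_one]
    refine (gb w hw).trans_lt ?_
    rw [hD]
    have : 0 < N * (C5 * (-r z) ^ e) := by positivity
    linarith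
  · have hzn : Ω ∈ 𝓝 z := ho.mem_nhds hz
    have dgz : DifferentiableAt ℂ g z := (dg z hz).differentiableAt hzn
    have hVz : DifferentiableAt ℂ V z := (dV z (by rw [mem_ball, dist_eq_norm]; linarith)).differentiableAt
      (isOpen_ball.mem_nhds (by rw [mem_ball, dist_eq_norm]; linarith))
    have hFV : ∀ᶠ w in 𝓝 z, F w = (J.A (w - z) + r z)⁻¹ - V w := by
      have : ball p (20 * t) ∈ 𝓝 z := isOpen_ball.mem_nhds (by rw [mem_ball, dist_eq_norm]; linarith)
      filter_upwards [hzn, this] with w h1 h2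
      exact hF w h1 (by rwa [mem_ball, dist_eq_norm] at h2)
    have hder := J.dnum rz.ne ((dF z hz).differentiableAt hzn) hVz hFV X
    have hV' : ‖fderiv ℂ V z‖ ≤ C6 := by
      refine Complex.norm_fderiv_le_div_of_mapsTo_ball (dV.mono ?_) (fun w _ ↦ ?_) (by positivity)
      · refine ball_subset_ball' ?_
        rw [dist_eq_norm]; linarith
      · rw [mem_closedBall, dist_eq_norm]
        exact (norm_sub_le _ _).trans (by linarith [hV w, hV z])
    rw [fderiv_const_mul dgz]
    simp only [smul_apply, smul_eq_mul, norm_mul, norm_inv, norm_real, norm_of_nonneg D0.le]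
    rw [← hg] at hder
    rw [hder, ← NN]
    have k1 : ‖(r z : ℂ) * (fderiv ℂ V z X * conj (J.a X) + V z * J.G X)‖ ≤ C8 * N ^ 2 := by
      rw [norm_mul, norm_real, Real.norm_of_nonpos rz.le]
      refine le_trans ?_ (low_alg (x := ‖X‖) (a := ‖J.a X‖) hm d0 rz1 N0.le (norm_nonneg _) Xp.le C20.le C60 NN G0)
      gcongr
      refine (norm_add_le _ _).trans ?_
      rw [norm_mul, norm_mul, RCLike.norm_conj, norm_real, norm_of_nonneg G1.le]
      gcongr
      · exact ((fderiv ℂ V z).le_opNorm X).trans (by gcongr)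
      · exact hV z
    have k2 : ‖((N ^ 2 / r z : ℝ) : ℂ)‖ = N ^ 2 / (-r z) := by
      rw [norm_real, norm_eq_abs, abs_div, abs_of_neg rz, abs_of_nonneg (by positivity)]
    have k3 := norm_sub_le_norm_add ((N ^ 2 / r z : ℝ) : ℂ) ((r z : ℂ) * (fderiv ℂ V z X * conj (J.a X) + V z * J.G X))
    rw [inv_mul_eq_div, le_div_iff₀ D0]
    refine le_trans ?_ (le_trans (sub_le_sub k2.ge k1) k3)
    have k4 : N ^ 2 / (-r z) - C8 * N ^ 2 = (1 - C8 * (-r z)) * (N ^ 2 / (-r z)) := by have hne := d0.ne'; clear_value N; generalize -r z = d at *; field_simp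
    have k5 : (1 - (2 * C5 + C8) * (-r z) ^ e) * (N / (-r z)) * D = ((1 - (2 * C5 + C8) * (-r z) ^ e) * (1 + 2 * C5 * (-r z) ^ e)) * (N ^ 2 / (-r z)) := by
      rw [hD]; ring
    rw [k4, k5]
    gcongr
    have k6 := mul_le_mul_of_nonneg_left dde C80.le
    have k7 : 0 ≤ (2 * C5 + C8) * (-r z) ^ e * (2 * C5 * (-r z) ^ e) := by positivity
    linarith
end

section
set_option maxSynthPendingDepth 3

variable {r : Cn n → ℝ} {e m K C η μ : ℝ} {z : Cn n}

def Jet.Corr (J : Jet r μ m K C η z) (D : ℝ) (u w2 w3 : Cn n) (l : ℂ) : Prop :=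
  ‖l‖ ≤ D * ‖u‖ ∧ ‖w2‖ ≤ D * ‖u‖ ^ 2 ∧ ‖w3‖ ≤ D * ‖u‖ ^ 3 ∧ J.a w2 + J.q u u = 0 ∧
  J.a w3 + (J.q u w2 + J.q w2 u) + J.T u u u = 0 ∧
  J.B u w2 + J.P u u u = -l * (K * ‖J.a u‖ ^ 2 + J.a u * J.B u J.n0)

lemma corr_ex (hm : 0 < m) (hC : 1 ≤ C) : ∃ D, 1 ≤ D ∧ ∀ {r : Cn n → ℝ} {K η μ : ℝ} {z : Cn n} (J : Jet r μ m K C η z) (v : Cn n), v ≠ 0 →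
    ∃ w2 w3 l, J.Corr D v w2 w3 l := by
  set D1 := (C + C ^ 3) / m with hD1
  set D2 := D1 + (C + C * D1) * C with hD2
  set D3 := (2 * C * D2 + C) * C with hD3
  have D10 : 0 ≤ D1 := by positivity
  have D20 : 0 ≤ D2 := by positivity
  have D30 : 0 ≤ D3 := by positivity
  refine ⟨1 + D1 + D2 + D3, by linarith, ?_⟩
  intro r K η μ z J v hv
  have x0 : 0 < ‖v‖ := norm_pos_iff.2 hv
  have hG := J.posG v
  have G0 : 0 < J.G v := lt_of_lt_of_le (by positivity) hG
  have hGX := J.GX v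
  set x := ‖v‖ with hx
  set l : ℂ := (-J.P v v v + J.q v v * J.B v J.n0) / J.G v with hl
  have hlG : l * J.G v = -J.P v v v + J.q v v * J.B v J.n0 := div_mul_cancel₀ _ (by exact_mod_cast G0.ne')
  have l1 : ‖l‖ ≤ D1 * x := by
    rw [hl, norm_div, norm_real, norm_of_nonneg G0.le, div_le_iff₀ G0]
    have k1 := J.bP v v v
    have k2 := J.bq v v
    have k3 : ‖J.B v J.n0‖ ≤ C * x * C := (J.bB v J.n0).trans (by gcongr; exact J.nn)
    calc _ ≤ ‖J.P v v v‖ + ‖J.q v v‖ * ‖J.B v J.n0‖ := by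
          refine (norm_add_le _ _).trans ?_; rw [norm_neg, norm_mul]
      _ ≤ C * x * x * x + (C * x * x) * (C * x * C) := by gcongr
      _ = D1 * x * (m * x ^ 2) := by rw [hD1]; field_simp
      _ ≤ _ := by gcongr
  set s : ℂ := -(J.q v v + l * J.a v) with hs
  have s1 : ‖s‖ ≤ (C + C * D1) * x ^ 2 := by
    rw [hs, norm_neg]
    calc _ ≤ ‖J.q v v‖ + ‖l‖ * ‖J.a v‖ := by refine (norm_add_le _ _).trans ?_; rw [norm_mul]
      _ ≤ C * x * x + D1 * x * (C * x) := by gcongr; exacts [J.bq v v, J.ba v]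
      _ = _ := by ring
  set w2 : Cn n := l • v + s • J.n0 with hw2
  have b2 : ‖w2‖ ≤ D2 * x ^ 2 := by
    calc _ ≤ ‖l‖ * x + ‖s‖ * ‖J.n0‖ := by refine (norm_add_le _ _).trans ?_; rw [norm_smul, norm_smul]
      _ ≤ D1 * x * x + (C + C * D1) * x ^ 2 * C := by gcongr; exact J.nn
      _ = _ := by rw [hD2]; ring
  set s3 : ℂ := -((J.q v w2 + J.q w2 v) + J.T v v v) with hs3
  have b3 : ‖s3 • J.n0‖ ≤ D3 * x ^ 3 := by
    rw [norm_smul, hs3, norm_neg]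
    have k1 : ‖J.q v w2‖ ≤ C * x * (D2 * x ^ 2) := (J.bq _ _).trans (by gcongr)
    have k2 : ‖J.q w2 v‖ ≤ C * (D2 * x ^ 2) * x := (J.bq _ _).trans (by gcongr)
    have k3 := J.bT v v v
    calc _ ≤ (‖J.q v w2‖ + ‖J.q w2 v‖ + ‖J.T v v v‖) * ‖J.n0‖ := by gcongr; exact norm_add₃_le
      _ ≤ (C * x * (D2 * x ^ 2) + C * (D2 * x ^ 2) * x + C * x * x * x) * C := by gcongr; exact J.nn
      _ = _ := by rw [hD3]; ring
  refine ⟨w2, s3 • J.n0, l, ?_, ?_, ?_, ?_, ?_, ?_⟩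
  · exact l1.trans (by gcongr; linarith)
  · exact b2.trans (by gcongr; linarith)
  · exact b3.trans (by gcongr; linarith)
  · rw [hw2, hs]; simp [J.an]
  · simp only [map_smul, J.an, smul_eq_mul, hs3]; ring
  · have e1 : J.B v w2 = l * J.B v v + s * J.B v J.n0 := by rw [hw2]; simp
    have e2 : (‖J.a v‖ ^ 2 : ℂ) = conj (J.a v) * J.a v := by
      rw [← normSq_eq_conj_mul_self, normSq_eq_norm_sq]; push_cast; rfl
    rw [e1, e2, hs]
    rw [← hGX] at hlG
    linear_combination hlG

lemma Jet.Corr.scale {J : Jet r μ m K C η z} {D : ℝ} {u w2 w3 : Cn n} {l : ℂ} (h : J.Corr D u w2 w3 l) (t : ℂ) :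
    J.Corr D (t • u) (t ^ 2 • w2) (t ^ 3 • w3) (t * l) := by
  obtain ⟨h1, h2, h3, h4, h5, h6⟩ := h
  refine ⟨?_, ?_, ?_, ?_, ?_, ?_⟩
  · rw [norm_mul, norm_smul]; nlinarith [mul_le_mul_of_nonneg_left h1 (norm_nonneg t)]
  · rw [norm_smul, norm_smul, norm_pow, mul_pow]; nlinarith [mul_le_mul_of_nonneg_left h2 (sq_nonneg ‖t‖)]
  · rw [norm_smul, norm_smul, norm_pow, mul_pow]; nlinarith [mul_le_mul_of_nonneg_left h3 (pow_nonneg (norm_nonneg t) 3)]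
  · simp; linear_combination t ^ 2 * h4
  · simp; linear_combination t ^ 3 * h5
  · have e2 : ∀ w : ℂ, (‖w‖ ^ 2 : ℂ) = conj w * w := fun w ↦ by
      rw [← normSq_eq_conj_mul_self, normSq_eq_norm_sq]; push_cast; rfl
    rw [e2] at h6 ⊢
    simp; linear_combination (conj t * t ^ 2) * h6

lemma Jet.disc_alg (J : Jet r μ m K C η z) {u w2 w3 d h : Cn n} (c4 : J.a w2 + J.q u u = 0)
    (c5 : J.a w3 + (J.q u w2 + J.q w2 u) + J.T u u u = 0) (hd : d = w2 + w3) (hud : h = u + d) :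
    J.a h + J.q h h + J.T h h h = J.a u + (J.q u w3 + J.q w3 u + J.q d d + (J.T d h h + J.T u d h + J.T u u d)) ∧
    J.P h h h = J.P u u u + (J.P d h h + J.P u d h + J.P u u d) ∧
    (J.B h h).re = (J.B u u).re + 2 * (J.B u w2).re + 2 * (J.B u w3).re + (J.B d d).re := by
  refine ⟨?_, ?_, ?_⟩
  · have k1 : J.T h h h = J.T u u u + (J.T d h h + J.T u d h + J.T u u d) := by rw [hud]; simp only [map_add, add_apply]; ring
    have k2 : J.q h h = J.q u u + (J.q u w2 + J.q w2 u) + (J.q u w3 + J.q w3 u) + J.q d d := by rw [hud, hd]; simp only [map_add, add_apply]; ring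
    have k3 : J.a h = J.a u + J.a w2 + J.a w3 := by rw [hud, hd]; simp only [map_add]; ring
    rw [k1, k2, k3]
    linear_combination c4 + c5
  · rw [hud]; simp only [map_add, add_apply]; ring
  · have k1 : J.B h h = J.B u u + (J.B u w2 + J.B u w3) + (J.B w2 u + J.B w3 u) + J.B d d := by rw [hud, hd]; simp only [map_add, add_apply]; ring
    have k2 : (J.B w2 u).re = (J.B u w2).re := by rw [J.sB w2 u]; simp
    have k3 : (J.B w3 u).re = (J.B u w3).re := by rw [J.sB w3 u]; simp
    rw [k1]; simp only [add_re, k2, k3]; ring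

lemma Jet.disc_est (J : Jet r (2 + 2 * e) m K C η z) (hC : 1 ≤ C) (hK : 0 ≤ K) (he : 0 < e) (he1 : e ≤ 1) {D : ℝ} (hD : 1 ≤ D) {u w2 w3 : Cn n} {l : ℂ}
    (hc : J.Corr D u w2 w3 l) (h1 : 2 * D * ‖u‖ ≤ 1) (hη : ‖u + w2 + w3‖ < η) :
    r (z + (u + w2 + w3)) ≤ r z + 2 * (J.a u).re + J.G u + (2 * C ^ 2 * D * ‖u‖ ^ 2 * ‖J.a u‖ + 200 * C * D ^ 3 * ‖u‖ ^ 4 + 81 * C * D ^ 4 * ‖u‖ ^ (2 + 2 * e)) := by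
  obtain ⟨c1, c2, c3, c4, c5, c6⟩ := hc
  set x := ‖u‖ with hx
  have x0 : 0 ≤ x := norm_nonneg u
  have x1 : x ≤ 1 := by linarith [mul_le_mul_of_nonneg_right hD x0]
  set d := w2 + w3 with hd
  set h := u + w2 + w3 with hh
  have hud : h = u + d := by rw [hh, hd, add_assoc]
  have dn : ‖d‖ ≤ 2 * D * x ^ 2 := by
    refine (norm_add_le _ _).trans ?_
    have : D * x ^ 3 ≤ D * x ^ 2 := mul_le_mul_of_nonneg_left (pow_le_pow_of_le_one x0 x1 (by norm_num)) (by linarith)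
    linarith
  have hn : ‖h‖ ≤ 3 * D * x := by
    rw [hud]; refine (norm_add_le _ _).trans ?_
    have h2 : 2 * D * x ^ 2 ≤ 2 * D * x := by gcongr; exact pow_le_of_le_one x0 x1 two_ne_zero
    have h3 : 1 * x ≤ D * x := by gcongr
    linarith
  have CD : ∀ (j k : ℕ), j ≤ k → C * D ^ j * x ^ 4 ≤ C * D ^ k * x ^ 4 := fun j k hjk ↦ by gcongr
  have d1 := CD 1 3 (by norm_num)
  have d2 := CD 2 3 (by norm_num)
  have q1 : ‖J.q u w3‖ ≤ C * x * (D * x ^ 3) := (J.bq _ _).trans (by gcongr)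
  have q2 : ‖J.q w3 u‖ ≤ C * (D * x ^ 3) * x := (J.bq _ _).trans (by gcongr)
  have q3 : ‖J.q d d‖ ≤ C * (2 * D * x ^ 2) * (2 * D * x ^ 2) := (J.bq _ _).trans (by gcongr)
  have t1 : ‖J.T d h h‖ ≤ C * (2 * D * x ^ 2) * (3 * D * x) * (3 * D * x) := (J.bT _ _ _).trans (by gcongr)
  have t2 : ‖J.T u d h‖ ≤ C * x * (2 * D * x ^ 2) * (3 * D * x) := (J.bT _ _ _).trans (by gcongr)
  have t3 : ‖J.T u u d‖ ≤ C * x * x * (2 * D * x ^ 2) := (J.bT _ _ _).trans (by gcongr)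
  have p1 : ‖J.P d h h‖ ≤ C * (2 * D * x ^ 2) * (3 * D * x) * (3 * D * x) := (J.bP _ _ _).trans (by gcongr)
  have p2 : ‖J.P u d h‖ ≤ C * x * (2 * D * x ^ 2) * (3 * D * x) := (J.bP _ _ _).trans (by gcongr)
  have p3 : ‖J.P u u d‖ ≤ C * x * x * (2 * D * x ^ 2) := (J.bP _ _ _).trans (by gcongr)
  have b1 : ‖J.B u w3‖ ≤ C * x * (D * x ^ 3) := (J.bB _ _).trans (by gcongr)
  have b3 : ‖J.B d d‖ ≤ C * (2 * D * x ^ 2) * (2 * D * x ^ 2) := (J.bB _ _).trans (by gcongr)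
  obtain ⟨eA, eP, eB⟩ := J.disc_alg c4 c5 hd hud
  have e6 : (J.B u w2).re + (J.P u u u).re ≤ D * x * (K * ‖J.a u‖ ^ 2) + D * x * (‖J.a u‖ * (C * x * C)) := by
    rw [← add_re, c6]
    refine (Complex.re_le_norm _).trans ?_
    rw [norm_mul, norm_neg]
    have k1 : ‖(K * ‖J.a u‖ ^ 2 + J.a u * J.B u J.n0 : ℂ)‖ ≤ K * ‖J.a u‖ ^ 2 + ‖J.a u‖ * (C * x * C) := by
      refine (norm_add_le _ _).trans (add_le_add (le_of_eq ?_) ?_)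
      · rw [norm_mul, norm_real, norm_of_nonneg hK, norm_pow, norm_real, norm_norm]
      · rw [norm_mul]; gcongr; exact (J.bB _ _).trans (by gcongr; exact J.nn)
    calc _ ≤ D * x * (K * ‖J.a u‖ ^ 2 + ‖J.a u‖ * (C * x * C)) := by gcongr
      _ = _ := by ring
  have e7 : 2 * (D * x * (K * ‖J.a u‖ ^ 2)) ≤ K * ‖J.a u‖ ^ 2 := by
    have : 0 ≤ K * ‖J.a u‖ ^ 2 := by positivity
    linarith [mul_le_mul_of_nonneg_right h1 this]
  have ht := (abs_le.1 (J.tay h hη)).2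
  have e8 : C * ‖h‖ ^ (2 + 2 * e) ≤ 81 * C * D ^ 4 * x ^ (2 + 2 * e) := by
    calc C * ‖h‖ ^ (2 + 2 * e) ≤ C * (3 * D * x) ^ (2 + 2 * e) := by gcongr
      _ = C * ((3 * D) ^ (2 + 2 * e) * x ^ (2 + 2 * e)) := by rw [Real.mul_rpow (by positivity) x0]
      _ ≤ C * ((3 * D) ^ (4 : ℝ) * x ^ (2 + 2 * e)) := by
        gcongr
        · linarith
        · linarith
      _ = _ := by rw [show (4:ℝ) = ((4:ℕ):ℝ) by norm_num, Real.rpow_natCast]; ring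
  rw [eA, eP, eB] at ht
  simp only [add_re] at ht
  have d3 : 0 ≤ C * D ^ 3 * x ^ 4 := by positivity
  have R : ∀ (w : ℂ) (y k : ℝ), ‖w‖ ≤ y → y ≤ k * (C * D ^ 3 * x ^ 4) → w.re ≤ k * (C * D ^ 3 * x ^ 4) := fun w y k h1 h2 ↦ (Complex.re_le_norm w).trans (h1.trans h2)
  have r1 := R (J.q u w3) _ 1 q1 (by linarith only [d1, d2, d3])
  have r2 := R (J.q w3 u) _ 1 q2 (by linarith only [d1, d2, d3])
  have r3 := R (J.q d d) _ 4 q3 (by linarith only [d1, d2, d3])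
  have r4 := R (J.T d h h) _ 18 t1 (by linarith only [d1, d2, d3])
  have r5 := R (J.T u d h) _ 6 t2 (by linarith only [d1, d2, d3])
  have r6 := R (J.T u u d) _ 2 t3 (by linarith only [d1, d2, d3])
  have r7 := R (J.P d h h) _ 18 p1 (by linarith only [d1, d2, d3])
  have r8 := R (J.P u d h) _ 6 p2 (by linarith only [d1, d2, d3])
  have r9 := R (J.P u u d) _ 2 p3 (by linarith only [d1, d2, d3])
  have r10 := R (J.B u w3) _ 1 b1 (by linarith only [d1, d2, d3])
  have r11 := R (J.B d d) _ 4 b3 (by linarith only [d1, d2, d3])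
  have f1 : 2 * (D * x * (‖J.a u‖ * (C * x * C))) = 2 * C ^ 2 * D * x ^ 2 * ‖J.a u‖ := by ring
  have f2 : 200 * C * D ^ 3 * x ^ 4 = 200 * (C * D ^ 3 * x ^ 4) := by ring
  unfold Jet.G
  rw [f2, ← f1]
  clear R q1 q2 q3 t1 t2 t3 p1 p2 p3 b1 b3 d1 d2 eA eP eB c6 CD
  generalize C * D ^ 3 * x ^ 4 = Q at *
  generalize 81 * C * D ^ 4 * x ^ (2 + 2 * e) = Q2 at *
  generalize D * x * (‖J.a u‖ * (C * x * C)) = Q3 at *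
  generalize D * x * (K * ‖J.a u‖ ^ 2) = Q4 at *
  generalize K * ‖J.a u‖ ^ 2 = Q5 at *
  linarith only [ht, e6, e7, e8, r1, r2, r3, r4, r5, r6, r7, r8, r9, r10, r11, d3]
end

section
set_option maxSynthPendingDepth 3

variable {r : Cn n → ℝ} {e m K C η μ : ℝ} {z : Cn n}

def Jet.raise (J : Jet r μ m K C η z) {κ : ℝ} (hκ : 0 ≤ κ) : Jet r μ m (K + κ) C η z :=
  { J with pos := fun X ↦ (J.pos X).trans (by have := mul_nonneg hκ (sq_nonneg ‖J.a X‖); linarith) }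

lemma Jet.G_smul (J : Jet r μ m K C η z) (t : ℂ) (X : Cn n) : J.G (t • X) = ‖t‖ ^ 2 * J.G X := by
  unfold Jet.G
  have : (J.B (t • X) (t • X)).re = ‖t‖ ^ 2 * (J.B X X).re := by
    have : J.B (t • X) (t • X) = ((‖t‖ ^ 2 : ℝ) : ℂ) * J.B X X := by
      rw [← normSq_eq_norm_sq, normSq_eq_conj_mul_self]; simp; ring
    rw [this, re_ofReal_mul]
  rw [this, map_smul, smul_eq_mul, norm_mul]; ring

lemma disc_id {ζ e0 : ℂ} {δ H : ℝ} (hδ : 0 < δ) (hH : ‖e0‖ ^ 2 + H = 1) (hw : 1 - ζ * e0 ≠ 0) :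
    -δ + 2 * ((-(√δ : ℂ) * ζ / (1 - ζ * e0)) * (√δ * e0)).re + ‖-(√δ : ℂ) * ζ / (1 - ζ * e0)‖ ^ 2 * H
      = -((1 - ‖ζ‖ ^ 2) * (δ / ‖1 - ζ * e0‖) ^ 2 / δ) := by
  have hs : (√δ : ℂ) * √δ = δ := by rw [← Complex.ofReal_mul, Real.mul_self_sqrt hδ.le]
  set Z := 1 - ζ * e0 with hZ
  have n0 : 0 < ‖Z‖ ^ 2 := by have := norm_pos_iff.2 hw; positivity
  have e1 : (-(√δ : ℂ) * ζ / Z) * (√δ * e0) = ((-δ : ℝ) : ℂ) * (Z⁻¹ - 1) := by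
    have : ζ * e0 = 1 - Z := by rw [hZ]; ring
    rw [show (-(√δ : ℂ) * ζ / Z) * (√δ * e0) = -((√δ : ℂ) * √δ) * (ζ * e0) * Z⁻¹ by ring, hs, this]
    push_cast; field_simp
  have e2 : Z.re = (1 + ‖Z‖ ^ 2 - ‖ζ‖ ^ 2 * ‖e0‖ ^ 2) / 2 := by
    have : ‖ζ‖ ^ 2 * ‖e0‖ ^ 2 = ‖1 - Z‖ ^ 2 := by rw [← mul_pow, ← norm_mul, hZ]; congr 2; ring
    rw [this, ← normSq_eq_norm_sq, ← normSq_eq_norm_sq, Complex.normSq_apply, Complex.normSq_apply]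
    simp; ring
  rw [e1, re_ofReal_mul, sub_re, Complex.inv_re, normSq_eq_norm_sq, e2, norm_div, norm_mul, norm_neg, norm_real,
    norm_of_nonneg (Real.sqrt_nonneg δ), div_pow, mul_pow, sq_sqrt hδ.le, Complex.one_re]
  have : H = 1 - ‖e0‖ ^ 2 := by linarith
  rw [this]
  have := norm_pos_iff.2 hw
  field_simp
  ring

lemma E_trade {δ E : ℝ} (hδ : 0 < δ) (hE : δ / 2 ≤ E) (he1 : e ≤ 1) (he : 0 < e) : E ^ (1 + e) * δ ≤ 2 * δ ^ e * E ^ 2 := by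
  have E0 : 0 < E := by linarith
  have e2 : δ = δ ^ (1 - e) * δ ^ e := by rw [← Real.rpow_add hδ]; simp
  have e3 : E ^ 2 = E ^ (1 + e) * E ^ (1 - e) := by rw [← Real.rpow_add E0, ← rpow_two]; congr 1; ring
  have e4 : δ ^ (1 - e) ≤ 2 * E ^ (1 - e) := by
    calc δ ^ (1 - e) ≤ (2 * E) ^ (1 - e) := by gcongr; linarith
      _ = 2 ^ (1 - e) * E ^ (1 - e) := Real.mul_rpow (by norm_num) E0.le
      _ ≤ 2 ^ (1 : ℝ) * E ^ (1 - e) := by gcongr <;> linarith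
      _ = _ := by simp
  calc E ^ (1 + e) * δ = E ^ (1 + e) * (δ ^ (1 - e) * δ ^ e) := by rw [← e2]
    _ ≤ E ^ (1 + e) * (2 * E ^ (1 - e) * δ ^ e) := by gcongr
    _ = _ := by rw [e3]; ring

lemma disc_scalar {δ E x y m c1 c2 c3 : ℝ} (hm : 0 < m) (hδ : 0 < δ) (hE : δ / 2 ≤ E) (hE1 : E ≤ 1) (he1 : e ≤ 1) (he : 0 < e)
    (hx : 0 ≤ x) (hxE : m * x ^ 2 ≤ 2 * E) (hy0 : 0 ≤ y) (hy : y ≤ E) (h1 : 0 ≤ c1) (h2 : 0 ≤ c2) (h3 : 0 ≤ c3) :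
    (c1 * x ^ 2 * y + c2 * x ^ 4 + c3 * x ^ (2 + 2 * e)) ≤ (2 * (c1 + c2 + c3) * (1 + 2 / m) ^ 2 * δ ^ e) * (E ^ 2 / δ) := by
  have E0 : 0 < E := by linarith
  have hx2 : x ^ 2 ≤ (1 + 2 / m) * E := by
    have : x ^ 2 ≤ 2 / m * E := by
      rw [div_mul_eq_mul_div, le_div_iff₀ hm]; linarith
    linarith
  have M1 : 1 ≤ 1 + 2 / m := by have : 0 ≤ 2 / m := by positivity
                                linarith
  generalize 1 + 2 / m = M at *
  have k0 : E ^ 2 ≤ E ^ (1 + e) := by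
    rw [← rpow_two]; exact rpow_le_rpow_of_exponent_ge E0 hE1 (by linarith)
  have k1 : x ^ 2 * y ≤ M ^ 2 * E ^ (1 + e) := by
    calc x ^ 2 * y ≤ (M * E) * E := by gcongr
      _ = M * E ^ 2 := by ring
      _ ≤ M ^ 2 * E ^ (1 + e) := by gcongr; nlinarith
  have k2 : x ^ 4 ≤ M ^ 2 * E ^ (1 + e) := by
    calc x ^ 4 = (x ^ 2) ^ 2 := by ring
      _ ≤ (M * E) ^ 2 := by gcongr
      _ = M ^ 2 * E ^ 2 := by ring
      _ ≤ _ := by gcongr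
  have k3 : x ^ (2 + 2 * e) ≤ M ^ 2 * E ^ (1 + e) := by
    calc x ^ (2 + 2 * e) = (x ^ 2) ^ (1 + e) := by rw [← rpow_two, ← Real.rpow_mul hx]; congr 1; ring
      _ ≤ (M * E) ^ (1 + e) := by gcongr
      _ = M ^ (1 + e) * E ^ (1 + e) := Real.mul_rpow (by linarith) E0.le
      _ ≤ M ^ (2 : ℝ) * E ^ (1 + e) := by gcongr; linarith
      _ = _ := by rw [rpow_two]
  have k4 := E_trade hδ hE he1 he
  have k5 : E ^ (1 + e) ≤ 2 * δ ^ e * (E ^ 2 / δ) := by rw [← mul_div_assoc, le_div_iff₀ hδ]; exact k4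
  calc _ = c1 * (x ^ 2 * y) + c2 * x ^ 4 + c3 * x ^ (2 + 2 * e) := by ring
    _ ≤ c1 * (M ^ 2 * E ^ (1 + e)) + c2 * (M ^ 2 * E ^ (1 + e)) + c3 * (M ^ 2 * E ^ (1 + e)) := by gcongr
    _ = (c1 + c2 + c3) * M ^ 2 * E ^ (1 + e) := by ring
    _ ≤ (c1 + c2 + c3) * M ^ 2 * (2 * δ ^ e * (E ^ 2 / δ)) := by gcongr
    _ = _ := by ring

lemma E_small {ζ e0 : ℂ} {δ H κ E1 : ℝ} (hδ : 0 < δ) (hH : ‖e0‖ ^ 2 + H = 1) (hH0 : 0 < H) (hζ : ‖ζ‖ ≤ 1) (hE1 : 0 < E1) (hκ : 8 ≤ κ * E1)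
    (hd : 2 * δ ≤ E1) (hHκ : κ * (δ * ‖e0‖ ^ 2) ≤ H) :
    1 - ζ * e0 ≠ 0 ∧ δ / 2 ≤ δ / ‖1 - ζ * e0‖ ∧ δ / ‖1 - ζ * e0‖ ≤ E1 ∧ H ≤ 2 * ‖1 - ζ * e0‖ := by
  have n0 := norm_nonneg e0
  have n1 : ‖e0‖ < 1 := by nlinarith
  have w1 : ‖ζ * e0‖ ≤ ‖e0‖ := by rw [norm_mul]; nlinarith
  have l1 : 1 - ‖e0‖ ≤ ‖1 - ζ * e0‖ := by have := norm_sub_norm_le (1:ℂ) (ζ * e0); rw [norm_one] at this; linarith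
  have u1 : ‖1 - ζ * e0‖ ≤ 2 := by have := norm_sub_le (1:ℂ) (ζ * e0); rw [norm_one] at this; linarith
  have p : 0 < ‖1 - ζ * e0‖ := by linarith
  refine ⟨norm_pos_iff.1 p, by gcongr, ?_, by nlinarith⟩
  rw [div_le_iff₀ p]
  rcases le_or_gt ‖e0‖ (1/2) with h | h
  · nlinarith
  · have h1 : 1 / 4 ≤ ‖e0‖ ^ 2 := by nlinarith
    have h2 : H / 2 ≤ 1 - ‖e0‖ := by nlinarith
    have κ0 : 0 < κ := by by_contra hc; push Not at hc; nlinarith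
    have h3 : κ * (δ * (1 / 4)) ≤ H := le_trans (by gcongr) hHκ
    have h4 : κ * δ / 8 ≤ ‖1 - ζ * e0‖ := by linarith
    have h5 := mul_le_mul_of_nonneg_left h4 hE1.le
    nlinarith
end

section
set_option maxSynthPendingDepth 3

variable {r : Cn n → ℝ} {e m K C D η κ E1 τ δ : ℝ} {z : Cn n}

lemma three_scal {x y w : ℝ} (hD : 1 ≤ D) (hx : 0 ≤ x) (h1 : x ≤ 1) (h2 : y ≤ D * x ^ 2) (h3 : w ≤ D * x ^ 3) :
    x + y + w ≤ 3 * D * x := by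
  have c2 : x ^ 2 ≤ x := by nlinarith
  have c3 : x ^ 3 ≤ x := by nlinarith
  have d1 : x ≤ D * x := by nlinarith
  have d2 : D * x ^ 2 ≤ D * x := by gcongr
  have d3 : D * x ^ 3 ≤ D * x := by gcongr
  linarith

lemma three_lt {x : ℝ} (hm : 0 < m) (hD : 0 < D) (hη : 0 < η) (hE : 0 < E1) (hx : 0 ≤ x) (h : m * x ^ 2 ≤ 2 * E1) (hηE : 73 * D ^ 2 * E1 ≤ m * η ^ 2) :
    3 * D * x < η / 2 := by
  refine lt_of_pow_lt_pow_left₀ 2 (by positivity) ?_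
  refine lt_of_mul_lt_mul_left ?_ hm.le
  have : 0 < D ^ 2 * E1 := by positivity
  have : D ^ 2 * (m * x ^ 2) ≤ D ^ 2 * (2 * E1) := by gcongr
  linarith

lemma fin_scal {E c R P G S x : ℝ} (hδ : 0 < δ) (E0 : 0 < E) (hτ : 0 < τ) (hτ1 : τ ≤ 1) (hx : 0 ≤ x) (hζ : x ≤ 1 - τ) (hτC : 2 * c ≤ τ)
    (main : R ≤ -δ + P + G + S) (sc : S ≤ c * (E ^ 2 / δ)) (id : -δ + P + G = -((1 - x ^ 2) * E ^ 2 / δ)) : R < 0 := by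
  have X0 : 0 < E ^ 2 / δ := by positivity
  have f1 : τ ≤ 1 - x ^ 2 := by nlinarith
  have f2 : τ * (E ^ 2 / δ) ≤ (1 - x ^ 2) * (E ^ 2 / δ) := by gcongr
  have f3 := mul_le_mul_of_nonneg_right hτC X0.le
  have f4 : 0 < τ * (E ^ 2 / δ) := by positivity
  have f5 : (1 - x ^ 2) * E ^ 2 / δ = (1 - x ^ 2) * (E ^ 2 / δ) := by ring
  rw [f5] at id
  linarith

lemma disc_in (J : Jet r (2 + 2 * e) m K C η z) (hm : 0 < m) (hC : 1 ≤ C) (hK : 0 ≤ K) (he : 0 < e) (he1 : e ≤ 1) (hD : 1 ≤ D)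
    (hη0 : 0 < η) (hδ : 0 < δ) (hrz : r z = -δ) {v w2 w3 : Cn n} {l : ℂ} (hv0 : v ≠ 0) (hv : ‖J.a v‖ ^ 2 + δ * J.G v = δ)
    (hκ : κ * ‖J.a v‖ ^ 2 ≤ J.G v) (hE1 : 0 < E1) (hE1' : E1 ≤ 1) (hκE : 8 ≤ κ * E1) (hδE : 2 * δ ≤ E1)
    (hDE : 8 * D ^ 2 * E1 ≤ m) (hηE : 73 * D ^ 2 * E1 ≤ m * η ^ 2) (hc : J.Corr D v w2 w3 l)
    (hτ : 0 < τ) (hτ1 : τ ≤ 1) (hτC : 2 * (2 * (2 * C ^ 2 * D + 200 * C * D ^ 3 + 81 * C * D ^ 4) * (1 + 2 / m) ^ 2 * δ ^ e) ≤ τ) {ζ : ℂ} (hζ : ‖ζ‖ ≤ 1 - τ) :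
    1 - ζ * (J.a v / (√δ : ℂ)) ≠ 0 ∧
    ∀ t : ℂ, t = -(√δ : ℂ) * ζ / (1 - ζ * (J.a v / (√δ : ℂ))) →
      ‖t • v + t ^ 2 • w2 + t ^ 3 • w3‖ < η / 2 ∧ r (z + (t • v + t ^ 2 • w2 + t ^ 3 • w3)) < 0 := by
  have sδ : 0 < √δ := Real.sqrt_pos.2 hδ
  have sδ2 : √δ ^ 2 = δ := sq_sqrt hδ.le
  have sδ' : (√δ : ℂ) ≠ 0 := by exact_mod_cast sδ.ne'
  have G0 : 0 < J.G v := lt_of_lt_of_le (by have := norm_pos_iff.2 hv0; positivity) (J.posG v)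
  set e0 : ℂ := J.a v / (√δ : ℂ) with he0
  have av : J.a v = √δ * e0 := by rw [he0]; field_simp
  have ne0 : ‖J.a v‖ ^ 2 = δ * ‖e0‖ ^ 2 := by
    rw [av, norm_mul, norm_real, norm_of_nonneg sδ.le, mul_pow, sδ2]
  have hH : ‖e0‖ ^ 2 + J.G v = 1 := by
    rw [ne0] at hv
    have : δ * (‖e0‖ ^ 2 + J.G v - 1) = 0 := by linarith
    rcases mul_eq_zero.1 this with h | h <;> linarith
  have hζ1 : ‖ζ‖ ≤ 1 := by linarith
  obtain ⟨w0, hEl, hEu, hHw⟩ := E_small hδ hH G0 hζ1 hE1 hκE hδE (by rw [← ne0]; exact hκ)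
  refine ⟨w0, ?_⟩
  rintro t ht
  set E := δ / ‖1 - ζ * e0‖ with hE
  have W0 : 0 < ‖1 - ζ * e0‖ := norm_pos_iff.2 w0
  have E0 : 0 < E := by positivity
  have nt : ‖t‖ = √δ * ‖ζ‖ / ‖1 - ζ * e0‖ := by
    rw [ht, norm_div, norm_mul, norm_neg, norm_real, norm_of_nonneg sδ.le]
  have nt2 : ‖t‖ ^ 2 * J.G v ≤ 2 * E := by
    rw [nt, div_pow, mul_pow, sδ2, hE]
    calc δ * ‖ζ‖ ^ 2 / ‖1 - ζ * e0‖ ^ 2 * J.G v ≤ δ * 1 ^ 2 / ‖1 - ζ * e0‖ ^ 2 * (2 * ‖1 - ζ * e0‖) := by gcongr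
      _ = _ := by field_simp
  have hcs := hc.scale t
  set u := t • v with hu
  have gu : J.G u = ‖t‖ ^ 2 * J.G v := J.G_smul t v
  have hx : m * ‖u‖ ^ 2 ≤ 2 * E := by rw [← gu] at nt2; exact (J.posG u).trans nt2
  have au : J.a u = t * (√δ * e0) := by rw [hu, map_smul, smul_eq_mul, av]
  have hy : ‖J.a u‖ ≤ E := by
    have e1 : ‖e0‖ ≤ 1 := by
      by_contra! h
      have := one_lt_pow₀ h two_ne_zero; linarith
    rw [au, norm_mul, nt, norm_mul, norm_real, norm_of_nonneg sδ.le, hE]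
    calc √δ * ‖ζ‖ / ‖1 - ζ * e0‖ * (√δ * ‖e0‖) ≤ √δ * 1 / ‖1 - ζ * e0‖ * (√δ * 1) := by gcongr
      _ = √δ ^ 2 / ‖1 - ζ * e0‖ := by ring
      _ = _ := by rw [sδ2]
  have h1 : 2 * D * ‖u‖ ≤ 1 := by
    have : m * (2 * D * ‖u‖) ^ 2 ≤ m * 1 := by
      have := mul_le_mul_of_nonneg_left (hx.trans (mul_le_mul_of_nonneg_left hEu (by norm_num))) (sq_nonneg D)
      linarith
    have := le_of_mul_le_mul_left this hm
    exact (sq_le_one_iff₀ (by positivity)).1 this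
  have hu1 : ‖u‖ ≤ 1 := by linarith [norm_nonneg u, mul_le_mul_of_nonneg_right hD (norm_nonneg u)]
  have hη : ‖u + t ^ 2 • w2 + t ^ 3 • w3‖ < η / 2 := by
    have a1 : ‖u + t ^ 2 • w2 + t ^ 3 • w3‖ ≤ 3 * D * ‖u‖ :=
      norm_add₃_le.trans (three_scal hD (norm_nonneg u) hu1 hcs.2.1 hcs.2.2.1)
    exact a1.trans_lt (three_lt hm (by linarith) hη0 hE1 (norm_nonneg u) (hx.trans (by linarith)) hηE)
  refine ⟨hη, ?_⟩
  have main := J.disc_est hC hK he he1 hD hcs h1 (hη.trans (by linarith))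
  have sc := disc_scalar (c1 := 2 * C ^ 2 * D) (c2 := 200 * C * D ^ 3) (c3 := 81 * C * D ^ 4) (x := ‖u‖) (y := ‖J.a u‖) hm hδ hEl (hEu.trans hE1') he1 he (norm_nonneg _) hx (norm_nonneg _) hy
    (by positivity) (by positivity) (by positivity)
  have id := disc_id (ζ := ζ) (e0 := e0) hδ hH w0
  rw [← ht, ← au, ← gu, ← hE] at id
  rw [hrz] at main
  exact fin_scal hδ E0 hτ hτ1 (norm_nonneg ζ) hζ hτC main sc id
end

section
set_option maxSynthPendingDepth 3

variable {r : Cn n → ℝ} {e m K C D η κ E1 τ δ : ℝ} {p z : Cn n}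

lemma cauchy_disc {Ω : Set (Cn n)} (ho : IsOpen Ω) {f : Cn n → ℂ} (hf : DifferentiableOn ℂ f Ω) (hfm : MapsTo f Ω (ball 0 1))
    {s e0 : ℂ} {v w2 w3 : Cn n} (hτ1 : τ < 1) (h : ∀ ζ : ℂ, ‖ζ‖ ≤ 1 - τ → 1 - ζ * e0 ≠ 0 ∧
      ∀ t : ℂ, t = -s * ζ / (1 - ζ * e0) → z + (t • v + t ^ 2 • w2 + t ^ 3 • w3) ∈ Ω) :
    ‖s‖ * ‖fderiv ℂ f z v‖ ≤ 1 / (1 - τ) := by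
  have hR : 0 < 1 - τ := by linarith
  set T : ℂ → ℂ := fun ζ ↦ -s * ζ / (1 - ζ * e0) with hT
  set H : ℂ → Cn n := fun ζ ↦ z + (T ζ • v + T ζ ^ 2 • w2 + T ζ ^ 3 • w3) with hH
  have dT : ∀ ζ, 1 - ζ * e0 ≠ 0 → DifferentiableAt ℂ T ζ := fun ζ hζ ↦ by
    refine DifferentiableAt.fun_div (by fun_prop) (by fun_prop) hζ
  have dH : ∀ ζ, 1 - ζ * e0 ≠ 0 → DifferentiableAt ℂ H ζ := fun ζ hζ ↦ by
    have := dT ζ hζ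
    refine (differentiableAt_const z).add (((this.smul_const v).add ((this.pow 2).smul_const w2)).add ((this.pow 3).smul_const w3))
  have hmem : ∀ ζ, ‖ζ‖ ≤ 1 - τ → H ζ ∈ Ω := fun ζ hζ ↦ (h ζ hζ).2 _ rfl
  have T0 : T 0 = 0 := by simp [hT]
  have H0 : H 0 = z := by simp [hH, T0]
  have tD : HasDerivAt T (-s) 0 := by
    have h1 : HasDerivAt (fun ζ : ℂ ↦ -s * ζ) (-s) 0 := by simpa using (hasDerivAt_id (0 : ℂ)).const_mul (-s)
    have h2 : HasDerivAt (fun ζ : ℂ ↦ 1 - ζ * e0) (-e0) 0 := by simpa using ((hasDerivAt_id (0 : ℂ)).mul_const e0).const_sub 1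
    have := h1.fun_div h2 (by simp)
    have e1 : (-s * (1 - 0 * e0) - -s * 0 * -e0) / (1 - 0 * e0) ^ 2 = -s := by simp
    rw [e1] at this
    exact this
  have hD : HasDerivAt H (-s • v) 0 := by
    have a1 := tD.smul_const v
    have a2 := (tD.fun_pow 2).smul_const w2
    have a3 := (tD.fun_pow 3).smul_const w3
    have := ((a1.add a2).add a3).const_add z
    have e1 : -s • v + ((2 : ℕ) * T 0 ^ (2 - 1) * -s) • w2 + ((3 : ℕ) * T 0 ^ (3 - 1) * -s) • w3 = -s • v := by simp [T0]
    rw [e1] at this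
    exact this
  have dg : DifferentiableOn ℂ (f ∘ H) (closedBall 0 (1 - τ)) := fun ζ hζ ↦ by
    have hζ' : ‖ζ‖ ≤ 1 - τ := by simpa using hζ
    exact (((hf _ (hmem ζ hζ')).differentiableAt (ho.mem_nhds (hmem ζ hζ'))).comp ζ (dH ζ (h ζ hζ').1)).differentiableWithinAt
  have hz : z ∈ Ω := by have := hmem 0 (by simpa using hR.le); rwa [H0] at this
  have fz : HasFDerivAt f (fderiv ℂ f z) (H 0) := by rw [H0]; exact ((hf z hz).differentiableAt (ho.mem_nhds hz)).hasFDerivAt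
  have gd : deriv (f ∘ H) 0 = fderiv ℂ f z (-s • v) := (fz.comp_hasDerivAt (0 : ℂ) hD).deriv
  have := Complex.norm_deriv_le_of_forall_mem_sphere_norm_le (f := f ∘ H) (c := 0) (C := 1) hR
    (DifferentiableOn.diffContOnCl (by rwa [closure_ball _ hR.ne'])) (fun ζ hζ ↦ by
      have hζ' : ‖ζ‖ ≤ 1 - τ := by simpa using (mem_sphere.1 hζ).le
      have := hfm (hmem ζ hζ')
      simpa using (mem_ball_zero_iff.1 this).le)
  rw [gd, map_smul, norm_smul, norm_neg] at this
  exact this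

lemma Jet.raise_G {μ : ℝ} (J : Jet r μ m K C η z) (hκ : 0 ≤ κ) (X : Cn n) : (J.raise hκ).G X = J.G X + κ * ‖J.a X‖ ^ 2 := by
  simp only [Jet.G, Jet.raise]; ring

theorem upper {Ω : Set (Cn n)} (ho : IsOpen Ω) (hm : 0 < m) (hK : 0 ≤ K) (hC : 1 ≤ C) (hη : 0 < η) (he : 0 < e) (he1 : e ≤ 1)
    (hin : ∀ w, ‖w - p‖ < η → r w < 0 → w ∈ Ω) (hr : ContinuousAt r p) (hrp : r p = 0) :
    ∃ κ C' η' : ℝ, 0 ≤ κ ∧ 0 < C' ∧ 0 < η' ∧ ∀ z : Cn n, ‖z - p‖ < η' → r z < 0 → ∀ J : Jet r (2 + 2 * e) m K C η z, ∀ X, X ≠ 0 →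
      ∀ f : Cn n → ℂ, DifferentiableOn ℂ f Ω → MapsTo f Ω (ball 0 1) →
        ‖fderiv ℂ f z X‖ ≤ (1 + C' * (-r z) ^ e) * (√(‖J.a X‖ ^ 2 + (-r z) * (J.G X + κ * ‖J.a X‖ ^ 2)) / (-r z)) := by
  obtain ⟨D, hD, hcor⟩ := corr_ex (n := n) (m := m) (C := C) hm hC
  obtain ⟨E1, hE1, hE1', hDE, hηE⟩ : ∃ E1 : ℝ, 0 < E1 ∧ E1 ≤ 1 ∧ 8 * D ^ 2 * E1 ≤ m ∧ 73 * D ^ 2 * E1 ≤ m * η ^ 2 := by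
    refine ⟨min 1 (min (m / (8 * D ^ 2)) (m * η ^ 2 / (73 * D ^ 2))), by positivity, min_le_left _ _, ?_, ?_⟩
    · rw [mul_comm, ← le_div_iff₀ (by positivity)]; exact (min_le_right _ _).trans (min_le_left _ _)
    · rw [mul_comm, ← le_div_iff₀ (by positivity)]; exact (min_le_right _ _).trans (min_le_right _ _)
  set κ := 8 / E1 with hκ
  have hκ0 : 0 ≤ κ := by positivity
  set c := 2 * (2 * (2 * C ^ 2 * D + 200 * C * D ^ 3 + 81 * C * D ^ 4) * (1 + 2 / m) ^ 2) with hc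
  have hc0 : 0 < c := by positivity
  have ev : ∀ᶠ w in 𝓝 p, 2 * (-r w) < E1 ∧ c * (-r w) ^ e < 1 / 2 := by
    have t1 : Tendsto (fun w ↦ 2 * (-r w)) (𝓝 p) (𝓝 0) := by
      have := (hr.neg).const_mul 2; simpa [ContinuousAt, hrp] using this
    have t2 : Tendsto (fun w ↦ c * (-r w) ^ e) (𝓝 p) (𝓝 0) := by
      have := ((hr.neg).rpow_const (Or.inr he.le)).const_mul c
      simpa [ContinuousAt, hrp, Real.zero_rpow he.ne'] using this
    exact (t1.eventually (gt_mem_nhds hE1)).and (t2.eventually (gt_mem_nhds (by norm_num)))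
  obtain ⟨η1, hη1, h1⟩ := Metric.eventually_nhds_iff_ball.1 ev
  refine ⟨κ, 2 * c, min η1 (η / 2), hκ0, by positivity, by positivity, fun z hz hrz J X hX f hf hfm ↦ ?_⟩
  obtain ⟨z1, z2⟩ := h1 z (by rw [mem_ball, dist_eq_norm]; exact hz.trans_le (min_le_left _ _))
  have z3 : ‖z - p‖ < η / 2 := hz.trans_le (min_le_right _ _)
  rw [← J.raise_G hκ0]
  set J' := J.raise hκ0 with hJ'
  have ha : J.a = J'.a := rfl
  have hGκ : ∀ v, κ * ‖J'.a v‖ ^ 2 ≤ J'.G v := fun v ↦ by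
    rw [hJ', J.raise_G hκ0]
    have := J.posG v
    have : 0 ≤ m * ‖v‖ ^ 2 := by positivity
    change κ * ‖J.a v‖ ^ 2 ≤ _
    linarith
  rw [ha]
  obtain ⟨δ, hδ⟩ : ∃ δ, δ = -r z := ⟨_, rfl⟩
  rw [← hδ] at z1 z2 ⊢
  have δ0 : 0 < δ := by linarith
  have sδ : 0 < √δ := Real.sqrt_pos.2 δ0
  have X0 : 0 < ‖X‖ := norm_pos_iff.2 hX
  have G0 : 0 < J'.G X := lt_of_lt_of_le (by positivity) (J'.posG X)
  set N := √(‖J'.a X‖ ^ 2 + δ * J'.G X) with hN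
  have N0 : 0 < N := Real.sqrt_pos.2 (by positivity)
  have N2 : N ^ 2 = ‖J'.a X‖ ^ 2 + δ * J'.G X := sq_sqrt (by positivity)
  set v : Cn n := ((√δ / N : ℝ) : ℂ) • X with hv
  have nv : ‖((√δ / N : ℝ) : ℂ)‖ = √δ / N := by rw [norm_real, norm_of_nonneg (by positivity)]
  have v0 : v ≠ 0 := smul_ne_zero (by rw [← norm_pos_iff, nv]; positivity) hX
  have hvN : ‖J'.a v‖ ^ 2 + δ * J'.G v = δ := by
    rw [hv, J'.G_smul, map_smul, norm_smul, nv, mul_pow, div_pow, sq_sqrt δ0.le]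
    calc _ = δ / N ^ 2 * (‖J'.a X‖ ^ 2 + δ * J'.G X) := by ring
      _ = δ := by rw [← N2]; field_simp
  obtain ⟨w2, w3, l, hcr⟩ := hcor J' v v0
  set τ := c * δ ^ e with hτ
  have τ0 : 0 < τ := by have := Real.rpow_pos_of_pos δ0 e; positivity
  have fin := cauchy_disc (z := z) (τ := τ) (s := (√δ : ℂ)) (e0 := J'.a v / (√δ : ℂ)) (v := v) (w2 := w2) (w3 := w3) ho hf hfm (by linarith) (fun ζ hζ ↦ by
    obtain ⟨a1, a2⟩ := disc_in J' hm hC (by positivity) he he1 hD hη δ0 (by linarith) v0 hvN (hGκ v) hE1 hE1'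
      (by rw [hκ]; field_simp; rfl) z1.le hDE hηE hcr τ0 (by linarith) (by rw [hτ, hc]; apply le_of_eq; ring) hζ
    refine ⟨a1, fun t ht ↦ ?_⟩
    obtain ⟨b1, b2⟩ := a2 t ht
    refine hin _ ?_ b2
    rw [add_sub_right_comm]
    exact (norm_add_le _ _).trans_lt (by linarith))
  rw [norm_real, norm_of_nonneg sδ.le, hv, map_smul, norm_smul, nv] at fin
  have e1 : √δ * (√δ / N * ‖fderiv ℂ f z X‖) = δ / N * ‖fderiv ℂ f z X‖ := by
    calc _ = √δ ^ 2 / N * ‖fderiv ℂ f z X‖ := by ring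
      _ = _ := by rw [sq_sqrt δ0.le]
  rw [e1] at fin
  have e2 : 1 / (1 - τ) ≤ 1 + 2 * τ := by rw [div_le_iff₀ (by linarith)]; linarith [mul_nonneg τ0.le (show 0 ≤ 1 - 2 * τ by linarith)]
  have e3 : ‖fderiv ℂ f z X‖ = (δ / N * ‖fderiv ℂ f z X‖) * (N / δ) := by field_simp
  rw [e3, show 2 * c * δ ^ e = 2 * τ by rw [hτ]; ring]
  exact mul_le_mul_of_nonneg_right (fin.trans e2) (by positivity)
end

section
set_option maxSynthPendingDepth 3

variable {e m K C η ε : ℝ} {r ρ : Cn n → ℝ} {p z : Cn n} {Ω : Set (Cn n)}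

lemma hc_of {N : ℕ} (hε : 0 < ε) {W : Set (Cn n)} (hW : IsOpen W) (hp : p ∈ W) (hc : ContDiffOn ℝ N ρ W)
    (hh : ∃ C : ℝ≥0, HolderOnWith C ε.toNNReal (iteratedFDeriv ℝ N ρ) W) : HC ε N ρ p := by
  obtain ⟨A, hA⟩ := hh
  refine HC.of_iter hε (hc.contDiffAt (hW.mem_nhds hp)) ⟨A, ?_⟩
  filter_upwards [(hW.prod hW).mem_nhds (show (p, p) ∈ W ×ˢ W from ⟨hp, hp⟩)] with q hq
  have := hA.dist_le hq.1 hq.2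
  rwa [dist_eq_norm, dist_eq_norm, Real.coe_toNNReal _ hε.le] at this

lemma levi_pos {φ : ℝ} (hφ : 0 < φ) (d1 : DifferentiableAt ℝ (fderiv ℝ r) p) (d2 : DifferentiableAt ℝ (fderiv ℝ ρ) p)
    (h1 : ∀ x, fderiv ℝ ρ p x = φ * fderiv ℝ r p x)
    (h2 : ∀ x, fderiv ℝ r p x = 0 → fderiv ℝ (fderiv ℝ ρ) p x x = φ * fderiv ℝ (fderiv ℝ r) p x x)
    (hL : ∀ X, X ≠ 0 → cderiv ρ p X = 0 → 0 < leviForm ρ p X) (X : Cn n) (hX : X ≠ 0) (hc : cderiv r p X = 0) :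
    0 < leviForm r p X := by
  have a1 : fderiv ℝ r p X = 0 := by have := congrArg Complex.re hc; simpa [cderiv] using this
  have a2 : fderiv ℝ r p (I • X) = 0 := by have := congrArg Complex.im hc; simpa [cderiv] using this
  have h := hL X hX (by simp only [cderiv, h1, a1, a2]; simp)
  rw [levi_eq d2, JB_levi, h2 _ a1, h2 _ a2] at h
  rw [levi_eq d1, JB_levi]
  by_contra! hn
  have := mul_nonpos_of_nonneg_of_nonpos hφ.le hn
  linarith

lemma bd_cderiv (h : bdist Ω =ᶠ[𝓝 z] fun w ↦ -r w) (X : Cn n) : ‖cderiv (bdist Ω) z X‖ = ‖cderiv r z X‖ := by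
  have : cderiv (bdist Ω) z X = -cderiv r z X := by
    unfold cderiv
    rw [h.fderiv_eq, fderiv_fun_neg]
    simp; ring
  rw [this, norm_neg]

lemma bd_levi (h : bdist Ω =ᶠ[𝓝 z] fun w ↦ -r w) (X : Cn n) : leviForm (fun w ↦ -bdist Ω w) z X = leviForm r z X := by
  have h' : (fun w ↦ -bdist Ω w) =ᶠ[𝓝 z] r := h.mono fun w hw ↦ by simp [hw]
  have (Y : Cn n) : (fun w ↦ fderiv ℝ (fun w ↦ -bdist Ω w) w Y) =ᶠ[𝓝 z] fun w ↦ fderiv ℝ r w Y :=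
    (h'.fderiv (𝕜 := ℝ)).mono fun w hw ↦ by simp only [hw]
  unfold leviForm
  rw [(this X).fderiv_eq, (this (I • X)).fderiv_eq]

lemma M_lower {δ a L : ℝ} (hδ : 0 < δ) (hK : 0 ≤ K) : √(a ^ 2 / δ ^ 2 + L / δ) ≤ √(a ^ 2 + δ * (L + K * a ^ 2)) / δ := by
  rw [le_div_iff₀ hδ, ← Real.sqrt_sq hδ.le, ← Real.sqrt_mul' _ (sq_nonneg _), Real.sqrt_sq hδ.le]
  refine Real.sqrt_le_sqrt ?_
  have : (a ^ 2 / δ ^ 2 + L / δ) * δ ^ 2 = a ^ 2 + δ * L := by field_simp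
  have : 0 ≤ δ * (K * a ^ 2) := by positivity
  linarith

lemma M_upper {δ a L κ : ℝ} (hδ : 0 < δ) (hK : 0 ≤ K) (hκ : 0 ≤ κ) (hL : 0 ≤ L + K * a ^ 2) (hs : K * δ ≤ 1 / 2) :
    √(a ^ 2 + δ * (L + K * a ^ 2 + κ * a ^ 2)) / δ ≤ (1 + 2 * (K + κ) * δ) * √(a ^ 2 / δ ^ 2 + L / δ) := by
  set S := a ^ 2 + δ * L with hS
  have e1 : a ^ 2 / δ ^ 2 + L / δ = S / δ ^ 2 := by rw [hS]; field_simp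
  have hS1 : a ^ 2 ≤ 2 * S := by nlinarith [mul_nonneg hδ.le hL, mul_le_mul_of_nonneg_right hs (sq_nonneg a)]
  have S0 : 0 ≤ S := by nlinarith [sq_nonneg a]
  rw [e1, Real.sqrt_div S0, Real.sqrt_sq hδ.le, ← mul_div_assoc]
  gcongr
  have t0 : 0 ≤ 2 * (K + κ) * δ := by positivity
  rw [Real.sqrt_le_left (by positivity), mul_pow, sq_sqrt S0]
  have : δ * (K + κ) * a ^ 2 ≤ δ * (K + κ) * (2 * S) := by gcongr
  nlinarith [mul_nonneg t0 S0, mul_nonneg (mul_nonneg t0 t0) S0]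

def Jet.shrink {μ η' : ℝ} (J : Jet r μ m K C η z) (h : η' ≤ η) : Jet r μ m K C η' z :=
  { J with tay := fun x hx ↦ J.tay x (hx.trans_le h) }

lemma comb {c1 c2 K' d dl : ℝ} (h2 : 0 ≤ c2) (hK : 0 ≤ K') (h1 : 0 ≤ c1) (hd : 0 ≤ d) (hd1 : d ≤ 1) (hl : dl ≤ d) :
    (1 + c2 * d) * (1 + 2 * K' * dl) ≤ 1 + (c1 + c2 + 2 * K' + 2 * K' * c2 + 1) * d := by
  have a1 : 2 * K' * dl ≤ 2 * K' * d := by gcongr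
  have a2 : (1 + c2 * d) * (1 + 2 * K' * dl) ≤ (1 + c2 * d) * (1 + 2 * K' * d) := by gcongr
  have a3 : 2 * K' * c2 * (d * d) ≤ 2 * K' * c2 * (d * 1) := by gcongr
  nlinarith [mul_nonneg h1 hd]

lemma car_zero : caratheodory Ω z 0 = 0 := by
  have : {r : ℝ | ∃ f : Cn n → ℂ, DifferentiableOn ℂ f Ω ∧ MapsTo f Ω (ball 0 1) ∧ r = ‖fderiv ℂ f z 0‖} = {0} := by
    ext x
    constructor
    · rintro ⟨f, -, -, h⟩; simpa using h
    · rintro rfl; exact ⟨fun _ ↦ 0, by fun_prop, fun w _ ↦ by simp, by simp⟩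
  rw [caratheodory, this, csSup_singleton]

lemma M_zero : Mfun Ω z 0 = 0 := by
  simp [Mfun, cderiv, leviForm]

lemma assemble {f : Cn n → ℂ} {X : Cn n} {δ C1 C2 K' M N1 N2 : ℝ} (hf : DifferentiableOn ℂ f Ω) (hfm : MapsTo f Ω (ball 0 1)) (δ0 : 0 < δ) (δ1 : δ ≤ 1)
    (he : 0 < e) (he1 : e ≤ 1) (hC1 : 0 < C1) (hC2 : 0 < C2) (hK' : 0 ≤ K') (hM : 0 ≤ M) (hN : 0 ≤ N1) (ml : M ≤ N1) (mu : N2 ≤ (1 + 2 * K' * δ) * M)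
    (hl : (1 - C1 * δ ^ e) * N1 ≤ ‖fderiv ℂ f z X‖)
    (hu : ∀ f : Cn n → ℂ, DifferentiableOn ℂ f Ω → MapsTo f Ω (ball 0 1) → ‖fderiv ℂ f z X‖ ≤ (1 + C2 * δ ^ e) * N2) :
    (1 - (C1 + C2 + 2 * K' + 2 * K' * C2 + 1) * δ ^ e) * M ≤ caratheodory Ω z X ∧
      caratheodory Ω z X ≤ (1 + (C1 + C2 + 2 * K' + 2 * K' * C2 + 1) * δ ^ e) * M := by
  have d0 : 0 ≤ δ ^ e := Real.rpow_nonneg δ0.le e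
  have d1 : δ ^ e ≤ 1 := Real.rpow_le_one δ0.le δ1 he.le
  have dl : δ ≤ δ ^ e := by simpa using rpow_le_rpow_of_exponent_ge δ0 δ1 he1
  have hle : caratheodory Ω z X ≤ (1 + C2 * δ ^ e) * N2 :=
    csSup_le ⟨_, f, hf, hfm, rfl⟩ (by rintro x ⟨g, hg, hgm, rfl⟩; exact hu g hg hgm)
  have hge : ‖fderiv ℂ f z X‖ ≤ caratheodory Ω z X :=
    le_csSup ⟨_, by rintro x ⟨g, hg, hgm, rfl⟩; exact hu g hg hgm⟩ ⟨f, hf, hfm, rfl⟩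
  constructor
  · have k1 : (1 - (C1 + C2 + 2 * K' + 2 * K' * C2 + 1) * δ ^ e) * M ≤ (1 - C1 * δ ^ e) * M := by
      gcongr
      have : 0 ≤ 2 * K' * C2 := by positivity
      linarith
    rcases le_total 0 (1 - C1 * δ ^ e) with h | h
    · exact (k1.trans (mul_le_mul_of_nonneg_left ml h)).trans (hl.trans hge)
    · exact (k1.trans (mul_nonpos_of_nonpos_of_nonneg h hM)).trans ((norm_nonneg _).trans hge)
  · calc _ ≤ (1 + C2 * δ ^ e) * N2 := hle
      _ ≤ (1 + C2 * δ ^ e) * ((1 + 2 * K' * δ) * M) := by gcongr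
      _ = (1 + C2 * δ ^ e) * (1 + 2 * K' * δ) * M := by ring
      _ ≤ _ := mul_le_mul_of_nonneg_right (comb hC2.le hK' hC1.le d0 d1 dl) hM

theorem main (ε : ℝ) (hε : ε ∈ Set.Ioc (0 : ℝ) 1) (k : ℕ) (hk : k = 0 ∨ k = 1)
    (Ω : Set (Cn n)) (hopen : IsOpen Ω) (hbdd : Bornology.IsBounded Ω) (hStein : HasSteinBasis Ω)
    (p : Cn n) (hp : IsStrictPscPtHolder Ω p (k + 2) ε) :
    ∃ (C : ℝ) (U : Set (Cn n)), 0 < C ∧ IsOpen U ∧ p ∈ U ∧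
      ∀ z ∈ Ω ∩ U, ∀ X : Cn n,
        (1 - C * bdist Ω z ^ (((k : ℝ) + ε) / 2)) * Mfun Ω z X ≤ caratheodory Ω z X ∧
        caratheodory Ω z X ≤ (1 + C * bdist Ω z ^ (((k : ℝ) + ε) / 2)) * Mfun Ω z X := by
  obtain ⟨hpf, W, hW, hpW, ρ, hρ, hρH, hΩW, hdρ, hLρ⟩ := hp
  have hd := hdρ p ⟨hpf, hpW⟩
  have hn : 0 < n := by
    rcases Nat.eq_zero_or_pos n with h | h
    · subst h; exact absurd (ContinuousLinearMap.ext fun x ↦ by rw [Subsingleton.elim x 0]; simp) hd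
    · exact h
  have hρC : HC ε (k + 2) ρ p := hc_of hε.1 hW hpW hρ hρH
  have hs : ∀ᶠ w in 𝓝 p, (w ∈ Ω ↔ ρ w < 0) := by
    filter_upwards [hW.mem_nhds hpW] with w hw
    have : w ∈ Ω ∩ W ↔ w ∈ {z ∈ W | ρ z < 0} := by rw [hΩW]
    simpa [hw] using this
  obtain ⟨r, φ, hφ, hrC, hrp, hsr, hbd, hd1, hdr, hd2⟩ := sd hε.1 hε.2 hρC hd hopen hpf hs
  obtain ⟨m, K, C, η0, hm, hK, hC, hη0, hJ⟩ := jets hε.1 hk hrC hdr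
    (levi_pos hφ hrC.2.1.self_of_nhds hρC.2.1.self_of_nhds hd1 hd2 (hLρ p ⟨hpf, hpW⟩))
  set e := ((k : ℝ) + ε) / 2 with he
  have eμ : 2 + ((k : ℝ) + ε) = 2 + 2 * e := by rw [he]; ring
  rw [eμ] at hJ
  have he0 : 0 < e := by have := hε.1; positivity
  have he1 : e ≤ 1 := by
    have : (k : ℝ) ≤ 1 := by rcases hk with rfl | rfl <;> norm_num
    have := hε.2
    rw [he]; linarith
  have hrc : ContinuousAt r p := hrC.cont hε.1
  have ev : ∀ᶠ w in 𝓝 p, (w ∈ Ω ↔ r w < 0) ∧ (w ∈ Ω → bdist Ω w = -r w) ∧ ContinuousAt r w ∧ -r w < 1 ∧ K * (-r w) < 1 / 2 := by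
    have t1 : Tendsto (fun w ↦ -r w) (𝓝 p) (𝓝 0) := by have := hrc.fun_neg; simpa only [ContinuousAt, hrp, neg_zero] using this
    have t2 : Tendsto (fun w ↦ K * -r w) (𝓝 p) (𝓝 0) := by simpa using t1.const_mul K
    exact hsr.and (hbd.and ((hrC.1.mono fun w hw ↦ hw.continuousAt).and
      ((t1.eventually (gt_mem_nhds one_pos)).and (t2.eventually (gt_mem_nhds (by norm_num))))))
  obtain ⟨η1, hη1, h1⟩ := Metric.eventually_nhds_iff_ball.1 ev
  set η := min η0 η1 with hη
  have η0' : 0 < η := lt_min hη0 hη1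
  have h1' : ∀ w, ‖w - p‖ < η → _ := fun w hw ↦ h1 w (by rw [mem_ball, dist_eq_norm]; exact hw.trans_le (min_le_right _ _))
  have hcl : ∀ w ∈ closure Ω, ‖w - p‖ < η → r w ≤ 0 := fun w hw hwp ↦ by
    by_contra! hc
    have o : ∀ᶠ y in 𝓝 w, ‖y - p‖ < η := ((continuous_id.sub continuous_const).norm.tendsto w).eventually (gt_mem_nhds hwp)
    obtain ⟨y, hy, hy2, hy3⟩ := ((mem_closure_iff_frequently.1 hw).and_eventually (((h1' w hwp).2.2.1.eventually_const_lt hc).and o)).exists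
    have := (h1' y hy3).1.1 hy
    linarith
  obtain ⟨C1, η2, hC1, hη2, hlow⟩ := lower hn hopen hbdd hStein (frontier_subset_closure hpf) hm hK.le hC η0' he0 he1 hcl
    (fun w hw hwp ↦ ⟨(h1' w hwp).1.1 hw, (h1' w hwp).2.2.2.1.le⟩)
  obtain ⟨κ, C2, η3, hκ, hC2, hη3, hup⟩ := upper hopen hm hK.le hC η0' he0 he1 (fun w hwp hw ↦ (h1' w hwp).1.2 hw) hrc hrp
  refine ⟨C1 + C2 + 2 * (K + κ) + 2 * (K + κ) * C2 + 1, ball p (min η (min η2 η3)), by positivity, isOpen_ball,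
    mem_ball_self (by positivity), fun z hz X ↦ ?_⟩
  obtain ⟨hzΩ, hzb⟩ := hz
  rw [mem_ball, dist_eq_norm] at hzb
  have z1 := hzb.trans_le (min_le_left _ _)
  have z2 := hzb.trans_le ((min_le_right _ _).trans (min_le_left _ _))
  have z3 := hzb.trans_le ((min_le_right _ _).trans (min_le_right _ _))
  by_cases hX : X = 0
  · subst hX; rw [car_zero, M_zero]; simp
  obtain ⟨g1, g2, -, g4, g5⟩ := h1' z z1
  have bz : bdist Ω =ᶠ[𝓝 z] fun w ↦ -r w := by
    have o : ∀ᶠ y in 𝓝 z, ‖y - p‖ < η := ((continuous_id.sub continuous_const).norm.tendsto z).eventually (gt_mem_nhds z1)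
    filter_upwards [o, hopen.mem_nhds hzΩ] with y hy hy2 using (h1' y hy).2.1 hy2
  obtain ⟨J0⟩ := hJ z (by rw [mem_ball, dist_eq_norm]; exact z1.trans_le (min_le_left _ _))
  obtain ⟨J⟩ : Nonempty (Jet r (2 + 2 * e) m K C η z) := ⟨J0.shrink (min_le_left _ _)⟩
  have r0 := g1.1 hzΩ
  obtain ⟨f, hf, hfm, hfl⟩ := hlow z hzΩ z2 J X hX
  have hu := hup z z3 r0 J X hX
  have hG : J.G X = leviForm r z X + K * ‖J.a X‖ ^ 2 := by rw [Jet.G, J.hB]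
  have hG0 : 0 ≤ leviForm r z X + K * ‖J.a X‖ ^ 2 := by rw [← hG]; exact le_trans (by positivity) (J.posG X)
  have hM : Mfun Ω z X = √(‖J.a X‖ ^ 2 / (-r z) ^ 2 + leviForm r z X / (-r z)) := by
    rw [Mfun, bd_cderiv bz, bd_levi bz, g2 hzΩ, J.ha]
  rw [hG] at hfl hu
  rw [g2 hzΩ, hM]
  have δ0 : 0 < -r z := by linarith
  have ml := M_lower (a := ‖J.a X‖) (L := leviForm r z X) δ0 hK.le
  have mu := M_upper δ0 hK.le hκ hG0 g5.le
  exact assemble hf hfm δ0 g4.le he0 he1 hC1 hC2 (by positivity) (Real.sqrt_nonneg _) (by positivity) ml mu hfl hu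
end

end CE

/-- Under assumption (∗), for a bounded domain whose closure admits a Stein
neighborhood basis, the Carathéodory metric satisfies
`(1 - C·δ^ε_k)·M ≤ γ_Ω ≤ (1 + C·δ^ε_k)·M` near `p`. -/
theorem caratheodory_estimate (n : ℕ) (ε : ℝ) (hε : ε ∈ Set.Ioc (0 : ℝ) 1) (k : ℕ) (hk : k = 0 ∨ k = 1)
    (Ω : Set (Cn n)) (hopen : IsOpen Ω) (hconn : IsConnected Ω) (hbdd : Bornology.IsBounded Ω) (hStein : HasSteinBasis Ω)
    (p : Cn n) (hp : IsStrictPscPtHolder Ω p (k + 2) ε) :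
    ∃ (C : ℝ) (U : Set (Cn n)), 0 < C ∧ IsOpen U ∧ p ∈ U ∧
      ∀ z ∈ Ω ∩ U, ∀ X : Cn n,
        (1 - C * bdist Ω z ^ (((k : ℝ) + ε) / 2)) * Mfun Ω z X ≤ caratheodory Ω z X ∧
        caratheodory Ω z X ≤ (1 + C * bdist Ω z ^ (((k : ℝ) + ε) / 2)) * Mfun Ω z X := by
  exact CE.main ε hε k hk Ω hopen hbdd hStein p hp

end
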